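/- There exist absolute constants C, c₁, c₂, c₃ > 0 with the following property. Let μ be an isotropic log-concave probability measure on ℝⁿ, let C·n²·ln n ≤ m ≤ exp(√n), let x₁,…,x_m be independent random vectors each distributed according to μ, and set B_m = absconv{x₁,…,x_m}. Then, with probability at least 1 − exp(−c₂·√n), every linear projection P : ℝⁿ → ℝⁿ (P² = P, not necessarily orthogonal) with n/4 ≤ rank(P) ≤ 3n/4 satisfies ‖P : X_{B_m} → X_{B_m}‖ ≥ c₁·√n/√(ln(1+m/n)); consequently, with the same probability, bc(X_{B_m}) ≥ c₃·√n/√(ln(1+m/n)). -/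

import Mathlib

open MeasureTheory Set
open scoped ENNReal RealInnerProductSpace Pointwise BigOperators

noncomputable section

abbrev Euc (n : ℕ) := EuclideanSpace ℝ (Fin n)

/-- The absolute convex hull of a set. -/
def absConv (n : ℕ) (A : Set (Euc n)) : Set (Euc n) := convexHull ℝ (A ∪ -A)

/-- A log-concave function on `ℝⁿ`. -/
def IsLogConcaveFn (n : ℕ) (f : Euc n → ℝ) : Prop :=
  ∀ x y : Euc n, ∀ a b : ℝ, 0 ≤ a → 0 ≤ b → a + b = 1 →
    f x ^ a * f y ^ b ≤ f (a • x + b • y)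

/-- `f` is a log-concave density of `μ` with barycenter `0`, total mass `1`
and identity covariance. -/
def IsIsotropicDensity (n : ℕ) (μ : Measure (Euc n)) (f : Euc n → ℝ) : Prop :=
  (∀ x, 0 ≤ f x) ∧ IsLogConcaveFn n f ∧
  μ = volume.withDensity (fun x => ENNReal.ofReal (f x)) ∧
  IsProbabilityMeasure μ ∧ (∫ x, x ∂μ) = 0 ∧
  ∀ y z : Euc n, (∫ x, ⟪x, y⟫ * ⟪x, z⟫ ∂μ) = ⟪y, z⟫

/-- An isotropic log-concave probability measure on `ℝⁿ`. -/
def IsIsotropicLogConcave (n : ℕ) (μ : Measure (Euc n)) : Prop :=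
  ∃ f, IsIsotropicDensity n μ f

/-- A centrally symmetric convex body. -/
def IsSymmConvexBody (n : ℕ) (K : Set (Euc n)) : Prop :=
  Convex ℝ K ∧ K = -K ∧ IsCompact K ∧ (0 : Euc n) ∈ interior K

/-- A convex body (not necessarily symmetric). -/
def IsConvexBody (n : ℕ) (K : Set (Euc n)) : Prop :=
  Convex ℝ K ∧ IsCompact K ∧ (interior K).Nonempty

/-- The operator norm of `T : X_K → X_L`, where `X_K` and `X_L` carry the gauges of `K`, `L`. -/
def bodyOpNorm (n : ℕ) (K L : Set (Euc n)) (T : Euc n →ₗ[ℝ] Euc n) : ℝ :=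
  sSup ((fun x => gauge L (T x)) '' K)

/-- The Banach–Mazur distance between the normed spaces with unit balls `K` and `L`. -/
def distBM (n : ℕ) (K L : Set (Euc n)) : ℝ :=
  sInf {d : ℝ | ∃ T : Euc n ≃ₗ[ℝ] Euc n,
    d = bodyOpNorm n K L T.toLinearMap * bodyOpNorm n L K T.symm.toLinearMap}

/-- The `ℓ₂ⁿ → ℓ₂ⁿ` operator norm of a linear map. -/
def eucOpNorm (n : ℕ) (T : Euc n →ₗ[ℝ] Euc n) : ℝ :=
  ‖LinearMap.toContinuousLinearMap T‖

/-- The standard orthonormal basis vectors of `ℝⁿ`, as a set. -/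
def stdBasisSet (n : ℕ) : Set (Euc n) :=
  Set.range fun i : Fin n => (EuclideanSpace.single i (1 : ℝ) : Euc n)

/-- The basis-enriched random polytope `absconv{e₁,…,eₙ, x₁/√n,…,x_m/√n}`. -/
def enrichedBody (n m : ℕ) (x : Fin m → Euc n) : Set (Euc n) :=
  absConv n (stdBasisSet n ∪ Set.range fun j => (Real.sqrt n)⁻¹ • x j)

/-- `s_k(T) ≥ 1`, via the Courant–Fischer characterization of singular values. -/
def SingValGe (n : ℕ) (T : Euc n →ₗ[ℝ] Euc n) (k : ℕ) : Prop :=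
  ∃ F : Submodule ℝ (Euc n), k ≤ Module.finrank ℝ F ∧ ∀ x ∈ F, ‖x‖ ≤ ‖T x‖

/-- A `(k,β)`-mixing operator. -/
def IsMixing (n : ℕ) (T : Euc n →ₗ[ℝ] Euc n) (k : ℕ) (β : ℝ) : Prop :=
  ∃ E : Submodule ℝ (Euc n), k ≤ Module.finrank ℝ E ∧
    ∀ x ∈ E, β * ‖x‖ ≤ ‖Submodule.orthogonalProjectionOnto Eᗮ (T x)‖

/-- The basis constant of the normed space with unit ball `K`. -/
def basisConstant (n : ℕ) (K : Set (Euc n)) : ℝ :=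
  sInf {c : ℝ | 0 < c ∧ ∃ b : Module.Basis (Fin n) ℝ (Euc n),
    ∀ k : ℕ, k ≤ n → ∀ lam : Fin n → ℝ,
      gauge K (∑ i ∈ Finset.univ.filter (fun i : Fin n => (i : ℕ) < k), lam i • b i) ≤
        c * gauge K (∑ i, lam i • b i)}

/-- The polar body. -/
def polarBody (n : ℕ) (B : Set (Euc n)) : Set (Euc n) :=
  {y | ∀ x ∈ B, ⟪x, y⟫ ≤ 1}

/-- The 1-summing norm of the identity `I : X_B* → ℓ₂ⁿ`. -/
def piOneId (n : ℕ) (B : Set (Euc n)) : ℝ :=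
  sInf {α : ℝ | 0 < α ∧ ∀ N : ℕ, ∀ z : Fin N → Euc n,
    ∑ j, ‖z j‖ ≤ α * sSup ((fun y => ∑ j, |⟪y, z j⟫|) '' B)}

/-- The normed space with unit ball `L` admits a `1`-unconditional basis. -/
def HasOneUncondBasis (n : ℕ) (L : Set (Euc n)) : Prop :=
  ∃ b : Module.Basis (Fin n) ℝ (Euc n), ∀ lam : Fin n → ℝ,
    gauge L (∑ i, lam i • b i) = gauge L (∑ i, |lam i| • b i)

/-- The Prékopa–Leindler inequality for a measure `μ` on a real vector space. -/
def PrekopaLeindler {E : Type*} [AddCommGroup E] [Module ℝ E] [MeasurableSpace E]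
    (μ : Measure E) : Prop :=
  ∀ a b : ℝ, 0 < a → 0 < b → a + b = 1 → ∀ f g h : E → ℝ≥0∞,
    Measurable f → Measurable g → Measurable h →
    (∀ x y, f x ^ a * g y ^ b ≤ h (a • x + b • y)) →
    (∫⁻ x, f x ∂μ) ^ a * (∫⁻ x, g x ∂μ) ^ b ≤ ∫⁻ x, h x ∂μ

lemma volume_add_le_of_compact {A B : Set ℝ} (hA : IsCompact A) (hB : IsCompact B)
    (hA' : A.Nonempty) (hB' : B.Nonempty) :
    volume A + volume B ≤ volume (A + B) := by
  obtain ⟨a, haA, ha⟩ := hA.exists_isGreatest hA'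
  obtain ⟨b, hbB, hb⟩ := hB.exists_isLeast hB'
  have h1 : (fun x => b + x) '' A ⊆ A + B := by
    rintro _ ⟨x, hx, rfl⟩; exact ⟨x, hx, b, hbB, add_comm _ _⟩
  have h2 : (fun x => a + x) '' B ⊆ A + B := by
    rintro _ ⟨x, hx, rfl⟩; exact ⟨a, haA, x, hx, rfl⟩
  have v1 : volume ((fun x => b + x) '' A) = volume A := by
    rw [Set.image_add_left, measure_preimage_add]
  have v2 : volume ((fun x => a + x) '' B) = volume B := by
    rw [Set.image_add_left, measure_preimage_add]
  have hdis : AEDisjoint volume ((fun x => b + x) '' A) ((fun x => a + x) '' B) := by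
    have : ((fun x => b + x) '' A) ∩ ((fun x => a + x) '' B) ⊆ {a + b} := by
      rintro z ⟨⟨x, hx, rfl⟩, ⟨y, hy, hxy⟩⟩
      have := ha hx; have := hb hy
      simp only at hxy ⊢
      simp only [mem_singleton_iff]; linarith
    exact measure_mono_null this (by simp)
  have hm : NullMeasurableSet ((fun x => a + x) '' B) volume :=
    ((hB.image (by fun_prop)).measurableSet).nullMeasurableSet
  rw [← v1, ← v2, ← measure_union₀ hm hdis]
  exact measure_mono (union_subset h1 h2)

lemma volume_add_le {A B C : Set ℝ} (hA : MeasurableSet A) (hB : MeasurableSet B)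
    (hA' : A.Nonempty) (hB' : B.Nonempty) (h : A + B ⊆ C) :
    volume A + volume B ≤ volume C := by
  obtain ⟨a, ha⟩ := hA'
  obtain ⟨b, hb⟩ := hB'
  have key : ∀ K L : Set ℝ, K ⊆ A → L ⊆ B → IsCompact K → IsCompact L →
      volume K + volume L ≤ volume C := by
    intro K L hK hL hKc hLc
    have := volume_add_le_of_compact (hKc.insert a) (hLc.insert b) ⟨a, by simp⟩ ⟨b, by simp⟩
    refine le_trans (add_le_add (measure_mono (subset_insert _ _)) (measure_mono (subset_insert _ _)))
      (this.trans (measure_mono (subset_trans (Set.add_subset_add ?_ ?_) h)))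
    · exact insert_subset ha hK
    · exact insert_subset hb hL
  have hsup : ∀ {D : Set ℝ}, MeasurableSet D →
      volume D = ⨆ K : {K : Set ℝ // K ⊆ D ∧ IsCompact K}, volume K.1 := by
    intro D hD
    rw [hD.measure_eq_iSup_isCompact]
    simp only [iSup_subtype, iSup_and]
  have : ∀ D : Set ℝ, Nonempty {K : Set ℝ // K ⊆ D ∧ IsCompact K} :=
    fun D => ⟨⟨∅, by simp, by simp⟩⟩
  rw [hsup hA, hsup hB]
  exact ENNReal.iSup_add_iSup_le fun K L => key _ _ K.2.1 L.2.1 K.2.2 L.2.2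

lemma ENNReal.geom_mean_le_arith_mean (a b : ℝ) (ha : 0 < a) (hb : 0 < b) (hab : a + b = 1)
    (x y : ℝ≥0∞) : x ^ a * y ^ b ≤ ENNReal.ofReal a * x + ENNReal.ofReal b * y := by
  by_cases hx : x = ∞
  · simp [hx, ENNReal.mul_top, ha]
  by_cases hy : y = ∞
  · simp [hy, ENNReal.mul_top, hb]
  lift x to NNReal using hx
  lift y to NNReal using hy
  have := NNReal.geom_mean_le_arith_mean2_weighted a.toNNReal b.toNNReal x y
    (by rw [← Real.toNNReal_add ha.le hb.le, hab]; simp)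
  rw [Real.coe_toNNReal a ha.le, Real.coe_toNNReal b hb.le] at this
  rw [← ENNReal.coe_rpow_of_nonneg _ ha.le, ← ENNReal.coe_rpow_of_nonneg _ hb.le]
  simp only [ENNReal.ofReal]
  exact_mod_cast this

lemma prekopaLeindler_real_normalized {a b : ℝ} (ha : 0 < a) (hb : 0 < b) (hab : a + b = 1)
    {f g h : ℝ → ℝ≥0∞} (hf : Measurable f) (hg : Measurable g) (hh : Measurable h)
    (hf1 : ⨆ x, f x = 1) (hg1 : ⨆ x, g x = 1)
    (H : ∀ x y, f x ^ a * g y ^ b ≤ h (a • x + b • y)) :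
    ENNReal.ofReal a * (∫⁻ x, f x) + ENNReal.ofReal b * ∫⁻ x, g x ≤ ∫⁻ x, min (h x) 1 := by
  have layer : ∀ {p : ℝ → ℝ≥0∞}, Measurable p → (∀ x, p x ≤ 1) →
      ∫⁻ x, p x = ∫⁻ s in Ioo (0 : ℝ) 1, volume {x | ENNReal.ofReal s < p x} := by
    intro p hp hp1
    have h1 : ∀ x, p x = ENNReal.ofReal (p x).toReal := fun x =>
      (ENNReal.ofReal_toReal (ne_top_of_le_ne_top ENNReal.one_ne_top (hp1 x))).symm
    have h2 : ∫⁻ x, p x = ∫⁻ x, ENNReal.ofReal (p x).toReal := lintegral_congr h1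
    rw [h2, lintegral_eq_lintegral_meas_lt volume (ae_of_all _ fun _ => ENNReal.toReal_nonneg)
      hp.ennreal_toReal.aemeasurable]
    have h3 : ∀ s ∈ Ioi (0 : ℝ), volume {x | s < (p x).toReal} =
        (Ioo (0 : ℝ) 1).indicator (fun s => volume {x | ENNReal.ofReal s < p x}) s := by
      intro s hs
      by_cases hs1 : s < 1
      · rw [indicator_of_mem (show s ∈ Ioo (0 : ℝ) 1 from ⟨hs, hs1⟩)]
        congr 1; ext x
        simp only [mem_ofPred_eq]
        rw [ENNReal.ofReal_lt_iff_lt_toReal (le_of_lt hs)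
          (ne_top_of_le_ne_top ENNReal.one_ne_top (hp1 x))]
      · rw [indicator_of_notMem (fun h => hs1 h.2)]
        have : {x | s < (p x).toReal} = ∅ := by
          ext x
          simp only [mem_ofPred_eq, mem_empty_iff_false, iff_false, not_lt]
          exact (ENNReal.toReal_mono ENNReal.one_ne_top (hp1 x)).trans (by simpa using hs1)
        simp [this]
    rw [setLIntegral_congr_fun measurableSet_Ioi h3, lintegral_indicator measurableSet_Ioo,
      Measure.restrict_restrict measurableSet_Ioo]
    congr 2
    ext s; simp only [mem_inter_iff, mem_Ioo, mem_Ioi]; tauto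
  rw [layer hf (fun x => hf1 ▸ le_iSup f x), layer hg (fun x => hg1 ▸ le_iSup g x),
    layer (hh.min measurable_const) (fun x => min_le_right _ _)]
  have meas : ∀ p : ℝ → ℝ≥0∞, Measurable fun s : ℝ => volume {x | ENNReal.ofReal s < p x} := by
    intro p
    refine Antitone.measurable fun s t hst => measure_mono fun x hx => ?_
    exact lt_of_le_of_lt (ENNReal.ofReal_le_ofReal hst) hx
  rw [← lintegral_const_mul _ (meas f), ← lintegral_const_mul _ (meas g),
    ← lintegral_add_left ((meas f).const_mul _)]
  refine setLIntegral_mono' measurableSet_Ioo fun s hs => ?_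
  have hs1 : ENNReal.ofReal s < 1 := by simpa using hs.2
  have scale : ∀ (c : ℝ) (A : Set ℝ), 0 < c → ENNReal.ofReal c * volume A = volume (c • A) := by
    intro c A hc
    rw [Measure.addHaar_smul]; simp [abs_of_pos hc]
  rw [scale a _ ha, scale b _ hb]
  have mf : MeasurableSet {x | ENNReal.ofReal s < f x} := measurableSet_lt measurable_const hf
  have mg : MeasurableSet {x | ENNReal.ofReal s < g x} := measurableSet_lt measurable_const hg
  have nf : {x | ENNReal.ofReal s < f x}.Nonempty := by
    obtain ⟨x, hx⟩ := lt_iSup_iff.1 (hf1 ▸ hs1); exact ⟨x, hx⟩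
  have ng : {x | ENNReal.ofReal s < g x}.Nonempty := by
    obtain ⟨x, hx⟩ := lt_iSup_iff.1 (hg1 ▸ hs1); exact ⟨x, hx⟩
  refine volume_add_le (mf.const_smul_of_ne_zero ha.ne') (mg.const_smul_of_ne_zero hb.ne')
    nf.smul_set ng.smul_set ?_
  rintro _ ⟨_, ⟨x, hx, rfl⟩, _, ⟨y, hy, rfl⟩, rfl⟩
  simp only [mem_ofPred_eq] at hx hy ⊢
  refine lt_min (lt_of_lt_of_le ?_ (H x y)) hs1
  calc ENNReal.ofReal s = ENNReal.ofReal s ^ a * ENNReal.ofReal s ^ b := by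
        rw [← ENNReal.rpow_add _ _ (by simpa using hs.1) (by simp), hab, ENNReal.rpow_one]
    _ < _ := ENNReal.mul_lt_mul (ENNReal.rpow_lt_rpow hx ha) (ENNReal.rpow_lt_rpow hy hb)

lemma prekopaLeindler_real : PrekopaLeindler (volume : Measure ℝ) := by
  intro a b ha hb hab f g h hf hg hh H
  have bdd : ∀ N : ℕ, (∫⁻ x, min (f x) N) ^ a * (∫⁻ x, min (g x) N) ^ b ≤ ∫⁻ x, h x := by
    intro N
    set F := ⨆ x, min (f x) N with hF
    set G := ⨆ x, min (g x) N with hG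
    have hFt : F ≠ ∞ := ne_top_of_le_ne_top (ENNReal.natCast_ne_top N)
      (iSup_le fun x => min_le_right _ _)
    have hGt : G ≠ ∞ := ne_top_of_le_ne_top (ENNReal.natCast_ne_top N)
      (iSup_le fun x => min_le_right _ _)
    by_cases hF0 : F = 0
    · have : ∀ x, min (f x) N = 0 := fun x => le_antisymm (hF0 ▸ le_iSup (fun x => min (f x) N) x) bot_le
      simp [this, ha]
    by_cases hG0 : G = 0
    · have : ∀ x, min (g x) N = 0 := fun x => le_antisymm (hG0 ▸ le_iSup (fun x => min (g x) N) x) bot_le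
      simp [this, hb]
    set c := F ^ a * G ^ b with hc
    have hc0 : c ≠ 0 := mul_ne_zero (by simp [ENNReal.rpow_eq_zero_iff, hF0, hFt])
      (by simp [ENNReal.rpow_eq_zero_iff, hG0, hGt])
    have hct : c ≠ ∞ := ENNReal.mul_ne_top (ENNReal.rpow_ne_top_of_nonneg ha.le hFt)
      (ENNReal.rpow_ne_top_of_nonneg hb.le hGt)
    have key := prekopaLeindler_real_normalized ha hb hab
      (f := fun x => F⁻¹ * min (f x) N) (g := fun x => G⁻¹ * min (g x) N)
      (h := fun x => c⁻¹ * h x) (by fun_prop) (by fun_prop) (by fun_prop)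
      (by rw [← ENNReal.mul_iSup, ENNReal.inv_mul_cancel hF0 hFt])
      (by rw [← ENNReal.mul_iSup, ENNReal.inv_mul_cancel hG0 hGt]) (by
        intro x y
        rw [ENNReal.mul_rpow_of_nonneg _ _ ha.le, ENNReal.mul_rpow_of_nonneg _ _ hb.le,
          ENNReal.inv_rpow, ENNReal.inv_rpow, hc, ENNReal.mul_inv
            (by simp [ENNReal.rpow_eq_zero_iff, hF0, hFt]) (by right; simp [ENNReal.rpow_eq_zero_iff, hG0, hGt])]
        calc _ = (F ^ a)⁻¹ * (G ^ b)⁻¹ * (min (f x) N ^ a * min (g y) N ^ b) := by ring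
          _ ≤ _ := by
            gcongr
            refine le_trans ?_ (H x y)
            gcongr <;> exact min_le_left _ _)
    have k2 := (ENNReal.geom_mean_le_arith_mean a b ha hb hab _ _).trans
      (key.trans (lintegral_mono fun x => min_le_left _ _))
    rw [lintegral_const_mul _ (by fun_prop), lintegral_const_mul _ (by fun_prop),
      lintegral_const_mul _ hh, ENNReal.mul_rpow_of_nonneg _ _ ha.le,
      ENNReal.mul_rpow_of_nonneg _ _ hb.le, ENNReal.inv_rpow, ENNReal.inv_rpow] at k2
    have k3 : c⁻¹ * ((∫⁻ x, min (f x) N) ^ a * (∫⁻ x, min (g x) N) ^ b) ≤ c⁻¹ * ∫⁻ x, h x := by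
      refine le_trans (le_of_eq ?_) k2
      rw [hc, ENNReal.mul_inv (by simp [ENNReal.rpow_eq_zero_iff, hF0, hFt])
        (by right; simp [ENNReal.rpow_eq_zero_iff, hG0, hGt])]
      ring
    rwa [ENNReal.mul_le_mul_iff_right (by simpa using hct) (by simpa using hc0)] at k3
  have conv : ∀ {p : ℝ → ℝ≥0∞}, Measurable p →
      Filter.Tendsto (fun N : ℕ => ∫⁻ x, min (p x) N) Filter.atTop (nhds (∫⁻ x, p x)) := by
    intro p hp
    refine lintegral_tendsto_of_tendsto_of_monotone (fun N => (by fun_prop)) ?_ ?_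
    · exact ae_of_all _ fun x m n hmn => min_le_min le_rfl (by exact_mod_cast hmn)
    · refine ae_of_all _ fun x => ?_
      have := ENNReal.tendsto_nat_nhds_top
      have h2 : Filter.Tendsto (fun N : ℕ => min (p x) (N : ℝ≥0∞)) Filter.atTop
        (nhds (min (p x) ∞)) := tendsto_const_nhds.min this
      simpa using h2
  by_cases h0 : ∫⁻ x, f x = 0
  · simp [h0, ha]
  by_cases h0' : ∫⁻ x, g x = 0
  · simp [h0', hb]
  refine le_of_tendsto (ENNReal.Tendsto.mul (((ENNReal.continuous_rpow_const).tendsto _).comp (conv hf)) ?_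
    (((ENNReal.continuous_rpow_const).tendsto _).comp (conv hg)) ?_) (Filter.Eventually.of_forall bdd)
  · left; simp [ENNReal.rpow_eq_zero_iff, h0, ha, not_lt.2 ha.le]
  · left; simp [ENNReal.rpow_eq_zero_iff, h0', hb, not_lt.2 hb.le]

lemma PrekopaLeindler.prod {E F : Type*} [AddCommGroup E] [Module ℝ E] [MeasurableSpace E]
    [AddCommGroup F] [Module ℝ F] [MeasurableSpace F] {μ : Measure E} {ν : Measure F}
    [SFinite μ] [SFinite ν] (hμ : PrekopaLeindler μ) (hν : PrekopaLeindler ν) :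
    PrekopaLeindler (μ.prod ν) := by
  intro a b ha hb hab f g h hf hg hh H
  rw [lintegral_prod _ hf.aemeasurable, lintegral_prod _ hg.aemeasurable,
    lintegral_prod _ hh.aemeasurable]
  refine hμ a b ha hb hab _ _ _ hf.lintegral_prod_right' hg.lintegral_prod_right'
    hh.lintegral_prod_right' fun x y => ?_
  refine hν a b ha hb hab _ _ _ (hf.comp measurable_prodMk_left) (hg.comp measurable_prodMk_left)
    (hh.comp measurable_prodMk_left) fun x' y' => ?_
  exact H (x, x') (y, y')

lemma PrekopaLeindler.of_measurePreserving {E F : Type*} [AddCommGroup E] [Module ℝ E]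
    [MeasurableSpace E] [AddCommGroup F] [Module ℝ F] [MeasurableSpace F] {μ : Measure E}
    {ν : Measure F} (hμ : PrekopaLeindler μ) (e : E → F)
    (he : ∀ (a b : ℝ) x y, e (a • x + b • y) = a • e x + b • e y) (hp : MeasurePreserving e μ ν) :
    PrekopaLeindler ν := by
  intro a b ha hb hab f g h hf hg hh H
  rw [← hp.lintegral_comp hf, ← hp.lintegral_comp hg, ← hp.lintegral_comp hh]
  refine hμ a b ha hb hab _ _ _ (hf.comp hp.measurable) (hg.comp hp.measurable)
    (hh.comp hp.measurable) fun x y => ?_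
  rw [he]; exact H _ _

lemma prekopaLeindler_pi (n : ℕ) : PrekopaLeindler (volume : Measure (Fin n → ℝ)) := by
  induction n with
  | zero =>
    intro a b ha hb hab f g h hf hg hh H
    have e : ∀ p : (Fin 0 → ℝ) → ℝ≥0∞, ∫⁻ x, p x = p 0 := by
      intro p
      rw [volume_pi, Measure.pi_of_empty _ (0 : Fin 0 → ℝ), lintegral_dirac]
    rw [e, e, e]
    simpa using H 0 0
  | succ n ih =>
    refine (prekopaLeindler_real.prod ih).of_measurePreserving
      (MeasurableEquiv.piFinSuccAbove (fun _ => ℝ) 0).symm ?_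
      (volume_preserving_piFinSuccAbove (fun _ => ℝ) 0).symm
    intro a b x y
    ext i
    refine Fin.cases ?_ (fun j => ?_) i <;>
      simp [MeasurableEquiv.piFinSuccAbove, Fin.insertNthEquiv]

theorem prekopaLeindler_euc (n : ℕ) : PrekopaLeindler (volume : Measure (Euc n)) :=
  (prekopaLeindler_pi n).of_measurePreserving _ (fun _ _ _ _ => rfl)
    (PiLp.volume_preserving_toLp (Fin n))

/-- `g` is log-concave, with the gain `exp (ab q(x - y) / 2)` at the point `ax + by`. -/
def StrongLC {d : ℕ} (q : Euc d → ℝ) (g : Euc d → ℝ≥0∞) : Prop :=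
  ∀ a b : ℝ, 0 < a → 0 < b → a + b = 1 → ∀ x y : Euc d,
    ENNReal.ofReal (Real.exp (a * b * q (x - y) / 2)) * (g x ^ a * g y ^ b) ≤ g (a • x + b • y)

/-- The measure `ν` has a measurable density which is strongly log-concave with gain `q`. -/
def LC {d : ℕ} (q : Euc d → ℝ) (ν : Measure (Euc d)) : Prop :=
  ∃ g : Euc d → ℝ≥0∞, Measurable g ∧ StrongLC q g ∧ ν = volume.withDensity g

lemma StrongLC.mono {d : ℕ} {q q' : Euc d → ℝ} {g : Euc d → ℝ≥0∞} (h : StrongLC q g)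
    (hq : ∀ x, q' x ≤ q x) : StrongLC q' g := by
  intro a b ha hb hab x y
  refine le_trans ?_ (h a b ha hb hab x y)
  gcongr
  exact hq _

lemma LC.mono {d : ℕ} {q q' : Euc d → ℝ} {ν : Measure (Euc d)} (h : LC q ν)
    (hq : ∀ x, q' x ≤ q x) : LC q' ν := by
  obtain ⟨g, hg, hs, rfl⟩ := h
  exact ⟨g, hg, hs.mono hq, rfl⟩

lemma StrongLC.mul {d : ℕ} {q q' : Euc d → ℝ} {g g' : Euc d → ℝ≥0∞} (h : StrongLC q g)
    (h' : StrongLC q' g') : StrongLC (fun x => q x + q' x) (fun x => g x * g' x) := by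
  intro a b ha hb hab x y
  have := mul_le_mul' (h a b ha hb hab x y) (h' a b ha hb hab x y)
  refine le_trans (le_of_eq ?_) this
  rw [ENNReal.mul_rpow_of_nonneg _ _ ha.le, ENNReal.mul_rpow_of_nonneg _ _ hb.le, mul_add, add_div,
    Real.exp_add, ENNReal.ofReal_mul (Real.exp_nonneg _)]
  ring

lemma StrongLC.const_mul {d : ℕ} {q : Euc d → ℝ} {g : Euc d → ℝ≥0∞} (h : StrongLC q g)
    (c : ℝ≥0∞) : StrongLC q (fun x => c * g x) := by
  intro a b ha hb hab x y
  have e : c ^ a * c ^ b = c := by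
    rw [← ENNReal.rpow_add_of_nonneg _ _ ha.le hb.le, hab, ENNReal.rpow_one]
  calc _ = (c ^ a * c ^ b) * (ENNReal.ofReal (Real.exp (a * b * q (x - y) / 2)) * (g x ^ a * g y ^ b)) := by
        rw [ENNReal.mul_rpow_of_nonneg _ _ ha.le, ENNReal.mul_rpow_of_nonneg _ _ hb.le]; ring
    _ ≤ _ := by rw [e]; exact mul_le_mul' le_rfl (h a b ha hb hab x y)

lemma LC.smul {d : ℕ} {q : Euc d → ℝ} {ν : Measure (Euc d)} (h : LC q ν) (c : ℝ≥0∞) :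
    LC q (c • ν) := by
  obtain ⟨g, hg, hs, rfl⟩ := h
  exact ⟨fun x => c * g x, hg.const_mul c, hs.const_mul c, (withDensity_smul c hg).symm⟩

lemma LC.withDensity {d : ℕ} {q q' : Euc d → ℝ} {ν : Measure (Euc d)} (h : LC q ν)
    {p : Euc d → ℝ≥0∞} (hp : Measurable p) (hs : StrongLC q' p) :
    LC (fun x => q x + q' x) (ν.withDensity p) := by
  obtain ⟨g, hg, hg', rfl⟩ := h
  exact ⟨fun x => g x * p x, hg.mul hp, hg'.mul hs, (withDensity_mul _ hg hp).symm⟩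

lemma isLogConcaveFn_lc {n : ℕ} {f : Euc n → ℝ} (h0 : ∀ x, 0 ≤ f x) (hf : IsLogConcaveFn n f) :
    LC (fun _ => 0) (volume.withDensity fun x => ENNReal.ofReal (f x)) := by
  set A : Set (Euc n) := {x | 0 < f x} with hA
  have step : ∀ x ∈ A, ∀ y ∈ A, ∀ a b : ℝ, 0 ≤ a → 0 ≤ b → a + b = 1 →
      0 < f x ^ a * f y ^ b := fun x hx y hy a b _ _ _ =>
    mul_pos (Real.rpow_pos_of_pos hx _) (Real.rpow_pos_of_pos hy _)
  have hAc : Convex ℝ A := by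
    intro x hx y hy a b ha hb hab
    exact lt_of_lt_of_le (step x hx y hy a b ha hb hab) (hf x y a b ha hb hab)
  have hlog : ConcaveOn ℝ A (fun x => Real.log (f x)) := by
    refine ⟨hAc, fun x hx y hy a b ha hb hab => ?_⟩
    have := Real.log_le_log (step x hx y hy a b ha hb hab) (hf x y a b ha hb hab)
    rwa [Real.log_mul (Real.rpow_pos_of_pos hx _).ne' (Real.rpow_pos_of_pos hy _).ne',
      Real.log_rpow hx, Real.log_rpow hy] at this
  have hcont : ContinuousOn f (interior A) := by
    refine (Real.continuous_exp.comp_continuousOn hlog.continuousOn_interior).congr fun x hx => ?_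
    exact (Real.exp_log (interior_subset hx : x ∈ A)).symm
  have hInt : Convex ℝ (interior A) := hAc.interior
  refine ⟨(interior A).indicator fun x => ENNReal.ofReal (f x), ?_, ?_, ?_⟩
  · refine measurable_of_restrict_of_restrict_compl (s := interior A) isOpen_interior.measurableSet ?_ ?_
    · have : (interior A).domRestrict ((interior A).indicator fun x => ENNReal.ofReal (f x)) =
          fun x => ENNReal.ofReal ((interior A).domRestrict f x) := by
        ext x; exact indicator_of_mem x.2 _
      rw [this]
      exact ENNReal.measurable_ofReal.comp (continuousOn_iff_continuous_domRestrict.1 hcont).measurable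
    · have : (interior A)ᶜ.domRestrict ((interior A).indicator fun x => ENNReal.ofReal (f x)) =
          fun _ => 0 := by
        ext x; exact indicator_of_notMem x.2 _
      rw [this]; exact measurable_const
  · intro a b ha hb hab x y
    by_cases hx : x ∈ interior A
    · by_cases hy : y ∈ interior A
      · rw [indicator_of_mem hx, indicator_of_mem hy, indicator_of_mem (hInt hx hy ha.le hb.le hab)]
        simp only [mul_zero, zero_div, Real.exp_zero, ENNReal.ofReal_one, one_mul]
        rw [ENNReal.ofReal_rpow_of_nonneg (h0 _) ha.le, ENNReal.ofReal_rpow_of_nonneg (h0 _) hb.le,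
          ← ENNReal.ofReal_mul (Real.rpow_nonneg (h0 _) _)]
        exact ENNReal.ofReal_le_ofReal (hf x y a b ha.le hb.le hab)
      · simp [indicator_of_notMem hy, hb]
    · simp [indicator_of_notMem hx, ha]
  · refine withDensity_congr_ae ?_
    have hnull : volume (frontier A) = 0 := hAc.addHaar_frontier volume
    filter_upwards [measure_eq_zero_iff_ae_notMem.1 hnull] with x hx
    by_cases hxi : x ∈ interior A
    · rw [indicator_of_mem hxi]
    · rw [indicator_of_notMem hxi]
      have : x ∉ A := fun hxA => hx ⟨subset_closure hxA, hxi⟩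
      simpa [hA] using this

/-- The coordinates of `ℝⁿ` adapted to an isometric embedding. -/
lemma exists_measurePreserving_split {k n : ℕ} (W : Euc k →ₗᵢ[ℝ] Euc n) :
    ∃ (l : ℕ) (U : Euc l →ₗ[ℝ] Euc n), MeasurePreserving
      (fun p : Euc k × Euc l => W p.1 + U p.2) (volume.prod volume) volume ∧
      (∀ y z, ‖W y + U z‖ ^ 2 = ‖y‖ ^ 2 + ‖z‖ ^ 2) ∧
      (∀ z, W.toContinuousLinearMap.adjoint (U z) = 0) := by
  set K : Submodule ℝ (Euc n) := (LinearMap.range W.toLinearMap)ᗮ with hK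
  set l := Module.finrank ℝ K with hl
  have hr : Module.finrank ℝ (LinearMap.range W.toLinearMap) = k := by
    rw [LinearMap.finrank_range_of_inj W.injective]; simp
  have hkl : k + l = n := by
    have := Submodule.finrank_add_finrank_orthogonal (LinearMap.range W.toLinearMap)
    rw [hr] at this; simpa using this
  let b : OrthonormalBasis (Fin l) ℝ K := (stdOrthonormalBasis ℝ K)
  let U : Euc l →ₗᵢ[ℝ] Euc n := K.subtypeₗᵢ.comp b.repr.symm.toLinearIsometry
  have orth : ∀ y z, ⟪W y, U z⟫ = 0 := by
    intro y z
    have : (U z : Euc n) ∈ K := (b.repr.symm z).2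
    exact (Submodule.mem_orthogonal _ _).1 this _ ⟨y, rfl⟩
  have nrm : ∀ y z, ‖W y + U z‖ ^ 2 = ‖y‖ ^ 2 + ‖z‖ ^ 2 := by
    intro y z
    rw [norm_add_sq_real, orth, W.norm_map, U.norm_map]; ring
  let e : WithLp 2 (Euc k × Euc l) →ₗ[ℝ] Euc n :=
    (W.toLinearMap.coprod U.toLinearMap) ∘ₗ (WithLp.linearEquiv 2 ℝ (Euc k × Euc l)).toLinearMap
  let eI : WithLp 2 (Euc k × Euc l) →ₗᵢ[ℝ] Euc n := ⟨e, fun p => by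
    have h1 : ‖e p‖ ^ 2 = ‖p‖ ^ 2 := by
      rw [WithLp.prod_norm_sq_eq_of_L2]; exact nrm _ _
    exact (pow_left_inj₀ (norm_nonneg _) (norm_nonneg _) two_ne_zero).1 h1⟩
  let eE : WithLp 2 (Euc k × Euc l) ≃ₗᵢ[ℝ] Euc n := eI.toLinearIsometryEquiv (by
    rw [(WithLp.linearEquiv 2 ℝ (Euc k × Euc l)).finrank_eq]; simp [hkl])
  refine ⟨l, U.toLinearMap, ?_, nrm, fun z => ?_⟩
  · have := eE.measurePreserving.comp (WithLp.volume_preserving_toLp (U := Euc k) (V := Euc l))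
    exact this
  · refine ext_inner_left ℝ fun y => ?_
    rw [ContinuousLinearMap.adjoint_inner_right, inner_zero_right]
    exact orth y z

/-- The coisometry `W†` of an isometric embedding `W`. -/
abbrev coiso {k n : ℕ} (W : Euc k →ₗᵢ[ℝ] Euc n) : Euc n →L[ℝ] Euc k :=
  W.toContinuousLinearMap.adjoint

lemma coiso_apply_self {k n : ℕ} (W : Euc k →ₗᵢ[ℝ] Euc n) (y : Euc k) : coiso W (W y) = y := by
  refine ext_inner_left ℝ fun z => ?_
  rw [ContinuousLinearMap.adjoint_inner_right]
  exact W.inner_map_map z y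

lemma norm_coiso_le {k n : ℕ} (W : Euc k →ₗᵢ[ℝ] Euc n) (x : Euc n) : ‖coiso W x‖ ≤ ‖x‖ := by
  have h : ‖coiso W x‖ ^ 2 ≤ ‖coiso W x‖ * ‖x‖ := by
    calc ‖coiso W x‖ ^ 2 = ⟪W (coiso W x), x⟫ := by
          rw [← real_inner_self_eq_norm_sq]
          exact ContinuousLinearMap.adjoint_inner_right _ _ _
      _ ≤ _ := by simpa using real_inner_le_norm (W (coiso W x)) x
  by_contra hc
  push Not at hc
  nlinarith [norm_nonneg x]

lemma StrongLC.lintegral_slice {l k n : ℕ} {t : ℝ} (ht : 0 ≤ t) {g : Euc n → ℝ≥0∞}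
    (hg : Measurable g) (h : StrongLC (fun x => t * ‖x‖ ^ 2) g) (W : Euc k →ₗᵢ[ℝ] Euc n)
    (U : Euc l →ₗ[ℝ] Euc n) (hU : ∀ y z, ‖W y + U z‖ ^ 2 = ‖y‖ ^ 2 + ‖z‖ ^ 2) :
    StrongLC (fun y => t * ‖y‖ ^ 2) fun y => ∫⁻ z, g (W y + U z) := by
  intro a b ha hb hab x y
  have hUc : Continuous U := U.continuous_of_finiteDimensional
  set c := ENNReal.ofReal (Real.exp (a * b * (t * ‖x - y‖ ^ 2) / 2)) with hc
  have m : ∀ v : Euc k, Measurable fun z => g (W v + U z) := fun v =>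
    hg.comp (by fun_prop : Continuous fun z => W v + U z).measurable
  have e : c ^ a * c ^ b = c := by
    rw [← ENNReal.rpow_add_of_nonneg _ _ ha.le hb.le, hab, ENNReal.rpow_one]
  have key := prekopaLeindler_euc l a b ha hb hab (fun z => c * g (W x + U z))
    (fun z => c * g (W y + U z)) (fun z => g (W (a • x + b • y) + U z)) ((m x).const_mul c)
    ((m y).const_mul c) (m _) (by
      intro z w
      have h1 := h a b ha hb hab (W x + U z) (W y + U w)
      have h2 : a • (W x + U z) + b • (W y + U w) = W (a • x + b • y) + U (a • z + b • w) := by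
        simp only [map_add, map_smul, smul_add]; abel
      rw [h2] at h1
      refine le_trans ?_ h1
      rw [ENNReal.mul_rpow_of_nonneg _ _ ha.le, ENNReal.mul_rpow_of_nonneg _ _ hb.le]
      calc _ = (c ^ a * c ^ b) * (g (W x + U z) ^ a * g (W y + U w) ^ b) := by ring
        _ ≤ _ := by
          rw [e, hc]
          gcongr
          have : W x + U z - (W y + U w) = W (x - y) + U (z - w) := by
            simp only [map_sub]; abel
          simp only [this, hU]
          nlinarith [sq_nonneg ‖z - w‖])
  rw [lintegral_const_mul _ (m x), lintegral_const_mul _ (m y),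
    ENNReal.mul_rpow_of_nonneg _ _ ha.le, ENNReal.mul_rpow_of_nonneg _ _ hb.le] at key
  refine le_trans (le_of_eq ?_) key
  show c * _ = _
  nth_rw 1 [← e]
  ring

lemma LC.map_coiso {k n : ℕ} {t : ℝ} (ht : 0 ≤ t) {ν : Measure (Euc n)}
    (h : LC (fun x => t * ‖x‖ ^ 2) ν) (W : Euc k →ₗᵢ[ℝ] Euc n) :
    LC (fun y => t * ‖y‖ ^ 2) (ν.map (coiso W)) := by
  obtain ⟨g, hg, hs, rfl⟩ := h
  obtain ⟨l, U, hp, hU, hQ⟩ := exists_measurePreserving_split W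
  have hUc : Continuous U := U.continuous_of_finiteDimensional
  have hm : Measurable fun p : Euc k × Euc l => g (W p.1 + U p.2) := hg.comp hp.measurable
  refine ⟨fun y => ∫⁻ z, g (W y + U z), hm.lintegral_prod_right', hs.lintegral_slice ht hg W U hU, ?_⟩
  ext s hs'
  have hQm : Measurable (coiso W) := (coiso W).continuous.measurable
  rw [Measure.map_apply hQm hs', withDensity_apply _ (hQm hs'), withDensity_apply _ hs',
    ← lintegral_indicator (hQm hs'), ← hp.lintegral_comp (hg.indicator (hQm hs')),
    ← lintegral_indicator hs']
  erw [lintegral_prod _ ((hg.indicator (hQm hs')).comp hp.measurable).aemeasurable]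
  refine lintegral_congr fun y => ?_
  have hy : ∀ z, W y + U z ∈ coiso W ⁻¹' s ↔ y ∈ s := by
    intro z
    rw [mem_preimage, map_add, hQ, coiso_apply_self, add_zero]
  by_cases hys : y ∈ s
  · rw [indicator_of_mem hys]
    exact lintegral_congr fun z => indicator_of_mem ((hy z).2 hys) _
  · rw [indicator_of_notMem hys]
    have : ∀ z, (coiso W ⁻¹' s).indicator g (W y + U z) = 0 := fun z =>
      indicator_of_notMem (fun h => hys ((hy z).1 h)) _
    simp [this]

/-- Concentration for strongly log-concave measures, by the Prékopa–Leindler inequality. -/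
lemma LC.lintegral_exp_mul_le {d : ℕ} {t : ℝ} (ht : 0 < t) {ν : Measure (Euc d)}
    (h : LC (fun x => t * ‖x‖ ^ 2) ν) [IsProbabilityMeasure ν] {f : Euc d → ℝ} (hf : Measurable f)
    {L : ℝ} (hL : ∀ x y, f x - f y ≤ L * ‖x - y‖) :
    (∫⁻ x, ENNReal.ofReal (Real.exp (f x)) ∂ν) * (∫⁻ x, ENNReal.ofReal (Real.exp (-f x)) ∂ν) ≤
      ENNReal.ofReal (Real.exp (L ^ 2 / t)) := by
  obtain ⟨g, hg, hs, hν⟩ := h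
  have h1 : ∫⁻ x, g x = 1 := by
    have := measure_univ (μ := ν)
    rwa [hν, withDensity_apply _ MeasurableSet.univ, setLIntegral_univ] at this
  have e1 : ∀ p : Euc d → ℝ, Measurable p → ∫⁻ x, ENNReal.ofReal (Real.exp (p x)) ∂ν =
      ∫⁻ x, g x * ENNReal.ofReal (Real.exp (p x)) := fun p hp => by
    rw [hν, lintegral_withDensity_eq_lintegral_mul _ hg (by fun_prop)]; rfl
  rw [e1 f hf, e1 (fun x => -f x) hf.neg]
  set c := ENNReal.ofReal (Real.exp (L ^ 2 / (2 * t)))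
  have key := prekopaLeindler_euc d (1/2) (1/2) (by norm_num) (by norm_num) (by norm_num)
    (fun x => g x * ENNReal.ofReal (Real.exp (f x))) (fun x => g x * ENNReal.ofReal (Real.exp (-f x)))
    (fun x => c * g x) (by fun_prop) (by fun_prop) (by fun_prop) (by
      intro x y
      have h2 := hs (1/2) (1/2) (by norm_num) (by norm_num) (by norm_num) x y
      refine le_trans ?_ (mul_le_mul' le_rfl h2)
      rw [ENNReal.mul_rpow_of_nonneg _ _ (by norm_num), ENNReal.mul_rpow_of_nonneg _ _ (by norm_num),
        ENNReal.ofReal_rpow_of_nonneg (Real.exp_nonneg _) (by norm_num),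
        ENNReal.ofReal_rpow_of_nonneg (Real.exp_nonneg _) (by norm_num), ← Real.exp_mul, ← Real.exp_mul]
      calc _ = (ENNReal.ofReal (Real.exp (f x * (1/2))) * ENNReal.ofReal (Real.exp (-f y * (1/2)))) *
            (g x ^ (1/2 : ℝ) * g y ^ (1/2 : ℝ)) := by ring
        _ ≤ (c * ENNReal.ofReal (Real.exp (1/2 * (1/2) * (t * ‖x - y‖ ^ 2) / 2))) *
            (g x ^ (1/2 : ℝ) * g y ^ (1/2 : ℝ)) := by
          refine mul_le_mul' ?_ le_rfl
          rw [← ENNReal.ofReal_mul (Real.exp_nonneg _), ← ENNReal.ofReal_mul (Real.exp_nonneg _),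
            ← Real.exp_add, ← Real.exp_add]
          refine ENNReal.ofReal_le_ofReal (Real.exp_le_exp.2 ?_)
          have h3 := hL x y
          have h4 : L * ‖x - y‖ / 2 ≤ L ^ 2 / (2 * t) + t * ‖x - y‖ ^ 2 / 8 := by
            have : L ^ 2 / (2 * t) + t * ‖x - y‖ ^ 2 / 8 - L * ‖x - y‖ / 2 =
                (2 * L - t * ‖x - y‖) ^ 2 / (8 * t) := by field_simp; ring
            have h5 : 0 ≤ (2 * L - t * ‖x - y‖) ^ 2 / (8 * t) := by positivity
            linarith
          linarith
        _ = _ := by ring)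
  rw [lintegral_const_mul _ hg, h1, mul_one, ← ENNReal.mul_rpow_of_nonneg _ _ (by norm_num)] at key
  have k2 := ENNReal.rpow_le_rpow key (show (0 : ℝ) ≤ 2 by norm_num)
  rw [← ENNReal.rpow_mul, ENNReal.ofReal_rpow_of_nonneg (Real.exp_nonneg _) (by norm_num),
    ← Real.exp_mul] at k2
  norm_num at k2
  refine k2.trans (ENNReal.ofReal_le_ofReal (Real.exp_le_exp.2 (le_of_eq ?_)))
  field_simp

/-- Infinitely differentiable real functions. -/
abbrev Smooth {d : ℕ} (f : Euc d → ℝ) : Prop := ContDiff ℝ ((⊤ : ℕ∞) : WithTop ℕ∞) f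

/-- The `i`-th partial derivative. -/
def pd {d : ℕ} (i : Fin d) (f : Euc d → ℝ) : Euc d → ℝ :=
  fun x => fderiv ℝ f x (EuclideanSpace.single i 1)

section calculus

variable {d : ℕ} {f g h V : Euc d → ℝ}

lemma Smooth.pd (hf : Smooth f) (i : Fin d) : Smooth (pd i f) :=
  (hf.fderiv_right (m := ((⊤ : ℕ∞) : WithTop ℕ∞)) (by simp)).clm_apply contDiff_const

lemma Smooth.differentiable' (hf : Smooth f) : Differentiable ℝ f := hf.differentiable (by simp)

lemma HasCompactSupport.pd (hf : HasCompactSupport f) (i : Fin d) : HasCompactSupport (pd i f) :=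
  hf.fderiv_apply ℝ _

lemma pd_mul (hf : Smooth f) (hg : Smooth g) (i : Fin d) :
    pd i (fun x => f x * g x) = fun x => pd i f x * g x + f x * pd i g x := by
  ext x
  simp only [pd]
  rw [fderiv_fun_mul (hf.differentiable' x) (hg.differentiable' x)]
  simp; ring

lemma pd_add (hf : Smooth f) (hg : Smooth g) (i : Fin d) :
    pd i (fun x => f x + g x) = fun x => pd i f x + pd i g x := by
  ext x
  simp only [pd]
  rw [fderiv_fun_add (hf.differentiable' x) (hg.differentiable' x)]; rfl

lemma pd_sum {ι : Type*} (s : Finset ι) {F : ι → Euc d → ℝ} (hF : ∀ j, Smooth (F j)) (i : Fin d) :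
    pd i (fun x => ∑ j ∈ s, F j x) = fun x => ∑ j ∈ s, pd i (F j) x := by
  ext x
  simp only [pd]
  rw [fderiv_fun_sum fun j _ => (hF j).differentiable' x]
  simp

lemma pd_neg (i : Fin d) : pd i (fun x => -f x) = fun x => -pd i f x := by
  ext x
  simp only [pd]
  rw [fderiv_fun_neg]; rfl

lemma pd_exp (hf : Smooth f) (i : Fin d) :
    pd i (fun x => Real.exp (f x)) = fun x => pd i f x * Real.exp (f x) := by
  ext x
  simp only [pd]
  rw [fderiv_exp (hf.differentiable' x)]
  simp; ring

lemma pd_comm (hf : Smooth f) (i j : Fin d) : pd i (pd j f) = pd j (pd i f) := by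
  ext x
  have h2 : DifferentiableAt ℝ (fderiv ℝ f) x :=
    (hf.fderiv_right (m := ((⊤ : ℕ∞) : WithTop ℕ∞)) (by simp)).differentiable (by simp) x
  have e : ∀ u v : Euc d, fderiv ℝ (fun y => fderiv ℝ f y u) x v = fderiv ℝ (fderiv ℝ f) x v u := by
    intro u v
    rw [fderiv_clm_apply h2 (differentiableAt_const _)]; simp
  have hs : IsSymmSndFDerivAt ℝ f x := hf.contDiffAt.isSymmSndFDerivAt (by
    simp only [minSmoothness_of_isRCLikeNormedField]
    exact WithTop.coe_le_coe.2 (le_top : (2 : ℕ∞) ≤ ⊤))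
  show fderiv ℝ (fun y => fderiv ℝ f y _) x _ = fderiv ℝ (fun y => fderiv ℝ f y _) x _
  rw [e, e]; exact hs _ _

lemma ContDiff.integrable_of_compact (hf : ContDiff ℝ ((⊤ : ℕ∞) : WithTop ℕ∞) f) (hc : HasCompactSupport f) :
    Integrable f volume := hf.continuous.integrable_of_hasCompactSupport hc

lemma integral_mul_pd (hf : Smooth f) (hg : Smooth g)
    (hc : HasCompactSupport f ∨ HasCompactSupport g) (i : Fin d) :
    ∫ x, f x * pd i g x = -∫ x, pd i f x * g x := by
  refine integral_mul_fderiv_eq_neg_fderiv_mul_of_integrable (f := f) (g := g)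
    (v := EuclideanSpace.single i 1) ?_ ?_ ?_ (fun x _ => hf.differentiable' x)
    (fun x _ => hg.differentiable' x)
  · exact ((hf.pd i).mul hg).integrable_of_compact
      (hc.elim (fun hc => (hc.pd i).mul_right) fun hc => hc.mul_left)
  · exact (hf.mul (hg.pd i)).integrable_of_compact
      (hc.elim (fun hc => hc.mul_right) fun hc => (hc.pd i).mul_left)
  · exact (hf.mul hg).integrable_of_compact
      (hc.elim (fun hc => hc.mul_right) fun hc => hc.mul_left)

/-- The generator `L h = -Δh + ∇V·∇h` of the Langevin diffusion with invariant density `exp(-V)`. -/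
def gen (V h : Euc d → ℝ) : Euc d → ℝ :=
  fun x => ∑ i, (-pd i (pd i h) x + pd i V x * pd i h x)

lemma Smooth.gen (hV : Smooth V) (hh : Smooth h) : Smooth (gen V h) :=
  ContDiff.sum fun i _ => ((hh.pd i).pd i).neg.add ((hV.pd i).mul (hh.pd i))

lemma pd_zero_outside (i : Fin d) {x : Euc d} (hx : x ∉ tsupport f) : pd i f x = 0 := by
  have : x ∉ Function.support (fun y => fderiv ℝ f y (EuclideanSpace.single i 1)) := fun h =>
    hx ((support_fderiv_subset ℝ) (fun h0 => h (by simp [h0])))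
  simpa [pd] using this

lemma HasCompactSupport.gen (hc : HasCompactSupport h) : HasCompactSupport (gen V h) := by
  refine HasCompactSupport.intro hc (fun x hx => ?_)
  simp only [_root_.gen]
  refine Finset.sum_eq_zero fun i _ => ?_
  have h2 : x ∉ tsupport (_root_.pd i h) := fun hx' => hx ((tsupport_fderiv_apply_subset ℝ _) hx')
  rw [pd_zero_outside i hx, pd_zero_outside i h2]; simp

lemma Smooth.expNeg (hV : Smooth V) : Smooth fun x => Real.exp (-V x) := hV.neg.exp

/-- The Dirichlet form. -/
lemma integral_gen_mul (hV : Smooth V) (hh : Smooth h) (hg : Smooth g)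
    (hc : HasCompactSupport h ∨ HasCompactSupport g) :
    ∫ x, gen V h x * g x * Real.exp (-V x) =
      ∫ x, (∑ i, pd i h x * pd i g x) * Real.exp (-V x) := by
  have hw := hV.expNeg
  have h1 : ∀ i, ∫ x, pd i h x * pd i (fun x => g x * Real.exp (-V x)) x =
      -∫ x, pd i (pd i h) x * (g x * Real.exp (-V x)) := fun i =>
    integral_mul_pd (hh.pd i) (hg.mul hw)
      (hc.imp (fun hc => hc.pd i) fun hc => hc.mul_right) i
  have e : ∀ i, pd i (fun x => g x * Real.exp (-V x)) = fun x =>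
      pd i g x * Real.exp (-V x) - g x * (pd i V x * Real.exp (-V x)) := by
    intro i
    rw [pd_mul hg hw, pd_exp (f := fun x => -V x) hV.neg, pd_neg]
    ext x; ring
  have i1 : ∀ i, Integrable (fun x => pd i (pd i h) x * (g x * Real.exp (-V x))) := fun i =>
    ((((hh.pd i).pd i)).mul (hg.mul hw)).integrable_of_compact
      (hc.elim (fun hc => ((hc.pd i).pd i).mul_right) fun hc => hc.mul_right.mul_left)
  have i2 : ∀ i, Integrable (fun x => pd i h x * pd i g x * Real.exp (-V x)) := fun i =>
    (((hh.pd i).mul (hg.pd i)).mul hw).integrable_of_compact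
      (hc.elim (fun hc => (hc.pd i).mul_right.mul_right) fun hc => (hc.pd i).mul_left.mul_right)
  have i3 : ∀ i, Integrable (fun x => pd i V x * pd i h x * g x * Real.exp (-V x)) := fun i =>
    ((((hV.pd i).mul (hh.pd i)).mul hg).mul hw).integrable_of_compact
      (hc.elim (fun hc => (hc.pd i).mul_left.mul_right.mul_right) fun hc => hc.mul_left.mul_right)
  have h2 : ∀ i, ∫ x, pd i h x * pd i g x * Real.exp (-V x) =
      ∫ x, (-pd i (pd i h) x + pd i V x * pd i h x) * g x * Real.exp (-V x) := by
    intro i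
    have e1 : ∫ x, pd i h x * pd i (fun x => g x * Real.exp (-V x)) x =
        (∫ x, pd i h x * pd i g x * Real.exp (-V x)) -
          ∫ x, pd i V x * pd i h x * g x * Real.exp (-V x) := by
      rw [← integral_sub (i2 i) (i3 i)]
      congr 1; ext x; rw [e]; ring
    have e2 : ∫ x, (-pd i (pd i h) x + pd i V x * pd i h x) * g x * Real.exp (-V x) =
        -(∫ x, pd i (pd i h) x * (g x * Real.exp (-V x))) +
          ∫ x, pd i V x * pd i h x * g x * Real.exp (-V x) := by
      rw [← integral_neg, ← integral_add (f := fun x => -(pd i (pd i h) x * (g x * Real.exp (-V x)))) (i1 i).neg (i3 i)]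
      congr 1; ext x; ring
    rw [e2, ← h1, e1]; ring
  simp only [gen, Finset.sum_mul]
  rw [integral_finsetSum _ fun i _ => i2 i, integral_finsetSum]
  · exact Finset.sum_congr rfl fun i _ => (h2 i).symm
  · intro i _
    refine (((((hh.pd i).pd i).neg.add ((hV.pd i).mul (hh.pd i))).mul hg).mul
      hw).integrable_of_compact ?_
    exact hc.elim (fun hc => ((((hc.pd i).pd i).neg.add (hc.pd i).mul_left).mul_right).mul_right)
      fun hc => hc.mul_left.mul_right

lemma pd_gen (hV : Smooth V) (hh : Smooth h) (i : Fin d) (x : Euc d) :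
    pd i (gen V h) x = gen V (pd i h) x + ∑ j, pd i (pd j V) x * pd j h x := by
  have hs : ∀ j, Smooth (fun x => -pd j (pd j h) x + pd j V x * pd j h x) := fun j =>
    ((hh.pd j).pd j).neg.add ((hV.pd j).mul (hh.pd j))
  have : gen V h = fun x => ∑ j, (-pd j (pd j h) x + pd j V x * pd j h x) := rfl
  rw [this, pd_sum _ hs]
  simp only [gen, ← Finset.sum_add_distrib]
  refine Finset.sum_congr rfl fun j _ => ?_
  rw [pd_add (f := fun x => -pd j (pd j h) x) ((hh.pd j).pd j).neg ((hV.pd j).mul (hh.pd j)),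
    pd_neg, pd_mul (hV.pd j) (hh.pd j), pd_comm (hh.pd j) i j, pd_comm hh i j]
  ring

/-- The integrated Bochner identity. -/
lemma integral_gen_sq (hV : Smooth V) (hh : Smooth h) (hc : HasCompactSupport h) :
    ∫ x, gen V h x ^ 2 * Real.exp (-V x) =
      (∑ i, ∫ x, (∑ j, pd j (pd i h) x ^ 2) * Real.exp (-V x)) +
        ∫ x, (∑ i, ∑ j, pd i (pd j V) x * pd j h x * pd i h x) * Real.exp (-V x) := by
  have hw := hV.expNeg
  have h1 := integral_gen_mul hV hh (hV.gen hh) (.inl hc)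
  have h2 : ∀ i, ∫ x, gen V (pd i h) x * pd i h x * Real.exp (-V x) =
      ∫ x, (∑ j, pd j (pd i h) x ^ 2) * Real.exp (-V x) := by
    intro i
    rw [integral_gen_mul hV (hh.pd i) (hh.pd i) (.inl (hc.pd i))]
    simp only [pow_two]
  have h3 : ∀ x, (∑ i, pd i h x * pd i (gen V h) x) * Real.exp (-V x) =
      (∑ i, gen V (pd i h) x * pd i h x * Real.exp (-V x)) +
      (∑ i, ∑ j, pd i (pd j V) x * pd j h x * pd i h x) * Real.exp (-V x) := by
    intro x
    rw [Finset.sum_mul, Finset.sum_mul, ← Finset.sum_add_distrib]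
    refine Finset.sum_congr rfl fun i _ => ?_
    rw [pd_gen hV hh, mul_add, add_mul, Finset.mul_sum]
    congr 1
    · ring
    · congr 1; exact Finset.sum_congr rfl fun j _ => by ring
  have i1 : ∀ i, Integrable (fun x => gen V (pd i h) x * pd i h x * Real.exp (-V x)) := fun i =>
    (((hV.gen (hh.pd i)).mul (hh.pd i)).mul hw).integrable_of_compact (hc.pd i).mul_left.mul_right
  have i2 : Integrable (fun x => (∑ i, ∑ j, pd i (pd j V) x * pd j h x * pd i h x) *
      Real.exp (-V x)) := by
    simp only [Finset.sum_mul]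
    refine integrable_finsetSum _ fun i _ => integrable_finsetSum _ fun j _ => ?_
    exact (((((hV.pd j).pd i).mul (hh.pd j)).mul (hh.pd i)).mul hw).integrable_of_compact
      (hc.pd i).mul_left.mul_right
  simp only [pow_two (gen V h _), ← h2]
  rw [h1]
  simp only [h3]
  rw [integral_add (integrable_finsetSum _ fun i _ => i1 i) i2, integral_finsetSum _ fun i _ => i1 i]

end calculus

section mollify

open Filter Topology

variable {d : ℕ} {f g η G V : Euc d → ℝ}

/-- The convolution of `η` and `G`. -/
def cv (η G : Euc d → ℝ) : Euc d → ℝ := fun x => ∫ y, η (x - y) * G y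

lemma cv_eq_convolution (η G : Euc d → ℝ) :
    cv η G = convolution η G (ContinuousLinearMap.lsmul ℝ ℝ) volume := by
  ext x
  rw [convolution_lsmul_swap]; rfl

lemma cv_integrable (hη : Continuous η) (hc : HasCompactSupport η)
    (hG : LocallyIntegrable G volume) (x : Euc d) : Integrable fun y => η (x - y) * G y :=
  (hc.convolutionExists_left (ContinuousLinearMap.lsmul ℝ ℝ) hη hG x).integrable_swap

lemma Smooth.cv (hη : Smooth η) (hc : HasCompactSupport η) (hG : LocallyIntegrable G volume) :
    Smooth (cv η G) := by
  rw [cv_eq_convolution]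
  exact hc.contDiff_convolution_left _ hη hG

lemma pd_cv (hη : Smooth η) (hc : HasCompactSupport η) (hG : LocallyIntegrable G volume)
    (i : Fin d) : pd i (cv η G) = cv (pd i η) G := by
  ext x
  have h := hc.hasFDerivAt_convolution_left (ContinuousLinearMap.lsmul ℝ ℝ)
    (hη.of_le (by exact_mod_cast le_top)) hG x
  rw [pd, cv_eq_convolution, h.fderiv]
  have hInt : ConvolutionExistsAt (fderiv ℝ η) G x
      ((ContinuousLinearMap.lsmul ℝ ℝ).precompL (Euc d)) volume :=
    (hc.fderiv ℝ).convolutionExists_left _ (hη.continuous_fderiv (by simp)) hG x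
  rw [convolution_def, ContinuousLinearMap.integral_apply hInt, cv_eq_convolution, convolution_def]
  rfl

lemma pd_reflect (hη : Smooth η) (i : Fin d) (x : Euc d) :
    pd i (fun y => η (x - y)) = fun y => -pd i η (x - y) := by
  ext y
  have h1 : HasFDerivAt (fun y : Euc d => x - y) (-ContinuousLinearMap.id ℝ (Euc d)) y := by
    simpa using (hasFDerivAt_id y).const_sub x
  have h := (hη.differentiable' (x - y)).hasFDerivAt.comp y h1
  rw [pd, show (fun y => η (x - y)) = η ∘ fun y => x - y from rfl, h.fderiv]
  simp [pd]

lemma Smooth.reflect (hη : Smooth η) (x : Euc d) : Smooth fun y => η (x - y) :=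
  hη.comp (contDiff_const.sub contDiff_id)

lemma hasCompactSupport_reflect (hc : HasCompactSupport η) (x : Euc d) :
    HasCompactSupport fun y => η (x - y) :=
  hc.comp_homeomorph (Homeomorph.subLeft x)

lemma pd_div_const (hf : Smooth f) (c : ℝ) (i : Fin d) :
    pd i (fun x => f x / c) = fun x => pd i f x / c := by
  ext x
  simp only [pd, div_eq_mul_inv]
  rw [fderiv_mul_const (hf.differentiable' x)]; simp; ring

lemma LocallyIntegrable.abs (hG : LocallyIntegrable G volume) :
    LocallyIntegrable (fun y => |G y|) volume := fun x => (hG x).norm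

/-- The potential of the Schrödinger operator conjugate to `gen V`. -/
def schroedingerPotential (V : Euc d → ℝ) : Euc d → ℝ :=
  fun x => ∑ i, (pd i V x ^ 2 / 4 - pd i (pd i V) x / 2)

lemma Smooth.schroedingerPotential (hV : Smooth V) : Smooth (schroedingerPotential V) :=
  ContDiff.sum fun i _ => (((hV.pd i).pow 2).div_const _).sub (((hV.pd i).pd i).div_const _)

lemma Smooth.expHalf (hV : Smooth V) : Smooth fun x => Real.exp (V x / 2) := (hV.div_const 2).exp

lemma gen_mul_expHalf (hV : Smooth V) (hg : Smooth g) (x : Euc d) :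
    gen V (fun x => g x * Real.exp (V x / 2)) x =
      Real.exp (V x / 2) * (-∑ i, pd i (pd i g) x + schroedingerPotential V x * g x) := by
  have hE := hV.expHalf
  have e1 : ∀ i, pd i (fun x => Real.exp (V x / 2)) = fun x => pd i V x / 2 * Real.exp (V x / 2) := by
    intro i
    rw [pd_exp (f := fun x => V x / 2) (hV.div_const 2), pd_div_const hV]
  have e2 : ∀ i, pd i (fun x => g x * Real.exp (V x / 2)) =
      fun x => (pd i g x + g x * (pd i V x / 2)) * Real.exp (V x / 2) := by
    intro i
    rw [pd_mul hg hE, e1]; ext x; ring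
  have hs : ∀ i, Smooth (fun x => pd i V x / 2) := fun i => (hV.pd i).div_const 2
  have e3 : ∀ i, pd i (fun x => (pd i g x + g x * (pd i V x / 2)) * Real.exp (V x / 2)) =
      fun x => (pd i (pd i g) x + pd i V x * pd i g x + g x * (pd i (pd i V) x / 2)
        + g x * (pd i V x ^ 2 / 4)) * Real.exp (V x / 2) := by
    intro i
    rw [pd_mul ((hg.pd i).add (hg.mul (hs i))) hE, e1, pd_add (hg.pd i) (hg.mul (hs i)),
      pd_mul hg (hs i), pd_div_const (hV.pd i)]
    ext x; ring
  simp only [gen, schroedingerPotential]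
  rw [Finset.sum_mul, ← Finset.sum_neg_distrib, ← Finset.sum_add_distrib, Finset.mul_sum]
  refine Finset.sum_congr rfl fun i _ => ?_
  rw [e2, e3]; ring

/-- `G` is a weak solution of `ΔG = WG`. -/
def WeakSol (W G : Euc d → ℝ) : Prop :=
  ∀ ψ : Euc d → ℝ, Smooth ψ → HasCompactSupport ψ →
    ∫ x, G x * (-∑ i, pd i (pd i ψ) x + W x * ψ x) = 0

lemma weakSol_of_orthogonal (hV : Smooth V)
    (h : ∀ φ : Euc d → ℝ, Smooth φ → HasCompactSupport φ →
      ∫ x, G x * Real.exp (-V x / 2) * gen V φ x = 0) :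
    WeakSol (schroedingerPotential V) G := by
  intro ψ hψ hc
  have := h (fun x => ψ x * Real.exp (V x / 2)) (hψ.mul hV.expHalf) hc.mul_right
  rw [← this]
  congr 1; ext x
  rw [gen_mul_expHalf hV hψ]
  have : Real.exp (-V x / 2) * Real.exp (V x / 2) = 1 := by rw [← Real.exp_add]; ring_nf; simp
  linear_combination (-(G x * (-∑ i, pd i (pd i ψ) x + schroedingerPotential V x * ψ x))) * this

lemma WeakSol.lap_cv {W : Euc d → ℝ} (hW : Continuous W) (h : WeakSol W G)
    (hη : Smooth η) (hc : HasCompactSupport η) (hG : LocallyIntegrable G volume) (x : Euc d) :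
    ∑ i, pd i (pd i (cv η G)) x = cv η (fun y => W y * G y) x := by
  have h1 := h _ (hη.reflect x) (hasCompactSupport_reflect hc x)
  have e1 : ∀ i, pd i (pd i (fun y => η (x - y))) = fun y => pd i (pd i η) (x - y) := by
    intro i
    rw [pd_reflect hη, pd_neg, pd_reflect (hη.pd i)]; ext; simp
  simp only [e1] at h1
  have e2 : ∀ i, pd i (pd i (cv η G)) x = ∫ y, pd i (pd i η) (x - y) * G y := by
    intro i
    rw [pd_cv hη hc hG, pd_cv (hη.pd i) (hc.pd i) hG]; rfl
  simp only [e2]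
  have i1 : ∀ i, Integrable fun y => pd i (pd i η) (x - y) * G y := fun i =>
    cv_integrable ((hη.pd i).pd i).continuous ((hc.pd i).pd i) hG x
  have i2 : Integrable fun y => η (x - y) * (W y * G y) :=
    cv_integrable hη.continuous hc (hG.continuous_mul hW) x
  rw [← integral_finsetSum _ fun i _ => i1 i, cv]
  have : ∫ y, G y * (-∑ i, pd i (pd i η) (x - y) + W y * η (x - y)) =
      (∫ y, η (x - y) * (W y * G y)) - ∫ y, ∑ i, pd i (pd i η) (x - y) * G y := by
    rw [← integral_sub i2 (integrable_finsetSum _ fun i _ => i1 i)]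
    congr 1; ext y; rw [← Finset.sum_mul]; ring
  linarith [this, h1]

section bump

variable (φ : ContDiffBump (0 : Euc d))

lemma smooth_normed : Smooth (φ.normed volume) := φ.contDiff_normed

lemma integral_normed_sub (x : Euc d) : ∫ y, φ.normed volume (x - y) = 1 := by
  rw [integral_sub_left_eq_self (fun y => φ.normed volume y) volume x, φ.integral_normed]

lemma cv_abs_sq_le (hG : LocallyIntegrable G volume)
    (hG2 : Integrable (fun y => G y ^ 2) volume) (x : Euc d) :
    cv (φ.normed volume) (fun y => |G y|) x ^ 2 ≤ cv (φ.normed volume) (fun y => G y ^ 2) x := by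
  set s := cv (φ.normed volume) (fun y => |G y|) x with hs
  have i1 := cv_integrable (φ.continuous_normed (μ := volume)) φ.hasCompactSupport_normed (LocallyIntegrable.abs hG) x
  have i2 := cv_integrable (φ.continuous_normed (μ := volume)) φ.hasCompactSupport_normed hG2.locallyIntegrable x
  have i3 : Integrable fun y => φ.normed volume (x - y) := φ.integrable_normed.comp_sub_left x
  have h : ∫ y, (2 * s * (φ.normed volume (x - y) * |G y|) - s ^ 2 * φ.normed volume (x - y)) ≤
      ∫ y, φ.normed volume (x - y) * G y ^ 2 := by
    refine integral_mono ((i1.const_mul _).sub (i3.const_mul _)) i2 fun y => ?_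
    have h0 : 0 ≤ φ.normed volume (x - y) := φ.nonneg_normed _
    have : φ.normed volume (x - y) * (2 * s * |G y| - s ^ 2) ≤ φ.normed volume (x - y) * G y ^ 2 := by
      refine mul_le_mul_of_nonneg_left ?_ h0
      nlinarith [sq_nonneg (s - |G y|), sq_abs (G y)]
    linarith
  rw [integral_sub (i1.const_mul _) (i3.const_mul _), integral_const_mul, integral_const_mul,
    integral_normed_sub] at h
  have e : ∫ y, φ.normed volume (x - y) * |G y| = s := rfl
  rw [e] at h
  show s ^ 2 ≤ ∫ y, φ.normed volume (x - y) * G y ^ 2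
  nlinarith

lemma abs_cv_le (x : Euc d) :
    |cv (φ.normed volume) G x| ≤ cv (φ.normed volume) (fun y => |G y|) x := by
  refine (abs_integral_le_integral_abs).trans (le_of_eq ?_)
  congr 1; ext y
  rw [abs_mul, abs_of_nonneg (φ.nonneg_normed _)]

lemma integrable_cv {F : Euc d → ℝ} (hF : Integrable F) : Integrable (cv (φ.normed volume) F) := by
  rw [cv_eq_convolution]
  exact φ.integrable_normed.integrable_convolution _ hF

lemma integral_cv {F : Euc d → ℝ} (hF : Integrable F) :
    ∫ x, cv (φ.normed volume) F x = ∫ x, F x := by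
  rw [cv_eq_convolution, integral_convolution (ν := volume) (μ := volume) _ φ.integrable_normed hF, φ.integral_normed]
  simp

lemma commutator_le {W : Euc d → ℝ} (hW : Continuous W) (hG : LocallyIntegrable G volume)
    {x : Euc d} {ω : ℝ} (hω : ∀ y, dist x y < φ.rOut → |W x - W y| ≤ ω) :
    |W x * cv (φ.normed volume) G x - cv (φ.normed volume) (fun y => W y * G y) x| ≤
      ω * cv (φ.normed volume) (fun y => |G y|) x := by
  have i1 := cv_integrable (φ.continuous_normed (μ := volume)) φ.hasCompactSupport_normed hG x
  have i2 := cv_integrable (φ.continuous_normed (μ := volume)) φ.hasCompactSupport_normed (hG.continuous_mul hW) x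
  have i3 := cv_integrable (φ.continuous_normed (μ := volume)) φ.hasCompactSupport_normed (LocallyIntegrable.abs hG) x
  simp only [cv]
  rw [← integral_const_mul, ← integral_sub (i1.const_mul _) i2, ← integral_const_mul]
  refine (abs_integral_le_integral_abs).trans
    (integral_mono ((i1.const_mul _).sub i2).abs (i3.const_mul _) fun y => ?_)
  by_cases hy : dist x y < φ.rOut
  · have e : W x * (φ.normed volume (x - y) * G y) - φ.normed volume (x - y) * (W y * G y) =
      φ.normed volume (x - y) * G y * (W x - W y) := by ring
    simp only [e, abs_mul, abs_of_nonneg (φ.nonneg_normed (x - y) (μ := volume))]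
    rw [mul_comm ω]
    exact mul_le_mul_of_nonneg_left (hω y hy)
      (mul_nonneg (φ.nonneg_normed _) (abs_nonneg _))
  · have : φ.normed volume (x - y) = 0 := by
      by_contra h
      have h2 : x - y ∈ Function.support (φ.normed volume) := h
      rw [φ.support_normed_eq, mem_ball_zero_iff, ← dist_eq_norm] at h2
      exact hy h2
    simp [this]

/-- The local energy estimate for a mollified weak solution. -/
lemma WeakSol.energy_le (hV : Smooth V) (h : WeakSol (schroedingerPotential V) G)
    (hG : LocallyIntegrable G volume) (hG2 : Integrable (fun y => G y ^ 2) volume)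
    {χ : Euc d → ℝ} (hχ : Smooth χ) (hχc : HasCompactSupport χ) (hχ1 : ∀ x, |χ x| ≤ 1)
    {κ ω : ℝ} (hκ : ∀ x, ∑ i, pd i χ x ^ 2 ≤ κ)
    (hω : ∀ x y, χ x ≠ 0 → dist x y < φ.rOut →
      |schroedingerPotential V x - schroedingerPotential V y| ≤ ω) (hω0 : 0 ≤ ω) :
    ∫ x, χ x ^ 2 * (∑ i, pd i (fun x => cv (φ.normed volume) G x * Real.exp (V x / 2)) x ^ 2) *
      Real.exp (-V x) ≤ (2 * ω + 4 * κ) * ∫ x, G x ^ 2 := by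
  set η := φ.normed volume with hη
  have hηs : Smooth η := smooth_normed φ
  have hηc : HasCompactSupport η := φ.hasCompactSupport_normed
  have hGε : Smooth (cv η G) := hηs.cv hηc hG
  set g := fun x => cv η G x * Real.exp (V x / 2) with hg
  have hgs : Smooth g := hGε.mul hV.expHalf
  have hχ2 : Smooth fun x => χ x ^ 2 := hχ.pow 2
  have hE := integral_gen_mul hV hgs (hχ2.mul hgs) (.inr (hχc.comp_left (g := fun t : ℝ => t ^ 2)
    (by simp)).mul_right)
  have hpd : ∀ i x, pd i (fun x => χ x ^ 2 * g x) x = 2 * χ x * pd i χ x * g x + χ x ^ 2 * pd i g x := by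
    intro i x
    have : pd i (fun x => χ x * χ x) = _ := pd_mul hχ hχ i
    simp only [← pow_two] at this
    rw [pd_mul hχ2 hgs, this]; ring
  have hg2 : ∀ x, g x ^ 2 * Real.exp (-V x) = cv η G x ^ 2 := by
    intro x
    simp only [hg]
    rw [mul_pow, mul_assoc, ← Real.exp_nat_mul, ← Real.exp_add]; ring_nf; simp
  set M := cv η (fun y => G y ^ 2) with hM
  have hMint : Integrable M := integrable_cv φ hG2
  have hMle : ∀ x, cv η G x ^ 2 ≤ M x := fun x => by
    refine le_trans ?_ (cv_abs_sq_le φ hG hG2 x)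
    rw [← sq_abs (cv η G x)]
    exact pow_le_pow_left₀ (abs_nonneg _) (abs_cv_le φ x) 2
  have hM0 : ∀ x, 0 ≤ M x := fun x => (sq_nonneg _).trans (hMle x)
  have iR : Integrable fun x => (∑ i, pd i g x * pd i (fun x => χ x ^ 2 * g x) x) * Real.exp (-V x) := by
    have hs : Smooth fun x => χ x ^ 2 * g x := hχ2.mul hgs
    have hsc : HasCompactSupport fun x => χ x ^ 2 * g x :=
      (hχc.comp_left (g := fun t : ℝ => t ^ 2) (by simp)).mul_right
    simp only [Finset.sum_mul]
    exact integrable_finsetSum _ fun i _ => (((hgs.pd i).mul (hs.pd i)).mul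
      hV.expNeg).integrable_of_compact (hsc.pd i).mul_left.mul_right
  have iL : Integrable fun x => gen V g x * (χ x ^ 2 * g x) * Real.exp (-V x) :=
    (((hV.gen hgs).mul (hχ2.mul hgs)).mul hV.expNeg).integrable_of_compact
      ((hχc.comp_left (g := fun t : ℝ => t ^ 2) (by simp)).mul_right.mul_left.mul_right)
  have iA : Integrable fun x => χ x ^ 2 * (∑ i, pd i g x ^ 2) * Real.exp (-V x) :=
    ((hχ2.mul (ContDiff.sum fun i _ => (hgs.pd i).pow 2)).mul hV.expNeg).integrable_of_compact
      (hχc.comp_left (g := fun t : ℝ => t ^ 2) (by simp)).mul_right.mul_right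
  have p1 : ∫ x, 1 / 2 * (χ x ^ 2 * (∑ i, pd i g x ^ 2) * Real.exp (-V x)) ≤
      ∫ x, ((∑ i, pd i g x * pd i (fun x => χ x ^ 2 * g x) x) * Real.exp (-V x) + 2 * κ * M x) := by
    refine integral_mono (iA.const_mul _) (iR.add (hMint.const_mul _)) fun x => ?_
    have q1 : ∑ i, (1 / 2 * (χ x ^ 2 * pd i g x ^ 2) - 2 * g x ^ 2 * pd i χ x ^ 2) ≤
        ∑ i, pd i g x * pd i (fun x => χ x ^ 2 * g x) x := by
      refine Finset.sum_le_sum fun i _ => ?_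
      rw [hpd]
      nlinarith [sq_nonneg (χ x * pd i g x + 2 * g x * pd i χ x)]
    rw [Finset.sum_sub_distrib, ← Finset.mul_sum, ← Finset.mul_sum, ← Finset.mul_sum] at q1
    have q2 := mul_le_mul_of_nonneg_right q1 (Real.exp_pos (-V x)).le
    have hκ0 : 0 ≤ ∑ i, pd i χ x ^ 2 := Finset.sum_nonneg fun i _ => sq_nonneg _
    have q3 : g x ^ 2 * Real.exp (-V x) * ∑ i, pd i χ x ^ 2 ≤ κ * M x := by
      rw [hg2, mul_comm κ]
      exact mul_le_mul (hMle x) (hκ x) hκ0 (hM0 x)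
    nlinarith
  have p2 : ∫ x, gen V g x * (χ x ^ 2 * g x) * Real.exp (-V x) ≤ ∫ x, ω * M x := by
    refine integral_mono iL (hMint.const_mul _) fun x => ?_
    by_cases hx : χ x = 0
    · simp only [hx]; simpa using mul_nonneg hω0 (hM0 x)
    have e1 : gen V g x * (χ x ^ 2 * g x) * Real.exp (-V x) =
        χ x ^ 2 * ((schroedingerPotential V x * cv η G x -
          cv η (fun y => schroedingerPotential V y * G y) x) * cv η G x) := by
      simp only [hg]
      rw [gen_mul_expHalf hV hGε, h.lap_cv hV.schroedingerPotential.continuous hηs hηc hG]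
      have : Real.exp (V x / 2) * Real.exp (V x / 2) * Real.exp (-V x) = 1 := by
        rw [← Real.exp_add, ← Real.exp_add]; ring_nf; simp
      linear_combination ((-cv η (fun y => schroedingerPotential V y * G y) x +
        schroedingerPotential V x * cv η G x) * χ x ^ 2 * cv η G x) * this
    have hN := abs_cv_le (G := G) φ x
    have c1 := commutator_le φ hV.schroedingerPotential.continuous hG fun y hy => hω x y hx hy
    have c2 := cv_abs_sq_le φ hG hG2 x
    have hN0 := (abs_nonneg _).trans hN
    simp only [e1]
    set a := schroedingerPotential V x * cv η G x -
          cv η (fun y => schroedingerPotential V y * G y) x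
    have h3 : |a * cv η G x| ≤ ω * cv η (fun y => |G y|) x * cv η (fun y => |G y|) x := by
      rw [abs_mul]
      exact mul_le_mul c1 hN (abs_nonneg _) (mul_nonneg hω0 hN0)
    have h4 : χ x ^ 2 ≤ 1 := by rw [← sq_abs]; exact pow_le_one₀ (abs_nonneg _) (hχ1 x)
    calc χ x ^ 2 * (a * cv η G x) ≤ χ x ^ 2 * |a * cv η G x| :=
          mul_le_mul_of_nonneg_left (le_abs_self _) (sq_nonneg _)
      _ ≤ 1 * |a * cv η G x| := mul_le_mul_of_nonneg_right h4 (abs_nonneg _)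
      _ ≤ ω * (cv η (fun y => |G y|) x ^ 2) := by rw [one_mul]; exact h3.trans (le_of_eq (by ring))
      _ ≤ ω * M x := mul_le_mul_of_nonneg_left c2 hω0
  rw [integral_const_mul, integral_add iR (hMint.const_mul _), integral_const_mul, ← hE,
    integral_cv φ hG2] at p1
  rw [integral_const_mul, integral_cv φ hG2] at p2
  linarith

lemma integral_mul_cv {Φ : Euc d → ℝ} (hΦ : Continuous Φ) (hΦc : HasCompactSupport Φ)
    (hG : LocallyIntegrable G volume) :
    ∫ x, Φ x * cv (φ.normed volume) G x = ∫ y, cv (φ.normed volume) Φ y * G y := by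
  simp only [cv, ← integral_const_mul, ← integral_mul_const]
  obtain ⟨C, hC⟩ := φ.continuous_normed (μ := volume) |>.bounded_above_of_compact_support
    φ.hasCompactSupport_normed
  set K := Metric.cthickening φ.rOut (tsupport Φ) with hK
  have hKc : IsCompact K := hΦc.isCompact.cthickening
  have hInt : Integrable (Function.uncurry fun x y => Φ x * (φ.normed volume (x - y) * G y))
      (volume.prod volume) := by
    have h1 : Integrable (fun z : Euc d × Euc d => Φ z.1 * (C * K.indicator G z.2))
        (volume.prod volume) :=
      (hΦ.integrable_of_hasCompactSupport hΦc).mul_prod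
        (((hG.integrableOn_isCompact hKc).integrable_indicator hKc.measurableSet).const_mul C)
    refine h1.mono ?_ (Filter.Eventually.of_forall fun z => ?_)
    · have m1 : AEStronglyMeasurable (fun z : Euc d × Euc d => G z.2) (volume.prod volume) :=
        hG.aestronglyMeasurable.comp_snd
      have m2 : Continuous fun z : Euc d × Euc d => Φ z.1 := hΦ.comp continuous_fst
      have m3 : Continuous fun z : Euc d × Euc d => φ.normed volume (z.1 - z.2) :=
        φ.continuous_normed.comp (continuous_fst.sub continuous_snd)
      exact m2.aestronglyMeasurable.mul (m3.aestronglyMeasurable.mul m1)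
    · obtain ⟨x, y⟩ := z
      simp only [Function.uncurry, norm_mul]
      by_cases h0 : Φ x = 0
      · simp [h0]
      by_cases h2 : φ.normed volume (x - y) = 0
      · simp only [h2]; simp; positivity
      have hy : y ∈ K := by
        have h3 : x - y ∈ Function.support (φ.normed volume) := h2
        rw [φ.support_normed_eq, mem_ball_zero_iff, ← dist_eq_norm, dist_comm] at h3
        exact Metric.mem_cthickening_of_dist_le y x _ _ (subset_tsupport _ h0) h3.le
      rw [indicator_of_mem hy]
      gcongr
      exact (hC _).trans (le_abs_self C)
  rw [integral_integral_swap hInt]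
  congr 1; ext y; congr 1; ext x
  rw [show x - y = -(y - x) by abel, φ.normed_neg]; ring

end bump

lemma exists_cutoff (d : ℕ) {R κ : ℝ} (hκ : 0 < κ) :
    ∃ χ : Euc d → ℝ, Smooth χ ∧ HasCompactSupport χ ∧ (∀ x, |χ x| ≤ 1) ∧
      (∀ x, ‖x‖ ≤ R → χ x = 1) ∧ ∀ x, ∑ i, pd i χ x ^ 2 ≤ κ := by
  let β : ContDiffBump (0 : Euc d) := ⟨1, 2, by norm_num, by norm_num⟩
  have hβ : Smooth (β : Euc d → ℝ) := β.contDiff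
  have hcont : Continuous fun x => ∑ i, pd i β x ^ 2 :=
    continuous_finsetSum _ fun i _ => (hβ.pd i).continuous.pow 2
  have hcs : HasCompactSupport fun x => ∑ i, pd i β x ^ 2 := by
    refine HasCompactSupport.intro β.hasCompactSupport.isCompact fun x hx => ?_
    exact Finset.sum_eq_zero fun i _ => by rw [pd_zero_outside i hx]; simp
  obtain ⟨C, hC⟩ := hcont.bounded_above_of_compact_support hcs
  obtain ⟨r, hr⟩ : ∃ r : ℝ, r = max (max 1 R) ((|C| + 1) / κ) := ⟨_, rfl⟩
  have hr1 : 1 ≤ r := by rw [hr]; exact (le_max_left _ _).trans (le_max_left _ _)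
  have hrR : R ≤ r := by rw [hr]; exact (le_max_right _ _).trans (le_max_left _ _)
  have hrC : (|C| + 1) / κ ≤ r := by rw [hr]; exact le_max_right _ _
  have hr0 : 0 < r := by linarith
  refine ⟨fun x => β (r⁻¹ • x), hβ.comp (contDiff_const_smul _), ?_, ?_, ?_, ?_⟩
  · exact β.hasCompactSupport.comp_homeomorph (Homeomorph.smulOfNeZero r⁻¹ (by positivity))
  · intro x; rw [abs_of_nonneg β.nonneg]; exact β.le_one
  · intro x hx
    refine β.one_of_mem_closedBall ?_
    rw [mem_closedBall_zero_iff, norm_smul, norm_inv, Real.norm_of_nonneg hr0.le]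
    show r⁻¹ * ‖x‖ ≤ 1
    rw [inv_mul_le_iff₀ hr0]; linarith
  · intro x
    have e : ∀ i, pd i (fun x => β (r⁻¹ • x)) x = r⁻¹ * pd i β (r⁻¹ • x) := by
      intro i
      have h1 : HasFDerivAt (fun y : Euc d => r⁻¹ • y) (r⁻¹ • ContinuousLinearMap.id ℝ (Euc d)) x :=
        (hasFDerivAt_id x).const_smul r⁻¹
      have h := (hβ.differentiable' (r⁻¹ • x)).hasFDerivAt.comp x h1
      rw [pd, show (fun y => β (r⁻¹ • y)) = β ∘ fun y => r⁻¹ • y from rfl, h.fderiv]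
      simp [pd]
    simp only [e, mul_pow]
    rw [← Finset.mul_sum]
    have h2 : ∑ i, pd i β (r⁻¹ • x) ^ 2 ≤ |C| :=
      (le_abs_self _).trans ((hC (r⁻¹ • x)).trans (le_abs_self C))
    rw [div_le_iff₀ hκ] at hrC
    rw [inv_pow, inv_mul_le_iff₀ (by positivity)]
    nlinarith [mul_le_mul_of_nonneg_right hr1 (mul_pos hr0 hκ).le]

lemma WeakSol.integral_mul_pd_eq_zero (hV : Smooth V) (h : WeakSol (schroedingerPotential V) G)
    (hG : LocallyIntegrable G volume) (hG2 : Integrable (fun y => G y ^ 2) volume)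
    {ψ : Euc d → ℝ} (hψ : Smooth ψ) (hψc : HasCompactSupport ψ) (i : Fin d) :
    ∫ x, (Real.exp (V x / 2) * pd i ψ x) * G x = 0 := by
  set Φ : Euc d → ℝ := fun x => Real.exp (V x / 2) * pd i ψ x with hΦ
  have hΦs : Smooth Φ := hV.expHalf.mul (hψ.pd i)
  have hΦc : HasCompactSupport Φ := (hψc.pd i).mul_left
  set B := ∫ x, ψ x ^ 2 * Real.exp (V x) with hB
  set A := ∫ x, G x ^ 2 with hA
  have hA0 : 0 ≤ A := integral_nonneg fun x => sq_nonneg _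
  have hB0 : 0 ≤ B := integral_nonneg fun x => by positivity
  set K := Metric.cthickening 1 (tsupport Φ) with hK
  have hKc : IsCompact K := hΦc.isCompact.cthickening
  set L := ∫ x in K, |G x| with hL
  have hL0 : 0 ≤ L := integral_nonneg fun x => abs_nonneg _
  suffices H : ∀ ε > 0, |∫ x, Φ x * G x| ≤ 3 * ε by
    have : |∫ x, Φ x * G x| ≤ 0 := le_of_forall_pos_le_add fun ε hε => by
      have := H (ε / 3) (by positivity); linarith
    exact abs_nonpos_iff.1 this
  intro ε hε
  obtain ⟨s, hs⟩ : ∃ s, s = (B + 1) / ε := ⟨_, rfl⟩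
  have hs0 : 0 < s := by rw [hs]; positivity
  have hBs : B / s ≤ ε := by
    rw [hs, div_div_eq_mul_div, div_le_iff₀ (by positivity)]; nlinarith
  obtain ⟨κ, hκ⟩ : ∃ κ, κ = ε / (6 * s * (A + 1)) := ⟨_, rfl⟩
  have hκ0 : 0 < κ := by rw [hκ]; positivity
  have hκs : s * ((2 * κ + 4 * κ) * A) ≤ ε := by
    have : κ * (6 * s * (A + 1)) = ε := by rw [hκ]; field_simp
    nlinarith [mul_pos hκ0 hs0]
  obtain ⟨R, hR⟩ := hψc.isCompact.isBounded.subset_closedBall 0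
  obtain ⟨χ, hχ, hχc, hχ1, hχR, hχκ⟩ := exists_cutoff d (R := R) hκ0
  have hWc : Continuous (schroedingerPotential V) := hV.schroedingerPotential.continuous
  obtain ⟨δ₁, hδ₁, hW⟩ : ∃ δ > 0, ∀ x y, χ x ≠ 0 → dist x y < δ →
      |schroedingerPotential V x - schroedingerPotential V y| ≤ κ := by
    have := hχc.isCompact.uniformContinuousAt_of_continuousAt _ (fun a _ => hWc.continuousAt)
      (Metric.dist_mem_uniformity hκ0)
    obtain ⟨δ, hδ, hd⟩ := Metric.mem_uniformity_dist.1 this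
    exact ⟨δ, hδ, fun x y hx hxy => (hd hxy (subset_tsupport _ hx)).le⟩
  obtain ⟨δ₂, hδ₂, hΦu⟩ := Metric.uniformContinuous_iff.1
    (hΦs.continuous.uniformContinuous_of_tendsto_cocompact hΦc.is_zero_at_infty) (ε / (L + 1)) (by positivity)
  obtain ⟨ρ, hρ⟩ : ∃ ρ, ρ = min (min δ₁ δ₂) 1 := ⟨_, rfl⟩
  have hρ0 : 0 < ρ := by rw [hρ]; positivity
  have hρ1 : ρ ≤ δ₁ := by rw [hρ]; exact (min_le_left _ _).trans (min_le_left _ _)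
  have hρ2 : ρ ≤ δ₂ := by rw [hρ]; exact (min_le_left _ _).trans (min_le_right _ _)
  have hρ3 : ρ ≤ 1 := by rw [hρ]; exact min_le_right _ _
  let φ : ContDiffBump (0 : Euc d) := ⟨ρ / 2, ρ, by positivity, by linarith⟩
  have hen := h.energy_le φ hV hG hG2 hχ hχc hχ1 hχκ
    (fun x y hx hxy => hW x y hx (lt_of_lt_of_le hxy hρ1)) hκ0.le
  set η := φ.normed volume with hη
  have hGε : Smooth (cv η G) := (smooth_normed φ).cv φ.hasCompactSupport_normed hG
  set g := fun x => cv η G x * Real.exp (V x / 2) with hg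
  have hgs : Smooth g := hGε.mul hV.expHalf
  have b1 : |∫ x, Φ x * cv η G x| ≤ 2 * ε := by
    have e1 : ∫ x, Φ x * cv η G x = -∫ x, pd i g x * ψ x := by
      rw [← integral_mul_pd hgs hψ (.inr hψc)]
      congr 1; ext x; simp only [hΦ, hg]; ring
    rw [e1, abs_neg]
    have i1 : Integrable fun x => pd i g x * ψ x :=
      ((hgs.pd i).mul hψ).integrable_of_compact hψc.mul_left
    have i2 : Integrable fun x => χ x ^ 2 * (∑ i, pd i g x ^ 2) * Real.exp (-V x) :=
      (((hχ.pow 2).mul (ContDiff.sum fun i _ => (hgs.pd i).pow 2)).mul hV.expNeg).integrable_of_compact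
      (hχc.comp_left (g := fun t : ℝ => t ^ 2) (by simp)).mul_right.mul_right
    have i3 : Integrable fun x => ψ x ^ 2 * Real.exp (V x) :=
      ((hψ.pow 2).mul hV.exp).integrable_of_compact
        (hψc.comp_left (g := fun t : ℝ => t ^ 2) (by simp)).mul_right
    have : |∫ x, pd i g x * ψ x| ≤ ∫ x, (s * (χ x ^ 2 * (∑ i, pd i g x ^ 2) * Real.exp (-V x)) +
        (ψ x ^ 2 * Real.exp (V x)) / s) := by
      refine (abs_integral_le_integral_abs).trans (integral_mono i1.abs
        ((i2.const_mul s).add (i3.div_const s)) fun x => ?_)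
      by_cases hx : ψ x = 0
      · simp only [hx]
        have : 0 ≤ ∑ i, pd i g x ^ 2 := Finset.sum_nonneg fun i _ => sq_nonneg _
        simp; positivity
      have hx1 : χ x = 1 := hχR x (mem_closedBall_zero_iff.1 (hR (subset_tsupport _ hx)))
      have hp : pd i g x ^ 2 ≤ ∑ i, pd i g x ^ 2 :=
        Finset.single_le_sum (f := fun i => pd i g x ^ 2) (fun i _ => sq_nonneg _) (Finset.mem_univ i)
      simp only [hx1, abs_mul]
      rw [one_pow, one_mul]
      have e2 : Real.exp (V x) = (Real.exp (-V x))⁻¹ := by rw [Real.exp_neg, inv_inv]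
      rw [e2]
      set w := Real.exp (-V x)
      have hw : 0 < w := Real.exp_pos _
      have h5 : |pd i g x| * |ψ x| ≤ s * (pd i g x ^ 2 * w) + ψ x ^ 2 * w⁻¹ / s := by
        rw [← sq_abs (pd i g x), ← sq_abs (ψ x)]
        set a := |pd i g x|
        set b := |ψ x|
        have hab : 0 ≤ a * b := mul_nonneg (abs_nonneg _) (abs_nonneg _)
        have : s * (a ^ 2 * w) + b ^ 2 * w⁻¹ / s - 2 * (a * b) = (s * a * w - b) ^ 2 / (s * w) := by
          field_simp; ring
        have h6 : 0 ≤ (s * a * w - b) ^ 2 / (s * w) := by positivity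
        linarith
      have h7 : s * (pd i g x ^ 2 * w) ≤ s * ((∑ i, pd i g x ^ 2) * w) := by gcongr
      linarith
    rw [integral_add (i2.const_mul s) (i3.div_const s), integral_const_mul, integral_div] at this
    have h8 := mul_le_mul_of_nonneg_left hen hs0.le
    linarith
  have b2 : |∫ y, (cv η Φ y - Φ y) * G y| ≤ ε := by
    have hle : ∀ y, |(cv η Φ y - Φ y) * G y| ≤ K.indicator (fun y => ε / (L + 1) * |G y|) y := by
      intro y
      by_cases hy : y ∈ K
      · rw [indicator_of_mem hy, abs_mul]
        refine mul_le_mul_of_nonneg_right ?_ (abs_nonneg _)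
        have := φ.dist_normed_convolution_le (μ := volume) (g := Φ) (x₀ := y) (ε := ε / (L + 1))
          hΦs.continuous.aestronglyMeasurable fun x hx => (hΦu (lt_of_lt_of_le hx hρ2)).le
        rw [← cv_eq_convolution] at this
        exact this
      · rw [indicator_of_notMem hy]
        have z1 : Φ y = 0 := by
          by_contra h0
          exact hy (Metric.self_subset_cthickening _ (subset_tsupport _ h0))
        have z2 : cv η Φ y = 0 := by
          refine integral_eq_zero_of_ae (Eventually.of_forall fun x => ?_)
          by_contra h0
          have hx0 : Φ x ≠ 0 := fun h1 => h0 (by simp [h1])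
          have hx1 : y - x ∈ Function.support η := fun h1 => h0 (by simp [h1])
          rw [φ.support_normed_eq, mem_ball_zero_iff, ← dist_eq_norm] at hx1
          exact hy (Metric.mem_cthickening_of_dist_le y x _ _ (subset_tsupport _ hx0)
            (hx1.le.trans hρ3))
        simp [z1, z2]
    have hGK : IntegrableOn (fun y => ε / (L + 1) * |G y|) K :=
      ((hG.integrableOn_isCompact hKc).abs).const_mul _
    calc |∫ y, (cv η Φ y - Φ y) * G y| ≤ ∫ y, |(cv η Φ y - Φ y) * G y| :=
          abs_integral_le_integral_abs
      _ ≤ ∫ y, K.indicator (fun y => ε / (L + 1) * |G y|) y :=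
          integral_mono_of_nonneg (Eventually.of_forall fun y => abs_nonneg _)
            (hGK.integrable_indicator hKc.measurableSet) (Eventually.of_forall hle)
      _ = ε / (L + 1) * L := by
          rw [integral_indicator hKc.measurableSet, integral_const_mul]
      _ ≤ ε := by
          rw [div_mul_eq_mul_div, div_le_iff₀ (by positivity)]; nlinarith
  have i4 : Integrable fun y => Φ y * G y := by
    have := hG.integrable_smul_left_of_hasCompactSupport hΦs.continuous hΦc
    exact this
  have i5 : Integrable fun y => cv η Φ y * G y := by
    have hc : Continuous (cv η Φ) :=
      ((smooth_normed φ).cv φ.hasCompactSupport_normed hΦs.continuous.locallyIntegrable).continuous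
    have hcs : HasCompactSupport (cv η Φ) := by
      rw [cv_eq_convolution]
      exact φ.hasCompactSupport_normed.convolution _ hΦc
    exact hG.integrable_smul_left_of_hasCompactSupport hc hcs
  have e6 : ∫ y, (cv η Φ y - Φ y) * G y = (∫ y, Φ y * cv η G y) - ∫ y, Φ y * G y := by
    rw [integral_mul_cv φ hΦs.continuous hΦc hG, ← integral_sub i5 i4]
    congr 1; ext y; ring
  rw [e6] at b2
  have := abs_sub_abs_le_abs_sub (∫ y, Φ y * G y) (∫ y, Φ y * cv η G y)
  rw [abs_sub_comm] at this
  linarith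

/-- A locally integrable function with vanishing weak gradient is almost everywhere constant. -/
lemma ae_const_of_weak_gradient_zero {g : Euc d → ℝ} (hg : LocallyIntegrable g volume)
    (h : ∀ ψ : Euc d → ℝ, Smooth ψ → HasCompactSupport ψ → ∀ i, ∫ x, pd i ψ x * g x = 0) :
    ∃ c : ℝ, ∀ᵐ x, g x = c := by
  let φ : ℕ → ContDiffBump (0 : Euc d) := fun k =>
    ⟨1 / (2 * ((k : ℝ) + 1)), 1 / ((k : ℝ) + 1), by positivity, by
      rw [div_lt_div_iff₀ (by positivity) (by positivity)]
      have : (0 : ℝ) ≤ k := by positivity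
      nlinarith⟩
  have hconst : ∀ k x y, cv ((φ k).normed volume) g x = cv ((φ k).normed volume) g y := by
    intro k
    have hs := (smooth_normed (φ k)).cv (φ k).hasCompactSupport_normed hg
    refine fun x y => is_const_of_fderiv_eq_zero (𝕜 := ℝ) hs.differentiable' (fun z => ?_) x y
    have hz : ∀ i, fderiv ℝ (cv ((φ k).normed volume) g) z (EuclideanSpace.single i 1) = 0 := by
      intro i
      have e := congrFun (pd_cv (smooth_normed (φ k)) (φ k).hasCompactSupport_normed hg i) z
      rw [pd] at e
      rw [e]
      have h1 := h _ ((smooth_normed (φ k)).reflect z)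
        (hasCompactSupport_reflect (φ k).hasCompactSupport_normed z) i
      rw [pd_reflect (smooth_normed (φ k))] at h1
      simp only [neg_mul, integral_neg, neg_eq_zero] at h1
      exact h1
    apply ContinuousLinearMap.coe_injective
    refine (EuclideanSpace.basisFun (Fin d) ℝ).toBasis.ext fun i => ?_
    simpa using hz i
  have hlim := ContDiffBump.ae_convolution_tendsto_right_of_locallyIntegrable (φ := φ)
    (l := atTop) (K := 2) (g := g) (μ := volume) tendsto_one_div_add_atTop_nhds_zero_nat
    (Eventually.of_forall fun k => by
      show 1 / ((k : ℝ) + 1) ≤ 2 * (1 / (2 * ((k : ℝ) + 1)))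
      apply le_of_eq; field_simp) hg
  obtain ⟨x₀, hx₀⟩ := hlim.exists
  refine ⟨g x₀, ?_⟩
  filter_upwards [hlim] with x hx
  refine tendsto_nhds_unique hx (hx₀.congr fun k => ?_)
  rw [← cv_eq_convolution]; exact hconst k _ _

/-- An `L²` function orthogonal to the range of the generator is a multiple of `exp(-V/2)`. -/
theorem ae_eq_of_orthogonal_gen (hV : Smooth V) (hG : MemLp G 2 volume)
    (h : ∀ φ : Euc d → ℝ, Smooth φ → HasCompactSupport φ →
      ∫ x, G x * Real.exp (-V x / 2) * gen V φ x = 0) :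
    ∃ c : ℝ, ∀ᵐ x, Real.exp (V x / 2) * G x = c := by
  have hGl : LocallyIntegrable G volume := hG.locallyIntegrable (by norm_num)
  have hw := weakSol_of_orthogonal hV h
  refine ae_const_of_weak_gradient_zero (hGl.continuous_mul hV.expHalf.continuous)
    fun ψ hψ hc i => ?_
  rw [← hw.integral_mul_pd_eq_zero hV hGl hG.integrable_sq hψ hc i]
  congr 1; ext x; ring

end mollify

lemma integral_add₃ {Ω : Type*} [MeasurableSpace Ω] {ν : Measure Ω} {u v w : Ω → ℝ}
    (hu : Integrable u ν) (hv : Integrable v ν) (hw : Integrable w ν) :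
    ∫ x, (u x + v x + w x) ∂ν = (∫ x, u x ∂ν) + (∫ x, v x ∂ν) + ∫ x, w x ∂ν := by
  rw [← integral_add hu hv]
  exact integral_add (hu.add hv) hw

section gibbs

variable {d : ℕ} {V f g h : Euc d → ℝ}

/-- The measure with density `exp(-V)`. -/
def gibbs (V : Euc d → ℝ) : Measure (Euc d) :=
  volume.withDensity fun x => ENNReal.ofReal (Real.exp (-V x))

lemma measurable_gibbs_density (hV : Smooth V) :
    Measurable fun x => ENNReal.ofReal (Real.exp (-V x)) :=
  (hV.expNeg.continuous.measurable).ennreal_ofReal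

lemma integral_gibbs (hV : Smooth V) (f : Euc d → ℝ) :
    ∫ x, f x ∂gibbs V = ∫ x, f x * Real.exp (-V x) := by
  rw [gibbs, integral_withDensity_eq_integral_toReal_smul (measurable_gibbs_density hV)
    (Filter.Eventually.of_forall fun x => ENNReal.ofReal_lt_top)]
  congr 1; ext x
  rw [ENNReal.toReal_ofReal (Real.exp_pos _).le, smul_eq_mul, mul_comm]

lemma gibbs_absolutelyContinuous : gibbs V ≪ volume := withDensity_absolutelyContinuous _ _

lemma absolutelyContinuous_gibbs (hV : Smooth V) : volume ≪ gibbs V :=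
  withDensity_absolutelyContinuous' (measurable_gibbs_density hV).aemeasurable
    (Filter.Eventually.of_forall fun x => by simp [Real.exp_pos])

lemma memLp_volume_of_gibbs (hV : Smooth V) (hf : MemLp f 2 (gibbs V)) :
    MemLp (fun x => f x * Real.exp (-V x / 2)) 2 volume := by
  have hm : AEStronglyMeasurable (fun x => f x * Real.exp (-V x / 2)) volume := by
    have h1 : AEStronglyMeasurable f volume :=
      hf.1.mono_ac (absolutelyContinuous_gibbs hV)
    exact h1.mul ((hV.neg.div_const 2).exp.continuous.aestronglyMeasurable)
  refine (memLp_two_iff_integrable_sq hm).2 ?_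
  have h2 := hf.integrable_sq
  rw [gibbs, integrable_withDensity_iff (measurable_gibbs_density hV)
    (Filter.Eventually.of_forall fun x => ENNReal.ofReal_lt_top)] at h2
  refine h2.congr (Filter.Eventually.of_forall fun x => ?_)
  simp only []
  rw [ENNReal.toReal_ofReal (Real.exp_pos _).le, mul_pow, ← Real.exp_nat_mul]
  congr 2; push_cast; ring

lemma memLp_of_compact [IsFiniteMeasure (gibbs V)] (hf : Smooth f) (hc : HasCompactSupport f) :
    MemLp f 2 (gibbs V) := hf.continuous.memLp_of_hasCompactSupport hc

lemma integral_gen_mul_gibbs (hV : Smooth V) (hh : Smooth h) (hg : Smooth g)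
    (hc : HasCompactSupport h ∨ HasCompactSupport g) :
    ∫ x, gen V h x * g x ∂gibbs V = ∫ x, ∑ i, pd i h x * pd i g x ∂gibbs V := by
  rw [integral_gibbs hV, integral_gibbs hV, integral_gen_mul hV hh hg hc]

lemma pd_const (c : ℝ) (i : Fin d) : pd i (fun _ : Euc d => c) = fun _ => 0 := by
  ext x; simp [pd]

lemma pd_const_mul (hf : Smooth f) (c : ℝ) (i : Fin d) :
    pd i (fun x => c * f x) = fun x => c * pd i f x := by
  rw [pd_mul contDiff_const hf, pd_const]; ext; ring

lemma integral_gen_gibbs (hV : Smooth V) (hh : Smooth h) (hc : HasCompactSupport h) :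
    ∫ x, gen V h x ∂gibbs V = 0 := by
  have := integral_gen_mul_gibbs hV hh (g := fun _ => 1) contDiff_const (.inl hc)
  simpa [pd_const] using this

lemma gen_add (hf : Smooth f) (hg : Smooth g) :
    gen V (fun x => f x + g x) = fun x => gen V f x + gen V g x := by
  ext x
  simp only [gen, ← Finset.sum_add_distrib]
  refine Finset.sum_congr rfl fun i _ => ?_
  rw [pd_add hf hg, pd_add (hf.pd i) (hg.pd i)]; ring

lemma gen_const_mul (hf : Smooth f) (c : ℝ) :
    gen V (fun x => c * f x) = fun x => c * gen V f x := by
  ext x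
  simp only [gen, Finset.mul_sum]
  refine Finset.sum_congr rfl fun i _ => ?_
  rw [pd_const_mul hf, pd_const_mul (hf.pd i)]; ring

/-- The subspace of `L²` spanned by the range of the generator and the constants. -/
def genSubmodule (V : Euc d → ℝ) [IsFiniteMeasure (gibbs V)] :
    Submodule ℝ (Lp ℝ 2 (gibbs V)) where
  carrier := {u | ∃ (h : Euc d → ℝ) (c : ℝ), Smooth h ∧ HasCompactSupport h ∧
    u =ᵐ[gibbs V] fun x => gen V h x + c}
  add_mem' := by
    rintro u v ⟨h, c, hh, hc, hu⟩ ⟨k, e, hk, hke, hv⟩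
    refine ⟨fun x => h x + k x, c + e, hh.add hk, hc.add hke, ?_⟩
    rw [gen_add hh hk]
    filter_upwards [hu, hv, Lp.coeFn_add u v] with x h1 h2 h3
    rw [h3, Pi.add_apply, h1, h2]; ring
  zero_mem' := by
    refine ⟨fun _ => 0, 0, contDiff_const, HasCompactSupport.zero, ?_⟩
    filter_upwards [Lp.coeFn_zero ℝ 2 (gibbs V)] with x h1
    rw [h1]; simp [gen, pd_const]
  smul_mem' := by
    rintro r u ⟨h, c, hh, hc, hu⟩
    refine ⟨fun x => r * h x, r * c, contDiff_const.mul hh, hc.mul_left, ?_⟩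
    rw [gen_const_mul hh]
    filter_upwards [hu, Lp.coeFn_smul r u] with x h1 h2
    rw [h2, Pi.smul_apply, h1, smul_eq_mul]; ring

lemma genSubmodule_dense (hV : Smooth V) [IsProbabilityMeasure (gibbs V)] :
    (genSubmodule V).topologicalClosure = ⊤ := by
  rw [Submodule.topologicalClosure_eq_top_iff, Submodule.eq_bot_iff]
  intro u hu
  rw [Submodule.mem_orthogonal] at hu
  have hmem : ∀ (h : Euc d → ℝ) (c : ℝ), Smooth h → HasCompactSupport h →
      ∫ x, (gen V h x + c) * u x ∂gibbs V = 0 := by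
    intro h c hh hc
    have hL : MemLp (fun x => gen V h x + c) 2 (gibbs V) :=
      (memLp_of_compact (hV.gen hh) hc.gen).add (memLp_const c)
    have := hu (hL.toLp _) ⟨h, c, hh, hc, hL.coeFn_toLp⟩
    rw [L2.inner_def] at this
    rw [← this]
    refine integral_congr_ae ?_
    filter_upwards [hL.coeFn_toLp] with x hx
    rw [hx]; simp [mul_comm]
  obtain ⟨c, hc⟩ := ae_eq_of_orthogonal_gen hV (memLp_volume_of_gibbs hV (Lp.memLp u))
    (fun φ hφ hφc => by
      have := hmem φ 0 hφ hφc
      rw [integral_gibbs hV] at this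
      rw [← this]; congr 1; ext x
      have e : Real.exp (-V x / 2) * Real.exp (-V x / 2) = Real.exp (-V x) := by
        rw [← Real.exp_add]; congr 1; ring
      rw [← e]; ring)
  have hc' : ∀ᵐ x ∂gibbs V, u x = c := gibbs_absolutelyContinuous (by
    filter_upwards [hc] with x hx
    rw [← hx]
    have e : Real.exp (-V x / 2) * Real.exp (V x / 2) = 1 := by
      rw [← Real.exp_add]; ring_nf; simp
    linear_combination (-(u x : ℝ)) * e)
  have h0 := hmem (fun _ => 0) 1 contDiff_const HasCompactSupport.zero
  have : c = 0 := by
    rw [integral_congr_ae (g := fun _ => c) (by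
      filter_upwards [hc'] with x hx
      rw [hx]; simp [gen, pd_const])] at h0
    simpa using h0
  rw [Lp.eq_zero_iff_ae_eq_zero]
  filter_upwards [hc'] with x hx
  rw [hx, this]; rfl

/-- Mean-zero functions in `L²` are limits of functions in the range of the generator. -/
lemma exists_gen_approx (hV : Smooth V) [IsProbabilityMeasure (gibbs V)]
    (hf : MemLp f 2 (gibbs V)) (hf0 : ∫ x, f x ∂gibbs V = 0) {ε : ℝ} (hε : 0 < ε) :
    ∃ h : Euc d → ℝ, Smooth h ∧ HasCompactSupport h ∧
      ∫ x, (f x - gen V h x) ^ 2 ∂gibbs V ≤ ε := by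
  have hd : hf.toLp f ∈ closure (genSubmodule V : Set (Lp ℝ 2 (gibbs V))) := by
    have : hf.toLp f ∈ (genSubmodule V).topologicalClosure := by
      rw [genSubmodule_dense hV]; trivial
    exact this
  obtain ⟨u, ⟨h, c, hh, hc, hu⟩, hdist⟩ := Metric.mem_closure_iff.1 hd (Real.sqrt ε) (by positivity)
  refine ⟨h, hh, hc, ?_⟩
  have hg : MemLp (gen V h) 2 (gibbs V) := memLp_of_compact (hV.gen hh) hc.gen
  have i1 : Integrable (fun x => (f x - gen V h x) ^ 2) (gibbs V) := (hf.sub hg).integrable_sq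
  have i2 : Integrable (fun x => f x - gen V h x) (gibbs V) :=
    (hf.sub hg).integrable (by norm_num)
  have e1 : ∫ x, (f x - gen V h x - c) ^ 2 ∂gibbs V =
      (∫ x, (f x - gen V h x) ^ 2 ∂gibbs V) + c ^ 2 := by
    have e2 : ∀ x, (f x - gen V h x - c) ^ 2 =
        (f x - gen V h x) ^ 2 + (-2 * c) * (f x - gen V h x) + c ^ 2 := fun x => by ring
    simp only [e2]
    rw [integral_add₃ i1 (i2.const_mul _) (integrable_const _), integral_const_mul,
      integral_sub (hf.integrable (by norm_num)) (hg.integrable (by norm_num)), hf0,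
      integral_gen_gibbs hV hh hc]
    simp
  have e3 : ∫ x, (f x - gen V h x - c) ^ 2 ∂gibbs V = ‖hf.toLp f - u‖ ^ 2 := by
    rw [← real_inner_self_eq_norm_sq, L2.inner_def]
    refine integral_congr_ae ?_
    filter_upwards [hu, hf.coeFn_toLp, Lp.coeFn_sub (hf.toLp f) u] with x h1 h2 h3
    rw [h3, Pi.sub_apply, h1, h2]; simp; ring
  have e4 : ‖hf.toLp f - u‖ ^ 2 ≤ ε := by
    rw [dist_eq_norm] at hdist
    calc ‖hf.toLp f - u‖ ^ 2 ≤ Real.sqrt ε ^ 2 := pow_le_pow_left₀ (norm_nonneg _) hdist.le 2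
      _ = ε := Real.sq_sqrt hε.le
  nlinarith [sq_nonneg c]

/-- Cauchy–Schwarz for integrals. -/
lemma integral_mul_sq_le {Ω : Type*} [MeasurableSpace Ω] {ν : Measure Ω} {u v : Ω → ℝ}
    (hu : MemLp u 2 ν) (hv : MemLp v 2 ν) :
    (∫ x, u x * v x ∂ν) ^ 2 ≤ (∫ x, u x ^ 2 ∂ν) * ∫ x, v x ^ 2 ∂ν := by
  have iu := hu.integrable_sq
  have iv := hv.integrable_sq
  have iuv : Integrable (fun x => u x * v x) ν := hu.integrable_mul hv
  have h : ∀ s : ℝ, 0 ≤ (∫ x, u x ^ 2 ∂ν) * (s * s) + 2 * (∫ x, u x * v x ∂ν) * s +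
      ∫ x, v x ^ 2 ∂ν := by
    intro s
    have e : ∫ x, (s * u x + v x) ^ 2 ∂ν = (∫ x, u x ^ 2 ∂ν) * (s * s) +
        2 * (∫ x, u x * v x ∂ν) * s + ∫ x, v x ^ 2 ∂ν := by
      have : ∀ x, (s * u x + v x) ^ 2 = s * s * u x ^ 2 + 2 * s * (u x * v x) + v x ^ 2 :=
        fun x => by ring
      simp only [this]
      rw [integral_add₃ (iu.const_mul _) (iuv.const_mul _) iv, integral_const_mul,
        integral_const_mul]
      ring
    rw [← e]; exact integral_nonneg fun x => sq_nonneg _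
  have := discrim_le_zero h
  simp only [discrim] at this
  nlinarith

end gibbs

section poincare

variable {d : ℕ} {V f g h : Euc d → ℝ}

/-- The Poincaré inequality with constant `C` for test functions. -/
def PoincareC (V : Euc d → ℝ) (C : ℝ) : Prop :=
  ∀ φ : Euc d → ℝ, Smooth φ → HasCompactSupport φ →
    (∫ x, φ x ^ 2 ∂gibbs V) - (∫ x, φ x ∂gibbs V) ^ 2 ≤ C * ∫ x, ∑ i, pd i φ x ^ 2 ∂gibbs V

lemma pd_sub_const (f : Euc d → ℝ) (c : ℝ) (i : Fin d) : pd i (fun x => f x - c) = pd i f := by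
  ext x
  simp only [pd]
  rw [fderiv_sub_const]

lemma integrable_sum_pd_sq (hf : ∀ i, MemLp (pd i f) 2 (gibbs V)) :
    Integrable (fun x => ∑ i, pd i f x ^ 2) (gibbs V) :=
  integrable_finsetSum _ fun i _ => (hf i).integrable_sq

lemma variance_le_of_energy (hV : Smooth V) [IsProbabilityMeasure (gibbs V)] {C : ℝ} (hC : 0 < C)
    (H : ∀ h : Euc d → ℝ, Smooth h → HasCompactSupport h →
      ∫ x, ∑ i, pd i h x ^ 2 ∂gibbs V ≤ C * ∫ x, gen V h x ^ 2 ∂gibbs V)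
    (hf : Smooth f) (hf2 : MemLp f 2 (gibbs V)) (hfd : ∀ i, MemLp (pd i f) 2 (gibbs V)) :
    (∫ x, f x ^ 2 ∂gibbs V) - (∫ x, f x ∂gibbs V) ^ 2 ≤ C * ∫ x, ∑ i, pd i f x ^ 2 ∂gibbs V := by
  set m := ∫ x, f x ∂gibbs V with hm
  have hf0 : MemLp (fun x => f x - m) 2 (gibbs V) := hf2.sub (memLp_const m)
  have hf1 := hf2.integrable (by norm_num)
  have hmean : ∫ x, (f x - m) ∂gibbs V = 0 := by
    rw [integral_sub hf1 (integrable_const _)]; simp [hm]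
  have hvar : ∫ x, (f x - m) ^ 2 ∂gibbs V = (∫ x, f x ^ 2 ∂gibbs V) - m ^ 2 := by
    have e : ∀ x, (f x - m) ^ 2 = f x ^ 2 + (-2 * m) * f x + m ^ 2 := fun x => by ring
    simp only [e]
    rw [integral_add₃ hf2.integrable_sq (hf1.const_mul _) (integrable_const _), integral_const_mul,
      ← hm]
    simp; ring
  rw [← hvar]
  refine le_of_forall_pos_le_add fun ε hε => ?_
  obtain ⟨h, hh, hc, happ⟩ := exists_gen_approx hV hf0 hmean hε
  have hL : MemLp (gen V h) 2 (gibbs V) := memLp_of_compact (hV.gen hh) hc.gen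
  have iLf : Integrable (fun x => gen V h x * (f x - m)) (gibbs V) := hL.integrable_mul hf0
  have e1 : ∫ x, (f x - m - gen V h x) ^ 2 ∂gibbs V = (∫ x, (f x - m) ^ 2 ∂gibbs V) +
      (-2) * (∫ x, gen V h x * (f x - m) ∂gibbs V) + ∫ x, gen V h x ^ 2 ∂gibbs V := by
    rw [← integral_const_mul, ← integral_add₃ hf0.integrable_sq (iLf.const_mul _) hL.integrable_sq]
    congr 1; ext x; ring
  have e2 := integral_gen_mul_gibbs hV hh (g := fun x => f x - m) (hf.sub contDiff_const) (.inl hc)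
  simp only [pd_sub_const] at e2
  have hhd : ∀ i, MemLp (pd i h) 2 (gibbs V) := fun i => memLp_of_compact (hh.pd i) (hc.pd i)
  have i1 : Integrable (fun x => ∑ i, pd i h x * pd i f x) (gibbs V) :=
    integrable_finsetSum _ fun i _ => (hhd i).integrable_mul (hfd i)
  have e4 : 2 * ∫ x, ∑ i, pd i h x * pd i f x ∂gibbs V ≤
      C⁻¹ * (∫ x, ∑ i, pd i h x ^ 2 ∂gibbs V) + C * ∫ x, ∑ i, pd i f x ^ 2 ∂gibbs V := by
    rw [← integral_const_mul, ← integral_const_mul, ← integral_const_mul, ← integral_add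
      ((integrable_sum_pd_sq hhd).const_mul _) ((integrable_sum_pd_sq hfd).const_mul _)]
    refine integral_mono (i1.const_mul _) (((integrable_sum_pd_sq hhd).const_mul _).add
      ((integrable_sum_pd_sq hfd).const_mul _)) fun x => ?_
    simp only [Finset.mul_sum, ← Finset.sum_add_distrib]
    refine Finset.sum_le_sum fun i _ => ?_
    have : C⁻¹ * pd i h x ^ 2 + C * pd i f x ^ 2 - 2 * (pd i h x * pd i f x) =
        C⁻¹ * (pd i h x - C * pd i f x) ^ 2 := by field_simp; ring
    have h2 : 0 ≤ C⁻¹ * (pd i h x - C * pd i f x) ^ 2 := by positivity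
    linarith
  have e5 : C⁻¹ * (∫ x, ∑ i, pd i h x ^ 2 ∂gibbs V) ≤ ∫ x, gen V h x ^ 2 ∂gibbs V := by
    rw [inv_mul_le_iff₀ hC]; exact H h hh hc
  rw [e1] at happ
  linarith

variable {t a : ℝ}

/-- A lower bound for the Hessian of `V`. -/
def HessGe (V : Euc d → ℝ) (t : ℝ) : Prop :=
  ∀ (x : Euc d) (v : Fin d → ℝ), t * ∑ i, v i ^ 2 ≤ ∑ i, ∑ j, pd i (pd j V) x * v j * v i

lemma bochner_le (hV : Smooth V) [IsProbabilityMeasure (gibbs V)] (hH : HessGe V t)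
    (hh : Smooth h) (hc : HasCompactSupport h) :
    (∑ i, ∫ x, ∑ j, pd j (pd i h) x ^ 2 ∂gibbs V) + t * ∫ x, ∑ i, pd i h x ^ 2 ∂gibbs V ≤
      ∫ x, gen V h x ^ 2 ∂gibbs V := by
  have h1 := integral_gen_sq hV hh hc
  simp only [← integral_gibbs hV] at h1
  rw [h1, ← integral_const_mul]
  have i1 : Integrable (fun x => ∑ i, ∑ j, pd i (pd j V) x * pd j h x * pd i h x) (gibbs V) := by
    refine integrable_finsetSum _ fun i _ => integrable_finsetSum _ fun j _ => ?_
    exact ((((hV.pd j).pd i).mul (hh.pd j)).mul (hh.pd i)).continuous.integrable_of_hasCompactSupport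
      (hc.pd i).mul_left
  have := integral_mono ((integrable_sum_pd_sq fun i =>
    memLp_of_compact (V := V) (hh.pd i) (hc.pd i)).const_mul t) i1 fun x => hH x fun i => pd i h x
  linarith

lemma smooth_coord (i : Fin d) : Smooth fun x : Euc d => x i :=
  (EuclideanSpace.proj (𝕜 := ℝ) i).contDiff

lemma pd_coord (i j : Fin d) : pd j (fun x : Euc d => x i) = fun _ => if i = j then 1 else 0 := by
  ext x
  have : fderiv ℝ (fun x : Euc d => x i) x = EuclideanSpace.proj (𝕜 := ℝ) i :=
    (EuclideanSpace.proj (𝕜 := ℝ) i).fderiv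
  rw [pd, this]
  simp

lemma sum_sq_mean_pd_le (hV : Smooth V) [IsProbabilityMeasure (gibbs V)]
    (hx : ∀ i, MemLp (fun x : Euc d => x i) 2 (gibbs V)) (m : Fin d → ℝ)
    (hcov : ∀ v : Fin d → ℝ, ∫ x, (∑ i, v i * (x i - m i)) ^ 2 ∂gibbs V ≤ a * ∑ i, v i ^ 2)
    (hh : Smooth h) (hc : HasCompactSupport h) :
    ∑ i, (∫ x, pd i h x ∂gibbs V) ^ 2 ≤ a * ∫ x, gen V h x ^ 2 ∂gibbs V := by
  have hL : MemLp (gen V h) 2 (gibbs V) := memLp_of_compact (hV.gen hh) hc.gen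
  have hxm : ∀ i, MemLp (fun x : Euc d => x i - m i) 2 (gibbs V) := fun i =>
    (hx i).sub (memLp_const _)
  have e1 : ∀ i, ∫ x, pd i h x ∂gibbs V = ∫ x, gen V h x * (x i - m i) ∂gibbs V := by
    intro i
    have := integral_gen_mul_gibbs hV hh (g := fun x : Euc d => x i - m i)
      ((smooth_coord i).sub contDiff_const) (.inl hc)
    rw [this]
    have e : ∀ j, pd j (fun x : Euc d => x i - m i) = fun _ => if i = j then 1 else 0 := by
      intro j; rw [← pd_coord i j, pd_sub_const]
    simp [e]
  set v : Fin d → ℝ := fun i => ∫ x, pd i h x ∂gibbs V with hv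
  set S := ∑ i, v i ^ 2 with hS
  have hS0 : 0 ≤ S := Finset.sum_nonneg fun i _ => sq_nonneg _
  have hlin : MemLp (fun x : Euc d => ∑ i, v i * (x i - m i)) 2 (gibbs V) :=
    memLp_finsetSum _ fun i _ => (hxm i).const_mul _
  have e2 : S = ∫ x, gen V h x * (∑ i, v i * (x i - m i)) ∂gibbs V := by
    simp only [Finset.mul_sum]
    rw [integral_finsetSum (f := fun i (x : Euc d) => gen V h x * (v i * (x i - m i))) _
      fun i _ => hL.integrable_mul ((hxm i).const_mul _)]
    refine Finset.sum_congr rfl fun i _ => ?_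
    have : ∀ x : Euc d, gen V h x * (v i * (x i - m i)) = v i * (gen V h x * (x i - m i)) :=
      fun x => by ring
    simp only [this]
    rw [integral_const_mul, ← e1]; simp only [hv]; ring
  have e3 := integral_mul_sq_le hL hlin
  rw [← e2] at e3
  have hE0 : 0 ≤ ∫ x, gen V h x ^ 2 ∂gibbs V := integral_nonneg fun x => sq_nonneg _
  have e4 := e3.trans (mul_le_mul_of_nonneg_left (hcov v) hE0)
  rcases hS0.eq_or_lt with h0 | h0
  · show S ≤ _
    have h1 := hcov 1
    have : 0 ≤ a ∨ d = 0 := by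
      by_cases hd : d = 0
      · exact .inr hd
      · left
        have h2 : 0 ≤ a * ∑ i : Fin d, (1 : Fin d → ℝ) i ^ 2 :=
          (integral_nonneg fun x => sq_nonneg _).trans h1
        simp at h2
        have : (0 : ℝ) < d := by positivity
        exact nonneg_of_mul_nonneg_left h2 this
    rcases this with h2 | h2
    · rw [← h0]; positivity
    · subst h2
      have : gen V h = fun _ => 0 := by ext x; simp [gen]
      rw [← h0, this]; simp
  · have : S * S ≤ (a * ∫ x, gen V h x ^ 2 ∂gibbs V) * S := by rw [← pow_two]; linarith
    exact le_of_mul_le_mul_right this h0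

lemma energy_le_of_poincare (hV : Smooth V) [IsProbabilityMeasure (gibbs V)] (hH : HessGe V t)
    (ht : 0 < t) {C : ℝ} (hC0 : 0 ≤ C) (hC : PoincareC V C)
    (hx : ∀ i, MemLp (fun x : Euc d => x i) 2 (gibbs V)) (m : Fin d → ℝ)
    (hcov : ∀ v : Fin d → ℝ, ∫ x, (∑ i, v i * (x i - m i)) ^ 2 ∂gibbs V ≤ a * ∑ i, v i ^ 2)
    (hh : Smooth h) (hc : HasCompactSupport h) :
    ∫ x, ∑ i, pd i h x ^ 2 ∂gibbs V ≤ (a + C) / (1 + t * C) * ∫ x, gen V h x ^ 2 ∂gibbs V := by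
  have h1 := bochner_le hV hH hh hc
  have h2 := sum_sq_mean_pd_le hV hx m hcov hh hc
  have h3 : ∑ i, ((∫ x, pd i h x ^ 2 ∂gibbs V) - (∫ x, pd i h x ∂gibbs V) ^ 2) ≤
      ∑ i, C * ∫ x, ∑ j, pd j (pd i h) x ^ 2 ∂gibbs V :=
    Finset.sum_le_sum fun i _ => hC _ (hh.pd i) (hc.pd i)
  rw [← Finset.mul_sum, Finset.sum_sub_distrib, ← integral_finsetSum _ fun i _ =>
    (memLp_of_compact (V := V) (hh.pd i) (hc.pd i)).integrable_sq] at h3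
  have h4 := mul_le_mul_of_nonneg_left h1 hC0
  rw [div_mul_eq_mul_div, le_div_iff₀ (by positivity)]
  nlinarith

/-- The Poincaré constant of a `t`-strongly log-concave measure with covariance at most `a` is at
most `√(a/t)`. -/
theorem poincare_improved (hV : Smooth V) [IsProbabilityMeasure (gibbs V)] (hH : HessGe V t)
    (ht : 0 < t) (ha : 0 < a)
    (hx : ∀ i, MemLp (fun x : Euc d => x i) 2 (gibbs V)) (m : Fin d → ℝ)
    (hcov : ∀ v : Fin d → ℝ, ∫ x, (∑ i, v i * (x i - m i)) ^ 2 ∂gibbs V ≤ a * ∑ i, v i ^ 2)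
    (hf : Smooth f) (hf2 : MemLp f 2 (gibbs V)) (hfd : ∀ i, MemLp (pd i f) 2 (gibbs V)) :
    (∫ x, f x ^ 2 ∂gibbs V) - (∫ x, f x ∂gibbs V) ^ 2 ≤
      Real.sqrt (a / t) * ∫ x, ∑ i, pd i f x ^ 2 ∂gibbs V := by
  set S := {C : ℝ | 0 ≤ C ∧ PoincareC V C} with hS
  have hgrad0 : ∀ φ : Euc d → ℝ, 0 ≤ ∫ x, ∑ i, pd i φ x ^ 2 ∂gibbs V := fun φ =>
    integral_nonneg fun x => Finset.sum_nonneg fun i _ => sq_nonneg _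
  have key : ∀ C : ℝ, 0 < C → (∀ h : Euc d → ℝ, Smooth h → HasCompactSupport h →
      ∫ x, ∑ i, pd i h x ^ 2 ∂gibbs V ≤ C * ∫ x, gen V h x ^ 2 ∂gibbs V) → C ∈ S := fun C hC H =>
    ⟨hC.le, fun φ hφ hφc => variance_le_of_energy hV hC H hφ (memLp_of_compact hφ hφc)
      fun i => memLp_of_compact (hφ.pd i) (hφc.pd i)⟩
  have hne : t⁻¹ ∈ S := key _ (by positivity) fun h hh hc => by
    have h1 := bochner_le hV hH hh hc
    have : 0 ≤ ∑ i, ∫ x, ∑ j, pd j (pd i h) x ^ 2 ∂gibbs V :=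
      Finset.sum_nonneg fun i _ => hgrad0 _
    rw [inv_mul_eq_div, le_div_iff₀ ht]; linarith
  have hbdd : BddBelow S := ⟨0, fun C hC => hC.1⟩
  have hinf0 : 0 ≤ sInf S := le_csInf ⟨_, hne⟩ fun C hC => hC.1
  have hinf : PoincareC V (sInf S) := by
    intro φ hφ hφc
    set A := (∫ x, φ x ^ 2 ∂gibbs V) - (∫ x, φ x ∂gibbs V) ^ 2
    set B := ∫ x, ∑ i, pd i φ x ^ 2 ∂gibbs V
    rcases (hgrad0 φ).eq_or_lt with h0 | h0
    · have := hne.2 φ hφ hφc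
      have hB : B = 0 := h0.symm
      rw [hB]; rw [← h0] at this; rw [mul_zero] at this ⊢; exact this
    · rw [← div_le_iff₀ h0]
      exact le_csInf ⟨_, hne⟩ fun C hC => by
        rw [div_le_iff₀ h0]; exact hC.2 φ hφ hφc
  have hfix : t * sInf S ^ 2 ≤ a := by
    have h1 : (a + sInf S) / (1 + t * sInf S) ∈ S := key _ (by positivity) fun h hh hc =>
      energy_le_of_poincare hV hH ht hinf0 hinf hx m hcov hh hc
    have h2 := csInf_le hbdd h1
    rw [le_div_iff₀ (by positivity)] at h2
    nlinarith
  set C₀ := Real.sqrt (a / t) with hC₀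
  have hC₀pos : 0 < C₀ := Real.sqrt_pos.2 (by positivity)
  have hC₀sq : t * C₀ ^ 2 = a := by rw [hC₀, Real.sq_sqrt (by positivity)]; field_simp
  have hle : sInf S ≤ C₀ := by
    refine Real.le_sqrt_of_sq_le ?_
    rw [le_div_iff₀ ht]; linarith
  have hP : PoincareC V C₀ := fun φ hφ hφc =>
    (hinf φ hφ hφc).trans (mul_le_mul_of_nonneg_right hle (hgrad0 φ))
  refine variance_le_of_energy hV hC₀pos (fun h hh hc => ?_) hf hf2 hfd
  have := energy_le_of_poincare hV hH ht hC₀pos.le hP hx m hcov hh hc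
  have e : (a + C₀) / (1 + t * C₀) = C₀ := by
    rw [div_eq_iff (by positivity)]; nlinarith
  rwa [e] at this

end poincare

section moments

variable {d : ℕ} {t : ℝ} {ν : Measure (Euc d)}

lemma LC.integrable_exp_inner (ht : 0 < t) (h : LC (fun x => t * ‖x‖ ^ 2) ν)
    [IsProbabilityMeasure ν] (θ : Euc d) : Integrable (fun x => Real.exp ⟪θ, x⟫) ν := by
  have key := h.lintegral_exp_mul_le ht (f := fun x => ⟪θ, x⟫) (by fun_prop) (L := ‖θ‖)
    fun x y => by rw [← inner_sub_right]; exact real_inner_le_norm _ _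
  have h2 : (∫⁻ x, ENNReal.ofReal (Real.exp (-⟪θ, x⟫)) ∂ν) ≠ 0 := by
    intro h0
    rw [lintegral_eq_zero_iff (by fun_prop)] at h0
    obtain ⟨x, hx⟩ := h0.exists
    simp at hx
    exact absurd hx (not_le.2 (Real.exp_pos _))
  have h3 : (∫⁻ x, ENNReal.ofReal (Real.exp ⟪θ, x⟫) ∂ν) ≠ ∞ := by
    intro h0
    rw [h0, ENNReal.top_mul h2] at key
    exact absurd key (by simp)
  exact (lintegral_ofReal_ne_top_iff_integrable (by fun_prop)
    (Filter.Eventually.of_forall fun x => (Real.exp_pos _).le)).1 h3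

lemma LC.memLp_inner (ht : 0 < t) (h : LC (fun x => t * ‖x‖ ^ 2) ν)
    [IsProbabilityMeasure ν] (θ : Euc d) (p : NNReal) : MemLp (fun x => ⟪θ, x⟫) p ν := by
  refine ProbabilityTheory.memLp_of_mem_interior_integrableExpSet ?_ p
  have : ProbabilityTheory.integrableExpSet (fun x => ⟪θ, x⟫) ν = Set.univ := by
    ext s
    simp only [ProbabilityTheory.integrableExpSet, mem_univ, iff_true]
    have := h.integrable_exp_inner ht (s • θ)
    simp only [real_inner_smul_left] at this
    exact this
  rw [this]; simp

lemma LC.memLp_coord (ht : 0 < t) (h : LC (fun x => t * ‖x‖ ^ 2) ν)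
    [IsProbabilityMeasure ν] (i : Fin d) (p : NNReal) : MemLp (fun x => x i) p ν := by
  have := h.memLp_inner ht (EuclideanSpace.single i 1) p
  simpa [EuclideanSpace.inner_single_left] using this

lemma MemLp.mul_four {Ω : Type*} [MeasurableSpace Ω] {P : Measure Ω} {u v : Ω → ℝ}
    (hu : MemLp u 4 P) (hv : MemLp v 4 P) : MemLp (fun x => u x * v x) 2 P := by
  have : ENNReal.HolderTriple 4 4 2 := ⟨by
    rw [← two_mul, show (4 : ℝ≥0∞) = 2 * 2 by norm_num,
      ENNReal.mul_inv (by simp) (by simp), ← mul_assoc,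
      ENNReal.mul_inv_cancel (by simp) (by simp), one_mul]⟩
  exact hv.mul hu

lemma LC.integral_exp_inner_sub_le (ht : 0 < t) (h : LC (fun x => t * ‖x‖ ^ 2) ν)
    [IsProbabilityMeasure ν] (θ m : Euc d) (hm : ∫ x, ⟪θ, x - m⟫ ∂ν = 0) :
    Integrable (fun x => Real.exp ⟪θ, x - m⟫) ν ∧
      ∫ x, Real.exp ⟪θ, x - m⟫ ∂ν ≤ Real.exp (‖θ‖ ^ 2 / t) := by
  have hInt : ∀ θ : Euc d, Integrable (fun x => Real.exp ⟪θ, x - m⟫) ν := fun θ => by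
    have := (h.integrable_exp_inner ht θ).mul_const (Real.exp (-⟪θ, m⟫))
    refine this.congr (Filter.Eventually.of_forall fun x => ?_)
    simp only []
    rw [inner_sub_right, sub_eq_add_neg, Real.exp_add]
  refine ⟨hInt θ, ?_⟩
  have key := h.lintegral_exp_mul_le ht (f := fun x => ⟪θ, x - m⟫) (by fun_prop) (L := ‖θ‖)
    fun x y => by
      rw [← inner_sub_right, sub_sub_sub_cancel_right]; exact real_inner_le_norm _ _
  have hneg : Integrable (fun x => Real.exp (-⟪θ, x - m⟫)) ν := by
    simpa [inner_neg_left] using hInt (-θ)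
  rw [← ofReal_integral_eq_lintegral_ofReal (hInt θ) (Filter.Eventually.of_forall fun x => (Real.exp_pos _).le),
    ← ofReal_integral_eq_lintegral_ofReal hneg (Filter.Eventually.of_forall fun x => (Real.exp_pos _).le),
    ← ENNReal.ofReal_mul (integral_nonneg fun x => (Real.exp_pos _).le),
    ENNReal.ofReal_le_ofReal_iff (Real.exp_pos _).le] at key
  have h1 : 1 ≤ ∫ x, Real.exp (-⟪θ, x - m⟫) ∂ν := by
    have hi : Integrable (fun x => ⟪θ, x - m⟫) ν := by
      have := ((h.memLp_inner ht θ 1).integrable (by simp)).sub (integrable_const ⟪θ, m⟫)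
      refine this.congr (Filter.Eventually.of_forall fun x => ?_)
      simp [inner_sub_right]
    calc (1 : ℝ) = ∫ x, (1 - ⟪θ, x - m⟫) ∂ν := by
          rw [integral_sub (integrable_const _) hi, hm]; simp
      _ ≤ _ := integral_mono ((integrable_const _).sub hi) hneg fun x => by
          have := Real.add_one_le_exp (-⟪θ, x - m⟫)
          show 1 - ⟪θ, x - m⟫ ≤ Real.exp (-⟪θ, x - m⟫)
          linarith
  have h0 : 0 ≤ ∫ x, Real.exp ⟪θ, x - m⟫ ∂ν := integral_nonneg fun x => (Real.exp_pos _).le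
  nlinarith

lemma LC.integral_inner_sq_le (ht : 0 < t) (h : LC (fun x => t * ‖x‖ ^ 2) ν)
    [IsProbabilityMeasure ν] (m : Euc d) (hm : ∀ θ : Euc d, ∫ x, ⟪θ, x - m⟫ ∂ν = 0) (θ : Euc d) :
    ∫ x, ⟪θ, x - m⟫ ^ 2 ∂ν ≤ 12 * ‖θ‖ ^ 2 / t := by
  by_cases hθ : θ = 0
  · simp [hθ]
  have hn : 0 < ‖θ‖ := norm_pos_iff.2 hθ
  set s := Real.sqrt t / ‖θ‖ with hs
  have hs0 : 0 < s := by positivity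
  have hst : ‖s • θ‖ ^ 2 / t = 1 := by
    rw [norm_smul, Real.norm_of_nonneg hs0.le, hs, div_mul_cancel₀ _ hn.ne', Real.sq_sqrt ht.le,
      div_self ht.ne']
  obtain ⟨i1, h1⟩ := h.integral_exp_inner_sub_le ht (s • θ) m (hm _)
  obtain ⟨i2, h2⟩ := h.integral_exp_inner_sub_le ht (-(s • θ)) m (hm _)
  rw [norm_neg] at h2
  rw [hst] at h1 h2
  have h3 : ∫ x, s ^ 2 * ⟪θ, x - m⟫ ^ 2 ∂ν ≤
      ∫ x, 2 * (Real.exp ⟪s • θ, x - m⟫ + Real.exp ⟪-(s • θ), x - m⟫) ∂ν := by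
    refine integral_mono_of_nonneg (Filter.Eventually.of_forall fun x => by positivity)
      ((i1.add i2).const_mul 2) (Filter.Eventually.of_forall fun x => ?_)
    simp only [inner_neg_left, real_inner_smul_left]
    set y := s * ⟪θ, x - m⟫
    have q : y ^ 2 / 2 ≤ Real.exp y + Real.exp (-y) := by
      rcases le_total 0 y with hy | hy
      · have := Real.quadratic_le_exp_of_nonneg hy
        linarith [Real.exp_pos (-y)]
      · have := Real.quadratic_le_exp_of_nonneg (neg_nonneg.2 hy)
        rw [neg_sq] at this
        linarith [Real.exp_pos y]
    nlinarith
  rw [integral_const_mul, integral_const_mul, integral_add i1 i2] at h3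
  have h4 : Real.exp 1 ≤ 3 := by linarith [Real.exp_one_lt_d9]
  have h5 : s ^ 2 * ∫ x, ⟪θ, x - m⟫ ^ 2 ∂ν ≤ 12 := by linarith
  rw [hs, div_pow, Real.sq_sqrt ht.le] at h5
  rw [le_div_iff₀ ht]
  rw [div_mul_eq_mul_div, div_le_iff₀ (by positivity)] at h5
  linarith

end moments

section smoothing

open Filter

variable {d : ℕ} {t s D : ℝ} {ν : Measure (Euc d)} {V f : Euc d → ℝ}

lemma strongLC_gauss (s : ℝ) :
    StrongLC (fun x : Euc d => s * ‖x‖ ^ 2) fun z => ENNReal.ofReal (Real.exp (-(s / 2) * ‖z‖ ^ 2)) := by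
  intro a b ha hb hab x y
  rw [ENNReal.ofReal_rpow_of_nonneg (Real.exp_nonneg _) ha.le,
    ENNReal.ofReal_rpow_of_nonneg (Real.exp_nonneg _) hb.le, ← Real.exp_mul, ← Real.exp_mul,
    ← ENNReal.ofReal_mul (Real.exp_nonneg _), ← ENNReal.ofReal_mul (Real.exp_nonneg _),
    ← Real.exp_add, ← Real.exp_add]
  refine ENNReal.ofReal_le_ofReal (Real.exp_le_exp.2 (le_of_eq ?_))
  have h1 : ‖a • x + b • y‖ ^ 2 = a ^ 2 * ‖x‖ ^ 2 + 2 * (a * b) * ⟪x, y⟫ + b ^ 2 * ‖y‖ ^ 2 := by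
    rw [norm_add_sq_real, norm_smul, norm_smul, real_inner_smul_left, real_inner_smul_right,
      mul_pow, mul_pow, Real.norm_eq_abs, Real.norm_eq_abs, sq_abs, sq_abs]; ring
  simp only [h1, norm_sub_sq_real]
  have : b = 1 - a := by linarith
  subst this; ring

/-- The centered Gaussian density with covariance `s⁻¹`. -/
def gaussKernel (d : ℕ) (s : ℝ) : Euc d → ℝ := fun z =>
  (∫ x : Euc d, Real.exp (-(s / 2) * ‖x‖ ^ 2))⁻¹ * Real.exp (-(s / 2) * ‖z‖ ^ 2)

/-- The centered Gaussian measure with covariance `s⁻¹`. -/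
def gaussMeasure (d : ℕ) (s : ℝ) : Measure (Euc d) :=
  volume.withDensity fun z => ENNReal.ofReal (gaussKernel d s z)

lemma gauss_integral_pos (hs : 0 < s) : 0 < ∫ x : Euc d, Real.exp (-(s / 2) * ‖x‖ ^ 2) := by
  rw [GaussianFourier.integral_rexp_neg_mul_sq_norm (by positivity : 0 < s / 2)]
  positivity

lemma gaussKernel_pos (hs : 0 < s) (z : Euc d) : 0 < gaussKernel d s z :=
  mul_pos (inv_pos.2 (gauss_integral_pos hs)) (Real.exp_pos _)

lemma smooth_gaussKernel : Smooth (gaussKernel d s) :=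
  contDiff_const.mul (contDiff_const.mul (contDiff_norm_sq ℝ)).exp

lemma gaussKernel_neg (z : Euc d) : gaussKernel d s (-z) = gaussKernel d s z := by
  simp [gaussKernel]

lemma gaussKernel_le (hs : 0 < s) (z : Euc d) : gaussKernel d s z ≤ gaussKernel d s 0 := by
  simp only [gaussKernel]
  refine mul_le_mul_of_nonneg_left ?_ (inv_pos.2 (gauss_integral_pos hs)).le
  refine Real.exp_le_exp.2 ?_
  simp; positivity

lemma measurable_gaussKernel : Measurable fun z => ENNReal.ofReal (gaussKernel d s z) :=
  (smooth_gaussKernel.continuous.measurable).ennreal_ofReal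

lemma isProbabilityMeasure_gauss (hs : 0 < s) : IsProbabilityMeasure (gaussMeasure d s) := by
  have hpos := gauss_integral_pos (d := d) hs
  have hi : Integrable fun x : Euc d => Real.exp (-(s / 2) * ‖x‖ ^ 2) := by
    by_contra hn
    rw [integral_undef hn] at hpos
    exact lt_irrefl _ hpos
  refine ⟨?_⟩
  rw [gaussMeasure, withDensity_apply _ MeasurableSet.univ, setLIntegral_univ,
    ← ofReal_integral_eq_lintegral_ofReal (f := gaussKernel d s) (hi.const_mul _)
      (Eventually.of_forall fun z => (gaussKernel_pos hs z).le)]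
  simp only [gaussKernel]
  rw [integral_const_mul, inv_mul_cancel₀ hpos.ne']; simp

lemma strongLC_gaussKernel (hs : 0 < s) :
    StrongLC (fun x : Euc d => s * ‖x‖ ^ 2) fun z => ENNReal.ofReal (gaussKernel d s z) := by
  have := (strongLC_gauss (d := d) s).const_mul
    (ENNReal.ofReal (∫ x : Euc d, Real.exp (-(s / 2) * ‖x‖ ^ 2))⁻¹)
  simp only [← ENNReal.ofReal_mul (inv_pos.2 (gauss_integral_pos (d := d) hs)).le] at this
  exact this

lemma lc_gaussMeasure (hs : 0 < s) : LC (fun x => s * ‖x‖ ^ 2) (gaussMeasure d s) :=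
  ⟨_, measurable_gaussKernel, strongLC_gaussKernel hs, rfl⟩

lemma integral_inner_gauss (θ : Euc d) : ∫ x, ⟪θ, x⟫ ∂gaussMeasure d s = 0 := by
  rw [gaussMeasure, integral_withDensity_eq_integral_toReal_smul measurable_gaussKernel
    (Eventually.of_forall fun x => ENNReal.ofReal_lt_top)]
  have h := integral_neg_eq_self (fun x => (ENNReal.ofReal (gaussKernel d s x)).toReal • ⟪θ, x⟫) volume
  simp only [gaussKernel_neg, inner_neg_right, smul_neg, integral_neg] at h
  linarith

/-- The density of the convolution of `ν` with a Gaussian. -/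
def gaussSmooth (ν : Measure (Euc d)) (s : ℝ) : Euc d → ℝ := fun y => ∫ x, gaussKernel d s (y - x) ∂ν

lemma integrable_gaussKernel_sub (hs : 0 < s) [IsFiniteMeasure ν] (y : Euc d) :
    Integrable (fun x => gaussKernel d s (y - x)) ν := by
  refine Integrable.of_bound (C := gaussKernel d s 0)
    (smooth_gaussKernel.continuous.comp (continuous_const.sub continuous_id)).aestronglyMeasurable
    (Eventually.of_forall fun x => ?_)
  rw [Real.norm_of_nonneg (gaussKernel_pos hs _).le]
  exact gaussKernel_le hs _

lemma gaussSmooth_pos (hs : 0 < s) [IsProbabilityMeasure ν] (y : Euc d) : 0 < gaussSmooth ν s y := by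
  rw [gaussSmooth, integral_pos_iff_support_of_nonneg (fun x => (gaussKernel_pos hs _).le)
    (integrable_gaussKernel_sub hs y)]
  have : Function.support (fun x => gaussKernel d s (y - x)) = univ := by
    ext x; simpa using (gaussKernel_pos hs _).ne'
  rw [this]; simp

lemma smooth_gaussSmooth {q : Euc d → ℝ} (h : LC q ν) [IsProbabilityMeasure ν]
    (hD : ν (Metric.closedBall 0 D)ᶜ = 0) : Smooth (gaussSmooth ν s) := by
  obtain ⟨g, hg, -, hν⟩ := h
  have hg1 : ∫⁻ x, g x ≠ ∞ := by
    have := measure_univ (μ := ν)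
    rw [hν, withDensity_apply _ MeasurableSet.univ, setLIntegral_univ] at this
    rw [this]; simp
  have hgt : ∀ᵐ x, g x < ∞ := ae_lt_top hg hg1
  have hG : LocallyIntegrable (fun x => (g x).toReal) volume :=
    (integrable_toReal_of_lintegral_ne_top hg.aemeasurable hg1).locallyIntegrable
  refine contDiff_iff_contDiffAt.2 fun y₀ => ?_
  obtain ⟨χ, hχ, hχc, -, hχ1, -⟩ := exists_cutoff d (R := ‖y₀‖ + 1 + D) one_pos
  have hs := (smooth_gaussKernel (d := d) (s := s)).mul hχ
  have hsm : Smooth (cv (fun z => gaussKernel d s z * χ z) fun x => (g x).toReal) :=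
    Smooth.cv hs hχc.mul_left hG
  refine hsm.contDiffAt.congr_of_eventuallyEq ?_
  filter_upwards [Metric.ball_mem_nhds y₀ one_pos] with y hy
  have e1 : cv (fun z => gaussKernel d s z * χ z) (fun x => (g x).toReal) y =
      ∫ x, gaussKernel d s (y - x) * χ (y - x) ∂ν := by
    rw [hν, integral_withDensity_eq_integral_toReal_smul hg hgt, cv]
    congr 1; ext x; rw [smul_eq_mul, mul_comm]
  rw [e1, gaussSmooth]
  refine integral_congr_ae ?_
  filter_upwards [measure_eq_zero_iff_ae_notMem.1 hD] with x hx
  simp only [mem_compl_iff, not_not, mem_closedBall_zero_iff] at hx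
  rw [hχ1, mul_one]
  have h1 : ‖y‖ ≤ ‖y₀‖ + 1 := by
    have := norm_le_norm_add_norm_sub y₀ y
    rw [Metric.mem_ball, dist_eq_norm, norm_sub_rev] at hy
    linarith
  linarith [norm_sub_le y x]

lemma ofReal_gaussSmooth (hs : 0 < s) [IsFiniteMeasure ν] (y : Euc d) :
    ENNReal.ofReal (gaussSmooth ν s y) = ∫⁻ x, ENNReal.ofReal (gaussKernel d s (y - x)) ∂ν :=
  ofReal_integral_eq_lintegral_ofReal (integrable_gaussKernel_sub hs y)
    (Eventually.of_forall fun x => (gaussKernel_pos hs _).le)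

lemma strongLC_gaussSmooth (ht : 0 < t) (hs : 0 < s) (h : LC (fun x => t * ‖x‖ ^ 2) ν)
    [IsFiniteMeasure ν] :
    StrongLC (fun x => t * s / (t + s) * ‖x‖ ^ 2) fun y => ENNReal.ofReal (gaussSmooth ν s y) := by
  simp only [ofReal_gaussSmooth hs]
  obtain ⟨g, hg, hgs, rfl⟩ := h
  have hkm : ∀ y : Euc d, Measurable fun x => ENNReal.ofReal (gaussKernel d s (y - x)) := fun y =>
    measurable_gaussKernel.comp (measurable_const.sub measurable_id)
  have e0 : ∀ y : Euc d, ∫⁻ x, ENNReal.ofReal (gaussKernel d s (y - x)) ∂volume.withDensity g =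
      ∫⁻ x, g x * ENNReal.ofReal (gaussKernel d s (y - x)) := fun y => by
    rw [lintegral_withDensity_eq_lintegral_mul _ hg (hkm y)]; rfl
  simp only [e0]
  intro a b ha hb hab y z
  have m : ∀ y : Euc d, Measurable fun x => g x * ENNReal.ofReal (gaussKernel d s (y - x)) :=
    fun y => hg.mul (hkm y)
  set c := ENNReal.ofReal (Real.exp (a * b * (t * s / (t + s) * ‖y - z‖ ^ 2) / 2)) with hc
  have e : c ^ a * c ^ b = c := by
    rw [← ENNReal.rpow_add_of_nonneg _ _ ha.le hb.le, hab, ENNReal.rpow_one]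
  have key := prekopaLeindler_euc d a b ha hb hab
    (fun x => c * (g x * ENNReal.ofReal (gaussKernel d s (y - x))))
    (fun x => c * (g x * ENNReal.ofReal (gaussKernel d s (z - x))))
    (fun x => g x * ENNReal.ofReal (gaussKernel d s (a • y + b • z - x)))
    ((m y).const_mul c) ((m z).const_mul c) (m _) (by
      intro x w
      have h1 := hgs a b ha hb hab x w
      have h2 := strongLC_gaussKernel hs a b ha hb hab (y - x) (z - w)
      have h3 : a • (y - x) + b • (z - w) = a • y + b • z - (a • x + b • w) := by
        simp only [smul_sub]; abel
      rw [h3] at h2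
      refine le_trans ?_ (mul_le_mul' h1 h2)
      simp only [ENNReal.mul_rpow_of_nonneg _ _ ha.le, ENNReal.mul_rpow_of_nonneg _ _ hb.le]
      set k₁ := ENNReal.ofReal (gaussKernel d s (y - x)) ^ a
      set k₂ := ENNReal.ofReal (gaussKernel d s (z - w)) ^ b
      calc _ = (c ^ a * c ^ b) * (g x ^ a * k₁ * (g w ^ b * k₂)) := by ring
        _ ≤ (ENNReal.ofReal (Real.exp (a * b * (t * ‖x - w‖ ^ 2) / 2)) *
            ENNReal.ofReal (Real.exp (a * b * (s * ‖y - x - (z - w)‖ ^ 2) / 2))) *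
            (g x ^ a * k₁ * (g w ^ b * k₂)) := by
          refine mul_le_mul' ?_ le_rfl
          rw [e, hc, ← ENNReal.ofReal_mul (Real.exp_nonneg _), ← Real.exp_add]
          refine ENNReal.ofReal_le_ofReal (Real.exp_le_exp.2 ?_)
          rw [← add_div, ← mul_add]
          refine div_le_div_of_nonneg_right (mul_le_mul_of_nonneg_left ?_ (by positivity)) (by norm_num)
          set u := x - w
          have hu : y - x - (z - w) = (y - z) - u := by simp only [u]; abel
          set p := y - z
          rw [hu, norm_sub_sq_real p u]
          have h4 : ‖(t + s) • u - s • p‖ ^ 2 =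
              (t + s) ^ 2 * ‖u‖ ^ 2 - 2 * (s * (t + s) * ⟪p, u⟫) + s ^ 2 * ‖p‖ ^ 2 := by
            rw [norm_sub_sq_real, norm_smul, norm_smul, real_inner_smul_left, real_inner_smul_right,
              mul_pow, mul_pow, Real.norm_eq_abs, Real.norm_eq_abs, sq_abs, sq_abs,
              real_inner_comm u p]; ring
          have h5 := sq_nonneg ‖(t + s) • u - s • p‖
          rw [h4] at h5
          rw [div_mul_eq_mul_div, div_le_iff₀ (by positivity)]
          nlinarith
        _ = _ := by ring)
  rw [lintegral_const_mul _ (m y), lintegral_const_mul _ (m z),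
    ENNReal.mul_rpow_of_nonneg _ _ ha.le, ENNReal.mul_rpow_of_nonneg _ _ hb.le] at key
  refine le_trans (le_of_eq ?_) key
  show c * _ = _
  nth_rw 1 [← e]
  ring

lemma fderiv_apply_eq_sum (f : Euc d → ℝ) (x w : Euc d) :
    fderiv ℝ f x w = ∑ j, w j * pd j f x := by
  have hw : w = ∑ j, w j • (EuclideanSpace.single j (1 : ℝ) : Euc d) := by
    have := (EuclideanSpace.basisFun (Fin d) ℝ).sum_repr w
    simpa using this.symm
  conv_lhs => rw [hw]
  simp [pd]

lemma hessGe_of_strongLC (hV : Smooth V)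
    (h : StrongLC (fun x => t * ‖x‖ ^ 2) fun x => ENNReal.ofReal (Real.exp (-V x))) : HessGe V t := by
  have hcv : ∀ a b : ℝ, 0 < a → 0 < b → a + b = 1 → ∀ x y : Euc d,
      V (a • x + b • y) + a * b * (t * ‖x - y‖ ^ 2) / 2 ≤ a * V x + b * V y := by
    intro a b ha hb hab x y
    have := h a b ha hb hab x y
    rw [ENNReal.ofReal_rpow_of_nonneg (Real.exp_nonneg _) ha.le,
      ENNReal.ofReal_rpow_of_nonneg (Real.exp_nonneg _) hb.le, ← Real.exp_mul, ← Real.exp_mul,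
      ← ENNReal.ofReal_mul (Real.exp_nonneg _), ← ENNReal.ofReal_mul (Real.exp_nonneg _),
      ← Real.exp_add, ← Real.exp_add, ENNReal.ofReal_le_ofReal_iff (Real.exp_nonneg _),
      Real.exp_le_exp] at this
    linarith
  intro x v
  set w : Euc d := WithLp.toLp 2 v with hw
  have hwn : ‖w‖ ^ 2 = ∑ i, v i ^ 2 := by
    rw [EuclideanSpace.norm_sq_eq]; simp [hw]
  have hline : ∀ r : ℝ, HasDerivAt (fun r : ℝ => x + r • w) w r := fun r => by
    simpa using ((hasDerivAt_id r).smul_const w).const_add x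
  have hφ : ∀ f : Euc d → ℝ, Smooth f → ∀ r : ℝ, HasDerivAt (fun r : ℝ => f (x + r • w))
      (∑ j, v j * pd j f (x + r • w)) r := fun f hf r => by
    have := (hf.differentiable' (x + r • w)).hasFDerivAt.comp_hasDerivAt r (hline r)
    rw [fderiv_apply_eq_sum] at this
    exact this
  set φ : ℝ → ℝ := fun r => V (x + r • w) - t / 2 * ‖w‖ ^ 2 * r ^ 2 with hφdef
  have hd : ∀ r, HasDerivAt φ (∑ j, v j * pd j V (x + r • w) - t * ‖w‖ ^ 2 * r) r := fun r => by
    have h1 := (hφ V hV r).sub (((hasDerivAt_pow 2 r)).const_mul (t / 2 * ‖w‖ ^ 2))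
    refine h1.congr_deriv ?_
    push_cast; ring
  have hconv : ConvexOn ℝ univ φ := by
    refine convexOn_iff_forall_pos.2 ⟨convex_univ, fun r _ s _ a b ha hb hab => ?_⟩
    have := hcv a b ha hb hab (x + r • w) (x + s • w)
    have e1 : a • (x + r • w) + b • (x + s • w) = x + (a * r + b * s) • w := by
      have : a • x + b • x = x := by rw [← add_smul, hab, one_smul]
      rw [smul_add, smul_add, add_smul, mul_smul, mul_smul]
      nth_rw 3 [← this]; abel
    have e2 : x + r • w - (x + s • w) = (r - s) • w := by rw [sub_smul]; abel
    rw [e1, e2, norm_smul, mul_pow, Real.norm_eq_abs, sq_abs] at this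
    simp only [hφdef, smul_eq_mul]
    have hb' : b = 1 - a := by linarith
    subst hb'
    nlinarith
  have hmono : Monotone fun r => ∑ j, v j * pd j V (x + r • w) - t * ‖w‖ ^ 2 * r := by
    have h1 := hconv.monotoneOn_deriv (fun r _ => (hd r).differentiableAt)
    intro r s hrs
    have := h1 (mem_univ r) (mem_univ s) hrs
    rwa [(hd r).deriv, (hd s).deriv] at this
  have hd2 : HasDerivAt (fun r => ∑ j, v j * pd j V (x + r • w) - t * ‖w‖ ^ 2 * r)
      (∑ j, v j * ∑ i, v i * pd i (pd j V) (x + (0 : ℝ) • w) - t * ‖w‖ ^ 2) 0 := by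
    refine (HasDerivAt.fun_sum fun j _ => (hφ (pd j V) (hV.pd j) 0).const_mul (v j)).sub ?_
    simpa using (hasDerivAt_id (0 : ℝ)).const_mul (t * ‖w‖ ^ 2)
  have := hd2.nonneg_of_monotone hmono
  rw [zero_smul, add_zero, hwn] at this
  have e : ∑ i, ∑ j, pd i (pd j V) x * v j * v i = ∑ j, v j * ∑ i, v i * pd i (pd j V) x := by
    rw [Finset.sum_comm]
    refine Finset.sum_congr rfl fun j _ => ?_
    rw [Finset.mul_sum]
    exact Finset.sum_congr rfl fun i _ => by ring
  rw [e]; linarith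

lemma map_add_gauss_eq (hs : 0 < s) [IsProbabilityMeasure ν] :
    (ν.prod (gaussMeasure d s)).map (fun p => p.1 + p.2) =
      volume.withDensity fun y => ENNReal.ofReal (gaussSmooth ν s y) := by
  have := isProbabilityMeasure_gauss (d := d) hs
  have hkm : Measurable fun p : Euc d × Euc d => ENNReal.ofReal (gaussKernel d s (p.2 - p.1)) :=
    measurable_gaussKernel.comp (measurable_snd.sub measurable_fst)
  refine Measure.ext fun A hA => ?_
  have hadd : Measurable fun p : Euc d × Euc d => p.1 + p.2 := measurable_fst.add measurable_snd
  rw [Measure.map_apply hadd hA, Measure.prod_apply (hadd hA), withDensity_apply _ hA]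
  simp only [ofReal_gaussSmooth hs]
  rw [lintegral_lintegral_swap (f := fun y x => ENNReal.ofReal (gaussKernel d s (y - x)))
    (hkm.comp measurable_swap).aemeasurable]
  refine lintegral_congr fun x => ?_
  have hB : MeasurableSet (Prod.mk x ⁻¹' ((fun p : Euc d × Euc d => p.1 + p.2) ⁻¹' A)) :=
    measurable_prodMk_left (hadd hA)
  rw [gaussMeasure, withDensity_apply _ hB, ← lintegral_indicator hB, ← lintegral_indicator hA,
    ← lintegral_add_left_eq_self (A.indicator _) x]
  refine lintegral_congr fun z => ?_
  by_cases hz : x + z ∈ A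
  · rw [indicator_of_mem hz, indicator_of_mem (show z ∈ Prod.mk x ⁻¹' ((fun p : Euc d × Euc d => p.1 + p.2) ⁻¹' A) from hz), add_sub_cancel_left]
  · rw [indicator_of_notMem hz, indicator_of_notMem (show z ∉ Prod.mk x ⁻¹' ((fun p : Euc d × Euc d => p.1 + p.2) ⁻¹' A) from hz)]

/-- Gaussian smoothing of a compactly supported strongly log-concave measure. -/
lemma exists_smooth_potential (ht : 0 < t) (hs : 0 < s) (h : LC (fun x => t * ‖x‖ ^ 2) ν)
    [IsProbabilityMeasure ν] (hD : ν (Metric.closedBall 0 D)ᶜ = 0) :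
    ∃ V : Euc d → ℝ, Smooth V ∧ HessGe V (t * s / (t + s)) ∧
      LC (fun x => t * s / (t + s) * ‖x‖ ^ 2) (gibbs V) ∧
      gibbs V = (ν.prod (gaussMeasure d s)).map fun p => p.1 + p.2 := by
  have hρ := smooth_gaussSmooth (s := s) h hD
  have hpos := gaussSmooth_pos (ν := ν) hs
  have hV : Smooth fun y => -Real.log (gaussSmooth ν s y) :=
    (hρ.log fun y => (hpos y).ne').neg
  have e : ∀ y, Real.exp (-(-Real.log (gaussSmooth ν s y))) = gaussSmooth ν s y := fun y => by
    rw [neg_neg, Real.exp_log (hpos y)]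
  have hLC := strongLC_gaussSmooth ht hs h
  refine ⟨_, hV, hessGe_of_strongLC hV (by simpa only [e] using hLC), ?_, ?_⟩
  · exact ⟨_, hρ.continuous.measurable.ennreal_ofReal, hLC, by simp only [gibbs, e]⟩
  · rw [map_add_gauss_eq hs]; simp only [gibbs, e]

end smoothing

section third

variable {d : ℕ} {t a D : ℝ} {ν : Measure (Euc d)}

lemma pd_quadratic {M : Fin d → Fin d → ℝ} (hM : ∀ i j, M i j = M j i) (m : Euc d) (k : Fin d) :
    pd k (fun y : Euc d => ∑ i, ∑ j, M i j * ((y i - m i) * (y j - m j))) =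
      fun y => 2 * ∑ j, M k j * (y j - m j) := by
  have hl : ∀ i, Smooth fun y : Euc d => y i - m i := fun i => (smooth_coord i).sub contDiff_const
  have hp : ∀ i, pd k (fun y : Euc d => y i - m i) = fun _ => if i = k then 1 else 0 := fun i => by
    rw [pd_sub_const, pd_coord]
  have hs : ∀ i j, Smooth fun y : Euc d => M i j * ((y i - m i) * (y j - m j)) := fun i j =>
    contDiff_const.mul ((hl i).mul (hl j))
  rw [pd_sum _ fun i => ContDiff.sum fun j _ => hs i j]
  ext y
  have e : ∀ i j, pd k (fun y : Euc d => M i j * ((y i - m i) * (y j - m j))) =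
      fun y => M i j * ((if i = k then 1 else 0) * (y j - m j)) +
        M i j * ((y i - m i) * (if j = k then 1 else 0)) := fun i j => by
    rw [pd_const_mul ((hl i).mul (hl j)), pd_mul (hl i) (hl j), hp, hp]
    ext y; ring
  simp only [fun i => pd_sum (d := d) Finset.univ (hs i) k, e, Finset.sum_add_distrib]
  have h1 : ∑ i, ∑ j, M i j * ((if i = k then 1 else 0) * (y j - m j)) = ∑ j, M k j * (y j - m j) := by
    rw [Finset.sum_eq_single k]
    · simp
    · intro i _ hi; simp [hi]
    · simp
  have h2 : ∑ i, ∑ j, M i j * ((y i - m i) * (if j = k then 1 else 0)) = ∑ j, M k j * (y j - m j) := by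
    refine Finset.sum_congr rfl fun i _ => ?_
    rw [Finset.sum_eq_single k]
    · simp [hM i k]
    · intro j _ hj; simp [hj]
    · simp
  rw [h1, h2]; ring

/-- The third moment bound for strongly log-concave measures. -/
theorem third_moment_le (ht : 0 < t) (ha : 0 < a) (h : LC (fun x => t * ‖x‖ ^ 2) ν)
    [IsProbabilityMeasure ν] (hD : ν (Metric.closedBall 0 D)ᶜ = 0) (m : Euc d)
    (hm : ∀ θ : Euc d, ∫ x, ⟪θ, x - m⟫ ∂ν = 0)
    (hcov : ∀ θ : Euc d, ∫ x, ⟪θ, x - m⟫ ^ 2 ∂ν ≤ a * ‖θ‖ ^ 2) (θ : Euc d) :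
    ∑ i, ∑ j, (∫ x, ⟪θ, x - m⟫ * ((x i - m i) * (x j - m j)) ∂ν) ^ 2 ≤
      16 * a ^ 2 * Real.sqrt (a / t) * ‖θ‖ ^ 2 := by
  obtain ⟨s, hsdef⟩ : ∃ s, s = t + 12 / a := ⟨_, rfl⟩
  have hst : t ≤ s := by rw [hsdef]; have : 0 < 12 / a := by positivity
                         linarith
  have hs : 0 < s := by linarith
  have hsa : 12 / s ≤ a := by
    rw [div_le_iff₀ hs, hsdef, mul_add, mul_div_cancel₀ _ ha.ne']; nlinarith
  obtain ⟨V, hV, hH, hVLC, hVeq⟩ := exists_smooth_potential ht hs h hD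
  have hγp := isProbabilityMeasure_gauss (d := d) hs
  set γ := gaussMeasure d s with hγ
  have hγLC := lc_gaussMeasure (d := d) hs
  have hadd : Measurable fun p : Euc d × Euc d => p.1 + p.2 := measurable_fst.add measurable_snd
  have hVp : IsProbabilityMeasure (gibbs V) := by
    rw [hVeq]; exact Measure.isProbabilityMeasure_map hadd.aemeasurable
  set P := ν.prod γ with hP
  have hfst : MeasurePreserving (Prod.fst : Euc d × Euc d → Euc d) P ν := measurePreserving_fst
  have hsnd : MeasurePreserving (Prod.snd : Euc d × Euc d → Euc d) P γ := measurePreserving_snd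
  obtain ⟨t', ht'⟩ : ∃ t', t' = t * s / (t + s) := ⟨_, rfl⟩
  rw [← ht'] at hH hVLC
  have ht'0 : 0 < t' := by rw [ht']; positivity
  have ht'2 : t / 2 ≤ t' := by
    rw [ht', div_le_div_iff₀ (by norm_num) (by positivity)]; nlinarith
  have hVmap : ∀ f : Euc d → ℝ, Continuous f → ∫ y, f y ∂gibbs V = ∫ p, f (p.1 + p.2) ∂P := by
    intro f hf
    rw [hVeq, integral_map hadd.aemeasurable hf.aestronglyMeasurable]
  -- integrability of coordinates
  have hX4 : ∀ i, MemLp (fun x : Euc d => x i - m i) 4 ν := fun i =>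
    (h.memLp_coord ht i 4).sub (memLp_const _)
  have hZ4 : ∀ i, MemLp (fun x : Euc d => x i) 4 γ := fun i => hγLC.memLp_coord hs i 4
  have hY4 : ∀ i, MemLp (fun x : Euc d => x i - m i) 4 (gibbs V) := fun i =>
    (hVLC.memLp_coord ht'0 i 4).sub (memLp_const _)
  have hXi4 : ∀ w : Euc d, MemLp (fun x : Euc d => ⟪w, x - m⟫) 4 ν := fun w => by
    refine ((h.memLp_inner ht w 4).sub (memLp_const ⟪w, m⟫)).ae_eq
      (Filter.Eventually.of_forall fun x => ?_)
    simp [inner_sub_right]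
  have hZi4 : ∀ w : Euc d, MemLp (fun x : Euc d => ⟪w, x⟫) 4 γ := fun w => hγLC.memLp_inner hs w 4
  have h42 : ∀ {Ω : Type} [MeasurableSpace Ω] {Q : Measure Ω} [IsProbabilityMeasure Q] {f : Ω → ℝ},
      MemLp f 4 Q → MemLp f 2 Q := fun hf => hf.mono_exponent (by norm_num)
  have h41 : ∀ {Ω : Type} [MeasurableSpace Ω] {Q : Measure Ω} [IsProbabilityMeasure Q] {f : Ω → ℝ},
      MemLp f 4 Q → Integrable f Q := fun hf => hf.integrable (by norm_num)
  have hZ0 : ∀ i, ∫ z : Euc d, z i ∂γ = 0 := fun i => by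
    have := integral_inner_gauss (s := s) (EuclideanSpace.single i (1 : ℝ) : Euc d)
    simpa [EuclideanSpace.inner_single_left] using this
  have hX0 : ∀ i, ∫ x : Euc d, (x i - m i) ∂ν = 0 := fun i => by
    have := hm (EuclideanSpace.single i (1 : ℝ))
    simpa [EuclideanSpace.inner_single_left] using this
  -- covariance of the smoothed measure
  have hcovY : ∀ v : Fin d → ℝ, ∫ y, (∑ i, v i * (y i - m i)) ^ 2 ∂gibbs V ≤
      2 * a * ∑ i, v i ^ 2 := by
    intro v
    set w : Euc d := WithLp.toLp 2 v with hw
    have hwn : ‖w‖ ^ 2 = ∑ i, v i ^ 2 := by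
      rw [EuclideanSpace.norm_sq_eq]; simp [hw]
    have e1 : ∀ y : Euc d, ∑ i, v i * (y i - m i) = ⟪w, y - m⟫ := fun y => by
      rw [PiLp.inner_apply]; exact Finset.sum_congr rfl fun i _ => by simp [hw, mul_comm]
    simp only [e1]
    rw [hVmap _ (by fun_prop)]
    have e2 : ∀ p : Euc d × Euc d, ⟪w, p.1 + p.2 - m⟫ ^ 2 =
        ⟪w, p.1 - m⟫ ^ 2 + 2 * (⟪w, p.1 - m⟫ * ⟪w, p.2⟫) + ⟪w, p.2⟫ ^ 2 := fun p => by
      rw [show p.1 + p.2 - m = (p.1 - m) + p.2 by abel, inner_add_right]; ring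
    simp only [e2]
    have j1 : Integrable (fun p : Euc d × Euc d => ⟪w, p.1 - m⟫ ^ 2) P :=
      hfst.integrable_comp_of_integrable (h42 (hXi4 w)).integrable_sq
    have j2 : Integrable (fun p : Euc d × Euc d => ⟪w, p.2⟫ ^ 2) P :=
      hsnd.integrable_comp_of_integrable (h42 (hZi4 w)).integrable_sq
    have j3 : Integrable (fun p : Euc d × Euc d => ⟪w, p.1 - m⟫ * ⟪w, p.2⟫) P :=
      (h41 (hXi4 w)).mul_prod (h41 (hZi4 w))
    rw [integral_add₃ j1 (j3.const_mul 2) j2, integral_const_mul,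
      integral_prod_mul (fun x => ⟪w, x - m⟫) (fun z => ⟪w, z⟫), hm w, zero_mul, mul_zero, add_zero]
    have k1 : ∫ p, ⟪w, p.1 - m⟫ ^ 2 ∂P = ∫ x, ⟪w, x - m⟫ ^ 2 ∂ν := by
      have := integral_fun_fst (μ := ν) (ν := γ) fun x => ⟪w, x - m⟫ ^ 2
      simpa using this
    have k2 : ∫ p, ⟪w, p.2⟫ ^ 2 ∂P = ∫ x, ⟪w, x⟫ ^ 2 ∂γ := by
      have := integral_fun_snd (μ := ν) (ν := γ) fun x => ⟪w, x⟫ ^ 2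
      simpa using this
    have k3 : ∫ x, ⟪w, x⟫ ^ 2 ∂γ ≤ 12 * ‖w‖ ^ 2 / s := by
      have := hγLC.integral_inner_sq_le hs 0 (fun θ => by simpa using integral_inner_gauss θ) w
      simpa using this
    rw [k1, k2, ← hwn]
    have k4 : 12 * ‖w‖ ^ 2 / s ≤ a * ‖w‖ ^ 2 := by
      rw [mul_div_right_comm]; exact mul_le_mul_of_nonneg_right hsa (sq_nonneg _)
    linarith [hcov w]
  -- the quadratic form
  set M : Fin d → Fin d → ℝ := fun i j => ∫ x, ⟪θ, x - m⟫ * ((x i - m i) * (x j - m j)) ∂ν with hMdef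
  have hMs : ∀ i j, M i j = M j i := fun i j => by
    simp only [hMdef]; congr 1; ext x; ring
  set S := ∑ i, ∑ j, M i j ^ 2 with hS
  have hS0 : 0 ≤ S := Finset.sum_nonneg fun i _ => Finset.sum_nonneg fun j _ => sq_nonneg _
  set q : Euc d → ℝ := fun y => ∑ i, ∑ j, M i j * ((y i - m i) * (y j - m j)) with hq
  have hl : ∀ i, Smooth fun y : Euc d => y i - m i := fun i => (smooth_coord i).sub contDiff_const
  have hqs : Smooth q := ContDiff.sum fun i _ => ContDiff.sum fun j _ =>
    contDiff_const.mul ((hl i).mul (hl j))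
  have hq2 : MemLp q 2 (gibbs V) := memLp_finsetSum _ fun i _ => memLp_finsetSum _ fun j _ =>
    (MemLp.mul_four (hY4 i) (hY4 j)).const_mul _
  have hqd : ∀ k, MemLp (pd k q) 2 (gibbs V) := fun k => by
    rw [hq, pd_quadratic hMs]
    exact (memLp_finsetSum _ fun j _ => (h42 (hY4 j)).const_mul _).const_mul 2
  have hvar := poincare_improved hV hH ht'0 (by positivity : 0 < 2 * a)
    (fun i => hVLC.memLp_coord ht'0 i 2) (fun i => m i) hcovY hqs hq2 hqd
  set c := ∫ y, q y ∂gibbs V with hc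
  have hgrad : ∫ y, ∑ k, pd k q y ^ 2 ∂gibbs V ≤ 8 * a * S := by
    rw [integral_finsetSum _ fun k _ => (hqd k).integrable_sq, hS, Finset.mul_sum]
    refine Finset.sum_le_sum fun k _ => ?_
    rw [hq, pd_quadratic hMs]
    simp only [mul_pow]
    rw [integral_const_mul]
    have := hcovY (M k)
    linarith
  have hsq : Real.sqrt (2 * a / t') ≤ 2 * Real.sqrt (a / t) := by
    rw [show 2 * Real.sqrt (a / t) = Real.sqrt (4 * (a / t)) by
      rw [Real.sqrt_mul (by norm_num), show (4 : ℝ) = 2 ^ 2 by norm_num, Real.sqrt_sq (by norm_num)]]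
    refine Real.sqrt_le_sqrt ?_
    rw [← mul_div_assoc, div_le_div_iff₀ ht'0 ht]; nlinarith
  -- the pairing
  have hU : MemLp (fun p : Euc d × Euc d => ⟪θ, p.1 - m⟫) 2 P :=
    (h42 (hXi4 θ)).comp_measurePreserving hfst
  have hqY : MemLp (fun p : Euc d × Euc d => q (p.1 + p.2) - c) 2 P := by
    have : MemLp (fun y => q y - c) 2 (gibbs V) := hq2.sub (memLp_const c)
    rw [hVeq] at this
    exact (memLp_map_measure_iff (hqs.continuous.sub continuous_const).aestronglyMeasurable
      hadd.aemeasurable).1 this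
  have hUq : ∀ i j, Integrable (fun p : Euc d × Euc d => ⟪θ, p.1 - m⟫ *
      (((p.1 + p.2) i - m i) * ((p.1 + p.2) j - m j))) P ∧
      ∫ p : Euc d × Euc d, ⟪θ, p.1 - m⟫ * (((p.1 + p.2) i - m i) * ((p.1 + p.2) j - m j)) ∂P
        = M i j := by
    intro i j
    have a1 : Integrable (fun x : Euc d => ⟪θ, x - m⟫ * ((x i - m i) * (x j - m j))) ν :=
      (h42 (hXi4 θ)).integrable_mul (MemLp.mul_four (hX4 i) (hX4 j))
    have a2 : ∀ i, Integrable (fun x : Euc d => ⟪θ, x - m⟫ * (x i - m i)) ν := fun i =>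
      (h42 (hXi4 θ)).integrable_mul (h42 (hX4 i))
    have a3 : Integrable (fun x : Euc d => ⟪θ, x - m⟫) ν := h41 (hXi4 θ)
    have a4 : Integrable (fun z : Euc d => z i * z j) γ := (h42 (hZ4 i)).integrable_mul (h42 (hZ4 j))
    have b1 : Integrable (fun p : Euc d × Euc d => ⟪θ, p.1 - m⟫ * ((p.1 i - m i) * (p.1 j - m j))) P :=
      hfst.integrable_comp_of_integrable a1
    have b2 : Integrable (fun p : Euc d × Euc d => ⟪θ, p.1 - m⟫ * (p.1 i - m i) * p.2 j) P :=
      (a2 i).mul_prod (h41 (hZ4 j))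
    have b3 : Integrable (fun p : Euc d × Euc d => ⟪θ, p.1 - m⟫ * (p.1 j - m j) * p.2 i) P :=
      (a2 j).mul_prod (h41 (hZ4 i))
    have b4 : Integrable (fun p : Euc d × Euc d => ⟪θ, p.1 - m⟫ * (p.2 i * p.2 j)) P :=
      a3.mul_prod a4
    have e : ∀ p : Euc d × Euc d, ⟪θ, p.1 - m⟫ * (((p.1 + p.2) i - m i) * ((p.1 + p.2) j - m j)) =
        ⟪θ, p.1 - m⟫ * ((p.1 i - m i) * (p.1 j - m j)) +
        (⟪θ, p.1 - m⟫ * (p.1 i - m i) * p.2 j + ⟪θ, p.1 - m⟫ * (p.1 j - m j) * p.2 i) +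
        ⟪θ, p.1 - m⟫ * (p.2 i * p.2 j) := fun p => by
      simp only [PiLp.add_apply]; ring
    simp only [e]
    refine ⟨(b1.add (b2.add b3)).add b4, ?_⟩
    have b23 : Integrable (fun p : Euc d × Euc d => ⟪θ, p.1 - m⟫ * (p.1 i - m i) * p.2 j +
      ⟪θ, p.1 - m⟫ * (p.1 j - m j) * p.2 i) P := b2.add b3
    rw [integral_add₃ b1 b23 b4, integral_add b2 b3,
      integral_prod_mul (fun x : Euc d => ⟪θ, x - m⟫ * (x i - m i)) (fun z : Euc d => z j),
      integral_prod_mul (fun x : Euc d => ⟪θ, x - m⟫ * (x j - m j)) (fun z : Euc d => z i),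
      integral_prod_mul (fun x : Euc d => ⟪θ, x - m⟫) (fun z : Euc d => z i * z j), hm, hZ0, hZ0]
    have := integral_fun_fst (μ := ν) (ν := γ) fun x : Euc d => ⟪θ, x - m⟫ * ((x i - m i) * (x j - m j))
    simp only [probReal_univ, one_smul] at this
    rw [this]; simp [hMdef]
  have hpair : ∫ p : Euc d × Euc d, ⟪θ, p.1 - m⟫ * (q (p.1 + p.2) - c) ∂P = S := by
    have e : ∀ p : Euc d × Euc d, ⟪θ, p.1 - m⟫ * (q (p.1 + p.2) - c) =
        (∑ i, ∑ j, M i j * (⟪θ, p.1 - m⟫ * (((p.1 + p.2) i - m i) * ((p.1 + p.2) j - m j)))) -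
          c * ⟪θ, p.1 - m⟫ := fun p => by
      simp only [hq, mul_sub, Finset.mul_sum]
      congr 1
      · exact Finset.sum_congr rfl fun i _ => Finset.sum_congr rfl fun j _ => by ring
      · ring
    simp only [e]
    have j1 : ∀ i j, Integrable (fun p : Euc d × Euc d => M i j * (⟪θ, p.1 - m⟫ *
      (((p.1 + p.2) i - m i) * ((p.1 + p.2) j - m j)))) P := fun i j => (hUq i j).1.const_mul _
    rw [integral_sub (integrable_finsetSum _ fun i _ => integrable_finsetSum _ fun j _ => j1 i j)
      ((hU.integrable (by norm_num)).const_mul c),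
      integral_finsetSum _ fun i _ => integrable_finsetSum _ fun j _ => j1 i j, integral_const_mul]
    have k1 : ∫ p : Euc d × Euc d, ⟪θ, p.1 - m⟫ ∂P = 0 := by
      have := integral_fun_fst (μ := ν) (ν := γ) fun x : Euc d => ⟪θ, x - m⟫
      rw [this, hm]; simp
    rw [k1, mul_zero, sub_zero, hS]
    refine Finset.sum_congr rfl fun i _ => ?_
    rw [integral_finsetSum _ fun j _ => j1 i j]
    refine Finset.sum_congr rfl fun j _ => ?_
    rw [integral_const_mul, (hUq i j).2, pow_two]
  have hCS := integral_mul_sq_le hU hqY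
  rw [hpair] at hCS
  have hU2 : ∫ p : Euc d × Euc d, ⟪θ, p.1 - m⟫ ^ 2 ∂P ≤ a * ‖θ‖ ^ 2 := by
    have := integral_fun_fst (μ := ν) (ν := γ) fun x : Euc d => ⟪θ, x - m⟫ ^ 2
    rw [this]; simpa using hcov θ
  have hQ2 : ∫ p : Euc d × Euc d, (q (p.1 + p.2) - c) ^ 2 ∂P ≤ 16 * Real.sqrt (a / t) * a * S := by
    rw [← hVmap (fun y => (q y - c) ^ 2) ((hqs.continuous.sub continuous_const).pow 2)]
    have e : ∀ y, (q y - c) ^ 2 = q y ^ 2 + (-2 * c) * q y + c ^ 2 := fun y => by ring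
    simp only [e]
    rw [integral_add₃ hq2.integrable_sq ((hq2.integrable (by norm_num)).const_mul _)
      (integrable_const _), integral_const_mul, ← hc]
    have h1 : Real.sqrt (2 * a / t') * ∫ y, ∑ k, pd k q y ^ 2 ∂gibbs V ≤
        2 * Real.sqrt (a / t) * (8 * a * S) :=
      mul_le_mul hsq hgrad (integral_nonneg fun y => Finset.sum_nonneg fun k _ => sq_nonneg _)
        (by positivity)
    simp
    nlinarith
  have hfin : S ^ 2 ≤ (a * ‖θ‖ ^ 2) * (16 * Real.sqrt (a / t) * a * S) :=
    hCS.trans (mul_le_mul hU2 hQ2 (integral_nonneg fun p => sq_nonneg _) (by positivity))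
  rcases hS0.eq_or_lt with h0 | h0
  · rw [← h0]; positivity
  · have : S * S ≤ (16 * a ^ 2 * Real.sqrt (a / t) * ‖θ‖ ^ 2) * S := by nlinarith
    exact le_of_mul_le_mul_right this h0

end third

section splitting

open Filter

variable {d : ℕ} {D : ℝ} {ν : Measure (Euc d)}

/-- `ν` is a probability measure supported in the ball of radius `D`. -/
structure Bdd (D : ℝ) (ν : Measure (Euc d)) : Prop where
  prob : IsProbabilityMeasure ν
  ball : ν (Metric.closedBall 0 D)ᶜ = 0

lemma Bdd.ae_mem (h : Bdd D ν) : ∀ᵐ x ∂ν, ‖x‖ ≤ D := by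
  filter_upwards [measure_eq_zero_iff_ae_notMem.1 h.ball] with x hx
  simpa using hx

lemma Bdd.nonneg (h : Bdd D ν) : 0 ≤ D := by
  have := h.prob
  obtain ⟨x, hx⟩ := h.ae_mem.exists
  exact (norm_nonneg x).trans hx

lemma Bdd.integrable (h : Bdd D ν) {E : Type*} [NormedAddCommGroup E] {f : Euc d → E}
    (hf : Continuous f) : Integrable f ν := by
  have := h.prob
  have h1 : IntegrableOn f (Metric.closedBall 0 D) ν :=
    hf.continuousOn.integrableOn_compact (isCompact_closedBall _ _)
  rwa [IntegrableOn, Measure.restrict_eq_self_of_ae_mem] at h1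
  filter_upwards [h.ae_mem] with x hx
  simpa using hx

lemma Bdd.memLp (h : Bdd D ν) {f : Euc d → ℝ} (hf : Continuous f) : MemLp f 2 ν :=
  (memLp_two_iff_integrable_sq hf.aestronglyMeasurable).2 (h.integrable (hf.pow 2))

/-- The barycenter. -/
def mean (ν : Measure (Euc d)) : Euc d := ∫ x, x ∂ν

/-- The covariance form. -/
def cov (ν : Measure (Euc d)) (u v : Euc d) : ℝ := ∫ x, ⟪u, x - mean ν⟫ * ⟪v, x - mean ν⟫ ∂ν

lemma cov_comm (u v : Euc d) : cov ν u v = cov ν v u := by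
  simp only [cov, mul_comm]

lemma cov_self_nonneg (u : Euc d) : 0 ≤ cov ν u u :=
  integral_nonneg fun x => mul_self_nonneg _

lemma Bdd.inner_mean (h : Bdd D ν) (w : Euc d) : ∫ x, ⟪w, x⟫ ∂ν = ⟪w, mean ν⟫ :=
  integral_inner (h.integrable continuous_id) w

lemma Bdd.integral_inner_sub (h : Bdd D ν) (w c : Euc d) :
    ∫ x, ⟪w, x - c⟫ ∂ν = ⟪w, mean ν - c⟫ := by
  have := h.prob
  simp only [inner_sub_right]
  rw [integral_sub (h.integrable (by fun_prop)) (integrable_const _), h.inner_mean]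
  simp

lemma Bdd.integral_inner_sub_mean (h : Bdd D ν) (w : Euc d) : ∫ x, ⟪w, x - mean ν⟫ ∂ν = 0 := by
  rw [h.integral_inner_sub]; simp

lemma Bdd.norm_mean_le (h : Bdd D ν) : ‖mean ν‖ ≤ D := by
  have := h.prob
  have := norm_integral_le_of_norm_le_const h.ae_mem
  simpa [mean] using this

lemma Bdd.cov_add_left (h : Bdd D ν) (u u' v : Euc d) :
    cov ν (u + u') v = cov ν u v + cov ν u' v := by
  simp only [cov, inner_add_left, add_mul]
  exact integral_add (h.integrable (by fun_prop)) (h.integrable (by fun_prop))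

lemma cov_smul_left (c : ℝ) (u v : Euc d) : cov ν (c • u) v = c * cov ν u v := by
  simp only [cov, real_inner_smul_left, mul_assoc]
  exact integral_const_mul _ _

/-- The covariance as a bilinear form. -/
def Bdd.covBilin (h : Bdd D ν) : Euc d →ₗ[ℝ] Euc d →ₗ[ℝ] ℝ :=
  LinearMap.mk₂ ℝ (cov ν) h.cov_add_left cov_smul_left
    (fun u v v' => by rw [cov_comm, h.cov_add_left, cov_comm, cov_comm v'])
    (fun c u v => by rw [cov_comm, cov_smul_left, cov_comm]; rfl)

lemma Bdd.covBilin_apply (h : Bdd D ν) (u v : Euc d) : h.covBilin u v = cov ν u v := rfl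

lemma Bdd.cov_sq_le (h : Bdd D ν) (u v : Euc d) : cov ν u v ^ 2 ≤ cov ν u u * cov ν v v := by
  have := integral_mul_sq_le (h.memLp (f := fun x => ⟪u, x - mean ν⟫) (by fun_prop))
    (h.memLp (f := fun x => ⟪v, x - mean ν⟫) (by fun_prop))
  simpa only [cov, pow_two] using this

lemma Bdd.integral_inner_mul (h : Bdd D ν) (u v c : Euc d) :
    ∫ x, ⟪u, x - c⟫ * ⟪v, x - c⟫ ∂ν = cov ν u v + ⟪u, mean ν - c⟫ * ⟪v, mean ν - c⟫ := by
  have hp := h.prob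
  have e : ∀ x, ⟪u, x - c⟫ * ⟪v, x - c⟫ = ⟪u, x - mean ν⟫ * ⟪v, x - mean ν⟫ +
      (⟪v, mean ν - c⟫ * ⟪u, x - mean ν⟫ + ⟪u, mean ν - c⟫ * ⟪v, x - mean ν⟫) +
      ⟪u, mean ν - c⟫ * ⟪v, mean ν - c⟫ := fun x => by
    have : x - c = (x - mean ν) + (mean ν - c) := by abel
    rw [this, inner_add_right, inner_add_right]; ring
  rw [integral_congr_ae (Eventually.of_forall e), integral_add₃ (h.integrable (by fun_prop)) (h.integrable (by fun_prop)) (integrable_const _),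
    integral_add (h.integrable (by fun_prop)) (h.integrable (by fun_prop)), integral_const_mul,
    integral_const_mul, h.integral_inner_sub_mean, h.integral_inner_sub_mean]
  simp [cov]

/-- The standard basis vectors. -/
abbrev stdE (i : Fin d) : Euc d := EuclideanSpace.single i (1 : ℝ)

/-- The squared Hilbert–Schmidt distance from the covariance to the identity. -/
def covDefect (ν : Measure (Euc d)) : ℝ :=
  ∑ i, ∑ j, (cov ν (stdE i) (stdE j) - if i = j then 1 else 0) ^ 2

lemma covDefect_nonneg : 0 ≤ covDefect ν :=
  Finset.sum_nonneg fun _ _ => Finset.sum_nonneg fun _ _ => sq_nonneg _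

/-- The density of a half of the splitting of `ν` in the direction `θ`. -/
def tilt (D ε : ℝ) (ν : Measure (Euc d)) (θ : Euc d) : Euc d → ℝ≥0∞ :=
  (Metric.closedBall 0 D).indicator fun x => ENNReal.ofReal (1 + ε * ⟪θ, x - mean ν⟫)

/-- A half of the splitting of `ν` in the direction `θ`. -/
def half (D ε : ℝ) (ν : Measure (Euc d)) (θ : Euc d) : Measure (Euc d) :=
  ν.withDensity (tilt D ε ν θ)

lemma measurable_tilt (ε : ℝ) (θ : Euc d) : Measurable (tilt D ε ν θ) :=
  Measurable.indicator (by fun_prop) Metric.isClosed_closedBall.measurableSet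

variable {ε : ℝ} {θ : Euc d}

lemma Bdd.tilt_bound (h : Bdd D ν) (hε : |ε| * (2 * D) ≤ 1 / 2) (hθ : ‖θ‖ = 1) {x : Euc d}
    (hx : ‖x‖ ≤ D) : |ε * ⟪θ, x - mean ν⟫| ≤ 1 / 2 := by
  rw [abs_mul]
  refine le_trans (mul_le_mul_of_nonneg_left ?_ (abs_nonneg ε)) hε
  have h1 := abs_real_inner_le_norm θ (x - mean ν)
  rw [hθ, one_mul] at h1
  linarith [norm_sub_le x (mean ν), h.norm_mean_le]

lemma Bdd.integral_half (h : Bdd D ν) (hε : |ε| * (2 * D) ≤ 1 / 2) (hθ : ‖θ‖ = 1)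
    {f : Euc d → ℝ} (hf : Continuous f) :
    ∫ x, f x ∂half D ε ν θ = (∫ x, f x ∂ν) + ε * ∫ x, ⟪θ, x - mean ν⟫ * f x ∂ν := by
  rw [half, integral_withDensity_eq_integral_toReal_smul (measurable_tilt ε θ)
    (Eventually.of_forall fun x => by
      rw [tilt, indicator]; split_ifs <;> simp),
    ← integral_const_mul, ← integral_add (h.integrable hf) (h.integrable (by fun_prop))]
  refine integral_congr_ae ?_
  filter_upwards [h.ae_mem] with x hx
  have hb := abs_le.1 (h.tilt_bound hε hθ hx)
  rw [tilt, indicator_of_mem (by simpa using hx), ENNReal.toReal_ofReal (by linarith), smul_eq_mul]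
  ring

lemma Bdd.bdd_half (h : Bdd D ν) (hε : |ε| * (2 * D) ≤ 1 / 2) (hθ : ‖θ‖ = 1) :
    Bdd D (half D ε ν θ) := by
  have hp := h.prob
  refine ⟨⟨?_⟩, withDensity_absolutelyContinuous _ _ h.ball⟩
  have e : (∫⁻ x, tilt D ε ν θ x ∂ν) = ∫⁻ x, ENNReal.ofReal (1 + ε * ⟪θ, x - mean ν⟫) ∂ν := by
    refine lintegral_congr_ae ?_
    filter_upwards [h.ae_mem] with x hx
    rw [tilt, indicator_of_mem (by simpa using hx)]
  rw [half, withDensity_apply _ MeasurableSet.univ, setLIntegral_univ, e,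
    ← ofReal_integral_eq_lintegral_ofReal (h.integrable (by fun_prop))]
  · rw [integral_add (integrable_const _) (h.integrable (by fun_prop)), integral_const_mul,
      h.integral_inner_sub_mean]
    simp
  · filter_upwards [h.ae_mem] with x hx
    have hb := abs_le.1 (h.tilt_bound hε hθ hx)
    show (0 : ℝ) ≤ _
    linarith

lemma Bdd.half_add_half (h : Bdd D ν) (hε : |ε| * (2 * D) ≤ 1 / 2) (hθ : ‖θ‖ = 1) :
    ν = (2⁻¹ : ℝ≥0∞) • half D ε ν θ + (2⁻¹ : ℝ≥0∞) • half D (-ε) ν θ := by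
  rw [← smul_add, half, half, ← withDensity_add_left (measurable_tilt ε θ),
    ← withDensity_smul _ ((measurable_tilt ε θ).add (measurable_tilt (-ε) θ))]
  conv_lhs => rw [← withDensity_one (μ := ν)]
  refine withDensity_congr_ae ?_
  filter_upwards [h.ae_mem] with x hx
  have hb := abs_le.1 (h.tilt_bound hε hθ hx)
  simp only [Pi.one_apply, Pi.smul_apply, Pi.add_apply, smul_eq_mul]
  rw [tilt, tilt, indicator_of_mem (by simpa using hx), indicator_of_mem (by simpa using hx),
    ← ENNReal.ofReal_add (by linarith) (by linarith)]
  have : 1 + ε * ⟪θ, x - mean ν⟫ + (1 + -ε * ⟪θ, x - mean ν⟫) = 2 := by ring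
  rw [this, ENNReal.ofReal_ofNat, ENNReal.inv_mul_cancel (by simp) (by simp)]

lemma Bdd.inner_mean_half (h : Bdd D ν) (hε : |ε| * (2 * D) ≤ 1 / 2) (hθ : ‖θ‖ = 1) (w : Euc d) :
    ⟪w, mean (half D ε ν θ) - mean ν⟫ = ε * cov ν w θ := by
  rw [← (h.bdd_half hε hθ).integral_inner_sub, h.integral_half hε hθ (by fun_prop),
    h.integral_inner_sub_mean, zero_add, cov_comm]
  rfl

/-- The third moment form. -/
def third (ν : Measure (Euc d)) (θ u v : Euc d) : ℝ :=
  ∫ x, ⟪θ, x - mean ν⟫ * (⟪u, x - mean ν⟫ * ⟪v, x - mean ν⟫) ∂ν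

lemma Bdd.cov_half (h : Bdd D ν) (hε : |ε| * (2 * D) ≤ 1 / 2) (hθ : ‖θ‖ = 1) (u v : Euc d) :
    cov (half D ε ν θ) u v =
      cov ν u v + ε * third ν θ u v - ε ^ 2 * (cov ν u θ * cov ν v θ) := by
  have h1 := (h.bdd_half hε hθ).integral_inner_mul u v (mean ν)
  rw [h.integral_half hε hθ (by fun_prop), h.inner_mean_half hε hθ, h.inner_mean_half hε hθ] at h1
  have h2 : cov (half D ε ν θ) u v = (∫ x, ⟪u, x - mean ν⟫ * ⟪v, x - mean ν⟫ ∂ν) +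
      ε * ∫ x, ⟪θ, x - mean ν⟫ * (⟪u, x - mean ν⟫ * ⟪v, x - mean ν⟫) ∂ν -
      ε * cov ν u θ * (ε * cov ν v θ) := by linarith
  rw [h2]
  show cov ν u v + ε * third ν θ u v - _ = _
  ring

lemma Bdd.cov_half_self_le (h : Bdd D ν) (hε : |ε| * (2 * D) ≤ 1 / 2) (hθ : ‖θ‖ = 1) (u : Euc d) :
    cov (half D ε ν θ) u u ≤ (1 + |ε| * (2 * D)) * cov ν u u := by
  have hp := h.prob
  rw [h.cov_half hε hθ]
  have h1 : ε * third ν θ u u ≤ |ε| * (2 * D) * cov ν u u := by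
    rw [third, cov, ← integral_const_mul, ← integral_const_mul]
    refine integral_mono_ae (h.integrable (by fun_prop)) (h.integrable (by fun_prop)) ?_
    filter_upwards [h.ae_mem] with x hx
    rw [← mul_assoc]
    refine mul_le_mul_of_nonneg_right ?_ (mul_self_nonneg _)
    refine (le_abs_self _).trans ?_
    rw [abs_mul]
    refine mul_le_mul_of_nonneg_left ?_ (abs_nonneg _)
    have h1 := abs_real_inner_le_norm θ (x - mean ν)
    rw [hθ, one_mul] at h1
    linarith [norm_sub_le x (mean ν), h.norm_mean_le]
  nlinarith [mul_self_nonneg (cov ν u θ), sq_nonneg ε, mul_nonneg (sq_nonneg ε) (mul_self_nonneg (cov ν u θ))]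

lemma Bdd.sum_cov_sq_le (h : Bdd D ν) {a : ℝ} (ha : 0 ≤ a) (hA : ∀ w, cov ν w w ≤ a * ‖w‖ ^ 2)
    (hθ : ‖θ‖ = 1) : ∑ i, cov ν (stdE i) θ ^ 2 ≤ a ^ 2 := by
  set g : Euc d := WithLp.toLp 2 fun i => cov ν (stdE i) θ with hg
  have hgn : ‖g‖ ^ 2 = ∑ i, cov ν (stdE i) θ ^ 2 := by
    rw [EuclideanSpace.norm_sq_eq]; simp [hg]
  have hsum : g = ∑ i, g i • stdE i := by
    have := (EuclideanSpace.basisFun (Fin d) ℝ).sum_repr g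
    simpa using this.symm
  have h1 : cov ν g θ = ‖g‖ ^ 2 := by
    rw [← h.covBilin_apply]
    nth_rw 1 [hsum]
    rw [map_sum, LinearMap.sum_apply, hgn]
    refine Finset.sum_congr rfl fun i _ => ?_
    rw [map_smul, LinearMap.smul_apply, h.covBilin_apply, smul_eq_mul, pow_two]
  have h2 := h.cov_sq_le g θ
  rw [h1] at h2
  have h3 : cov ν g g * cov ν θ θ ≤ (a * ‖g‖ ^ 2) * (a * 1) := by
    refine mul_le_mul (hA g) ?_ (cov_self_nonneg _) (by positivity)
    simpa [hθ] using hA θ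
  rw [← hgn]
  rcases (sq_nonneg ‖g‖).eq_or_lt with h0 | h0
  · rw [← h0]; positivity
  · have : ‖g‖ ^ 2 * ‖g‖ ^ 2 ≤ a ^ 2 * ‖g‖ ^ 2 := by nlinarith
    exact le_of_mul_le_mul_right this h0

/-- The average growth of the covariance defect under splitting. -/
lemma Bdd.covDefect_half_add (h : Bdd D ν) (hε : |ε| * (2 * D) ≤ 1 / 2) (hθ : ‖θ‖ = 1)
    {a : ℝ} (ha : 0 ≤ a) (hA : ∀ w, cov ν w w ≤ a * ‖w‖ ^ 2) :
    covDefect (half D ε ν θ) + covDefect (half D (-ε) ν θ) ≤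
      2 * (covDefect ν + ε ^ 2 * (∑ i, ∑ j, third ν θ (stdE i) (stdE j) ^ 2) +
        2 * ε ^ 2 * a ^ 2 + ε ^ 4 * a ^ 4) := by
  have hε' : |-ε| * (2 * D) ≤ 1 / 2 := by rwa [abs_neg]
  set g : Fin d → ℝ := fun i => cov ν (stdE i) θ with hg
  set B : Fin d → Fin d → ℝ := fun i j => cov ν (stdE i) (stdE j) - if i = j then 1 else 0 with hB
  set M : Fin d → Fin d → ℝ := fun i j => third ν θ (stdE i) (stdE j) with hM
  have e1 : covDefect (half D ε ν θ) = ∑ i, ∑ j, (B i j + ε * M i j - ε ^ 2 * (g i * g j)) ^ 2 := by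
    refine Finset.sum_congr rfl fun i _ => Finset.sum_congr rfl fun j _ => ?_
    rw [h.cov_half hε hθ]; simp only [hB, hM, hg]; ring
  have e2 : covDefect (half D (-ε) ν θ) =
      ∑ i, ∑ j, (B i j - ε * M i j - ε ^ 2 * (g i * g j)) ^ 2 := by
    refine Finset.sum_congr rfl fun i _ => Finset.sum_congr rfl fun j _ => ?_
    rw [h.cov_half hε' hθ]; simp only [hB, hM, hg]; ring
  have hG : ∑ i, g i ^ 2 ≤ a ^ 2 := h.sum_cov_sq_le ha hA hθ
  have hG0 : 0 ≤ ∑ i, g i ^ 2 := Finset.sum_nonneg fun i _ => sq_nonneg _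
  have hcg : 0 ≤ ∑ i, ∑ j, cov ν (stdE i) (stdE j) * (g i * g j) := by
    have : ∑ i, ∑ j, cov ν (stdE i) (stdE j) * (g i * g j) =
        cov ν (∑ i, g i • stdE i) (∑ i, g i • stdE i) := by
      rw [← h.covBilin_apply]
      simp only [map_sum, LinearMap.sum_apply, map_smul, LinearMap.smul_apply, h.covBilin_apply,
        smul_eq_mul, Finset.mul_sum]
      rw [Finset.sum_comm]
      exact Finset.sum_congr rfl fun i _ => Finset.sum_congr rfl fun j _ => by ring
    rw [this]; exact cov_self_nonneg _
  have hBg : -∑ i, g i ^ 2 ≤ ∑ i, ∑ j, B i j * (g i * g j) := by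
    have : ∑ i, ∑ j, B i j * (g i * g j) =
        (∑ i, ∑ j, cov ν (stdE i) (stdE j) * (g i * g j)) - ∑ i, g i ^ 2 := by
      rw [← Finset.sum_sub_distrib]
      refine Finset.sum_congr rfl fun i _ => ?_
      simp only [hB, sub_mul, Finset.sum_sub_distrib]
      congr 1
      simp [pow_two]
    rw [this]; linarith
  have hgg : ∑ i, ∑ j, (g i * g j) ^ 2 = (∑ i, g i ^ 2) ^ 2 := by
    rw [pow_two (∑ i, g i ^ 2), Finset.sum_mul_sum]
    exact Finset.sum_congr rfl fun i _ => Finset.sum_congr rfl fun j _ => by ring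
  have e3 : covDefect (half D ε ν θ) + covDefect (half D (-ε) ν θ) =
      2 * (covDefect ν + ε ^ 2 * (∑ i, ∑ j, M i j ^ 2) -
        2 * ε ^ 2 * (∑ i, ∑ j, B i j * (g i * g j)) + ε ^ 4 * ∑ i, ∑ j, (g i * g j) ^ 2) := by
    rw [e1, e2, show covDefect ν = ∑ i, ∑ j, B i j ^ 2 from rfl]
    simp only [Finset.mul_sum, ← Finset.sum_add_distrib, ← Finset.sum_sub_distrib]
    exact Finset.sum_congr rfl fun i _ => Finset.sum_congr rfl fun j _ => by ring
  rw [e3, hgg]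
  have h4 : (∑ i, g i ^ 2) ^ 2 ≤ a ^ 4 := by
    calc (∑ i, g i ^ 2) ^ 2 ≤ (a ^ 2) ^ 2 := pow_le_pow_left₀ hG0 hG 2
      _ = a ^ 4 := by ring
  have h5 := mul_le_mul_of_nonneg_left hBg (sq_nonneg ε)
  have h6 := mul_le_mul_of_nonneg_left h4 (by positivity : 0 ≤ ε ^ 4)
  have h7 := mul_le_mul_of_nonneg_left hG (sq_nonneg ε)
  linarith

lemma concaveOn_log_add_sq : ConcaveOn ℝ (Ioo 0 2) fun r : ℝ => Real.log r + r ^ 2 / 8 := by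
  have hd : ∀ r ∈ Ioo (0 : ℝ) 2, HasDerivAt (fun r : ℝ => Real.log r + r ^ 2 / 8) (r⁻¹ + r / 4) r := by
    intro r hr
    have := (Real.hasDerivAt_log hr.1.ne').add ((hasDerivAt_pow 2 r).div_const 8)
    refine this.congr_deriv ?_
    push_cast; ring
  refine AntitoneOn.concaveOn_of_deriv (convex_Ioo 0 2)
    (fun r hr => (hd r hr).continuousAt.continuousWithinAt) ?_ ?_
  · rw [interior_Ioo]; exact fun r hr => (hd r hr).differentiableAt.differentiableWithinAt
  · rw [interior_Ioo]
    intro r hr s hs hrs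
    rw [(hd r hr).deriv, (hd s hs).deriv]
    have hr0 := hr.1
    have hs0 := hs.1
    have : r⁻¹ + r / 4 - (s⁻¹ + s / 4) = (s - r) * (4 - r * s) / (4 * r * s) := by field_simp; ring
    have h2 : r * s ≤ 4 := by nlinarith [hr.2, hs.2]
    have h3 : 0 ≤ (s - r) * (4 - r * s) / (4 * r * s) := by
      apply div_nonneg (mul_nonneg (by linarith) (by linarith)) (by positivity)
    linarith

lemma Bdd.strongLC_tilt (h : Bdd D ν) (hε : |ε| * (2 * D) ≤ 1 / 2) (hθ : ‖θ‖ = 1) :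
    StrongLC (fun x => ε ^ 2 / 4 * ⟪θ, x⟫ ^ 2) (tilt D ε ν θ) := by
  intro a b ha hb hab x y
  by_cases hx : x ∈ Metric.closedBall (0 : Euc d) D
  · by_cases hy : y ∈ Metric.closedBall (0 : Euc d) D
    · have hxy : a • x + b • y ∈ Metric.closedBall (0 : Euc d) D :=
        (convex_closedBall _ _) hx hy ha.le hb.le hab
      rw [tilt, indicator_of_mem hx, indicator_of_mem hy, indicator_of_mem hxy]
      have hbx := abs_le.1 (h.tilt_bound hε hθ (mem_closedBall_zero_iff.1 hx))
      have hby := abs_le.1 (h.tilt_bound hε hθ (mem_closedBall_zero_iff.1 hy))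
      set r := 1 + ε * ⟪θ, x - mean ν⟫ with hr
      set s := 1 + ε * ⟪θ, y - mean ν⟫ with hs
      have hr0 : 0 < r := by linarith
      have hs0 : 0 < s := by linarith
      have e1 : 1 + ε * ⟪θ, a • x + b • y - mean ν⟫ = a * r + b * s := by
        have : a • x + b • y - mean ν = a • (x - mean ν) + b • (y - mean ν) := by
          have h1 : a • mean ν + b • mean ν = mean ν := by rw [← add_smul, hab, one_smul]
          rw [smul_sub, smul_sub]
          nth_rw 1 [← h1]; abel
        rw [this, inner_add_right, real_inner_smul_right, real_inner_smul_right, hr, hs]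
        linear_combination -hab
      have e2 : ε ^ 2 / 4 * ⟪θ, x - y⟫ ^ 2 = (r - s) ^ 2 / 4 := by
        have : x - y = (x - mean ν) - (y - mean ν) := by abel
        rw [this, inner_sub_right, hr, hs]; ring
      have hpos : 0 < a * r + b * s := by positivity
      simp only [e1, e2]
      rw [ENNReal.ofReal_rpow_of_pos hr0, ENNReal.ofReal_rpow_of_pos hs0,
        ← ENNReal.ofReal_mul (by positivity), ← ENNReal.ofReal_mul (Real.exp_nonneg _)]
      refine ENNReal.ofReal_le_ofReal ?_
      rw [Real.rpow_def_of_pos hr0, Real.rpow_def_of_pos hs0, ← Real.exp_add, ← Real.exp_add,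
        ← Real.le_log_iff_exp_le hpos]
      have := concaveOn_log_add_sq.2 (⟨hr0, by linarith⟩ : r ∈ Ioo (0 : ℝ) 2)
        (⟨hs0, by linarith⟩ : s ∈ Ioo (0 : ℝ) 2) ha.le hb.le hab
      simp only [smul_eq_mul] at this
      have hb' : b = 1 - a := by linarith
      subst hb'
      nlinarith
    · simp [tilt, indicator_of_notMem hy, hb]
  · simp [tilt, indicator_of_notMem hx, ha]

end splitting

section coupling

open Filter ProbabilityTheory

/-- The pairs `(x, u)` for which `u` is a short vector well correlated with `x`. -/
def goodPairs (k d : ℕ) : Set (Euc d × Euc d) :=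
  {p | (k : ℝ) / 5 ≤ ⟪p.1, p.2⟫ ∧ ‖p.2‖ ≤ 10 * Real.sqrt k}

lemma measurableSet_goodPairs (k d : ℕ) : MeasurableSet (goodPairs k d) := by
  refine IsClosed.measurableSet ?_
  have h1 : IsClosed {p : Euc d × Euc d | (k : ℝ) / 5 ≤ ⟪p.1, p.2⟫} :=
    isClosed_le continuous_const (by fun_prop)
  have h2 : IsClosed {p : Euc d × Euc d | ‖p.2‖ ≤ 10 * Real.sqrt k} :=
    isClosed_le (by fun_prop) continuous_const
  exact h1.inter h2

/-- `ν` is coupled with a subgaussian vector which is well correlated with it up to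
probability `β`. -/
def Coup (T : ℝ) (k : ℕ) {d : ℕ} (ν : Measure (Euc d)) (β : ℝ) : Prop :=
  ∃ P : Measure (Euc d × Euc d), IsProbabilityMeasure P ∧ P.map Prod.fst = ν ∧
    (∀ θ : Euc d, ∫⁻ p, ENNReal.ofReal (Real.exp ⟪θ, p.2⟫) ∂P ≤
      ENNReal.ofReal (Real.exp (‖θ‖ ^ 2 / T))) ∧
    P (goodPairs k d)ᶜ ≤ ENNReal.ofReal β

variable {T : ℝ} {k d : ℕ} {ν : Measure (Euc d)} {D : ℝ}

lemma Coup.mono {β β' : ℝ} (h : Coup T k ν β) (hb : β ≤ β') : Coup T k ν β' := by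
  obtain ⟨P, h1, h2, h3, h4⟩ := h
  exact ⟨P, h1, h2, h3, h4.trans (ENNReal.ofReal_le_ofReal hb)⟩

lemma Coup.of_one_le (hT : 0 < T) [IsProbabilityMeasure ν] {β : ℝ} (hb : 1 ≤ β) : Coup T k ν β := by
  have hm : Measurable fun x : Euc d => (x, (0 : Euc d)) := measurable_id.prodMk measurable_const
  have hP : IsProbabilityMeasure (ν.map fun x : Euc d => (x, (0 : Euc d))) :=
    Measure.isProbabilityMeasure_map hm.aemeasurable
  refine ⟨_, hP, ?_, fun θ => ?_, ?_⟩
  · rw [Measure.map_map measurable_fst hm]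
    exact Measure.map_id
  · rw [lintegral_map (by fun_prop) hm]
    simp only [inner_zero_right, Real.exp_zero, lintegral_const, measure_univ, mul_one]
    exact ENNReal.ofReal_le_ofReal (Real.one_le_exp (by positivity))
  · exact prob_le_one.trans (by simpa using ENNReal.ofReal_le_ofReal hb)

lemma Coup.mix {ν₁ ν₂ : Measure (Euc d)} {c₁ c₂ β₁ β₂ : ℝ} (hc₁ : 0 ≤ c₁) (hc₂ : 0 ≤ c₂)
    (hc : c₁ + c₂ = 1) (hb₁ : 0 ≤ β₁) (hb₂ : 0 ≤ β₂) (h₁ : Coup T k ν₁ β₁) (h₂ : Coup T k ν₂ β₂)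
    (hν : ν = ENNReal.ofReal c₁ • ν₁ + ENNReal.ofReal c₂ • ν₂) :
    Coup T k ν (c₁ * β₁ + c₂ * β₂) := by
  obtain ⟨P, hP, hPf, hPe, hPg⟩ := h₁
  obtain ⟨Q, hQ, hQf, hQe, hQg⟩ := h₂
  have hs : ENNReal.ofReal c₁ + ENNReal.ofReal c₂ = 1 := by
    rw [← ENNReal.ofReal_add hc₁ hc₂, hc]; simp
  refine ⟨ENNReal.ofReal c₁ • P + ENNReal.ofReal c₂ • Q, ⟨by simp [hs]⟩, ?_, fun θ => ?_, ?_⟩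
  · rw [Measure.map_add _ _ measurable_fst, Measure.map_smul, Measure.map_smul, hPf, hQf, hν]
  · rw [lintegral_add_measure, lintegral_smul_measure, lintegral_smul_measure]
    refine (add_le_add (mul_le_mul' le_rfl (hPe θ)) (mul_le_mul' le_rfl (hQe θ))).trans ?_
    rw [← add_mul, hs, one_mul]
  · rw [Measure.add_apply, Measure.smul_apply, Measure.smul_apply, smul_eq_mul, smul_eq_mul]
    refine (add_le_add (mul_le_mul' le_rfl hPg) (mul_le_mul' le_rfl hQg)).trans ?_
    rw [← ENNReal.ofReal_mul hc₁, ← ENNReal.ofReal_mul hc₂,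
      ← ENNReal.ofReal_add (by positivity) (by positivity)]

/-- A coupling of an image of `ν` lifts to a coupling of `ν`. -/
lemma exists_lift_coupling {E F G : Type*} [MeasurableSpace E] [MeasurableSpace F]
    [MeasurableSpace G] [StandardBorelSpace G] [Nonempty G] {ν : Measure E} [IsProbabilityMeasure ν]
    {q : E → F} (hq : Measurable q) {P : Measure (F × G)} [IsProbabilityMeasure P]
    (hP : P.map Prod.fst = ν.map q) :
    ∃ R : Measure (E × G), IsProbabilityMeasure R ∧ R.map Prod.fst = ν ∧
      R.map (Prod.map q id) = P := by
  let κ : Kernel E G := P.condKernel.comap q hq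
  have hκ : IsMarkovKernel κ := inferInstance
  refine ⟨ν ⊗ₘ κ, inferInstance, Measure.fst_compProd ν κ, ?_⟩
  have hm : Measurable (Prod.map q (id : G → G)) := hq.prodMap measurable_id
  refine Measure.ext fun s hs => ?_
  rw [Measure.map_apply hm hs, Measure.compProd_apply (hm hs)]
  conv_rhs => rw [← P.disintegrate P.condKernel]
  rw [Measure.compProd_apply hs, Measure.fst, hP, lintegral_map (Kernel.measurable_kernel_prodMk_left hs) hq]
  rfl

lemma Coup.of_map_coiso {d' : ℕ} (W : Euc d' →ₗᵢ[ℝ] Euc d) [IsProbabilityMeasure ν] {β : ℝ}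
    (hT : 0 < T) (h : Coup T k (ν.map (coiso W)) β) : Coup T k ν β := by
  obtain ⟨P, hP, hPf, hPe, hPg⟩ := h
  obtain ⟨R, hR, hRf, hRP⟩ := exists_lift_coupling (coiso W).continuous.measurable hPf
  have hm : Measurable fun p : Euc d × Euc d' => (p.1, W p.2) :=
    measurable_fst.prodMk (W.continuous.measurable.comp measurable_snd)
  have hq : Measurable (Prod.map (coiso W) (id : Euc d' → Euc d')) :=
    (coiso W).continuous.measurable.prodMap measurable_id
  have hin : ∀ (x : Euc d) (u : Euc d'), ⟪x, W u⟫ = ⟪coiso W x, u⟫ := fun x u =>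
    (ContinuousLinearMap.adjoint_inner_left W.toContinuousLinearMap u x).symm
  refine ⟨R.map fun p => (p.1, W p.2), Measure.isProbabilityMeasure_map hm.aemeasurable, ?_,
    fun θ => ?_, ?_⟩
  · rw [Measure.map_map measurable_fst hm]; exact hRf
  · rw [lintegral_map (by fun_prop) hm]
    simp only [hin]
    have := hPe (coiso W θ)
    rw [← hRP, lintegral_map (by fun_prop) hq] at this
    refine this.trans (ENNReal.ofReal_le_ofReal (Real.exp_le_exp.2 ?_))
    have := norm_coiso_le W θ
    gcongr
  · rw [Measure.map_apply hm (measurableSet_goodPairs k d).compl]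
    rw [← hRP, Measure.map_apply hq (measurableSet_goodPairs k d').compl] at hPg
    refine le_trans (le_of_eq ?_) hPg
    congr 1
    ext p
    simp only [goodPairs, mem_preimage, mem_compl_iff, mem_ofPred_eq, hin, LinearIsometry.norm_map]
    rfl

lemma Bdd.variance_lipschitz_le (hB : Bdd D ν) {t : ℝ} (ht : 0 < t)
    (h : LC (fun x => t * ‖x‖ ^ 2) ν) {f : Euc d → ℝ} (hf : Continuous f)
    (hL : ∀ x y, f x - f y ≤ ‖x - y‖) : ∫ x, (f x - ∫ y, f y ∂ν) ^ 2 ∂ν ≤ 12 / t := by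
  have hp := hB.prob
  set c := ∫ y, f y ∂ν with hc
  set s := Real.sqrt t with hs
  have hs0 : 0 < s := Real.sqrt_pos.2 ht
  have hst : s ^ 2 = t := Real.sq_sqrt ht.le
  have key := h.lintegral_exp_mul_le ht (f := fun x => s * (f x - c)) (by fun_prop) (L := s)
    fun x y => by
      have := mul_le_mul_of_nonneg_left (hL x y) hs0.le
      linarith
  have i1 : Integrable (fun x => Real.exp (s * (f x - c))) ν := hB.integrable (by fun_prop)
  have i2 : Integrable (fun x => Real.exp (-(s * (f x - c)))) ν := hB.integrable (by fun_prop)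
  rw [← ofReal_integral_eq_lintegral_ofReal i1 (Eventually.of_forall fun x => (Real.exp_pos _).le),
    ← ofReal_integral_eq_lintegral_ofReal i2 (Eventually.of_forall fun x => (Real.exp_pos _).le),
    ← ENNReal.ofReal_mul (integral_nonneg fun x => (Real.exp_pos _).le),
    ENNReal.ofReal_le_ofReal_iff (Real.exp_pos _).le, hst, div_self ht.ne'] at key
  have hmean : ∫ x, (f x - c) ∂ν = 0 := by
    rw [integral_sub (hB.integrable hf) (integrable_const _)]; simp [hc]
  have hge : ∀ r : ℝ, 1 ≤ ∫ x, Real.exp (r * (f x - c)) ∂ν := fun r => by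
    calc (1 : ℝ) = ∫ x, (1 + r * (f x - c)) ∂ν := by
          rw [integral_add (integrable_const _) (hB.integrable (by fun_prop)), integral_const_mul,
            hmean]; simp
      _ ≤ _ := integral_mono (hB.integrable (by fun_prop)) (hB.integrable (by fun_prop)) fun x => by
          have := Real.add_one_le_exp (r * (f x - c))
          show 1 + r * (f x - c) ≤ _
          linarith
  have h1 := hge s
  have h2 : 1 ≤ ∫ x, Real.exp (-(s * (f x - c))) ∂ν := by simpa only [neg_mul] using hge (-s)
  have he : Real.exp 1 ≤ 3 := by linarith [Real.exp_one_lt_d9]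
  have h3 : ∫ x, s ^ 2 * (f x - c) ^ 2 ∂ν ≤
      ∫ x, 2 * (Real.exp (s * (f x - c)) + Real.exp (-(s * (f x - c)))) ∂ν := by
    refine integral_mono (hB.integrable (by fun_prop)) (hB.integrable (by fun_prop)) fun x => ?_
    simp only []
    set y := s * (f x - c) with hy
    have q : y ^ 2 / 2 ≤ Real.exp y + Real.exp (-y) := by
      rcases le_total 0 y with hy | hy
      · have := Real.quadratic_le_exp_of_nonneg hy
        linarith [Real.exp_pos (-y)]
      · have := Real.quadratic_le_exp_of_nonneg (neg_nonneg.2 hy)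
        rw [neg_sq] at this
        linarith [Real.exp_pos y]
    have : s ^ 2 * (f x - c) ^ 2 = y ^ 2 := by rw [hy]; ring
    linarith
  rw [integral_const_mul, integral_const_mul, integral_add i1 i2, hst] at h3
  rw [le_div_iff₀ ht]
  nlinarith

lemma norm_sub_sq_eq_sum (x b : Euc d) : ‖x - b‖ ^ 2 = ∑ i, ⟪stdE i, x - b⟫ * ⟪stdE i, x - b⟫ := by
  rw [EuclideanSpace.norm_sq_eq]
  refine Finset.sum_congr rfl fun i _ => ?_
  simp [EuclideanSpace.inner_single_left, pow_two]

lemma Bdd.integral_norm_sub_mean_sq (hB : Bdd D ν) :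
    ∫ x, ‖x - mean ν‖ ^ 2 ∂ν = ∑ i, cov ν (stdE i) (stdE i) := by
  simp only [norm_sub_sq_eq_sum]
  rw [integral_finsetSum _ fun i _ => hB.integrable (by fun_prop)]
  rfl

lemma sq_sum_defect_le : (∑ i, (cov ν (stdE i) (stdE i) - 1)) ^ 2 ≤ d * covDefect ν := by
  have h1 := sq_sum_le_card_mul_sum_sq (s := Finset.univ) (f := fun i => cov ν (stdE i) (stdE i) - 1)
  rw [Finset.card_univ, Fintype.card_fin] at h1
  refine h1.trans (mul_le_mul_of_nonneg_left ?_ (by positivity))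
  refine Finset.sum_le_sum fun i _ => ?_
  have := Finset.single_le_sum (f := fun j => (cov ν (stdE i) (stdE j) - if i = j then 1 else 0) ^ 2)
    (fun j _ => sq_nonneg _) (Finset.mem_univ i)
  simpa using this

set_option maxHeartbeats 400000 in
/-- A strongly log-concave measure with covariance close to the identity is coupled with its
own deviation from the mean. -/
lemma Bdd.coup_self (hB : Bdd D ν) (hT : 0 < T) (h : LC (fun x => T * ‖x‖ ^ 2) ν)
    (hdk : d ≤ k) (hk : 240 / T ≤ k) :
    Coup T k ν (20 / k * ((k - d) + covDefect ν) + 1200 / (T * k) +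
      1200 * (∫ x, ‖x‖ ^ 2 ∂ν) / (T * k ^ 2)) := by
  have hp := hB.prob
  have hk0 : (0 : ℝ) < k := lt_of_lt_of_le (by positivity) hk
  have hdk' : (d : ℝ) ≤ k := by exact_mod_cast hdk
  have hE0 : 0 ≤ ∫ x, ‖x‖ ^ 2 ∂ν := integral_nonneg fun x => sq_nonneg _
  have hΨ0 := covDefect_nonneg (ν := ν)
  by_cases hcost : (k : ℝ) / 20 < (k - d) + covDefect ν
  · refine Coup.of_one_le hT ?_
    have h1 : 1 ≤ 20 / k * ((k - d) + covDefect ν) := by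
      rw [div_mul_eq_mul_div, le_div_iff₀ hk0]; linarith
    have h2 : 0 ≤ 1200 / (T * k) := by positivity
    have h3 : 0 ≤ 1200 * (∫ x, ‖x‖ ^ 2 ∂ν) / (T * k ^ 2) := by positivity
    linarith
  push Not at hcost
  set b := mean ν with hb
  have hm : Measurable fun x : Euc d => (x, x - b) := measurable_id.prodMk (measurable_id.sub_const b)
  refine ⟨ν.map fun x => (x, x - b), Measure.isProbabilityMeasure_map hm.aemeasurable, ?_,
    fun θ => ?_, ?_⟩
  · rw [Measure.map_map measurable_fst hm]; exact Measure.map_id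
  · rw [lintegral_map (by fun_prop) hm]
    obtain ⟨i1, i2⟩ := h.integral_exp_inner_sub_le hT θ b (hB.integral_inner_sub_mean θ)
    rw [← ofReal_integral_eq_lintegral_ofReal i1 (Eventually.of_forall fun x => (Real.exp_pos _).le)]
    exact ENNReal.ofReal_le_ofReal i2
  rw [Measure.map_apply hm (measurableSet_goodPairs k d).compl]
  -- the trace
  set tr := ∫ x, ‖x - b‖ ^ 2 ∂ν with htr
  have htr1 : tr = d + ∑ i, (cov ν (stdE i) (stdE i) - 1) := by
    rw [htr, hB.integral_norm_sub_mean_sq, Finset.sum_sub_distrib]; simp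
  have hdef := sq_sum_defect_le (ν := ν)
  set σ := ∑ i, (cov ν (stdE i) (stdE i) - 1) with hσ
  have hσ2 : σ ^ 2 ≤ (0.224 * k) ^ 2 := by
    have : d * covDefect ν ≤ k * (k / 20) := mul_le_mul hdk' (by linarith) hΨ0 hk0.le
    nlinarith
  have hσ3 := abs_le.1 (abs_le_of_sq_le_sq hσ2 (by positivity))
  have hd95 : 0.95 * (k : ℝ) ≤ d := by linarith
  -- concentration of the norm
  set Y : Euc d → ℝ := fun x => ‖x - b‖ with hY
  have hYc : Continuous Y := by fun_prop
  have hvar := hB.variance_lipschitz_le hT h hYc fun x y => by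
    have := norm_sub_norm_le (x - b) (y - b)
    rwa [sub_sub_sub_cancel_right] at this
  set m := ∫ x, Y x ∂ν with hmdef
  have hm0 : 0 ≤ m := integral_nonneg fun x => norm_nonneg _
  have hvar2 : ∫ x, (Y x - m) ^ 2 ∂ν = tr - m ^ 2 := by
    have e : ∀ x, (Y x - m) ^ 2 = Y x ^ 2 + (-2 * m) * Y x + m ^ 2 := fun x => by ring
    simp only [e]
    rw [integral_add₃ (hB.integrable (by fun_prop)) (hB.integrable (by fun_prop))
      (integrable_const _), integral_const_mul, ← hmdef]
    simp [htr]; ring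
  have h12 : 12 / T ≤ k / 20 := by
    have : 12 / T = (240 / T) / 20 := by ring
    rw [this]; gcongr
  have hvn : 0 ≤ ∫ x, (Y x - m) ^ 2 ∂ν := integral_nonneg fun x => sq_nonneg _
  set r := Real.sqrt k with hr
  have hr0 : 0 < r := Real.sqrt_pos.2 hk0
  have hr2 : r ^ 2 = k := Real.sq_sqrt hk0.le
  have hm1 : 0.8 * r ≤ m := by
    refine (pow_le_pow_iff_left₀ (by positivity) hm0 two_ne_zero).1 ?_
    rw [mul_pow, hr2]; norm_num; linarith
  have hm2 : m ≤ 1.2 * r := by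
    refine (pow_le_pow_iff_left₀ hm0 (by positivity) two_ne_zero).1 ?_
    rw [mul_pow, hr2]; norm_num; linarith
  have hsub : (fun x : Euc d => (x, x - b)) ⁻¹' (goodPairs k d)ᶜ ⊆
      {x | 0.01 * k ≤ (Y x - m) ^ 2} ∪ {x | 0.01 * k ^ 2 ≤ ⟪b, x - b⟫ ^ 2} := by
    intro x hx
    by_contra hcon
    simp only [mem_union, mem_ofPred_eq, not_or, not_le] at hcon
    obtain ⟨c1, c2⟩ := hcon
    refine hx ?_
    have c1' := abs_lt.1 (abs_lt_of_sq_lt_sq (show (Y x - m) ^ 2 < (0.1 * r) ^ 2 by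
      rw [mul_pow, hr2]; norm_num at c1 ⊢; linarith) (by positivity))
    have c2' := abs_lt.1 (abs_lt_of_sq_lt_sq (show ⟪b, x - b⟫ ^ 2 < (0.1 * k) ^ 2 by
      rw [mul_pow]; norm_num at c2 ⊢; linarith) (by positivity))
    refine ⟨?_, ?_⟩
    · have e : ⟪x, x - b⟫ = Y x ^ 2 + ⟪b, x - b⟫ := by
        simp only [hY]
        rw [← real_inner_self_eq_norm_sq, ← inner_add_left, sub_add_cancel]
      show (k : ℝ) / 5 ≤ ⟪x, x - b⟫
      rw [e]
      have hYr : 0.7 * r ≤ Y x := by linarith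
      have : (0.7 * r) ^ 2 ≤ Y x ^ 2 := pow_le_pow_left₀ (by positivity) hYr 2
      rw [mul_pow, hr2] at this
      norm_num at this c2'
      linarith [c2'.1]
    · show Y x ≤ 10 * r
      linarith
  refine (measure_mono hsub).trans ((measure_union_le _ _).trans ?_)
  have cheb : ∀ (g : Euc d → ℝ) (A B : ℝ), Continuous g → 0 < A → ∫ x, g x ^ 2 ∂ν ≤ B →
      ν {x | A ≤ g x ^ 2} ≤ ENNReal.ofReal (B / A) := by
    intro g A B hg hA hI
    have := mul_meas_ge_le_integral_of_nonneg (μ := ν) (f := fun x => g x ^ 2)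
      (Eventually.of_forall fun x => sq_nonneg _) (hB.integrable (by fun_prop)) A
    rw [← ofReal_measureReal]
    refine ENNReal.ofReal_le_ofReal ?_
    rw [le_div_iff₀ hA]; linarith
  have hb2 : ‖b‖ ^ 2 ≤ ∫ x, ‖x‖ ^ 2 ∂ν := by
    have e : ∫ x, ‖x‖ ^ 2 ∂ν = tr + ‖b‖ ^ 2 := by
      have e1 : ∀ x : Euc d, ‖x‖ ^ 2 = ‖x - b‖ ^ 2 + 2 * ⟪b, x - b⟫ + ‖b‖ ^ 2 := fun x => by
        have := norm_add_sq_real (x - b) b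
        rw [sub_add_cancel, real_inner_comm] at this
        linarith
      rw [integral_congr_ae (Eventually.of_forall e1),
        integral_add₃ (hB.integrable (by fun_prop)) (hB.integrable (by fun_prop))
        (integrable_const _), integral_const_mul, hB.integral_inner_sub_mean]
      simp only [mul_zero, add_zero, integral_const, probReal_univ, one_smul]
      rfl
    have : 0 ≤ tr := integral_nonneg fun x => sq_nonneg _
    linarith
  have p1 := cheb (fun x => Y x - m) (0.01 * k) (12 / T) (by fun_prop) (by positivity) hvar
  have p2 := cheb (fun x => ⟪b, x - b⟫) (0.01 * k ^ 2) (12 * ‖b‖ ^ 2 / T) (by fun_prop)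
    (by positivity) (h.integral_inner_sq_le hT b hB.integral_inner_sub_mean b)
  refine (add_le_add p1 p2).trans ?_
  rw [← ENNReal.ofReal_add (by positivity) (by positivity)]
  refine ENNReal.ofReal_le_ofReal ?_
  have q1 : 12 / T / (0.01 * k) = 1200 / (T * k) := by field_simp; norm_num
  have q2 : 12 * ‖b‖ ^ 2 / T / (0.01 * k ^ 2) ≤ 1200 * (∫ x, ‖x‖ ^ 2 ∂ν) / (T * k ^ 2) := by
    have : 12 * ‖b‖ ^ 2 / T / (0.01 * k ^ 2) = 1200 * ‖b‖ ^ 2 / (T * k ^ 2) := by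
      field_simp; ring
    rw [this]; gcongr
  have q3 : 0 ≤ 20 / k * ((k - d) + covDefect ν) :=
    mul_nonneg (by positivity) (add_nonneg (by linarith) hΨ0)
  linarith

end coupling

section rounds

open Filter

variable {T t D ε : ℝ} {k d : ℕ} {ν : Measure (Euc d)}

/-- The second moment. -/
def secondMoment (ν : Measure (Euc d)) : ℝ := ∫ x, ‖x‖ ^ 2 ∂ν

lemma secondMoment_nonneg : 0 ≤ secondMoment ν := integral_nonneg fun x => sq_nonneg _

/-- The failure probability available to a measure on `ℝᵈ` with parameter `t`. -/
def budget (T : ℝ) (k d : ℕ) (c Ψ E : ℝ) : ℝ :=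
  20 / k * ((k - d) + Ψ + c) + 1200 / (T * k) + 1200 * E / (T * k ^ 2)

lemma budget_nonneg {c Ψ E : ℝ} (hT : 0 < T) (hdk : d ≤ k) (hc : 0 ≤ c) (hΨ : 0 ≤ Ψ) (hE : 0 ≤ E) :
    0 ≤ budget T k d c Ψ E := by
  have : (0 : ℝ) ≤ k - d := sub_nonneg.2 (by exact_mod_cast hdk)
  unfold budget; positivity

lemma budget_mono {c c' Ψ Ψ' E E' : ℝ} {d' : ℕ} (hT : 0 < T)
    (h : (k - d : ℝ) + Ψ + c ≤ (k - d') + Ψ' + c') (hE : E ≤ E') :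
    budget T k d c Ψ E ≤ budget T k d' c' Ψ' E' := by
  unfold budget; gcongr

lemma div_sqrt_le_mul_sqrt_sub (ht : 0 < t) {κ : ℝ} (hκ0 : 0 ≤ κ) (hκ : κ ≤ 3 * t) :
    κ / Real.sqrt t ≤ 3 * (Real.sqrt (t + κ) - Real.sqrt t) := by
  have h1 : 0 < Real.sqrt t := Real.sqrt_pos.2 ht
  have h2 : Real.sqrt (t + κ) ≤ 2 * Real.sqrt t := by
    rw [show 2 * Real.sqrt t = Real.sqrt (4 * t) by
      rw [Real.sqrt_mul (by norm_num), show (4 : ℝ) = 2 ^ 2 by norm_num, Real.sqrt_sq (by norm_num)]]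
    exact Real.sqrt_le_sqrt (by linarith)
  have h3 : Real.sqrt t ≤ Real.sqrt (t + κ) := Real.sqrt_le_sqrt (by linarith)
  have h4 : Real.sqrt (t + κ) ^ 2 = t + κ := Real.sq_sqrt (by linarith)
  have h5 : Real.sqrt t ^ 2 = t := Real.sq_sqrt ht.le
  rw [div_le_iff₀ h1]
  nlinarith

/-- The gain of strong log-concavity after splitting in the first `j` coordinate directions. -/
def roundGain (t ε : ℝ) (j : ℕ) (x : Euc d) : ℝ :=
  t * ‖x‖ ^ 2 + ε ^ 2 / 4 * ∑ i : Fin d, if (i : ℕ) < j then x i ^ 2 else 0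

lemma le_roundGain (j : ℕ) (x : Euc d) : t * ‖x‖ ^ 2 ≤ roundGain t ε j x := by
  unfold roundGain
  have : 0 ≤ ∑ i : Fin d, if (i : ℕ) < j then x i ^ 2 else 0 :=
    Finset.sum_nonneg fun i _ => by split_ifs <;> positivity
  nlinarith [mul_nonneg (by positivity : 0 ≤ ε ^ 2 / 4) this]

lemma roundGain_succ (i : Fin d) (x : Euc d) :
    roundGain t ε ((i : ℕ) + 1) x = roundGain t ε i x + ε ^ 2 / 4 * ⟪stdE i, x⟫ ^ 2 := by
  unfold roundGain
  have h : ∑ l : Fin d, (if (l : ℕ) < (i : ℕ) + 1 then x l ^ 2 else 0) =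
      (∑ l : Fin d, if (l : ℕ) < i then x l ^ 2 else 0) + x i ^ 2 := by
    have h1 : x i ^ 2 = ∑ l : Fin d, if l = i then x l ^ 2 else 0 := by simp
    rw [h1, ← Finset.sum_add_distrib]
    refine Finset.sum_congr rfl fun l _ => ?_
    by_cases hl : l = i
    · subst hl; simp
    · have h2 : (l : ℕ) ≠ i := fun h => hl (Fin.ext h)
      have h3 : (l : ℕ) < i + 1 ↔ (l : ℕ) < i := by omega
      simp [hl, h3]
  rw [h, EuclideanSpace.inner_single_left]
  simp; ring

lemma roundGain_full (x : Euc d) : roundGain t ε d x = (t + ε ^ 2 / 4) * ‖x‖ ^ 2 := by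
  unfold roundGain
  rw [EuclideanSpace.norm_sq_eq]
  simp; ring

lemma Bdd.secondMoment_half (h : Bdd D ν) {θ : Euc d} (hε : |ε| * (2 * D) ≤ 1 / 2) (hθ : ‖θ‖ = 1) :
    secondMoment (half D ε ν θ) + secondMoment (half D (-ε) ν θ) = 2 * secondMoment ν := by
  have hε' : |-ε| * (2 * D) ≤ 1 / 2 := by rwa [abs_neg]
  unfold secondMoment
  rw [h.integral_half hε hθ (by fun_prop), h.integral_half hε' hθ (by fun_prop)]
  ring

lemma Bdd.covDefect_avg_le (h : Bdd D ν) (hε0 : 0 < ε) (hε4 : ε ≤ 1 / 4) (hεD : ε * (2 * D) ≤ 1 / 2)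
    (ht : 0 < t) (ht1 : t ≤ 1) (hLC : LC (fun x => t * ‖x‖ ^ 2) ν)
    (hA : ∀ w, cov ν w w ≤ 3 * ‖w‖ ^ 2) {θ : Euc d} (hθ : ‖θ‖ = 1) :
    covDefect (half D ε ν θ) + covDefect (half D (-ε) ν θ) ≤
      2 * (covDefect ν + 300 * ε ^ 2 / Real.sqrt t) := by
  have hp := h.prob
  have hε : |ε| * (2 * D) ≤ 1 / 2 := by rwa [abs_of_pos hε0]
  have h1 := h.covDefect_half_add hε hθ (by norm_num : (0 : ℝ) ≤ 3) hA
  have h2 := third_moment_le ht (by norm_num : (0 : ℝ) < 3) hLC h.ball (mean ν)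
    h.integral_inner_sub_mean (fun w => by simpa only [cov, ← pow_two] using hA w) θ
  have e : ∑ i, ∑ j, third ν θ (stdE i) (stdE j) ^ 2 =
      ∑ i, ∑ j, (∫ x, ⟪θ, x - mean ν⟫ * ((x i - mean ν i) * (x j - mean ν j)) ∂ν) ^ 2 := by
    simp [third, EuclideanSpace.inner_single_left]
  rw [← e, hθ] at h2
  set S := ∑ i, ∑ j, third ν θ (stdE i) (stdE j) ^ 2
  have hs0 : 0 < Real.sqrt t := Real.sqrt_pos.2 ht
  have hs1 : Real.sqrt t ≤ 1 := Real.sqrt_le_iff.2 ⟨by norm_num, by linarith⟩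
  have h3 : Real.sqrt (3 / t) ≤ 1.74 / Real.sqrt t := by
    rw [Real.sqrt_div (by norm_num)]
    gcongr
    rw [Real.sqrt_le_left (by norm_num)]; norm_num
  have h4 : S ≤ 260 / Real.sqrt t := by
    refine h2.trans ?_
    have : 260 / Real.sqrt t = 260 / 1.74 * (1.74 / Real.sqrt t) := by field_simp
    rw [this]
    have h5 : 0 ≤ Real.sqrt (3 / t) := Real.sqrt_nonneg _
    nlinarith
  have h6 : (1 : ℝ) ≤ 1 / Real.sqrt t := by rw [le_div_iff₀ hs0]; linarith
  have h7 : ε ^ 2 ≤ 1 / 16 := by nlinarith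
  have h8 : ε ^ 2 * S + 2 * ε ^ 2 * 3 ^ 2 + ε ^ 4 * 3 ^ 4 ≤ 300 * ε ^ 2 / Real.sqrt t := by
    have e1 : 300 * ε ^ 2 / Real.sqrt t = ε ^ 2 * (260 / Real.sqrt t + 40 * (1 / Real.sqrt t)) := by
      field_simp; norm_num
    have e2 : ε ^ 2 * S + 2 * ε ^ 2 * 3 ^ 2 + ε ^ 4 * 3 ^ 4 = ε ^ 2 * (S + 18 + 81 * ε ^ 2) := by ring
    rw [e1, e2]
    refine mul_le_mul_of_nonneg_left ?_ (sq_nonneg _)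
    linarith
  linarith

/-- A round of splittings, one in each coordinate direction. -/
lemma round_coup (hT : 0 < T) (ht : 0 < t) (ht1 : t ≤ 1) (hdk : d ≤ k) (hε0 : 0 < ε)
    (hε4 : ε ≤ 1 / 4) (hεD : ε * (2 * D) ≤ 1 / 2) (hpow : (1 + ε * (2 * D)) ^ k ≤ 3 / 2)
    {c : ℝ} (hc : 0 ≤ c)
    (hnext : ∀ ν : Measure (Euc d), Bdd D ν → LC (fun x => (t + ε ^ 2 / 4) * ‖x‖ ^ 2) ν →
      Coup T k ν (budget T k d c (covDefect ν) (secondMoment ν)))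
    (l : ℕ) : ∀ j : ℕ, j + l = d → ∀ ν : Measure (Euc d), Bdd D ν → LC (roundGain t ε j) ν →
      (∀ w, cov ν w w ≤ 2 * (1 + ε * (2 * D)) ^ j * ‖w‖ ^ 2) →
      Coup T k ν (budget T k d (c + l * (300 * ε ^ 2 / Real.sqrt t)) (covDefect ν)
        (secondMoment ν)) := by
  have hε : |ε| * (2 * D) ≤ 1 / 2 := by rwa [abs_of_pos hε0]
  have hε' : |-ε| * (2 * D) ≤ 1 / 2 := by rwa [abs_neg]
  induction l with
  | zero =>
    intro j hj ν hB hLC _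
    have : j = d := by omega
    subst this
    simpa using hnext ν hB (hLC.mono fun x => by rw [roundGain_full])
  | succ l ih =>
    intro j hj ν hB hLC hA
    have hp := hB.prob
    have hD0 := hB.nonneg
    have hjd : j < d := by omega
    set i : Fin d := ⟨j, hjd⟩ with hi
    have hθ : ‖(stdE i : Euc d)‖ = 1 := by simp
    have hA3 : ∀ w, cov ν w w ≤ 3 * ‖w‖ ^ 2 := fun w => by
      refine (hA w).trans (mul_le_mul_of_nonneg_right ?_ (sq_nonneg _))
      have h1 : (1 + ε * (2 * D)) ^ j ≤ (1 + ε * (2 * D)) ^ k :=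
        pow_le_pow_right₀ (by nlinarith [mul_nonneg hε0.le hD0]) (by omega)
      linarith
    have hLCt : LC (fun x => t * ‖x‖ ^ 2) ν := hLC.mono fun x => le_roundGain j x
    have havg := hB.covDefect_avg_le hε0 hε4 hεD ht ht1 hLCt hA3 hθ
    have hsm := hB.secondMoment_half hε hθ
    have step : ∀ σ : ℝ, |σ| * (2 * D) ≤ 1 / 2 → |σ| = ε →
        Coup T k (half D σ ν (stdE i)) (budget T k d (c + l * (300 * ε ^ 2 / Real.sqrt t))
          (covDefect (half D σ ν (stdE i))) (secondMoment (half D σ ν (stdE i)))) := by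
      intro σ hσ hσε
      refine ih (j + 1) (by omega) _ (hB.bdd_half hσ hθ) ?_ fun w => ?_
      · refine (hLC.withDensity (measurable_tilt σ _) (hB.strongLC_tilt hσ hθ)).mono fun x => ?_
        have h2 : σ ^ 2 = ε ^ 2 := by rw [← sq_abs, hσε]
        have := roundGain_succ (t := t) (ε := ε) i x
        rw [h2]
        exact this.le
      · refine (hB.cov_half_self_le hσ hθ w).trans ?_
        rw [hσε]
        have := mul_le_mul_of_nonneg_left (hA w)
          (by nlinarith [mul_nonneg hε0.le hD0] : 0 ≤ 1 + ε * (2 * D))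
        refine this.trans (le_of_eq ?_)
        rw [pow_succ]; ring
    have hc' : 0 ≤ c + l * (300 * ε ^ 2 / Real.sqrt t) := by positivity
    have hmix := Coup.mix (ν := ν) (c₁ := 1 / 2) (c₂ := 1 / 2) (by norm_num) (by norm_num)
      (by norm_num) (budget_nonneg hT hdk hc' covDefect_nonneg secondMoment_nonneg)
      (budget_nonneg hT hdk hc' covDefect_nonneg secondMoment_nonneg)
      (step ε hε (abs_of_pos hε0)) (step (-ε) hε' (by rw [abs_neg, abs_of_pos hε0])) (by
        have := hB.half_add_half hε hθ
        have e : ENNReal.ofReal (1 / 2) = 2⁻¹ := by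
          rw [one_div, ENNReal.ofReal_inv_of_pos (by norm_num)]; simp
        rw [e]; exact this)
    refine hmix.mono ?_
    have e : ∀ Ψ₁ Ψ₂ E₁ E₂ c₁ : ℝ, 1 / 2 * budget T k d c₁ Ψ₁ E₁ + 1 / 2 * budget T k d c₁ Ψ₂ E₂ =
        budget T k d c₁ ((Ψ₁ + Ψ₂) / 2) ((E₁ + E₂) / 2) := fun Ψ₁ Ψ₂ E₁ E₂ c₁ => by
      unfold budget; ring
    rw [e]
    refine budget_mono hT ?_ (by rw [hsm]; linarith)
    push_cast
    linarith

end rounds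

section localization

open Filter Topology

variable {T t D ε : ℝ} {k d : ℕ} {ν : Measure (Euc d)}

lemma Bdd.map_coiso (h : Bdd D ν) {d' : ℕ} (W : Euc d' →ₗᵢ[ℝ] Euc d) : Bdd D (ν.map (coiso W)) := by
  have hp := h.prob
  have hm : Measurable (coiso W) := (coiso W).continuous.measurable
  refine ⟨Measure.isProbabilityMeasure_map hm.aemeasurable, ?_⟩
  rw [Measure.map_apply hm Metric.isClosed_closedBall.measurableSet.compl]
  refine measure_mono_null (fun x hx => ?_) h.ball
  simp only [preimage_compl, mem_compl_iff, mem_preimage, mem_closedBall_zero_iff] at hx ⊢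
  exact fun h1 => hx ((norm_coiso_le W x).trans h1)

lemma inner_coiso {d' : ℕ} (W : Euc d' →ₗᵢ[ℝ] Euc d) (u : Euc d') (x : Euc d) :
    ⟪u, coiso W x⟫ = ⟪W u, x⟫ :=
  ContinuousLinearMap.adjoint_inner_right W.toContinuousLinearMap u x

lemma Bdd.cov_map_coiso (h : Bdd D ν) {d' : ℕ} (W : Euc d' →ₗᵢ[ℝ] Euc d) (u v : Euc d') :
    cov (ν.map (coiso W)) u v = cov ν (W u) (W v) := by
  have hm : Measurable (coiso W) := (coiso W).continuous.measurable
  have hmean : mean (ν.map (coiso W)) = coiso W (mean ν) := by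
    rw [mean, integral_map hm.aemeasurable (by fun_prop), mean]
    exact ContinuousLinearMap.integral_comp_comm (coiso W) (φ := fun x => x)
      (h.integrable continuous_id)
  rw [cov, integral_map hm.aemeasurable (by fun_prop), hmean, cov]
  simp only [← map_sub, inner_coiso]

lemma Bdd.secondMoment_map_coiso_le (h : Bdd D ν) {d' : ℕ} (W : Euc d' →ₗᵢ[ℝ] Euc d) :
    secondMoment (ν.map (coiso W)) ≤ secondMoment ν := by
  have hm : Measurable (coiso W) := (coiso W).continuous.measurable
  rw [secondMoment, integral_map hm.aemeasurable (by fun_prop), secondMoment]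
  refine integral_mono (h.integrable (by fun_prop)) (h.integrable (by fun_prop)) fun x => ?_
  exact pow_le_pow_left₀ (norm_nonneg _) (norm_coiso_le W x) 2

lemma sum_sq_orthonormalBasis (ℓ : Euc d →ₗ[ℝ] ℝ) (b : OrthonormalBasis (Fin d) ℝ (Euc d)) :
    ∑ i, ℓ (b i) ^ 2 = ∑ i, ℓ (stdE i) ^ 2 := by
  set y : Euc d := WithLp.toLp 2 fun i => ℓ (stdE i) with hy
  have hℓ : ∀ x, ℓ x = ⟪x, y⟫ := fun x => by
    have hx : x = ∑ i, x i • stdE i := by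
      have := (EuclideanSpace.basisFun (Fin d) ℝ).sum_repr x
      simpa using this.symm
    conv_lhs => rw [hx]
    rw [PiLp.inner_apply]
    simp [hy, mul_comm]
  have h1 := b.sum_sq_norm_inner_right y
  have h2 := (EuclideanSpace.basisFun (Fin d) ℝ).sum_sq_norm_inner_right y
  rw [← h2] at h1
  simpa [hℓ] using h1

lemma Bdd.covDefect_eq (h : Bdd D ν) (b : OrthonormalBasis (Fin d) ℝ (Euc d)) :
    covDefect ν = ∑ i, ∑ j, (cov ν (b i) (b j) - ⟪b i, b j⟫) ^ 2 := by
  let B : Euc d →ₗ[ℝ] Euc d →ₗ[ℝ] ℝ := h.covBilin - innerₗ (Euc d)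
  have hB : ∀ u v, B u v = cov ν u v - ⟪u, v⟫ := fun u v => rfl
  have e1 : covDefect ν = ∑ i, ∑ j, B (stdE i) (stdE j) ^ 2 := by
    refine Finset.sum_congr rfl fun i _ => Finset.sum_congr rfl fun j _ => ?_
    rw [hB, EuclideanSpace.inner_single_left]
    simp
  have e2 : ∑ i, ∑ j, (cov ν (b i) (b j) - ⟪b i, b j⟫) ^ 2 = ∑ i, ∑ j, B (b i) (b j) ^ 2 := rfl
  rw [e1, e2]
  simp only [sum_sq_orthonormalBasis (B _) b]
  rw [Finset.sum_comm, Finset.sum_comm (f := fun i j => B (b i) (stdE j) ^ 2)]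
  refine Finset.sum_congr rfl fun j _ => ?_
  exact (sum_sq_orthonormalBasis (B.flip (stdE j)) b).symm

/-- Projecting out a direction of large variance decreases the covariance defect. -/
lemma Bdd.exists_project (h : Bdd D ν) {d' : ℕ} (hd : d = d' + 1) {v : Euc d} (hv : ‖v‖ = 1)
    (hv2 : 2 < cov ν v v) :
    ∃ W : Euc d' →ₗᵢ[ℝ] Euc d, covDefect (ν.map (coiso W)) + 1 ≤ covDefect ν := by
  subst hd
  have ho : Orthonormal ℝ (({0} : Set (Fin (d' + 1))).domRestrict fun _ => v) := by
    refine ⟨fun i => hv, fun i j hij => ?_⟩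
    exact absurd (Subtype.ext ((mem_singleton_iff.1 i.2).trans (mem_singleton_iff.1 j.2).symm)) hij
  obtain ⟨b, hb⟩ := ho.exists_orthonormalBasis_extension_of_card_eq (by simp)
  have hb0 : b 0 = v := hb 0 rfl
  let e := EuclideanSpace.basisFun (Fin d') ℝ
  let W₀ : Euc d' →ₗ[ℝ] Euc (d' + 1) := e.toBasis.constr ℝ fun i => b i.succ
  have hW₀ : ∀ i, W₀ (stdE i) = b i.succ := fun i => by
    rw [show (stdE i : Euc d') = e.toBasis i by simp [e]]
    exact e.toBasis.constr_basis ℝ (fun i => b i.succ) i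
  let W : Euc d' →ₗᵢ[ℝ] Euc (d' + 1) := W₀.isometryOfOrthonormal (v := e.toBasis)
    (by simpa using e.orthonormal) (by
      have : (W₀ ∘ e.toBasis) = b ∘ Fin.succ := by
        ext1 i; simpa [e] using hW₀ i
      rw [this]; exact b.orthonormal.comp _ (Fin.succ_injective _))
  have hW : ∀ i, W (stdE i) = b i.succ := hW₀
  refine ⟨W, ?_⟩
  rw [h.covDefect_eq b, Fin.sum_univ_succ]
  have h1 : 1 ≤ ∑ j, (cov ν (b 0) (b j) - ⟪b 0, b j⟫) ^ 2 := by
    have := Finset.single_le_sum (f := fun j => (cov ν (b 0) (b j) - ⟪b 0, b j⟫) ^ 2)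
      (fun j _ => sq_nonneg _) (Finset.mem_univ 0)
    refine le_trans ?_ this
    simp only [hb0]
    rw [real_inner_self_eq_norm_sq, hv]
    nlinarith
  have h2 : covDefect (ν.map (coiso W)) ≤
      ∑ i : Fin d', ∑ j, (cov ν (b i.succ) (b j) - ⟪b i.succ, b j⟫) ^ 2 := by
    refine Finset.sum_le_sum fun i _ => ?_
    rw [Fin.sum_univ_succ]
    refine le_add_of_nonneg_of_le (sq_nonneg _) (le_of_eq ?_)
    refine Finset.sum_congr rfl fun j _ => ?_
    rw [h.cov_map_coiso, hW, hW]
    congr 2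
    have := (orthonormal_iff_ite.1 b.orthonormal) i.succ j.succ
    rw [this]; simp
  linarith

lemma exists_unit_of_not_cov_le {a : ℝ} (h : ¬∀ w, cov ν w w ≤ a * ‖w‖ ^ 2) :
    ∃ v : Euc d, ‖v‖ = 1 ∧ a < cov ν v v := by
  push Not at h
  obtain ⟨w, hw⟩ := h
  have hw0 : w ≠ 0 := by
    rintro rfl
    simp [cov] at hw
  have hn : 0 < ‖w‖ := norm_pos_iff.2 hw0
  refine ⟨‖w‖⁻¹ • w, by rw [norm_smul, norm_inv, norm_norm, inv_mul_cancel₀ hn.ne'], ?_⟩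
  rw [cov_smul_left, cov_comm, cov_smul_left, ← mul_assoc, ← pow_two, inv_pow,
    lt_inv_mul_iff₀ (by positivity)]
  linarith

/-- Strongly log-concave measures with covariance close to the identity can be coupled. -/
lemma coup_of_rounds (hT : 0 < T) (hT1 : T ≤ 1 / 2) (hk : 240 / T ≤ k) {t₀ : ℝ} (ht₀ : 0 < t₀)
    (hε0 : 0 < ε) (hε4 : ε ≤ 1 / 4) (hεD : ε * (2 * D) ≤ 1 / 2)
    (hpow : (1 + ε * (2 * D)) ^ k ≤ 3 / 2) (hεt : ε ^ 2 / 4 ≤ 3 * t₀) (hεT : ε ^ 2 / 4 ≤ T) (r : ℕ) :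
    ∀ t, t₀ ≤ t → t ≤ 2 * T → T ≤ t + r * (ε ^ 2 / 4) → ∀ (d : ℕ), d ≤ k → ∀ ν : Measure (Euc d),
      Bdd D ν → LC (fun x => t * ‖x‖ ^ 2) ν →
      Coup T k ν (budget T k d (3600 * k * (Real.sqrt (2 * T) - Real.sqrt t)) (covDefect ν)
        (secondMoment ν)) := by
  have leaf : ∀ t, T ≤ t → t ≤ 2 * T → ∀ (d : ℕ), d ≤ k → ∀ ν : Measure (Euc d),
      Bdd D ν → LC (fun x => t * ‖x‖ ^ 2) ν →
      Coup T k ν (budget T k d (3600 * k * (Real.sqrt (2 * T) - Real.sqrt t)) (covDefect ν)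
        (secondMoment ν)) := by
    intro t hTt ht2 d hdk ν hB hLC
    have h1 := hB.coup_self hT (hLC.mono fun x =>
      mul_le_mul_of_nonneg_right hTt (sq_nonneg _)) hdk hk
    refine h1.mono ?_
    have h2 : 0 ≤ 3600 * (k : ℝ) * (Real.sqrt (2 * T) - Real.sqrt t) :=
      mul_nonneg (by positivity) (sub_nonneg.2 (Real.sqrt_le_sqrt ht2))
    unfold budget secondMoment
    have h3 : 20 / (k : ℝ) * (k - d + covDefect ν) ≤ 20 / (k : ℝ) *
        (k - d + covDefect ν + 3600 * k * (Real.sqrt (2 * T) - Real.sqrt t)) :=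
      mul_le_mul_of_nonneg_left (by linarith) (by positivity)
    linarith
  induction r with
  | zero =>
    intro t _ ht2 hTt
    exact leaf t (by simpa using hTt) ht2
  | succ r ih =>
    intro t ht ht2 hTt
    by_cases hle : T ≤ t
    · exact leaf t hle ht2
    push Not at hle
    have ht0 : 0 < t := lt_of_lt_of_le ht₀ ht
    have hstep := div_sqrt_le_mul_sqrt_sub (κ := ε ^ 2 / 4) ht0 (by positivity) (by linarith)
    have hmono : Real.sqrt (t + ε ^ 2 / 4) ≤ Real.sqrt (2 * T) := Real.sqrt_le_sqrt (by linarith)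
    intro d
    induction d with
    | zero =>
      intro hdk ν hB hLC
      have hp := hB.prob
      refine Coup.of_one_le hT ?_
      have hk0 : (0 : ℝ) < k := lt_of_lt_of_le (by positivity) hk
      have h2 : 0 ≤ 3600 * (k : ℝ) * (Real.sqrt (2 * T) - Real.sqrt t) :=
        mul_nonneg (by positivity) (sub_nonneg.2 (Real.sqrt_le_sqrt ht2))
      have h3 := covDefect_nonneg (ν := ν)
      have h4 := secondMoment_nonneg (ν := ν)
      unfold budget
      have h5 : 1 ≤ 20 / (k : ℝ) * (k - (0 : ℕ) + covDefect ν +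
          3600 * k * (Real.sqrt (2 * T) - Real.sqrt t)) := by
        rw [div_mul_eq_mul_div, le_div_iff₀ hk0]; push_cast; linarith
      have h6 : 0 ≤ 1200 / (T * k) := by positivity
      have h7 : 0 ≤ 1200 * secondMoment ν / (T * k ^ 2) := by positivity
      linarith
    | succ d' ihd =>
      intro hdk ν hB hLC
      have hp := hB.prob
      by_cases hA : ∀ w, cov ν w w ≤ 2 * ‖w‖ ^ 2
      · have hround := round_coup hT ht0 (by linarith) hdk hε0 hε4 hεD hpow
          (c := 3600 * k * (Real.sqrt (2 * T) - Real.sqrt (t + ε ^ 2 / 4)))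
          (mul_nonneg (by positivity) (sub_nonneg.2 hmono))
          (ih (t + ε ^ 2 / 4) (by nlinarith [sq_nonneg ε]) (by linarith) (by push_cast at hTt; linarith)
            (d' + 1) hdk) (d' + 1) 0 (by omega) ν hB
          (hLC.mono fun x => by simp [roundGain]) (by simpa using hA)
        refine hround.mono (budget_mono hT ?_ le_rfl)
        have h1 : ((d' + 1 : ℕ) : ℝ) * (300 * ε ^ 2 / Real.sqrt t) ≤
            k * (1200 * (ε ^ 2 / 4 / Real.sqrt t)) := by
          refine mul_le_mul (by exact_mod_cast hdk) (le_of_eq (by ring)) (by positivity) (by positivity)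
        have h2 : (k : ℝ) * (1200 * (ε ^ 2 / 4 / Real.sqrt t)) ≤
            k * (1200 * (3 * (Real.sqrt (t + ε ^ 2 / 4) - Real.sqrt t))) := by gcongr
        linarith
      · obtain ⟨v, hv, hv2⟩ := exists_unit_of_not_cov_le hA
        obtain ⟨W, hW⟩ := hB.exists_project rfl hv hv2
        have h1 := ihd (by omega) _ (hB.map_coiso W) (hLC.map_coiso ht0.le W)
        refine Coup.of_map_coiso W hT (h1.mono (budget_mono hT ?_ (hB.secondMoment_map_coiso_le W)))
        push_cast
        linarith

lemma Bdd.coup (hB : Bdd D ν) (hT : 0 < T) (hT1 : T ≤ 1 / 2) (hk : 240 / T ≤ k) (hdk : d ≤ k)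
    (ht : 0 < t) (htT : t ≤ T) (hLC : LC (fun x => t * ‖x‖ ^ 2) ν) :
    Coup T k ν (budget T k d (3600 * k * Real.sqrt (2 * T)) (covDefect ν) (secondMoment ν)) := by
  have hD := hB.nonneg
  have hev : ∀ᶠ ε : ℝ in 𝓝[>] 0, 0 < ε ∧ ε ≤ 1 / 4 ∧ ε * (2 * D) ≤ 1 / 2 ∧
      (1 + ε * (2 * D)) ^ k ≤ 3 / 2 ∧ ε ^ 2 / 4 ≤ 3 * t ∧ ε ^ 2 / 4 ≤ T := by
    have key : ∀ f : ℝ → ℝ, Continuous f → ∀ c, f 0 < c → ∀ᶠ ε : ℝ in 𝓝[>] 0, f ε ≤ c :=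
      fun f hf c hc => ((hf.tendsto 0).mono_left nhdsWithin_le_nhds).eventually (eventually_le_nhds hc)
    filter_upwards [self_mem_nhdsWithin, key (fun ε => ε) continuous_id (1 / 4) (by norm_num),
      key (fun ε => ε * (2 * D)) (by fun_prop) (1 / 2) (by norm_num),
      key (fun ε => (1 + ε * (2 * D)) ^ k) (by fun_prop) (3 / 2) (by norm_num),
      key (fun ε => ε ^ 2 / 4) (by fun_prop) (3 * t) (by simpa using ht),
      key (fun ε => ε ^ 2 / 4) (by fun_prop) T (by simpa using hT)] with ε h0 h1 h2 h3 h4 h5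
    exact ⟨h0, h1, h2, h3, h4, h5⟩
  obtain ⟨ε, h0, h1, h2, h3, h4, h5⟩ := hev.exists
  obtain ⟨r, hr⟩ := exists_nat_ge (T / (ε ^ 2 / 4))
  rw [div_le_iff₀ (by positivity)] at hr
  have := coup_of_rounds hT hT1 hk ht h0 h1 h2 h3 h4 h5 r t le_rfl (by linarith) (by linarith) d hdk
    ν hB hLC
  refine this.mono (budget_mono hT ?_ le_rfl)
  have : 0 ≤ (k : ℝ) * Real.sqrt t := by positivity
  linarith

lemma Coup.add_rest {ρ μ : Measure (Euc d)} [IsProbabilityMeasure μ] {Z β : ℝ} (hT : 0 < T)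
    (hZ : 0 ≤ Z) (hZ1 : Z ≤ 1) (hβ : 0 ≤ β)
    (h : Coup T k ν β) (hμ : μ = ENNReal.ofReal Z • ν + ρ) : Coup T k μ (β + (1 - Z)) := by
  obtain ⟨P, hP, hPf, hPe, hPg⟩ := h
  have hν : ν univ = 1 := by
    rw [← hPf, Measure.map_apply measurable_fst MeasurableSet.univ]; simp
  have hρ : ENNReal.ofReal Z + ρ univ = 1 := by
    have := measure_univ (μ := μ)
    rw [hμ] at this
    simpa [hν] using this
  have hρ' : ρ univ = ENNReal.ofReal (1 - Z) := by
    have h1 : ENNReal.ofReal Z + ENNReal.ofReal (1 - Z) = 1 := by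
      rw [← ENNReal.ofReal_add hZ (by linarith)]; simp
    rw [← h1] at hρ
    exact (ENNReal.add_right_inj ENNReal.ofReal_ne_top).1 hρ
  have hm : Measurable fun x : Euc d => (x, (0 : Euc d)) := measurable_id.prodMk measurable_const
  refine ⟨ENNReal.ofReal Z • P + ρ.map fun x => (x, 0), ⟨?_⟩, ?_, fun θ => ?_, ?_⟩
  · rw [Measure.add_apply, Measure.smul_apply, measure_univ, Measure.map_apply hm MeasurableSet.univ]
    simpa using hρ
  · rw [Measure.map_add _ _ measurable_fst, Measure.map_smul, hPf,
      Measure.map_map measurable_fst hm, hμ]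
    congr 1
    exact Measure.map_id
  · rw [lintegral_add_measure, lintegral_smul_measure, lintegral_map (by fun_prop) hm]
    simp only [inner_zero_right, Real.exp_zero, lintegral_const, ENNReal.ofReal_one, one_mul]
    set c := ENNReal.ofReal (Real.exp (‖θ‖ ^ 2 / T))
    have hc : 1 ≤ c := by
      rw [← ENNReal.ofReal_one]
      exact ENNReal.ofReal_le_ofReal (Real.one_le_exp (by positivity))
    calc _ ≤ ENNReal.ofReal Z * c + ρ univ * c :=
          add_le_add (mul_le_mul' le_rfl (hPe θ)) (le_mul_of_one_le_right' hc)
      _ = c := by rw [← add_mul, hρ, one_mul]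
  · rw [Measure.add_apply, Measure.smul_apply, smul_eq_mul, ENNReal.ofReal_add hβ (by linarith)]
    refine add_le_add ?_ ?_
    · calc _ ≤ 1 * ENNReal.ofReal β := mul_le_mul' (by simpa using hZ1) hPg
        _ = _ := one_mul _
    · rw [Measure.map_apply hm (measurableSet_goodPairs k d).compl, ← hρ']
      exact measure_mono (subset_univ _)

end localization

section truncation

open Filter Topology

variable {k : ℕ} {μ : Measure (Euc k)}

/-- Isotropic log-concave probability measures, in a form closed under orthogonal projections. -/
structure Iso (μ : Measure (Euc k)) : Prop where
  prob : IsProbabilityMeasure μ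
  lc : LC (fun _ => 0) μ
  memLp : ∀ y, MemLp (fun x => ⟪y, x⟫) 2 μ
  mean_zero : ∀ y, ∫ x, ⟪y, x⟫ ∂μ = 0
  second : ∀ y z, ∫ x, ⟪y, x⟫ * ⟪z, x⟫ ∂μ = ⟪y, z⟫

lemma IsIsotropicLogConcave.iso (h : IsIsotropicLogConcave k μ) : Iso μ := by
  obtain ⟨f, h0, hf, hμ, hp, hm, hc⟩ := h
  have hL : ∀ y, MemLp (fun x => ⟪y, x⟫) 2 μ := fun y => by
    by_cases hy : y = 0
    · simp [hy]
    rw [memLp_two_iff_integrable_sq (by fun_prop)]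
    by_contra hn
    have h1 := hc y y
    rw [integral_undef (fun h2 => hn (h2.congr (Eventually.of_forall fun x => by
      simp only [real_inner_comm, pow_two])))] at h1
    exact hy (inner_self_eq_zero.1 h1.symm)
  refine ⟨hp, hμ ▸ isLogConcaveFn_lc h0 hf, hL, fun y => ?_, fun y z => ?_⟩
  · have hi : Integrable (fun x : Euc k => x) μ := by
      have h1 : Integrable (fun x : Euc k => ∑ i, x i • stdE i) μ := by
        refine integrable_finsetSum _ fun i _ => Integrable.smul_const ?_ _
        simpa [EuclideanSpace.inner_single_left] using (hL (stdE i)).integrable one_le_two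
      refine h1.congr (Eventually.of_forall fun x => ?_)
      simpa using (EuclideanSpace.basisFun (Fin k) ℝ).sum_repr x
    rw [integral_inner hi, hm, inner_zero_right]
  · simpa only [real_inner_comm] using hc y z

lemma Iso.map_coiso (h : Iso μ) {d : ℕ} (W : Euc d →ₗᵢ[ℝ] Euc k) : Iso (μ.map (coiso W)) := by
  have hp := h.prob
  have hm : Measurable (coiso W) := (coiso W).continuous.measurable
  refine ⟨Measure.isProbabilityMeasure_map hm.aemeasurable, ?_, fun y => ?_, fun y => ?_, fun y z => ?_⟩
  · have := LC.map_coiso le_rfl (h.lc.mono (q' := fun x => 0 * ‖x‖ ^ 2) fun x => by simp) W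
    exact this.mono fun x => by simp
  · rw [memLp_map_measure_iff (by fun_prop) hm.aemeasurable]
    simpa only [Function.comp_def, inner_coiso] using h.memLp (W y)
  · rw [integral_map hm.aemeasurable (by fun_prop)]
    simpa only [inner_coiso] using h.mean_zero (W y)
  · rw [integral_map hm.aemeasurable (by fun_prop)]
    simpa only [inner_coiso, W.inner_map_map] using h.second (W y) (W z)

/-- A log-concave cutoff with bounded support. -/
def gaussCut (N : ℕ) : Euc k → ℝ :=
  (Metric.closedBall 0 (N : ℝ)).indicator fun x => Real.exp (-((N : ℝ)⁻¹ / 2) * ‖x‖ ^ 2)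

lemma gaussCut_nonneg (N : ℕ) (x : Euc k) : 0 ≤ gaussCut N x :=
  indicator_nonneg (fun _ _ => Real.exp_nonneg _) _

lemma gaussCut_le_one (N : ℕ) (x : Euc k) : gaussCut N x ≤ 1 := by
  rw [gaussCut, indicator]
  split_ifs
  · exact Real.exp_le_one_iff.2 (by
      have : (0 : ℝ) ≤ (N : ℝ)⁻¹ / 2 * ‖x‖ ^ 2 := by positivity
      linarith)
  · exact zero_le_one

lemma measurable_gaussCut (N : ℕ) : Measurable (gaussCut N : Euc k → ℝ) :=
  Measurable.indicator (by fun_prop) Metric.isClosed_closedBall.measurableSet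

lemma tendsto_gaussCut (x : Euc k) : Tendsto (fun N => gaussCut N x) atTop (𝓝 1) := by
  have h1 : Tendsto (fun N : ℕ => Real.exp (-((N : ℝ)⁻¹ / 2) * ‖x‖ ^ 2)) atTop (𝓝 1) := by
    have h2 : Tendsto (fun N : ℕ => (N : ℝ)⁻¹) atTop (𝓝 0) := tendsto_inv_atTop_nhds_zero_nat
    have h3 : Continuous fun s : ℝ => Real.exp (-(s / 2) * ‖x‖ ^ 2) := by fun_prop
    simpa [Function.comp_def] using (h3.tendsto 0).comp h2
  refine h1.congr' ?_
  obtain ⟨N₀, hN₀⟩ := exists_nat_ge ‖x‖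
  filter_upwards [eventually_ge_atTop N₀] with N hN
  rw [gaussCut, indicator_of_mem]
  rw [mem_closedBall_zero_iff]
  exact hN₀.trans (by exact_mod_cast hN)

lemma strongLC_gaussCut (N : ℕ) :
    StrongLC (fun x : Euc k => (N : ℝ)⁻¹ * ‖x‖ ^ 2) fun x => ENNReal.ofReal (gaussCut N x) := by
  intro a b ha hb hab x y
  by_cases hx : x ∈ Metric.closedBall (0 : Euc k) N
  · by_cases hy : y ∈ Metric.closedBall (0 : Euc k) N
    · have hxy : a • x + b • y ∈ Metric.closedBall (0 : Euc k) (N : ℝ) :=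
        (convex_closedBall _ _) hx hy ha.le hb.le hab
      simp only [gaussCut, indicator_of_mem hx, indicator_of_mem hy, indicator_of_mem hxy]
      exact strongLC_gauss (d := k) (N : ℝ)⁻¹ a b ha hb hab x y
    · simp [gaussCut, indicator_of_notMem hy, hb]
  · simp [gaussCut, indicator_of_notMem hx, ha]

lemma tendsto_integral_gaussCut {f : Euc k → ℝ} (hf : Integrable f μ) :
    Tendsto (fun N => ∫ x, gaussCut N x * f x ∂μ) atTop (𝓝 (∫ x, f x ∂μ)) := by
  refine tendsto_integral_of_dominated_convergence (fun x => ‖f x‖)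
    (fun N => (measurable_gaussCut N).aestronglyMeasurable.mul hf.1) hf.norm (fun N => ?_) ?_
  · refine Eventually.of_forall fun x => ?_
    rw [norm_mul, Real.norm_of_nonneg (gaussCut_nonneg N x)]
    exact mul_le_of_le_one_left (norm_nonneg _) (gaussCut_le_one N x)
  · exact Eventually.of_forall fun x => by simpa using (tendsto_gaussCut x).mul_const (f x)

/-- The mass left by the cutoff. -/
def cutMass (μ : Measure (Euc k)) (N : ℕ) : ℝ := ∫ x, gaussCut N x ∂μ

/-- The normalized truncated measure. -/
def cutMeasure (μ : Measure (Euc k)) (N : ℕ) : Measure (Euc k) :=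
  ENNReal.ofReal (cutMass μ N)⁻¹ • μ.withDensity fun x => ENNReal.ofReal (gaussCut N x)

lemma tendsto_cutMass [IsProbabilityMeasure μ] : Tendsto (cutMass μ) atTop (𝓝 1) := by
  unfold cutMass
  simpa using tendsto_integral_gaussCut (μ := μ) (f := fun _ => 1) (integrable_const 1)

lemma integrable_gaussCut [IsProbabilityMeasure μ] (N : ℕ) : Integrable (gaussCut N) μ :=
  Integrable.of_bound (measurable_gaussCut N).aestronglyMeasurable 1
    (Eventually.of_forall fun x => by
      rw [Real.norm_of_nonneg (gaussCut_nonneg N x)]; exact gaussCut_le_one N x)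

lemma cutMass_le_one [IsProbabilityMeasure μ] (N : ℕ) : cutMass μ N ≤ 1 := by
  have := integral_mono (integrable_gaussCut (μ := μ) N) (integrable_const (1 : ℝ)) (gaussCut_le_one N)
  simpa [cutMass] using this

lemma integral_cutMeasure {N : ℕ} (hZ : 0 < cutMass μ N) (f : Euc k → ℝ) :
    ∫ x, f x ∂cutMeasure μ N = (cutMass μ N)⁻¹ * ∫ x, gaussCut N x * f x ∂μ := by
  rw [cutMeasure, integral_smul_measure, ENNReal.toReal_ofReal (by positivity),
    integral_withDensity_eq_integral_toReal_smul (measurable_gaussCut N).ennreal_ofReal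
    (Eventually.of_forall fun x => ENNReal.ofReal_lt_top)]
  simp only [ENNReal.toReal_ofReal (gaussCut_nonneg N _), smul_eq_mul]

lemma bdd_cutMeasure [IsProbabilityMeasure μ] {N : ℕ} (hZ : 0 < cutMass μ N) :
    Bdd N (cutMeasure μ N) := by
  refine ⟨⟨?_⟩, ?_⟩
  · rw [cutMeasure, Measure.smul_apply, withDensity_apply _ MeasurableSet.univ, setLIntegral_univ,
      ← ofReal_integral_eq_lintegral_ofReal (integrable_gaussCut N)
      (Eventually.of_forall (gaussCut_nonneg N)), smul_eq_mul, ← ENNReal.ofReal_mul (by positivity)]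
    rw [show ∫ x, gaussCut N x ∂μ = cutMass μ N from rfl, inv_mul_cancel₀ hZ.ne', ENNReal.ofReal_one]
  · rw [cutMeasure, Measure.smul_apply,
      withDensity_apply _ Metric.isClosed_closedBall.measurableSet.compl,
      setLIntegral_congr_fun (g := fun _ => 0) Metric.isClosed_closedBall.measurableSet.compl]
    · simp
    · intro x hx
      simp [gaussCut, indicator_of_notMem hx]

lemma eq_cutMeasure_add {N : ℕ} (hZ : 0 < cutMass μ N) :
    μ = ENNReal.ofReal (cutMass μ N) • cutMeasure μ N +
      μ.withDensity fun x => 1 - ENNReal.ofReal (gaussCut N x) := by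
  rw [cutMeasure, smul_smul, ← ENNReal.ofReal_mul hZ.le, mul_inv_cancel₀ hZ.ne', ENNReal.ofReal_one,
    one_smul, ← withDensity_add_left (measurable_gaussCut N).ennreal_ofReal]
  conv_lhs => rw [← withDensity_one (μ := μ)]
  congr 1
  ext x
  simp only [Pi.one_apply, Pi.add_apply]
  rw [add_tsub_cancel_of_le]
  simpa using ENNReal.ofReal_le_ofReal (gaussCut_le_one N x)

lemma tendsto_integral_cutMeasure [IsProbabilityMeasure μ] {f : Euc k → ℝ} (hf : Integrable f μ) :
    Tendsto (fun N => ∫ x, f x ∂cutMeasure μ N) atTop (𝓝 (∫ x, f x ∂μ)) := by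
  have h1 := (tendsto_cutMass (μ := μ)).inv₀ one_ne_zero |>.mul (tendsto_integral_gaussCut hf)
  rw [inv_one, one_mul] at h1
  refine h1.congr' ?_
  filter_upwards [(tendsto_cutMass (μ := μ)).eventually (lt_mem_nhds zero_lt_one)] with N hN
  exact (integral_cutMeasure hN f).symm

lemma Iso.integrable_mul (h : Iso μ) (u v : Euc k) : Integrable (fun x => ⟪u, x⟫ * ⟪v, x⟫) μ :=
  (h.memLp u).integrable_mul (h.memLp v)

lemma Iso.tendsto_cov (h : Iso μ) (u v : Euc k) :
    Tendsto (fun N => cov (cutMeasure μ N) u v) atTop (𝓝 ⟪u, v⟫) := by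
  have hp := h.prob
  have hi : ∀ y, Tendsto (fun N => ∫ x, ⟪y, x⟫ ∂cutMeasure μ N) atTop (𝓝 0) := fun y => by
    have := tendsto_integral_cutMeasure ((h.memLp y).integrable one_le_two)
    rwa [h.mean_zero] at this
  have h2 := tendsto_integral_cutMeasure (h.integrable_mul u v)
  rw [h.second] at h2
  have h3 := h2.sub ((hi u).mul (hi v))
  rw [mul_zero, sub_zero] at h3
  refine h3.congr' ?_
  filter_upwards [(tendsto_cutMass (μ := μ)).eventually (lt_mem_nhds zero_lt_one)] with N hN
  have hB := bdd_cutMeasure hN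
  have := hB.integral_inner_mul u v 0
  simp only [sub_zero] at this
  rw [hB.inner_mean, hB.inner_mean]
  linarith

lemma Iso.tendsto_covDefect (h : Iso μ) :
    Tendsto (fun N => covDefect (cutMeasure μ N)) atTop (𝓝 0) := by
  have : (0 : ℝ) = ∑ i : Fin k, ∑ j : Fin k,
      (⟪(stdE i : Euc k), stdE j⟫ - if i = j then 1 else 0) ^ 2 := by
    refine (Finset.sum_eq_zero fun i _ => Finset.sum_eq_zero fun j _ => ?_).symm
    rw [EuclideanSpace.inner_single_left]
    simp
  rw [this]
  exact tendsto_finsetSum _ fun i _ => tendsto_finsetSum _ fun j _ =>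
    ((h.tendsto_cov _ _).sub_const _).pow 2

lemma norm_sq_eq_sum_inner (x : Euc k) : ‖x‖ ^ 2 = ∑ i, ⟪stdE i, x⟫ * ⟪stdE i, x⟫ := by
  simpa using norm_sub_sq_eq_sum x 0

lemma Iso.integrable_norm_sq (h : Iso μ) : Integrable (fun x => ‖x‖ ^ 2) μ := by
  simp only [norm_sq_eq_sum_inner]
  exact integrable_finsetSum _ fun i _ => h.integrable_mul _ _

lemma Iso.integral_norm_sq (h : Iso μ) : ∫ x, ‖x‖ ^ 2 ∂μ = k := by
  simp only [norm_sq_eq_sum_inner]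
  rw [integral_finsetSum _ fun i _ => h.integrable_mul _ _]
  simp [h.second]

/-- Isotropic log-concave vectors can be coupled with subgaussian vectors correlated to them. -/
theorem exists_coup : ∃ T : ℝ, 0 < T ∧ ∃ k₀ : ℕ, ∀ k ≥ k₀, ∀ μ : Measure (Euc k), Iso μ →
    Coup T k μ (1 / 256) := by
  have hT : (0 : ℝ) < (10⁻¹ ^ 8) ^ 2 / 2 := by norm_num
  set T : ℝ := (10⁻¹ ^ 8) ^ 2 / 2 with hTdef
  have hs : Real.sqrt (2 * T) = 10⁻¹ ^ 8 := by
    rw [hTdef, mul_div_cancel₀ _ two_ne_zero, Real.sqrt_sq (by norm_num)]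
  have hT1 : T ≤ 1 / 2 := by rw [hTdef]; norm_num
  clear_value T
  obtain ⟨k₀, hk₀⟩ := exists_nat_ge (3600 * 1024 / T)
  refine ⟨T, hT, k₀, fun k hk μ h => ?_⟩
  have hp := h.prob
  have hkk : 3600 * 1024 / T ≤ k := hk₀.trans (by exact_mod_cast hk)
  have hk0 : (0 : ℝ) < k := lt_of_lt_of_le (by positivity) hkk
  have e1 : ∀ᶠ N in atTop, 1 - 1 / 40000 < cutMass μ N :=
    tendsto_cutMass.eventually (lt_mem_nhds (by norm_num))
  have e2 : ∀ᶠ N in atTop, covDefect (cutMeasure μ N) < k / 40000 :=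
    h.tendsto_covDefect.eventually (gt_mem_nhds (by positivity))
  have e3 : ∀ᶠ N in atTop, secondMoment (cutMeasure μ N) < 2 * k := by
    have := tendsto_integral_cutMeasure h.integrable_norm_sq
    rw [h.integral_norm_sq] at this
    exact this.eventually (gt_mem_nhds (by linarith))
  have e4 : ∀ᶠ N : ℕ in atTop, (N : ℝ)⁻¹ < T :=
    tendsto_inv_atTop_nhds_zero_nat.eventually (gt_mem_nhds hT)
  obtain ⟨N, h1, h2, h3, h4, h5⟩ := (e1.and (e2.and (e3.and (e4.and (eventually_gt_atTop 0))))).exists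
  have hZ : 0 < cutMass μ N := lt_trans (by norm_num) h1
  have hN : (0 : ℝ) < (N : ℝ)⁻¹ := by positivity
  have hLC : LC (fun x => (N : ℝ)⁻¹ * ‖x‖ ^ 2) (cutMeasure μ N) :=
    ((h.lc.withDensity (measurable_gaussCut N).ennreal_ofReal (strongLC_gaussCut N)).smul _).mono
      fun x => by simp
  have hB := bdd_cutMeasure hZ
  have hc := hB.coup hT hT1 (le_trans (by gcongr; norm_num) hkk) le_rfl hN h4.le hLC
  refine (hc.add_rest hT hZ.le (cutMass_le_one N) (budget_nonneg hT le_rfl (by positivity)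
    covDefect_nonneg secondMoment_nonneg) (eq_cutMeasure_add hZ)).mono ?_
  have h6 : 1200 / (T * k) + 1200 * secondMoment (cutMeasure μ N) / (T * k ^ 2) ≤ 1 / 1024 := by
    have h7 : 1200 * secondMoment (cutMeasure μ N) / (T * k ^ 2) ≤ 2400 / (T * k) := by
      rw [div_le_div_iff₀ (by positivity) (by positivity)]
      have : 0 ≤ T * (k : ℝ) := by positivity
      nlinarith
    have h8 : 3600 / (T * k) ≤ 1 / 1024 := by
      rw [div_le_iff₀ hT] at hkk
      rw [div_le_div_iff₀ (by positivity) (by norm_num)]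
      linarith
    have : 1200 / (T * k) + 2400 / (T * k) = 3600 / (T * (k : ℝ)) := by ring
    linarith
  have h9 : 20 / (k : ℝ) * (k - k + covDefect (cutMeasure μ N) + 3600 * k * Real.sqrt (2 * T)) ≤
      20 / 40000 + 72000 * 10⁻¹ ^ 8 := by
    rw [hs, div_mul_eq_mul_div, div_le_iff₀ hk0]
    linarith
  unfold budget
  norm_num at h9 ⊢
  linarith

end truncation

section borell

open Filter

lemma LC.prekopaLeindler {n : ℕ} {μ : Measure (Euc n)} (h : LC (fun _ => 0) μ) :
    PrekopaLeindler μ := by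
  obtain ⟨g, hg, hs, rfl⟩ := h
  intro a b ha hb hab p q r hp hq hr H
  rw [lintegral_withDensity_eq_lintegral_mul _ hg hp, lintegral_withDensity_eq_lintegral_mul _ hg hq,
    lintegral_withDensity_eq_lintegral_mul _ hg hr]
  refine prekopaLeindler_euc n a b ha hb hab _ _ _ (hg.mul hp) (hg.mul hq) (hg.mul hr) fun x y => ?_
  have h1 := hs a b ha hb hab x y
  simp only [mul_zero, zero_div, Real.exp_zero, ENNReal.ofReal_one, one_mul] at h1
  simp only [Pi.mul_apply]
  rw [ENNReal.mul_rpow_of_nonneg _ _ ha.le, ENNReal.mul_rpow_of_nonneg _ _ hb.le]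
  calc _ = (g x ^ a * g y ^ b) * (p x ^ a * q y ^ b) := by ring
    _ ≤ _ := mul_le_mul' h1 (H x y)

variable {E : Type*} [AddCommGroup E] [Module ℝ E] [MeasurableSpace E] {ν : Measure E}

lemma PrekopaLeindler.measure_le (h : PrekopaLeindler ν) {a b : ℝ} (ha : 0 < a) (hb : 0 < b)
    (hab : a + b = 1) {A B C : Set E} (hA : MeasurableSet A) (hB : MeasurableSet B)
    (hC : MeasurableSet C) (hABC : ∀ x ∈ A, ∀ y ∈ B, a • x + b • y ∈ C) :
    ν A ^ a * ν B ^ b ≤ ν C := by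
  have := h a b ha hb hab (A.indicator 1) (B.indicator 1) (C.indicator 1)
    (measurable_one.indicator hA) (measurable_one.indicator hB) (measurable_one.indicator hC)
    (fun x y => by
      by_cases hx : x ∈ A
      · by_cases hy : y ∈ B
        · simp [hx, hy, hABC x hx y hy]
        · simp [hy, hb]
      · simp [hx, ha])
  simpa [lintegral_indicator_one, hA, hB, hC] using this

/-- Geometric decay of the tails of a linear functional under a log-concave measure. -/
lemma PrekopaLeindler.measure_tail_le (h : PrekopaLeindler ν) [IsProbabilityMeasure ν]
    (ℓ : E →ₗ[ℝ] ℝ) (hℓ : Measurable ℓ) {s q : ℝ} (hs : 0 < s) (hq : 0 ≤ q) (hq2 : q ≤ 1 / 2)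
    (hν : ν {x | s < |ℓ x|} ≤ ENNReal.ofReal q) (j : ℕ) :
    ν {x | 2 * j * s ≤ |ℓ x|} ≤ ENNReal.ofReal ((2 * q) ^ j) := by
  have hm : Measurable fun x => |ℓ x| := hℓ.abs
  rcases j with _ | _ | i
  · simp
  · refine (measure_mono fun x hx => ?_).trans (hν.trans (ENNReal.ofReal_le_ofReal ?_))
    · have hx' : 2 * ((0 + 1 : ℕ) : ℝ) * s ≤ |ℓ x| := hx
      push_cast at hx'
      change s < |ℓ x|
      linarith
    · simp; linarith
  set j : ℕ := i + 1 + 1 with hj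
  have hj0 : (0 : ℝ) < j := by positivity
  have hj1 : (1 : ℝ) < j := by rw [hj]; push_cast; linarith [(Nat.cast_nonneg i : (0 : ℝ) ≤ i)]
  have hC : MeasurableSet {x | s < |ℓ x|} := measurableSet_lt measurable_const hm
  have hB : MeasurableSet {x | s < |ℓ x|}ᶜ := hC.compl
  have hA : MeasurableSet {x | 2 * j * s ≤ |ℓ x|} := measurableSet_le measurable_const hm
  have key := h.measure_le (a := 1 / j) (b := (j - 1) / j) (by positivity)
    (div_pos (by linarith) hj0) (by field_simp; ring) hA hB hC (fun x hx y hy => by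
      have hx' : 2 * j * s ≤ |ℓ x| := hx
      have hy' : |ℓ y| ≤ s := not_lt.1 hy
      change s < |ℓ _|
      rw [map_add, map_smul, map_smul, smul_eq_mul, smul_eq_mul]
      have e1 : |1 / (j : ℝ) * ℓ x| = |ℓ x| / j := by
        rw [abs_mul, abs_of_pos (by positivity)]; ring
      have e2 : |((j : ℝ) - 1) / j * ℓ y| ≤ (j - 1) / j * s := by
        rw [abs_mul, abs_of_pos (div_pos (by linarith) hj0)]
        exact mul_le_mul_of_nonneg_left hy' (div_pos (by linarith) hj0).le
      have e3 : 2 * s ≤ |ℓ x| / j := by rw [le_div_iff₀ hj0]; linarith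
      have e4 : ((j : ℝ) - 1) / j * s < s := by
        have : ((j : ℝ) - 1) / j < 1 := by rw [div_lt_one hj0]; linarith
        nlinarith
      have e5 := abs_sub_abs_le_abs_add (1 / (j : ℝ) * ℓ x) (((j : ℝ) - 1) / j * ℓ y)
      rw [e1] at e5
      linarith)
  have hBge : ENNReal.ofReal (1 / 2) ≤ ν {x | s < |ℓ x|}ᶜ := by
    rw [prob_compl_eq_one_sub hC, show (1 / 2 : ℝ) = 1 - 1 / 2 by norm_num,
      ENNReal.ofReal_sub _ (by norm_num), ENNReal.ofReal_one]
    exact tsub_le_tsub_left (hν.trans (ENNReal.ofReal_le_ofReal hq2)) _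
  have key2 := (mul_le_mul' le_rfl (ENNReal.rpow_le_rpow hBge
    (div_pos (by linarith) hj0 : 0 < ((j : ℝ) - 1) / j).le)).trans (key.trans hν)
  have key3 := pow_le_pow_left' key2 j
  rw [mul_pow, ← ENNReal.rpow_mul_natCast, ← ENNReal.rpow_mul_natCast, div_mul_cancel₀ _ hj0.ne',
    div_mul_cancel₀ _ hj0.ne', ENNReal.rpow_one, show (j : ℝ) - 1 = ((i + 1 : ℕ) : ℝ) by
      rw [hj]; push_cast; ring, ENNReal.rpow_natCast, ← ENNReal.ofReal_pow (by norm_num),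
    ← ENNReal.ofReal_pow hq] at key3
  have h2 : (1 : ℝ≥0∞) = ENNReal.ofReal ((1 / 2) ^ (i + 1)) * ENNReal.ofReal (2 ^ (i + 1)) := by
    rw [← ENNReal.ofReal_mul (by positivity), ← mul_pow]; norm_num
  calc ν {x | 2 * j * s ≤ |ℓ x|} = ν {x | 2 * j * s ≤ |ℓ x|} * ENNReal.ofReal ((1 / 2) ^ (i + 1)) *
        ENNReal.ofReal (2 ^ (i + 1)) := by rw [mul_assoc (ν _), ← h2, mul_one]
    _ ≤ ENNReal.ofReal (q ^ j) * ENNReal.ofReal (2 ^ (i + 1)) := mul_le_mul' key3 le_rfl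
    _ ≤ _ := by
      rw [← ENNReal.ofReal_mul (by positivity)]
      refine ENNReal.ofReal_le_ofReal ?_
      rw [mul_pow, mul_comm]
      exact mul_le_mul_of_nonneg_right (pow_le_pow_right₀ (by norm_num) (by omega)) (by positivity)

lemma lintegral_exp_le_of_tail {Ω : Type*} [MeasurableSpace Ω] {P : Measure Ω} {Y : Ω → ℝ}
    (hY : Measurable Y) (hY0 : ∀ ω, 0 ≤ Y ω) {κ l : ℝ} (hκ : 0 ≤ κ) (hl : 0 ≤ l)
    (hκl : κ * Real.exp l ≤ 2 / 3) (h : ∀ j : ℕ, P {ω | j ≤ Y ω} ≤ ENNReal.ofReal (κ ^ j)) :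
    ∫⁻ ω, ENNReal.ofReal (Real.exp (l * Y ω)) ∂P ≤ ENNReal.ofReal (3 * Real.exp l) := by
  have hms : ∀ j : ℕ, MeasurableSet {ω | (j : ℝ) ≤ Y ω} := fun j =>
    measurableSet_le measurable_const hY
  calc ∫⁻ ω, ENNReal.ofReal (Real.exp (l * Y ω)) ∂P
      ≤ ∫⁻ ω, ∑' j : ℕ, {ω | (j : ℝ) ≤ Y ω}.indicator
          (fun _ => ENNReal.ofReal (Real.exp (l * (j + 1)))) ω ∂P := by
        refine lintegral_mono fun ω => ?_
        refine le_trans ?_ (ENNReal.le_tsum ⌊Y ω⌋₊)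
        rw [indicator_of_mem (by exact Nat.floor_le (hY0 ω))]
        refine ENNReal.ofReal_le_ofReal (Real.exp_le_exp.2 ?_)
        exact mul_le_mul_of_nonneg_left (Nat.lt_floor_add_one _).le hl
    _ = ∑' j : ℕ, ENNReal.ofReal (Real.exp (l * (j + 1))) * P {ω | (j : ℝ) ≤ Y ω} := by
        rw [lintegral_tsum fun j => (measurable_const.indicator (hms j)).aemeasurable]
        simp only [lintegral_indicator_const (hms _)]
    _ ≤ ∑' j : ℕ, ENNReal.ofReal (Real.exp l) * ENNReal.ofReal (2 / 3) ^ j := by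
        refine ENNReal.tsum_le_tsum fun j => (mul_le_mul' le_rfl (h j)).trans ?_
        rw [← ENNReal.ofReal_mul (Real.exp_nonneg _), ← ENNReal.ofReal_pow (by norm_num),
          ← ENNReal.ofReal_mul (Real.exp_nonneg _)]
        refine ENNReal.ofReal_le_ofReal ?_
        have e : Real.exp (l * (j + 1)) = Real.exp l * Real.exp l ^ j := by
          rw [← Real.exp_nat_mul, ← Real.exp_add]; ring_nf
        rw [e, mul_assoc, ← mul_pow, mul_comm _ κ]
        exact mul_le_mul_of_nonneg_left (pow_le_pow_left₀ (by positivity) hκl j) (Real.exp_nonneg _)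
    _ = ENNReal.ofReal (3 * Real.exp l) := by
        rw [ENNReal.tsum_mul_left, ENNReal.tsum_geometric, ← ENNReal.ofReal_one,
          ← ENNReal.ofReal_sub _ (by norm_num), ← ENNReal.ofReal_inv_of_pos (by norm_num),
          ← ENNReal.ofReal_mul (Real.exp_nonneg _)]
        congr 1; ring

lemma PrekopaLeindler.lintegral_exp_le (h : PrekopaLeindler ν) [IsProbabilityMeasure ν]
    (ℓ : E →ₗ[ℝ] ℝ) (hℓ : Measurable ℓ) {s q l : ℝ} (hs : 0 < s) (hq : 0 ≤ q) (hq2 : q ≤ 1 / 2)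
    (hl : 0 ≤ l) (hql : 2 * q * Real.exp l ≤ 2 / 3) (hν : ν {x | s < |ℓ x|} ≤ ENNReal.ofReal q) :
    ∫⁻ x, ENNReal.ofReal (Real.exp (l * (|ℓ x| / (2 * s)))) ∂ν ≤ ENNReal.ofReal (3 * Real.exp l) := by
  refine lintegral_exp_le_of_tail (hℓ.abs.div_const _) (fun x => by positivity) (by positivity) hl hql
    fun j => ?_
  refine (measure_mono fun x hx => ?_).trans (h.measure_tail_le ℓ hℓ hs hq hq2 hν j)
  have hx' : (j : ℝ) ≤ |ℓ x| / (2 * s) := hx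
  rw [le_div_iff₀ (by positivity)] at hx'
  change 2 * j * s ≤ |ℓ x|
  linarith

end borell

section volumeBound

open Filter

variable {d : ℕ} {ν : Measure (Euc d)} {R : ℝ}

/-- The smoothed density of `ν` at scale `R`. -/
def ballMass (ν : Measure (Euc d)) (R : ℝ) (y : Euc d) : ℝ≥0∞ := ν (Metric.closedBall y R)

lemma measurableSet_dist_le (R : ℝ) : MeasurableSet {p : Euc d × Euc d | dist p.2 p.1 ≤ R} :=
  (isClosed_le (by fun_prop) continuous_const).measurableSet

lemma measurable_ballMass [IsProbabilityMeasure ν] : Measurable (ballMass ν R) :=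
  measurable_measure_prodMk_left (ν := ν) (measurableSet_dist_le R)

lemma setLIntegral_ballMass [IsProbabilityMeasure ν] {S : Set (Euc d)} (hS : MeasurableSet S) :
    ∫⁻ y in S, ballMass ν R y = ∫⁻ z, volume (S ∩ Metric.closedBall z R) ∂ν := by
  have h1 : ∀ y, ballMass ν R y = ∫⁻ z, {p : Euc d × Euc d | dist p.2 p.1 ≤ R}.indicator 1 (y, z) ∂ν :=
    fun y => by
      rw [ballMass, ← lintegral_indicator_one Metric.isClosed_closedBall.measurableSet]; rfl
  simp only [h1]
  rw [lintegral_lintegral_swap]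
  · refine lintegral_congr fun z => ?_
    rw [inter_comm, ← Measure.restrict_apply' hS,
      ← lintegral_indicator_one Metric.isClosed_closedBall.measurableSet]
    refine lintegral_congr fun y => ?_
    simp only [indicator, Metric.mem_closedBall, dist_comm, mem_ofPred_eq, Pi.one_apply]
  · exact (measurable_one.indicator (measurableSet_dist_le R)).aemeasurable

lemma PrekopaLeindler.ballMass_le (h : PrekopaLeindler ν) {a b : ℝ} (ha : 0 < a) (hb : 0 < b)
    (hab : a + b = 1) (x y : Euc d) :
    ballMass ν R x ^ a * ballMass ν R y ^ b ≤ ballMass ν R (a • x + b • y) := by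
  refine h.measure_le ha hb hab Metric.isClosed_closedBall.measurableSet
    Metric.isClosed_closedBall.measurableSet Metric.isClosed_closedBall.measurableSet
    fun u hu v hv => ?_
  rw [mem_closedBall_iff_norm] at *
  calc ‖a • u + b • v - (a • x + b • y)‖ = ‖a • (u - x) + b • (v - y)‖ := by
        congr 1; rw [smul_sub, smul_sub]; abel
    _ ≤ a * ‖u - x‖ + b * ‖v - y‖ := by
        refine (norm_add_le _ _).trans_eq ?_
        rw [norm_smul, norm_smul, Real.norm_of_nonneg ha.le, Real.norm_of_nonneg hb.le]
    _ ≤ a * R + b * R := by gcongr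
    _ = R := by rw [← add_mul, hab, one_mul]

lemma ballMass_neg (hsym : ν.map Neg.neg = ν) (y : Euc d) : ballMass ν R (-y) = ballMass ν R y := by
  conv_rhs => rw [ballMass, ← hsym,
    Measure.map_apply measurable_neg Metric.isClosed_closedBall.measurableSet]
  rw [ballMass]
  congr 1
  ext z
  simp only [mem_preimage, mem_closedBall_iff_norm, sub_neg_eq_add]
  rw [← norm_neg]; congr! 2; abel

lemma PrekopaLeindler.ballMass_le_zero (h : PrekopaLeindler ν) (hsym : ν.map Neg.neg = ν) (y : Euc d) :
    ballMass ν R y ≤ ballMass ν R 0 := by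
  have h1 := h.ballMass_le (R := R) (a := 1 / 2) (b := 1 / 2) (by norm_num) (by norm_num)
    (by norm_num) y (-y)
  rw [ballMass_neg hsym, smul_neg, add_neg_cancel, ← ENNReal.rpow_add_of_nonneg _ _ (by norm_num)
    (by norm_num)] at h1
  norm_num at h1
  exact h1

/-- The set where the smoothed density is comparable to its maximum. -/
def levelSet (ν : Measure (Euc d)) (R : ℝ) : Set (Euc d) :=
  {y | ENNReal.ofReal (Real.exp (-6 * d)) * ballMass ν R 0 ≤ ballMass ν R y}

lemma measurableSet_levelSet [IsProbabilityMeasure ν] : MeasurableSet (levelSet ν R) :=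
  measurableSet_le measurable_const measurable_ballMass

lemma PrekopaLeindler.convex_levelSet (h : PrekopaLeindler ν) : Convex ℝ (levelSet ν R) := by
  rw [convex_iff_forall_pos]
  intro x hx y hy a b ha hb hab
  refine le_trans ?_ (h.ballMass_le ha hb hab x y)
  calc _ = (ENNReal.ofReal (Real.exp (-6 * d)) * ballMass ν R 0) ^ a *
        (ENNReal.ofReal (Real.exp (-6 * d)) * ballMass ν R 0) ^ b := by
        rw [← ENNReal.rpow_add_of_nonneg _ _ ha.le hb.le, hab, ENNReal.rpow_one]
    _ ≤ _ := mul_le_mul' (ENNReal.rpow_le_rpow hx ha.le) (ENNReal.rpow_le_rpow hy hb.le)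

lemma PrekopaLeindler.ballMass_le_half (h : PrekopaLeindler ν) {y : Euc d} (hy : y ∉ levelSet ν R) :
    ballMass ν R y ≤ ENNReal.ofReal (Real.exp (-3 * d)) * ballMass ν R ((1 / 2 : ℝ) • y) := by
  have h1 := h.ballMass_le (R := R) (a := 1 / 2) (b := 1 / 2) (by norm_num) (by norm_num)
    (by norm_num) y 0
  rw [smul_zero, add_zero] at h1
  have h2 : ballMass ν R y ≤ ENNReal.ofReal (Real.exp (-6 * d)) * ballMass ν R 0 := (not_le.1 hy).le
  have e : ballMass ν R y = ballMass ν R y ^ (1 / 2 : ℝ) * ballMass ν R y ^ (1 / 2 : ℝ) := by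
    rw [← ENNReal.rpow_add_of_nonneg _ _ (by norm_num) (by norm_num)]; norm_num
  calc ballMass ν R y = ballMass ν R y ^ (1 / 2 : ℝ) * ballMass ν R y ^ (1 / 2 : ℝ) := e
    _ ≤ ballMass ν R y ^ (1 / 2 : ℝ) *
        (ENNReal.ofReal (Real.exp (-6 * d)) * ballMass ν R 0) ^ (1 / 2 : ℝ) :=
      mul_le_mul' le_rfl (ENNReal.rpow_le_rpow h2 (by norm_num))
    _ = ENNReal.ofReal (Real.exp (-3 * d)) *
        (ballMass ν R y ^ (1 / 2 : ℝ) * ballMass ν R 0 ^ (1 / 2 : ℝ)) := by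
      rw [ENNReal.mul_rpow_of_nonneg _ _ (by norm_num),
        ENNReal.ofReal_rpow_of_nonneg (Real.exp_nonneg _) (by norm_num), ← Real.exp_mul,
        show (-6 * (d : ℝ)) * (1 / 2) = -3 * d by ring]
      ring
    _ ≤ _ := mul_le_mul' le_rfl h1

lemma lintegral_ballMass_half [IsProbabilityMeasure ν] :
    ∫⁻ y, ballMass ν R ((1 / 2 : ℝ) • y) = 2 ^ d * ∫⁻ y, ballMass ν R y := by
  rw [← lintegral_map (f := ballMass ν R) measurable_ballMass (measurable_const_smul (1 / 2 : ℝ)),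
    Measure.map_addHaar_smul _ (by norm_num), lintegral_smul_measure, finrank_euclideanSpace_fin]
  rw [smul_eq_mul]
  congr 1
  rw [abs_of_pos (by positivity)]
  rw [one_div, inv_pow, inv_inv, ENNReal.ofReal_pow (by norm_num)]
  norm_num

lemma volume_closedBall_eq (z : Euc d) (hR : 0 ≤ R) : volume (Metric.closedBall z R) =
    ENNReal.ofReal (R ^ d) * volume (Metric.closedBall (0 : Euc d) 1) := by
  rw [Measure.addHaar_closedBall' _ _ hR, finrank_euclideanSpace_fin]

lemma lintegral_ballMass [IsProbabilityMeasure ν] (hR : 0 ≤ R) :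
    ∫⁻ y, ballMass ν R y = volume (Metric.closedBall (0 : Euc d) R) := by
  have := setLIntegral_ballMass (ν := ν) (R := R) MeasurableSet.univ
  rw [setLIntegral_univ] at this
  rw [this]
  simp only [univ_inter, volume_closedBall_eq _ hR]
  simp

lemma PrekopaLeindler.setLIntegral_compl_levelSet_le (h : PrekopaLeindler ν) [IsProbabilityMeasure ν]
    (hR : 0 ≤ R) : ∫⁻ y in (levelSet ν R)ᶜ, ballMass ν R y ≤
      ENNReal.ofReal ((1 / 9) ^ d) * volume (Metric.closedBall (0 : Euc d) R) := by
  calc ∫⁻ y in (levelSet ν R)ᶜ, ballMass ν R y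
      ≤ ∫⁻ y in (levelSet ν R)ᶜ, ENNReal.ofReal (Real.exp (-3 * d)) * ballMass ν R ((1 / 2 : ℝ) • y) :=
        setLIntegral_mono' measurableSet_levelSet.compl fun y hy => h.ballMass_le_half hy
    _ ≤ ∫⁻ y, ENNReal.ofReal (Real.exp (-3 * d)) * ballMass ν R ((1 / 2 : ℝ) • y) :=
        setLIntegral_le_lintegral _ _
    _ = ENNReal.ofReal (Real.exp (-3 * d)) * 2 ^ d * volume (Metric.closedBall (0 : Euc d) R) := by
        rw [lintegral_const_mul' _ _ ENNReal.ofReal_ne_top,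
          lintegral_ballMass_half, lintegral_ballMass hR, mul_assoc]
    _ ≤ _ := by
        refine mul_le_mul' ?_ le_rfl
        rw [show (2 : ℝ≥0∞) = ENNReal.ofReal 2 by simp, ← ENNReal.ofReal_pow (by norm_num),
          ← ENNReal.ofReal_mul (Real.exp_nonneg _)]
        refine ENNReal.ofReal_le_ofReal ?_
        rw [show (-3 * (d : ℝ)) = d * (-3) by ring, Real.exp_nat_mul, ← mul_pow]
        refine pow_le_pow_left₀ (by positivity) ?_ d
        rw [Real.exp_neg, show (3 : ℝ) = (3 : ℕ) * 1 by norm_num, Real.exp_nat_mul]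
        have h1 : (18 : ℝ) ≤ Real.exp 1 ^ 3 := by
          have := Real.exp_one_gt_d9
          calc (18 : ℝ) ≤ 2.7 ^ 3 := by norm_num
            _ ≤ _ := pow_le_pow_left₀ (by norm_num) (by linarith) 3
        rw [inv_mul_le_iff₀ (by positivity)]
        linarith

lemma volume_ball_pos (hR : 0 < R) : volume (Metric.closedBall (0 : Euc d) R) ≠ 0 :=
  (Metric.measure_closedBall_pos _ _ hR).ne'

lemma volume_ball_ne_top : volume (Metric.closedBall (0 : Euc d) R) ≠ ∞ :=
  (isCompact_closedBall _ _).measure_ne_top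

lemma PrekopaLeindler.ballMass_zero_ge (h : PrekopaLeindler ν) [IsProbabilityMeasure ν]
    (hsym : ν.map Neg.neg = ν) (hR : 0 < R)
    (hν : ENNReal.ofReal (3 / 4) ≤ ν (Metric.closedBall 0 (2 * R))) :
    ENNReal.ofReal (3 / 4) * volume (Metric.closedBall (0 : Euc d) R) ≤
      ballMass ν R 0 * volume (Metric.closedBall (0 : Euc d) (3 * R)) := by
  calc _ ≤ volume (Metric.closedBall (0 : Euc d) R) * ν (Metric.closedBall 0 (2 * R)) := by
        rw [mul_comm]; exact mul_le_mul' le_rfl hν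
    _ = ∫⁻ z in Metric.closedBall 0 (2 * R), volume (Metric.closedBall (0 : Euc d) R) ∂ν := by
        rw [setLIntegral_const]
    _ ≤ ∫⁻ z in Metric.closedBall 0 (2 * R), volume (Metric.closedBall (0 : Euc d) (3 * R) ∩
          Metric.closedBall z R) ∂ν := by
        refine setLIntegral_mono' Metric.isClosed_closedBall.measurableSet fun z hz => ?_
        rw [inter_eq_right.2 (Metric.closedBall_subset_closedBall' (by
          rw [Metric.mem_closedBall] at hz; linarith)), volume_closedBall_eq z hR.le,
          ← volume_closedBall_eq 0 hR.le]
    _ ≤ ∫⁻ z, volume (Metric.closedBall (0 : Euc d) (3 * R) ∩ Metric.closedBall z R) ∂ν :=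
        setLIntegral_le_lintegral _ _
    _ = ∫⁻ y in Metric.closedBall (0 : Euc d) (3 * R), ballMass ν R y :=
        (setLIntegral_ballMass Metric.isClosed_closedBall.measurableSet).symm
    _ ≤ ∫⁻ y in Metric.closedBall (0 : Euc d) (3 * R), ballMass ν R 0 :=
        lintegral_mono fun y => h.ballMass_le_zero hsym y
    _ = _ := by rw [setLIntegral_const]

lemma PrekopaLeindler.volume_levelSet_le (h : PrekopaLeindler ν) [IsProbabilityMeasure ν]
    (hsym : ν.map Neg.neg = ν) (hR : 0 < R)
    (hν : ENNReal.ofReal (3 / 4) ≤ ν (Metric.closedBall 0 (2 * R))) :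
    volume (levelSet ν R) ≤
      ENNReal.ofReal (4 / 3 * Real.exp (6 * d)) * volume (Metric.closedBall (0 : Euc d) (3 * R)) := by
  have h1 := mul_meas_ge_le_lintegral (μ := (volume : Measure (Euc d)))
    (measurable_ballMass (ν := ν) (R := R)) (ENNReal.ofReal (Real.exp (-6 * d)) * ballMass ν R 0)
  rw [lintegral_ballMass hR.le] at h1
  have h2 := h.ballMass_zero_ge hsym hR hν
  set V := volume (Metric.closedBall (0 : Euc d) R) with hV
  set V3 := volume (Metric.closedBall (0 : Euc d) (3 * R))
  set L := volume (levelSet ν R)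
  have h1' : ENNReal.ofReal (Real.exp (-6 * d)) * ballMass ν R 0 * L ≤ V := h1
  have h3 : V * (ENNReal.ofReal (3 / 4) * ENNReal.ofReal (Real.exp (-6 * d)) * L) ≤ V * V3 := by
    calc _ = ENNReal.ofReal (Real.exp (-6 * d)) * L * (ENNReal.ofReal (3 / 4) * V) := by ring
      _ ≤ ENNReal.ofReal (Real.exp (-6 * d)) * L * (ballMass ν R 0 * V3) := mul_le_mul' le_rfl h2
      _ = (ENNReal.ofReal (Real.exp (-6 * d)) * ballMass ν R 0 * L) * V3 := by ring
      _ ≤ _ := mul_le_mul' h1' le_rfl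
  rw [ENNReal.mul_le_mul_iff_right (volume_ball_pos hR) volume_ball_ne_top] at h3
  have h4 : ENNReal.ofReal (4 / 3 * Real.exp (6 * d)) *
      (ENNReal.ofReal (3 / 4) * ENNReal.ofReal (Real.exp (-6 * d))) = 1 := by
    rw [← ENNReal.ofReal_mul (by norm_num), ← ENNReal.ofReal_mul (by positivity), neg_mul,
      Real.exp_neg]
    rw [show 4 / 3 * Real.exp (6 * d) * (3 / 4 * (Real.exp (6 * d))⁻¹) = 1 by
      have := Real.exp_pos (6 * (d : ℝ)); field_simp]
    simp
  calc L = ENNReal.ofReal (4 / 3 * Real.exp (6 * d)) *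
        (ENNReal.ofReal (3 / 4) * ENNReal.ofReal (Real.exp (-6 * d))) * L := by rw [h4, one_mul]
    _ = ENNReal.ofReal (4 / 3 * Real.exp (6 * d)) *
        (ENNReal.ofReal (3 / 4) * ENNReal.ofReal (Real.exp (-6 * d)) * L) := by ring
    _ ≤ _ := mul_le_mul' le_rfl h3

lemma PrekopaLeindler.moment_le_of_levelSet (h : PrekopaLeindler ν) [IsProbabilityMeasure ν]
    (hd : 0 < d) (hR : 0 < R) {t : Euc d} (ht : ‖t‖ = 1) {r' : ℝ} (hr' : 0 ≤ r')
    (hK : ∀ y ∈ levelSet ν R, |⟪t, y⟫| ≤ r') :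
    ∫⁻ y, ENNReal.ofReal (|⟪t, y⟫| ^ d) ∂ν ≤
      ENNReal.ofReal ((6 * Real.exp 1 * (r' + 2 * R)) ^ d) := by
  have hs : 0 < r' + 2 * R := by positivity
  have hmeas : MeasurableSet {z : Euc d | r' + 2 * R < |⟪t, z⟫|} :=
    measurableSet_lt measurable_const (by fun_prop)
  have h1 : ν {z | r' + 2 * R < |⟪t, z⟫|} ≤ ENNReal.ofReal ((1 / 9) ^ d) := by
    have h2 : volume (Metric.closedBall (0 : Euc d) R) * ν {z | r' + 2 * R < |⟪t, z⟫|} ≤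
        volume (Metric.closedBall (0 : Euc d) R) * ENNReal.ofReal ((1 / 9) ^ d) := by
      calc _ = ∫⁻ z in {z | r' + 2 * R < |⟪t, z⟫|}, volume (Metric.closedBall (0 : Euc d) R) ∂ν := by
            rw [setLIntegral_const]
        _ ≤ ∫⁻ z in {z | r' + 2 * R < |⟪t, z⟫|}, volume ((levelSet ν R)ᶜ ∩ Metric.closedBall z R) ∂ν := by
            refine setLIntegral_mono' hmeas fun z hz => ?_
            have hz' : r' + 2 * R < |⟪t, z⟫| := hz
            have hsub : Metric.closedBall z R ⊆ (levelSet ν R)ᶜ := fun y hy hyK => by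
              have h3 := hK y hyK
              have h4 : |⟪t, z - y⟫| ≤ R := by
                refine (abs_real_inner_le_norm _ _).trans ?_
                rw [ht, one_mul, norm_sub_rev]
                exact mem_closedBall_iff_norm.1 hy
              rw [inner_sub_right] at h4
              have := abs_sub_abs_le_abs_sub ⟪t, z⟫ ⟪t, y⟫
              linarith
            rw [inter_eq_right.2 hsub, volume_closedBall_eq z hR.le, ← volume_closedBall_eq 0 hR.le]
        _ ≤ ∫⁻ z, volume ((levelSet ν R)ᶜ ∩ Metric.closedBall z R) ∂ν := setLIntegral_le_lintegral _ _
        _ = ∫⁻ y in (levelSet ν R)ᶜ, ballMass ν R y :=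
            (setLIntegral_ballMass measurableSet_levelSet.compl).symm
        _ ≤ _ := (h.setLIntegral_compl_levelSet_le hR.le).trans_eq (mul_comm _ _)
    rwa [ENNReal.mul_le_mul_iff_right (volume_ball_pos hR) volume_ball_ne_top] at h2
  have hd1 : ((1 / 9 : ℝ)) ^ d ≤ 1 / 9 := pow_le_of_le_one (by norm_num) (by norm_num) hd.ne'
  have he : 2 * (1 / 9 : ℝ) ^ d * Real.exp d ≤ 2 / 3 := by
    rw [show (d : ℝ) = d * 1 by ring, Real.exp_nat_mul, mul_assoc, ← mul_pow]
    have h5 : 1 / 9 * Real.exp 1 ≤ 1 / 3 := by linarith [Real.exp_one_lt_d9]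
    have h6 : (1 / 9 * Real.exp 1) ^ d ≤ 1 / 3 :=
      (pow_le_of_le_one (by positivity) (by linarith) hd.ne').trans h5
    linarith
  have h2 := h.lintegral_exp_le (innerₗ (Euc d) t) (by fun_prop) hs (by positivity)
    (hd1.trans (by norm_num)) (Nat.cast_nonneg d) he h1
  have h3 : ∀ y : Euc d, ENNReal.ofReal (|⟪t, y⟫| ^ d) ≤ ENNReal.ofReal ((2 * (r' + 2 * R)) ^ d) *
      ENNReal.ofReal (Real.exp (d * (|⟪t, y⟫| / (2 * (r' + 2 * R))))) := fun y => by
    rw [← ENNReal.ofReal_mul (by positivity)]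
    refine ENNReal.ofReal_le_ofReal ?_
    rw [Real.exp_nat_mul, ← mul_pow]
    refine pow_le_pow_left₀ (abs_nonneg _) ?_ d
    have := Real.add_one_le_exp (|⟪t, y⟫| / (2 * (r' + 2 * R)))
    calc |⟪t, y⟫| = 2 * (r' + 2 * R) * (|⟪t, y⟫| / (2 * (r' + 2 * R))) := by field_simp
      _ ≤ _ := mul_le_mul_of_nonneg_left (by linarith) (by positivity)
  calc _ ≤ ∫⁻ y, ENNReal.ofReal ((2 * (r' + 2 * R)) ^ d) *
      ENNReal.ofReal (Real.exp (d * (|⟪t, y⟫| / (2 * (r' + 2 * R))))) ∂ν := lintegral_mono h3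
    _ ≤ ENNReal.ofReal ((2 * (r' + 2 * R)) ^ d) * ENNReal.ofReal (3 * Real.exp d) := by
      rw [lintegral_const_mul _ (by fun_prop)]
      exact mul_le_mul' le_rfl h2
    _ ≤ _ := by
      rw [← ENNReal.ofReal_mul (by positivity)]
      refine ENNReal.ofReal_le_ofReal ?_
      rw [show (d : ℝ) = d * 1 by ring, Real.exp_nat_mul]
      have h3d : (3 : ℝ) ≤ 3 ^ d := le_self_pow₀ (by norm_num) hd.ne'
      calc _ = (2 * (r' + 2 * R) * Real.exp 1) ^ d * 3 := by rw [mul_pow _ (Real.exp 1)]; ring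
        _ ≤ (2 * (r' + 2 * R) * Real.exp 1) ^ d * 3 ^ d := by gcongr
        _ = _ := by rw [← mul_pow]; congr 1; ring

/-- If all one-dimensional marginals of a symmetric log-concave measure on `ℝᵈ` have large moments of
order `d`, then the measure does not concentrate on a small ball. -/
theorem PrekopaLeindler.moment_le_radius (h : PrekopaLeindler ν) [IsProbabilityMeasure ν]
    (hd : 0 < d) (hsym : ν.map Neg.neg = ν) (hR : 0 < R)
    (hν : ENNReal.ofReal (3 / 4) ≤ ν (Metric.closedBall 0 (2 * R))) {r : ℝ} (hr : 0 ≤ r)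
    (hmom : ∀ t : Euc d, ‖t‖ = 1 → ENNReal.ofReal (r ^ d) ≤ ∫⁻ y, ENNReal.ofReal (|⟪t, y⟫| ^ d) ∂ν) :
    r ≤ 6 * Real.exp 1 * (4 * Real.exp 6 + 3) * R := by
  by_contra! hc
  set r' : ℝ := 4 * Real.exp 6 * R with hr'
  have hr'0 : 0 < r' := by positivity
  -- a slightly larger ball
  obtain ⟨r'', hr1, hr2⟩ : ∃ r'', r' < r'' ∧ 6 * Real.exp 1 * (r'' + 2 * R) < r := by
    refine ⟨r' + R, by linarith, lt_of_le_of_lt (le_of_eq ?_) hc⟩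
    rw [hr']; ring
  have hr''0 : 0 < r'' := hr'0.trans hr1
  have hsub : Metric.closedBall (0 : Euc d) r'' ⊆ closure (levelSet ν R) := by
    intro z hz
    by_contra hzK
    obtain ⟨f, u, hf1, hf2⟩ := geometric_hahn_banach_closed_point h.convex_levelSet.closure
      isClosed_closure hzK
    obtain ⟨y₀, hy₀⟩ : ∃ y₀ : Euc d, ∀ x, f x = ⟪y₀, x⟫ :=
      ⟨(InnerProductSpace.toDual ℝ (Euc d)).symm f, fun x =>
        (InnerProductSpace.toDual_symm_apply).symm⟩
    have hle : ∀ y ∈ levelSet ν R, |⟪y₀, y⟫| ≤ ⟪y₀, z⟫ := fun y hy => by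
      have hy' : -y ∈ levelSet ν R := by
        change _ ≤ ballMass ν R (-y); rw [ballMass_neg hsym]; exact hy
      have a1 := hf1 y (subset_closure hy)
      have a2 := hf1 (-y) (subset_closure hy')
      rw [hy₀] at a1 a2 hf2
      rw [inner_neg_right] at a2
      exact abs_le.2 ⟨by linarith, by linarith⟩
    have h0 : (0 : Euc d) ∈ levelSet ν R := by
      change _ ≤ ballMass ν R 0
      refine mul_le_of_le_one_left' ?_
      rw [← ENNReal.ofReal_one]
      exact ENNReal.ofReal_le_ofReal (Real.exp_le_one_iff.2 (by
        have : (0 : ℝ) ≤ d := Nat.cast_nonneg d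
        linarith))
    have hy0 : y₀ ≠ 0 := by
      rintro rfl
      have a1 := hf1 0 (subset_closure h0)
      rw [hy₀] at a1 hf2
      simp only [inner_zero_left] at a1 hf2
      linarith
    have hn : 0 < ‖y₀‖ := norm_pos_iff.2 hy0
    have hm := h.moment_le_of_levelSet hd hR (t := ‖y₀‖⁻¹ • y₀) (by
      rw [norm_smul, norm_inv, norm_norm, inv_mul_cancel₀ hn.ne']) hr''0.le (fun y hy => by
        rw [real_inner_smul_left, abs_mul, abs_of_pos (by positivity), inv_mul_le_iff₀ hn]
        refine (hle y hy).trans ((real_inner_le_norm _ _).trans ?_)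
        exact mul_le_mul_of_nonneg_left (mem_closedBall_zero_iff.1 hz) hn.le)
    have hm2 := (hmom (‖y₀‖⁻¹ • y₀) (by
      rw [norm_smul, norm_inv, norm_norm, inv_mul_cancel₀ hn.ne'])).trans hm
    rw [ENNReal.ofReal_le_ofReal_iff (by positivity), pow_le_pow_iff_left₀ hr (by positivity) hd.ne'] at hm2
    linarith
  have hvol : volume (Metric.closedBall (0 : Euc d) r'') ≤ volume (levelSet ν R) := by
    refine (measure_mono hsub).trans ?_
    rw [closure_eq_self_union_frontier]
    refine (measure_union_le _ _).trans ?_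
    rw [h.convex_levelSet.addHaar_frontier volume, add_zero]
  have h2 := hvol.trans (h.volume_levelSet_le hsym hR hν)
  rw [volume_closedBall_eq 0 hr''0.le, volume_closedBall_eq 0 (by positivity : 0 ≤ 3 * R), ← mul_assoc,
    ENNReal.mul_le_mul_iff_left (volume_ball_pos one_pos) volume_ball_ne_top,
    ← ENNReal.ofReal_mul (by positivity), ENNReal.ofReal_le_ofReal_iff (by positivity),
    show (6 * (d : ℝ)) = d * 6 by ring, Real.exp_nat_mul] at h2
  have h3 : r'' ^ d ≤ r' ^ d := by
    calc r'' ^ d ≤ 4 / 3 * Real.exp 6 ^ d * (3 * R) ^ d := h2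
      _ ≤ (4 / 3) ^ d * Real.exp 6 ^ d * (3 * R) ^ d := by
        gcongr; exact le_self_pow₀ (by norm_num) hd.ne'
      _ = r' ^ d := by rw [← mul_pow, ← mul_pow, hr']; congr 1; ring
  rw [pow_le_pow_iff_left₀ hr''0.le hr'0.le hd.ne'] at h3
  linarith

end volumeBound

section gaussianVectors

open Filter ProbabilityTheory

variable {n d : ℕ}

lemma charFun_gaussMeasure (t : Euc n) :
    charFun (gaussMeasure n 1) t = Complex.exp (-(‖t‖ ^ 2 : ℝ) / 2) := by
  have hA : ∀ w : Euc n, ∫ v : Euc n, Complex.exp (-(1 / 2 : ℂ) * (‖v‖ : ℂ) ^ 2 +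
      Complex.I * (⟪w, v⟫ : ℝ)) = (Real.pi / (1 / 2 : ℂ)) ^ (Module.finrank ℝ (Euc n) / 2 : ℂ) *
        Complex.exp (-(‖w‖ ^ 2 : ℝ) / 2) := fun w => by
    rw [GaussianFourier.integral_cexp_neg_mul_sq_norm_add (by norm_num) Complex.I w, Complex.I_sq]
    congr 2; push_cast; ring
  have h0 : ((∫ x : Euc n, Real.exp (-(1 / 2) * ‖x‖ ^ 2) : ℝ) : ℂ) =
      (Real.pi / (1 / 2 : ℂ)) ^ (Module.finrank ℝ (Euc n) / 2 : ℂ) := by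
    have := hA 0
    simp only [inner_zero_left, Complex.ofReal_zero, mul_zero, add_zero, norm_zero] at this
    rw [← integral_complex_ofReal]
    push_cast
    rw [this]; simp
  have hne : ((∫ x : Euc n, Real.exp (-(1 / 2) * ‖x‖ ^ 2) : ℝ) : ℂ) ≠ 0 :=
    Complex.ofReal_ne_zero.2 (gauss_integral_pos one_pos).ne'
  rw [charFun_apply, gaussMeasure, integral_withDensity_eq_integral_toReal_smul measurable_gaussKernel
    (Eventually.of_forall fun x => ENNReal.ofReal_lt_top)]
  simp only [ENNReal.toReal_ofReal (gaussKernel_pos one_pos _).le]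
  have e : ∀ x : Euc n, gaussKernel n 1 x • Complex.exp ((⟪x, t⟫ : ℝ) * Complex.I) =
      ((∫ x : Euc n, Real.exp (-(1 / 2) * ‖x‖ ^ 2) : ℝ) : ℂ)⁻¹ *
        Complex.exp (-(1 / 2 : ℂ) * (‖x‖ : ℂ) ^ 2 + Complex.I * (⟪t, x⟫ : ℝ)) := fun x => by
    rw [gaussKernel, Complex.real_smul, Complex.exp_add, real_inner_comm]
    push_cast
    rw [mul_comm Complex.I]; ring
  rw [integral_congr_ae (Eventually.of_forall e), integral_const_mul, hA, ← h0, inv_mul_cancel_left₀ hne]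

instance : IsProbabilityMeasure (gaussMeasure n 1) := isProbabilityMeasure_gauss one_pos

lemma map_inner_gaussMeasure {u : Euc n} (hu : ‖u‖ = 1) :
    (gaussMeasure n 1).map (fun x => ⟪u, x⟫) = gaussianReal 0 1 := by
  have hm : Measurable fun x : Euc n => ⟪u, x⟫ := by fun_prop
  have := Measure.isProbabilityMeasure_map (μ := gaussMeasure n 1) hm.aemeasurable
  refine Measure.ext_of_charFun ?_
  ext s
  rw [charFun_apply_real, integral_map hm.aemeasurable (by fun_prop), charFun_gaussianReal]
  have h1 := charFun_gaussMeasure (s • u)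
  rw [charFun_apply] at h1
  simp only [real_inner_smul_right] at h1
  simp only [real_inner_comm] at h1
  push_cast at h1
  rw [h1, norm_smul, hu, mul_one, ← Complex.ofReal_pow, Real.norm_eq_abs, sq_abs]
  congr 1
  simp
  ring

lemma map_sum_gaussMeasure {t : Euc d} (ht : ‖t‖ = 1) :
    (Measure.pi fun _ : Fin d => gaussMeasure n 1).map (fun g => ∑ i, t i • g i) = gaussMeasure n 1 := by
  have hm : Measurable fun g : Fin d → Euc n => ∑ i, t i • g i := by fun_prop
  have := Measure.isProbabilityMeasure_map (μ := Measure.pi fun _ : Fin d => gaussMeasure n 1)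
    hm.aemeasurable
  refine Measure.ext_of_charFun ?_
  ext ξ
  rw [charFun_apply, integral_map hm.aemeasurable (by fun_prop), charFun_gaussMeasure]
  simp_rw [sum_inner, Complex.ofReal_sum, Finset.sum_mul, Complex.exp_sum]
  rw [integral_fintype_prod_eq_prod (𝕜 := ℂ)
    (f := fun i x => Complex.exp (((⟪t i • x, ξ⟫ : ℝ) : ℂ) * Complex.I))]
  have e : ∀ i, ∫ x, Complex.exp (((⟪t i • x, ξ⟫ : ℝ) : ℂ) * Complex.I) ∂gaussMeasure n 1 =
      Complex.exp (-(‖t i • ξ‖ ^ 2 : ℝ) / 2) := fun i => by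
    rw [← charFun_gaussMeasure, charFun_apply]
    simp only [real_inner_smul_left, real_inner_smul_right]
  simp only [e]
  rw [← Complex.exp_sum]
  congr 1
  rw [← Finset.sum_div, Finset.sum_neg_distrib, ← Complex.ofReal_sum]
  congr 3
  simp only [norm_smul, mul_pow, ← Finset.sum_mul]
  rw [← EuclideanSpace.norm_sq_eq, ht]; simp

lemma gaussianReal_moment_ge {p : ℕ} (hp : 0 < p) :
    ENNReal.ofReal ((Real.exp (-4) * Real.sqrt p) ^ p) ≤
      ∫⁻ s, ENNReal.ofReal (|s| ^ p) ∂gaussianReal 0 1 := by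
  have hp1 : (1 : ℝ) ≤ p := by exact_mod_cast hp
  have hs1 : 1 ≤ Real.sqrt p := Real.one_le_sqrt.2 hp1
  have hs2 : Real.sqrt p ^ 2 = p := Real.sq_sqrt (by linarith)
  set S := Icc (Real.sqrt p) (2 * Real.sqrt p)
  have h1 : ENNReal.ofReal (Real.exp (-4 * p)) ≤ gaussianReal 0 1 S := by
    rw [gaussianReal_apply 0 one_ne_zero]
    calc ENNReal.ofReal (Real.exp (-4 * p)) ≤ ENNReal.ofReal (Real.exp (-4 * p)) * volume S := by
          rw [Real.volume_Icc]
          refine le_mul_of_one_le_right' ?_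
          rw [← ENNReal.ofReal_one]
          exact ENNReal.ofReal_le_ofReal (by linarith)
      _ = ∫⁻ x in S, ENNReal.ofReal (Real.exp (-4 * p)) := by rw [setLIntegral_const]
      _ ≤ _ := by
          refine setLIntegral_mono' measurableSet_Icc fun x hx => ENNReal.ofReal_le_ofReal ?_
          rw [gaussianPDFReal]
          simp only [NNReal.coe_one, mul_one, sub_zero]
          have h2 : Real.sqrt (2 * Real.pi) ≤ 3 := by
            rw [show (3 : ℝ) = Real.sqrt 9 by
              rw [show (9 : ℝ) = 3 ^ 2 by norm_num, Real.sqrt_sq (by norm_num)]]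
            exact Real.sqrt_le_sqrt (by linarith [Real.pi_lt_d2])
          have h3 : (3 : ℝ) ≤ Real.exp (2 * p) := by
            have := Real.add_one_le_exp (2 * (p : ℝ)); linarith
          have h4 : x ^ 2 ≤ 4 * p := by
            have : x ^ 2 ≤ (2 * Real.sqrt p) ^ 2 := pow_le_pow_left₀ (by linarith [hx.1]) hx.2 2
            linarith [mul_pow 2 (Real.sqrt p) 2]
          calc Real.exp (-4 * p) = (Real.exp (2 * p))⁻¹ * Real.exp (-2 * p) := by
                rw [← Real.exp_neg, ← Real.exp_add]; ring_nf
            _ ≤ (Real.sqrt (2 * Real.pi))⁻¹ * Real.exp (-x ^ 2 / 2) := by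
                refine mul_le_mul (inv_anti₀ (by positivity) (h2.trans h3)) ?_ (Real.exp_nonneg _)
                  (by positivity)
                exact Real.exp_le_exp.2 (by linarith)
  calc _ = ENNReal.ofReal (Real.sqrt p ^ p) * ENNReal.ofReal (Real.exp (-4 * p)) := by
        rw [← ENNReal.ofReal_mul (by positivity), mul_pow, ← Real.exp_nat_mul]
        congr 1; ring_nf
    _ ≤ ENNReal.ofReal (Real.sqrt p ^ p) * gaussianReal 0 1 S := mul_le_mul' le_rfl h1
    _ = ∫⁻ s in S, ENNReal.ofReal (Real.sqrt p ^ p) ∂gaussianReal 0 1 := by rw [setLIntegral_const]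
    _ ≤ ∫⁻ s in S, ENNReal.ofReal (|s| ^ p) ∂gaussianReal 0 1 := by
        refine setLIntegral_mono' measurableSet_Icc fun x hx => ENNReal.ofReal_le_ofReal ?_
        exact pow_le_pow_left₀ (by positivity) (hx.1.trans (le_abs_self _)) p
    _ ≤ _ := setLIntegral_le_lintegral _ _

lemma gaussMeasure_moment_ge {p : ℕ} (hp : 0 < p) (x : Euc n) :
    ENNReal.ofReal ((Real.exp (-4) * Real.sqrt p * ‖x‖) ^ p) ≤
      ∫⁻ g, ENNReal.ofReal (|⟪g, x⟫| ^ p) ∂gaussMeasure n 1 := by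
  by_cases hx : x = 0
  · simp [hx, hp.ne']
  have hn : 0 < ‖x‖ := norm_pos_iff.2 hx
  have hu : ‖‖x‖⁻¹ • x‖ = 1 := by rw [norm_smul, norm_inv, norm_norm, inv_mul_cancel₀ hn.ne']
  have h1 := gaussianReal_moment_ge hp
  rw [← map_inner_gaussMeasure hu, lintegral_map (by fun_prop) (by fun_prop)] at h1
  calc _ = ENNReal.ofReal (‖x‖ ^ p) * ENNReal.ofReal ((Real.exp (-4) * Real.sqrt p) ^ p) := by
        rw [← ENNReal.ofReal_mul (by positivity), ← mul_pow, mul_comm]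
    _ ≤ ENNReal.ofReal (‖x‖ ^ p) * ∫⁻ g, ENNReal.ofReal (|⟪‖x‖⁻¹ • x, g⟫| ^ p) ∂gaussMeasure n 1 :=
        mul_le_mul' le_rfl h1
    _ = _ := by
        rw [← lintegral_const_mul _ (by fun_prop)]
        refine lintegral_congr fun g => ?_
        rw [← ENNReal.ofReal_mul (by positivity), ← mul_pow, real_inner_smul_left, abs_mul,
          abs_of_pos (by positivity), mul_inv_cancel_left₀ hn.ne', real_inner_comm]

variable {t L : ℝ} {ν : Measure (Euc d)} {f : Euc d → ℝ}

/-- Gaussian concentration of Lipschitz functions. -/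
lemma LC.lipschitz_mgf (ht : 0 < t) (h : LC (fun x => t * ‖x‖ ^ 2) ν) [IsProbabilityMeasure ν]
    (hf : Measurable f) (hL : ∀ x y, |f x - f y| ≤ L * ‖x - y‖) :
    Integrable f ν ∧ ∀ c : ℝ, Integrable (fun x => Real.exp (c * f x)) ν ∧
      ∫ x, Real.exp (c * f x) ∂ν ≤ Real.exp (c * (∫ x, f x ∂ν) + c ^ 2 * L ^ 2 / t) := by
  have hpos : ∀ c : ℝ, (∫⁻ x, ENNReal.ofReal (Real.exp (c * f x)) ∂ν) ≠ 0 := fun c h0 => by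
    rw [lintegral_eq_zero_iff (by fun_prop)] at h0
    obtain ⟨x, hx⟩ := h0.exists
    simp at hx
    exact absurd hx (not_le.2 (Real.exp_pos _))
  have key : ∀ c : ℝ, (∫⁻ x, ENNReal.ofReal (Real.exp (c * f x)) ∂ν) *
      (∫⁻ x, ENNReal.ofReal (Real.exp (-c * f x)) ∂ν) ≤
        ENNReal.ofReal (Real.exp (c ^ 2 * L ^ 2 / t)) := fun c => by
    have := h.lintegral_exp_mul_le ht (f := fun x => c * f x) (by fun_prop) (L := |c| * L)
      fun x y => by
        rw [← mul_sub]
        refine (le_abs_self _).trans ?_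
        rw [abs_mul, mul_assoc]
        exact mul_le_mul_of_nonneg_left (hL x y) (abs_nonneg c)
    simpa only [mul_pow, sq_abs, neg_mul] using this
  have hInt : ∀ c : ℝ, Integrable (fun x => Real.exp (c * f x)) ν := fun c => by
    refine (lintegral_ofReal_ne_top_iff_integrable (by fun_prop)
      (Eventually.of_forall fun x => (Real.exp_pos _).le)).1 fun h0 => ?_
    have := key c
    rw [h0, ENNReal.top_mul (hpos (-c))] at this
    exact absurd this (by simp)
  have hfi : Integrable f ν := by
    refine Integrable.mono' ((hInt 1).add (hInt (-1))) hf.aestronglyMeasurable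
      (Eventually.of_forall fun x => ?_)
    rw [Real.norm_eq_abs]
    simp only [Pi.add_apply, one_mul, neg_mul]
    have h1 := Real.add_one_le_exp (f x)
    have h2 := Real.add_one_le_exp (-f x)
    have h3 := Real.exp_pos (f x)
    have h4 := Real.exp_pos (-f x)
    rw [abs_le]; constructor <;> linarith
  refine ⟨hfi, fun c => ⟨hInt c, ?_⟩⟩
  set w := ∫ x, f x ∂ν
  have hJ : Real.exp (-c * w) ≤ ∫ x, Real.exp (-c * f x) ∂ν := by
    have h1 : ∫ x, Real.exp (-c * w) * (1 + -c * (f x - w)) ∂ν ≤ ∫ x, Real.exp (-c * f x) ∂ν := by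
      refine integral_mono (((integrable_const _).add
        ((hfi.sub (integrable_const _)).const_mul _)).const_mul _) (hInt _) fun x => ?_
      have h2 := Real.add_one_le_exp (-c * (f x - w))
      calc Real.exp (-c * w) * (1 + -c * (f x - w)) ≤
          Real.exp (-c * w) * Real.exp (-c * (f x - w)) :=
            mul_le_mul_of_nonneg_left (by linarith) (Real.exp_nonneg _)
        _ = Real.exp (-c * f x) := by rw [← Real.exp_add]; ring_nf
    have hi : Integrable (fun x => f x - w) ν := hfi.sub (integrable_const _)
    rw [integral_const_mul, integral_add (integrable_const _) (hi.const_mul _), integral_const_mul,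
      integral_sub hfi (integrable_const _)] at h1
    simpa [w] using h1
  have hk := key c
  rw [← ofReal_integral_eq_lintegral_ofReal (hInt c) (Eventually.of_forall fun x => (Real.exp_pos _).le),
    ← ofReal_integral_eq_lintegral_ofReal (hInt (-c))
      (Eventually.of_forall fun x => (Real.exp_pos _).le),
    ← ENNReal.ofReal_mul (integral_nonneg fun x => (Real.exp_pos _).le),
    ENNReal.ofReal_le_ofReal_iff (Real.exp_nonneg _)] at hk
  have h5 : (∫ x, Real.exp (c * f x) ∂ν) * Real.exp (-c * w) ≤ Real.exp (c ^ 2 * L ^ 2 / t) :=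
    (mul_le_mul_of_nonneg_left hJ (integral_nonneg fun x => (Real.exp_pos _).le)).trans hk
  rw [neg_mul, Real.exp_neg, ← div_eq_mul_inv, div_le_iff₀ (Real.exp_pos _), ← Real.exp_add] at h5
  rwa [add_comm]

lemma LC.lipschitz_concentration (ht : 0 < t) (h : LC (fun x => t * ‖x‖ ^ 2) ν)
    [IsProbabilityMeasure ν] (hf : Measurable f) (hL0 : 0 < L)
    (hL : ∀ x y, |f x - f y| ≤ L * ‖x - y‖) {s : ℝ} (hs : 0 ≤ s) :
    ν {x | s ≤ |f x - ∫ y, f y ∂ν|} ≤ ENNReal.ofReal (2 * Real.exp (-(t * s ^ 2 / (4 * L ^ 2)))) := by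
  obtain ⟨hfi, hm⟩ := h.lipschitz_mgf ht hf hL
  set w := ∫ x, f x ∂ν
  have side : ∀ c : ℝ, |c| = t * s / (2 * L ^ 2) →
      ν {x | |c| * s ≤ c * (f x - w)} ≤ ENNReal.ofReal (Real.exp (-(t * s ^ 2 / (4 * L ^ 2)))) := by
    intro c hc
    obtain ⟨hi, hle⟩ := hm c
    have h1 := mul_meas_ge_le_integral_of_nonneg (μ := ν) (f := fun x => Real.exp (c * f x))
      (Eventually.of_forall fun x => (Real.exp_pos _).le) hi (Real.exp (|c| * s + c * w))
    have h2 : ν.real {x | Real.exp (|c| * s + c * w) ≤ Real.exp (c * f x)} ≤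
        Real.exp (-(t * s ^ 2 / (4 * L ^ 2))) := by
      rw [← le_div_iff₀' (Real.exp_pos _)] at h1
      refine h1.trans ?_
      rw [div_le_iff₀ (Real.exp_pos _), ← Real.exp_add]
      refine hle.trans (Real.exp_le_exp.2 (le_of_eq ?_))
      rw [← sq_abs c, hc]
      field_simp
      ring
    have h3 : {x | |c| * s ≤ c * (f x - w)} = {x | Real.exp (|c| * s + c * w) ≤ Real.exp (c * f x)} := by
      ext x
      simp only [mem_ofPred_eq, Real.exp_le_exp]
      constructor <;> intro h4 <;> linarith [mul_sub c (f x) w]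
    rw [h3, ← ofReal_measureReal]
    exact ENNReal.ofReal_le_ofReal h2
  have hc0 : 0 ≤ t * s / (2 * L ^ 2) := by positivity
  have s1 := side (t * s / (2 * L ^ 2)) (abs_of_nonneg hc0)
  have s2 := side (-(t * s / (2 * L ^ 2))) (by rw [abs_neg, abs_of_nonneg hc0])
  rw [two_mul, ENNReal.ofReal_add (Real.exp_nonneg _) (Real.exp_nonneg _)]
  refine (measure_mono (fun x hx => ?_)).trans ((measure_union_le _ _).trans (add_le_add s1 s2))
  have hx' : s ≤ |f x - w| := hx
  rw [abs_of_nonneg hc0, abs_neg, abs_of_nonneg hc0]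
  rcases le_abs.1 hx' with h1 | h1
  · exact Or.inl (mul_le_mul_of_nonneg_left h1 hc0)
  · refine Or.inr ?_
    have := mul_le_mul_of_nonneg_left h1 hc0
    rwa [← neg_mul_comm] at this

end gaussianVectors

section net

open Module

lemma card_le_of_sphere_separated {d : ℕ} (s : Finset (Euc d)) (hs : ∀ c ∈ s, ‖c‖ = 1)
    (h : ∀ c ∈ s, ∀ e ∈ s, c ≠ e → 1 / 8 ≤ ‖c - e‖) : s.card ≤ 17 ^ d := by
  set A := ⋃ c ∈ s, Metric.ball c (1 / 16)
  have hD : (s : Set (Euc d)).Pairwise (Function.onFun Disjoint fun c => Metric.ball c (1 / 16)) := by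
    rintro c hc e he hce
    apply Metric.ball_disjoint_ball
    rw [dist_eq_norm]
    linarith [h c hc e he hce]
  have hA : A ⊆ Metric.ball 0 (17 / 16) := by
    refine iUnion₂_subset fun x hx => Metric.ball_subset_ball' ?_
    rw [dist_zero_right, hs x hx]; norm_num
  set V := volume (Metric.ball (0 : Euc d) 1)
  have hball : ∀ (x : Euc d) {r : ℝ}, 0 < r → volume (Metric.ball x r) = ENNReal.ofReal (r ^ d) * V :=
    fun x r hr => by rw [Measure.addHaar_ball_of_pos _ _ hr, finrank_euclideanSpace_fin]
  have h1 : (s.card : ℝ≥0∞) * ENNReal.ofReal ((1 / 16) ^ d) * V ≤ ENNReal.ofReal ((17 / 16) ^ d) * V := by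
    calc _ = volume A := by
          rw [measure_biUnion_finset hD fun c _ => measurableSet_ball]
          simp only [hball _ (show (0 : ℝ) < 1 / 16 by norm_num)]
          rw [Finset.sum_const, nsmul_eq_mul, mul_assoc]
      _ ≤ volume (Metric.ball (0 : Euc d) (17 / 16)) := measure_mono hA
      _ = _ := hball _ (by norm_num)
  have h2 := (ENNReal.mul_le_mul_iff_left (Metric.measure_ball_pos _ _ zero_lt_one).ne'
    measure_ball_lt_top.ne).1 h1
  have h3 := ENNReal.toReal_le_of_le_ofReal (by positivity) h2
  rw [ENNReal.toReal_mul, ENNReal.toReal_natCast, ENNReal.toReal_ofReal (by positivity)] at h3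
  have h4 : (s.card : ℝ) ≤ 17 ^ d := by
    rw [← le_div_iff₀ (by positivity), ← div_pow] at h3
    norm_num at h3 ⊢
    exact h3
  exact_mod_cast h4

lemma exists_sphere_net (d : ℕ) : ∃ N : Finset (Euc d), N.card ≤ 17 ^ d ∧ (∀ c ∈ N, ‖c‖ = 1) ∧
    ∀ t : Euc d, ‖t‖ = 1 → ∃ c ∈ N, ‖t - c‖ ≤ 1 / 8 := by
  classical
  let Q : ℕ → Prop := fun k => ∃ s : Finset (Euc d), s.card = k ∧ (∀ c ∈ s, ‖c‖ = 1) ∧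
    ∀ c ∈ s, ∀ e ∈ s, c ≠ e → 1 / 8 ≤ ‖c - e‖
  have hQ0 : Q 0 := ⟨∅, by simp⟩
  obtain ⟨s, hs, hs1, hs2⟩ := Nat.findGreatest_spec (P := Q) (Nat.zero_le (17 ^ d)) hQ0
  refine ⟨s, card_le_of_sphere_separated s hs1 hs2, hs1, fun t ht => ?_⟩
  by_contra! hc
  have hts : t ∉ s := fun h => by
    have := hc t h
    rw [sub_self, norm_zero] at this
    linarith
  have hQ : Q (s.card + 1) := by
    refine ⟨insert t s, Finset.card_insert_of_notMem hts, fun c hc' => ?_, fun c hc' e he hce => ?_⟩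
    · rcases Finset.mem_insert.1 hc' with rfl | h
      exacts [ht, hs1 c h]
    · rcases Finset.mem_insert.1 hc' with rfl | h
      · rcases Finset.mem_insert.1 he with rfl | h'
        · exact absurd rfl hce
        · exact (hc e h').le
      · rcases Finset.mem_insert.1 he with rfl | h'
        · rw [norm_sub_rev]; exact (hc c h).le
        · exact hs2 c h e h' hce
  have hle : s.card + 1 ≤ 17 ^ d := by
    obtain ⟨s', h1, h2, h3⟩ := hQ
    exact h1 ▸ card_le_of_sphere_separated s' h2 h3
  exact Nat.findGreatest_is_greatest (P := Q) (by rw [← hs]; exact Nat.lt_succ_self _) hle hQ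

/-- A seminorm which is nearly constant on a net of the sphere is bounded below on the sphere. -/
lemma half_le_of_net {d : ℕ} {N : Euc d → ℝ} (hN : Continuous N)
    (hadd : ∀ x y, N (x + y) ≤ N x + N y) (hsmul : ∀ (c : ℝ) x, N (c • x) = |c| * N x)
    {S : Finset (Euc d)} (hS : ∀ t : Euc d, ‖t‖ = 1 → ∃ c ∈ S, ‖t - c‖ ≤ 1 / 8) {w : ℝ} (hw : 0 ≤ w)
    (hNS : ∀ c ∈ S, |N c - w| ≤ w / 4) (t : Euc d) (ht : ‖t‖ = 1) : w / 2 ≤ N t := by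
  obtain ⟨t₀, ht₀, hmax⟩ := (isCompact_sphere (0 : Euc d) 1).exists_isMaxOn ⟨t, by simpa using ht⟩
    hN.continuousOn
  rw [mem_sphere_zero_iff_norm] at ht₀
  have hM : ∀ x : Euc d, N x ≤ N t₀ * ‖x‖ := fun x => by
    by_cases hx : x = 0
    · have := hsmul 0 x
      simp at this
      simp [hx, this]
    have hn : 0 < ‖x‖ := norm_pos_iff.2 hx
    have h1 := hmax (show ‖x‖⁻¹ • x ∈ Metric.sphere (0 : Euc d) 1 by
      rw [mem_sphere_zero_iff_norm, norm_smul, norm_inv, norm_norm, inv_mul_cancel₀ hn.ne'])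
    have h2 : N (‖x‖⁻¹ • x) ≤ N t₀ := h1
    rw [hsmul, abs_of_pos (by positivity), inv_mul_le_iff₀ hn] at h2
    linarith
  have hnn : 0 ≤ N t₀ := by
    have h1 := hM (-t₀)
    have h2 := hadd t₀ (-t₀)
    have h3 := hsmul 0 t₀
    have h4 := hsmul (-1) t₀
    simp at h2 h3 h4
    linarith
  have hstep : ∀ x : Euc d, ‖x‖ ≤ 1 / 8 → N x ≤ N t₀ / 8 := fun x hx => by
    have := mul_le_mul_of_nonneg_left hx hnn
    linarith [hM x]
  obtain ⟨c₀, hc₀, hc₀'⟩ := hS t₀ ht₀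
  have h1 := hadd c₀ (t₀ - c₀)
  rw [add_sub_cancel] at h1
  have h2 := hstep _ hc₀'
  have h3 := abs_le.1 (hNS c₀ hc₀)
  obtain ⟨c, hc, hc'⟩ := hS t ht
  have h4 := hadd t (c - t)
  rw [add_sub_cancel] at h4
  have h5 := hstep (c - t) (by rwa [norm_sub_rev])
  have h6 := abs_le.1 (hNS c hc)
  linarith [h3.2, h6.1]

end net

section symmetric

open Filter

variable {n p : ℕ} {ν : Measure (Euc n)}

/-- Symmetric log-concave probability measures with bounded covariance. -/
structure SymLC (ν : Measure (Euc n)) : Prop where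
  prob : IsProbabilityMeasure ν
  pl : PrekopaLeindler ν
  symm : ν.map Neg.neg = ν
  second : ∀ θ : Euc n, ∫⁻ x, ENNReal.ofReal (⟪θ, x⟫ ^ 2) ∂ν ≤ ENNReal.ofReal (4 * ‖θ‖ ^ 2)

lemma Iso.lintegral_inner_sq {μ : Measure (Euc n)} (h : Iso μ) (θ : Euc n) :
    ∫⁻ x, ENNReal.ofReal (⟪θ, x⟫ ^ 2) ∂μ = ENNReal.ofReal (‖θ‖ ^ 2) := by
  rw [← ofReal_integral_eq_lintegral_ofReal (by simpa only [pow_two] using h.integrable_mul θ θ)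
    (Eventually.of_forall fun x => sq_nonneg _)]
  simp only [pow_two]
  rw [h.second, real_inner_self_eq_norm_mul_norm]

lemma Iso.symLC {μ : Measure (Euc n)} (h : Iso μ) : SymLC ((μ.prod μ).map fun q => q.1 - q.2) := by
  have hp := h.prob
  have hm : Measurable fun q : Euc n × Euc n => q.1 - q.2 := by fun_prop
  refine ⟨Measure.isProbabilityMeasure_map hm.aemeasurable, ?_, ?_, fun θ => ?_⟩
  · refine (h.lc.prekopaLeindler.prod h.lc.prekopaLeindler).of_measurePreserving
      (fun q => q.1 - q.2) (fun a b x y => ?_) ⟨hm, rfl⟩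
    simp only [Prod.fst_add, Prod.smul_fst, Prod.snd_add, Prod.smul_snd, smul_sub]
    abel
  · rw [Measure.map_map measurable_neg hm]
    conv_rhs => rw [← Measure.prod_swap, Measure.map_map hm measurable_swap]
    congr 1
    ext1 q
    simp
  · rw [lintegral_map (by fun_prop) hm]
    calc _ ≤ ∫⁻ q, (ENNReal.ofReal 2 * ENNReal.ofReal (⟪θ, q.1⟫ ^ 2) +
          ENNReal.ofReal 2 * ENNReal.ofReal (⟪θ, q.2⟫ ^ 2)) ∂μ.prod μ := by
          refine lintegral_mono fun q => ?_
          rw [← ENNReal.ofReal_mul (by norm_num), ← ENNReal.ofReal_mul (by norm_num), ← ENNReal.ofReal_add (by positivity) (by positivity)]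
          refine ENNReal.ofReal_le_ofReal ?_
          rw [inner_sub_right]
          nlinarith [sq_nonneg (⟪θ, q.1⟫ + ⟪θ, q.2⟫)]
      _ = ENNReal.ofReal 2 * ENNReal.ofReal (‖θ‖ ^ 2) + ENNReal.ofReal 2 * ENNReal.ofReal (‖θ‖ ^ 2) := by
          rw [lintegral_add_left (by fun_prop), lintegral_const_mul _ (by fun_prop),
            lintegral_const_mul _ (by fun_prop), lintegral_prod _ (by fun_prop),
            lintegral_prod _ (by fun_prop)]
          simp [h.lintegral_inner_sq]
      _ = _ := by
          rw [← ENNReal.ofReal_mul (by norm_num), ← ENNReal.ofReal_add (by positivity) (by positivity)]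
          congr 1; ring

lemma SymLC.moment_le (h : SymLC ν) (hp : 0 < p) (ξ : Euc n) :
    ∫⁻ x, ENNReal.ofReal (|⟪ξ, x⟫| ^ p) ∂ν ≤ ENNReal.ofReal ((180 * p * ‖ξ‖) ^ p) := by
  have := h.prob
  by_cases hξ : ξ = 0
  · simp [hξ, hp.ne']
  have hn : 0 < ‖ξ‖ := norm_pos_iff.2 hξ
  have htail : ν {x | 10 * ‖ξ‖ < |⟪ξ, x⟫|} ≤ ENNReal.ofReal (1 / 25) := by
    have h1 := mul_meas_ge_le_lintegral (μ := ν) (f := fun x => ENNReal.ofReal (⟪ξ, x⟫ ^ 2))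
      (by fun_prop) (ENNReal.ofReal ((10 * ‖ξ‖) ^ 2))
    have h2 : ENNReal.ofReal ((10 * ‖ξ‖) ^ 2) * ν {x | 10 * ‖ξ‖ < |⟪ξ, x⟫|} ≤
        ENNReal.ofReal ((10 * ‖ξ‖) ^ 2) * ENNReal.ofReal (1 / 25) := by
      rw [← ENNReal.ofReal_mul (by positivity)]
      refine le_trans (mul_le_mul' le_rfl (measure_mono fun x hx => ?_)) (h1.trans ((h.second ξ).trans
        (le_of_eq (by congr 1; ring))))
      have hx' : 10 * ‖ξ‖ < |⟪ξ, x⟫| := hx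
      refine ENNReal.ofReal_le_ofReal ?_
      rw [← sq_abs ⟪ξ, x⟫]
      exact pow_le_pow_left₀ (by positivity) hx'.le 2
    rwa [ENNReal.mul_le_mul_iff_right (by simp [hξ]) ENNReal.ofReal_ne_top] at h2
  have h1 := h.pl.lintegral_exp_le (innerₗ (Euc n) ξ) (by fun_prop) (s := 10 * ‖ξ‖) (by positivity)
    (by norm_num) (by norm_num) zero_le_one (by linarith [Real.exp_one_lt_d9]) htail
  calc _ ≤ ∫⁻ x, ENNReal.ofReal ((20 * ‖ξ‖) ^ p * p.factorial) *
        ENNReal.ofReal (Real.exp (1 * (|⟪ξ, x⟫| / (2 * (10 * ‖ξ‖))))) ∂ν := by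
        refine lintegral_mono fun x => ?_
        rw [← ENNReal.ofReal_mul (by positivity)]
        refine ENNReal.ofReal_le_ofReal ?_
        have h2 := Real.pow_div_factorial_le_exp (|⟪ξ, x⟫| / (2 * (10 * ‖ξ‖))) (by positivity) p
        rw [div_le_iff₀ (by positivity)] at h2
        calc |⟪ξ, x⟫| ^ p = (20 * ‖ξ‖) ^ p * (|⟪ξ, x⟫| / (2 * (10 * ‖ξ‖))) ^ p := by
              rw [← mul_pow]; congr 1; field_simp; ring
          _ ≤ (20 * ‖ξ‖) ^ p * (Real.exp (|⟪ξ, x⟫| / (2 * (10 * ‖ξ‖))) * p.factorial) := by gcongr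
          _ = _ := by rw [one_mul]; ring
    _ ≤ ENNReal.ofReal ((20 * ‖ξ‖) ^ p * p.factorial) * ENNReal.ofReal (3 * Real.exp 1) := by
        rw [lintegral_const_mul _ (by fun_prop)]
        exact mul_le_mul' le_rfl h1
    _ ≤ _ := by
        rw [← ENNReal.ofReal_mul (by positivity)]
        refine ENNReal.ofReal_le_ofReal ?_
        have h3 : (p.factorial : ℝ) ≤ p ^ p := by exact_mod_cast Nat.factorial_le_pow p
        have h4 : 3 * Real.exp 1 ≤ 9 ^ p := by
          have : (9 : ℝ) ≤ 9 ^ p := le_self_pow₀ (by norm_num) hp.ne'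
          linarith [Real.exp_one_lt_d9]
        calc _ ≤ (20 * ‖ξ‖) ^ p * p ^ p * 9 ^ p := by gcongr
          _ = _ := by rw [← mul_pow, ← mul_pow]; congr 1; ring

/-- The `L^p` norm of the linear functional `⟨ξ, ·⟩`. -/
def momNorm (ν : Measure (Euc n)) (p : ℕ) (ξ : Euc n) : ℝ :=
  (eLpNorm' (fun x => ⟪ξ, x⟫) p ν).toReal

lemma eLpNorm'_inner_pow (hp : 0 < p) (ξ : Euc n) : eLpNorm' (fun x => ⟪ξ, x⟫) p ν ^ p =
    ∫⁻ x, ENNReal.ofReal (|⟪ξ, x⟫| ^ p) ∂ν := by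
  have hp' : (p : ℝ) ≠ 0 := by exact_mod_cast hp.ne'
  rw [eLpNorm', ← ENNReal.rpow_natCast, ← ENNReal.rpow_mul, one_div, inv_mul_cancel₀ hp',
    ENNReal.rpow_one]
  refine lintegral_congr fun x => ?_
  rw [ENNReal.rpow_natCast, Real.enorm_eq_ofReal_abs, ENNReal.ofReal_pow (abs_nonneg _)]

lemma SymLC.eLpNorm'_ne_top (h : SymLC ν) (hp : 0 < p) (ξ : Euc n) :
    eLpNorm' (fun x => ⟪ξ, x⟫) p ν ≠ ∞ := fun h0 => by
  have h1 := h.moment_le hp ξ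
  rw [← eLpNorm'_inner_pow hp, h0, ENNReal.top_pow hp.ne'] at h1
  exact absurd h1 (by simp)

lemma momNorm_nonneg (ξ : Euc n) : 0 ≤ momNorm ν p ξ := ENNReal.toReal_nonneg

lemma SymLC.ofReal_momNorm_pow (h : SymLC ν) (hp : 0 < p) (ξ : Euc n) :
    ENNReal.ofReal (momNorm ν p ξ ^ p) = ∫⁻ x, ENNReal.ofReal (|⟪ξ, x⟫| ^ p) ∂ν := by
  rw [← eLpNorm'_inner_pow hp, ENNReal.ofReal_pow (momNorm_nonneg _), momNorm,
    ENNReal.ofReal_toReal (h.eLpNorm'_ne_top hp ξ)]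

lemma SymLC.momNorm_le (h : SymLC ν) (hp : 0 < p) (ξ : Euc n) :
    momNorm ν p ξ ≤ 180 * p * ‖ξ‖ := by
  have h1 := h.moment_le hp ξ
  rw [← h.ofReal_momNorm_pow hp, ENNReal.ofReal_le_ofReal_iff (by positivity),
    pow_le_pow_iff_left₀ (momNorm_nonneg _) (by positivity) hp.ne'] at h1
  exact h1

lemma SymLC.momNorm_add_le (h : SymLC ν) (hp : 0 < p) (ξ η : Euc n) :
    momNorm ν p (ξ + η) ≤ momNorm ν p ξ + momNorm ν p η := by
  rw [momNorm, momNorm, momNorm, ← ENNReal.toReal_add (h.eLpNorm'_ne_top hp ξ) (h.eLpNorm'_ne_top hp η)]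
  refine ENNReal.toReal_mono (ENNReal.add_ne_top.2 ⟨h.eLpNorm'_ne_top hp ξ, h.eLpNorm'_ne_top hp η⟩) ?_
  have := eLpNorm'_add_le (μ := ν) (f := fun x => ⟪ξ, x⟫) (g := fun x => ⟪η, x⟫) (q := p)
    (by fun_prop) (by fun_prop) (by exact_mod_cast hp)
  refine le_trans (le_of_eq ?_) this
  congr 1
  ext x
  simp [inner_add_left]

lemma SymLC.momNorm_smul (h : SymLC ν) (hp : 0 < p) (c : ℝ) (ξ : Euc n) :
    momNorm ν p (c • ξ) = |c| * momNorm ν p ξ := by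
  have h1 := h.ofReal_momNorm_pow hp (c • ξ)
  simp only [real_inner_smul_left, abs_mul, mul_pow] at h1
  simp only [ENNReal.ofReal_mul (pow_nonneg (abs_nonneg c) p)] at h1
  rw [lintegral_const_mul _ (by fun_prop), ← h.ofReal_momNorm_pow hp, ← ENNReal.ofReal_mul (by positivity),
    ENNReal.ofReal_eq_ofReal_iff (pow_nonneg (momNorm_nonneg _) _)
      (mul_nonneg (by positivity) (pow_nonneg (momNorm_nonneg _) _)), ← mul_pow] at h1
  exact (pow_left_inj₀ (momNorm_nonneg _) (mul_nonneg (abs_nonneg c) (momNorm_nonneg _)) hp.ne').1 h1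

lemma SymLC.momNorm_lipschitz (h : SymLC ν) (hp : 0 < p) (ξ η : Euc n) :
    |momNorm ν p ξ - momNorm ν p η| ≤ 180 * p * ‖ξ - η‖ := by
  have h1 := h.momNorm_add_le hp η (ξ - η)
  have h2 := h.momNorm_add_le hp ξ (η - ξ)
  have h3 := h.momNorm_le hp (ξ - η)
  have h4 := h.momNorm_le hp (η - ξ)
  rw [add_sub_cancel] at h1 h2
  rw [norm_sub_rev] at h4
  rw [abs_le]; constructor <;> linarith

lemma SymLC.continuous_momNorm (h : SymLC ν) (hp : 0 < p) : Continuous (momNorm ν p) := by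
  have : LipschitzWith (180 * p : NNReal) (momNorm ν p) := LipschitzWith.of_dist_le_mul fun x y => by
    rw [Real.dist_eq, dist_eq_norm]
    simpa using h.momNorm_lipschitz hp x y
  exact this.continuous

end symmetric

section paouris

open Filter

variable {n p : ℕ} {ν : Measure (Euc n)}

/-- The linear map whose coordinates are the functionals `⟨g i, ·⟩`. -/
def rowMap (g : Fin p → Euc n) (x : Euc n) : Euc p := WithLp.toLp 2 fun i => ⟪g i, x⟫

lemma measurable_rowMap (g : Fin p → Euc n) : Measurable (rowMap g) :=
  (PiLp.continuous_toLp 2 _).measurable.comp (by fun_prop)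

lemma inner_rowMap (g : Fin p → Euc n) (t : Euc p) (x : Euc n) :
    ⟪t, rowMap g x⟫ = ⟪∑ i, t i • g i, x⟫ := by
  rw [PiLp.inner_apply, sum_inner]
  simp [rowMap, real_inner_smul_left, mul_comm]

lemma SymLC.rowMap_moment_le (h : SymLC ν) (hn : 0 < n) (hp : 0 < p) (g : Fin p → Euc n)
    (hg : ∑ i, ‖g i‖ ^ 2 ≤ 48 * (p * n)) {r : ℝ} (hr : 0 ≤ r)
    (hmom : ∀ t : Euc p, ‖t‖ = 1 → r ≤ momNorm ν p (∑ i, t i • g i)) :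
    r ≤ 6 * Real.exp 1 * (4 * Real.exp 6 + 3) * Real.sqrt (192 * (p * n)) := by
  have hprob := h.prob
  have hm := measurable_rowMap g
  have hprob' : IsProbabilityMeasure (ν.map (rowMap g)) := Measure.isProbabilityMeasure_map hm.aemeasurable
  have hpn : (0 : ℝ) < 192 * (p * n) := by positivity
  have hR := Real.sqrt_pos.2 hpn
  set R := Real.sqrt (192 * (p * n))
  have hR2 : R ^ 2 = 192 * (p * n) := Real.sq_sqrt hpn.le
  refine PrekopaLeindler.moment_le_radius (ν := ν.map (rowMap g)) ?_ hp ?_ hR ?_ hr fun t ht => ?_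
  · refine h.pl.of_measurePreserving (rowMap g) (fun a b x y => ?_) ⟨hm, rfl⟩
    ext i
    simp [rowMap, inner_add_right, real_inner_smul_right]
  · conv_rhs => rw [← h.symm]
    rw [Measure.map_map measurable_neg hm, Measure.map_map hm measurable_neg]
    congr 1
    ext x i
    simp [rowMap]
  · have hsq : ∫⁻ x, ENNReal.ofReal (‖rowMap g x‖ ^ 2) ∂ν ≤ ENNReal.ofReal (R ^ 2) := by
      have e : ∀ x, ENNReal.ofReal (‖rowMap g x‖ ^ 2) = ∑ i, ENNReal.ofReal (⟪g i, x⟫ ^ 2) := fun x => by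
        rw [EuclideanSpace.norm_sq_eq, ← ENNReal.ofReal_sum_of_nonneg fun i _ => sq_nonneg _]
        simp [rowMap]
      simp only [e]
      rw [lintegral_finsetSum _ fun i _ => by fun_prop]
      refine (Finset.sum_le_sum fun i _ => h.second (g i)).trans ?_
      rw [← ENNReal.ofReal_sum_of_nonneg fun i _ => by positivity, ← Finset.mul_sum]
      exact ENNReal.ofReal_le_ofReal (by linarith)
    have h1 := mul_meas_ge_le_lintegral (μ := ν) (f := fun x => ENNReal.ofReal (‖rowMap g x‖ ^ 2))
      (hm.norm.pow_const 2).ennreal_ofReal (ENNReal.ofReal ((2 * R) ^ 2))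
    have h2 : ν {x | 2 * R < ‖rowMap g x‖} ≤ ENNReal.ofReal (1 / 4) := by
      have h3 : ENNReal.ofReal ((2 * R) ^ 2) * ν {x | 2 * R < ‖rowMap g x‖} ≤
          ENNReal.ofReal ((2 * R) ^ 2) * ENNReal.ofReal (1 / 4) := by
        rw [← ENNReal.ofReal_mul (by positivity)]
        refine le_trans (mul_le_mul' le_rfl (measure_mono fun x hx => ?_)) (h1.trans (hsq.trans
          (le_of_eq (by congr 1; ring))))
        have hx' : 2 * R < ‖rowMap g x‖ := hx
        exact ENNReal.ofReal_le_ofReal (pow_le_pow_left₀ (by positivity) hx'.le 2)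
      rwa [ENNReal.mul_le_mul_iff_right (by simp [hR.ne']) ENNReal.ofReal_ne_top] at h3
    have hms : MeasurableSet {x | 2 * R < ‖rowMap g x‖} := measurableSet_lt measurable_const hm.norm
    rw [Measure.map_apply hm Metric.isClosed_closedBall.measurableSet]
    have e : rowMap g ⁻¹' Metric.closedBall 0 (2 * R) = {x | 2 * R < ‖rowMap g x‖}ᶜ := by
      ext x; simp
    rw [e, prob_compl_eq_one_sub hms, show (3 / 4 : ℝ) = 1 - 1 / 4 by norm_num,
      ENNReal.ofReal_sub _ (by norm_num), ENNReal.ofReal_one]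
    exact tsub_le_tsub_left h2 _
  · rw [lintegral_map (by fun_prop) hm]
    simp only [inner_rowMap]
    rw [← h.ofReal_momNorm_pow hp]
    exact ENNReal.ofReal_le_ofReal (pow_le_pow_left₀ hr (hmom t ht) p)

lemma lintegral_norm_sq_gaussMeasure :
    ∫⁻ x, ENNReal.ofReal (‖x‖ ^ 2) ∂gaussMeasure n 1 ≤ ENNReal.ofReal (12 * n) := by
  have hLC := lc_gaussMeasure (d := n) one_pos
  have hi : ∀ i : Fin n, Integrable (fun x : Euc n => ⟪stdE i, x⟫ * ⟪stdE i, x⟫) (gaussMeasure n 1) :=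
    fun i => by
      have := hLC.memLp_inner one_pos (stdE i) 2
      rw [ENNReal.coe_ofNat] at this
      exact this.integrable_mul this
  have hInt : Integrable (fun x => ‖x‖ ^ 2) (gaussMeasure n 1) := by
    simp only [norm_sq_eq_sum_inner]
    exact integrable_finsetSum _ fun i _ => hi i
  rw [← ofReal_integral_eq_lintegral_ofReal hInt (Eventually.of_forall fun x => sq_nonneg _)]
  refine ENNReal.ofReal_le_ofReal ?_
  simp only [norm_sq_eq_sum_inner]
  rw [integral_finsetSum _ fun i _ => hi i]
  calc _ ≤ ∑ i : Fin n, (12 : ℝ) := Finset.sum_le_sum fun i _ => by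
        have := hLC.integral_inner_sq_le one_pos 0 (fun θ => by simpa using integral_inner_gauss θ) (stdE i)
        simpa [pow_two] using this
    _ = 12 * n := by simp [mul_comm]

lemma measure_pi_gauss_norm_le (hn : 0 < n) (hp : 0 < p) :
    (Measure.pi fun _ : Fin p => gaussMeasure n 1) {g | 48 * (p * n : ℝ) < ∑ i, ‖g i‖ ^ 2} ≤
      ENNReal.ofReal (1 / 4) := by
  set P := Measure.pi fun _ : Fin p => gaussMeasure n 1
  have hpn : (0 : ℝ) < 48 * (p * n) := by positivity
  have h0 : ∫⁻ g, ENNReal.ofReal (∑ i, ‖g i‖ ^ 2) ∂P ≤ ENNReal.ofReal (12 * (p * n)) := by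
    simp only [ENNReal.ofReal_sum_of_nonneg fun i _ => sq_nonneg _]
    rw [lintegral_finsetSum _ fun i _ => by fun_prop]
    calc _ ≤ ∑ i : Fin p, ENNReal.ofReal (12 * n) := Finset.sum_le_sum fun i _ => by
          have := (measurePreserving_eval (fun _ : Fin p => gaussMeasure n 1) i).lintegral_comp
            (f := fun x : Euc n => ENNReal.ofReal (‖x‖ ^ 2)) (by fun_prop)
          exact this.trans_le lintegral_norm_sq_gaussMeasure
      _ = _ := by
          rw [Finset.sum_const, Finset.card_univ, Fintype.card_fin, nsmul_eq_mul,
            ← ENNReal.ofReal_natCast, ← ENNReal.ofReal_mul (by positivity)]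
          congr 1; ring
  have h1 := mul_meas_ge_le_lintegral (μ := P) (f := fun g => ENNReal.ofReal (∑ i, ‖g i‖ ^ 2))
    (by fun_prop) (ENNReal.ofReal (48 * (p * n)))
  have h3 : ENNReal.ofReal (48 * (p * n)) * P {g | 48 * (p * n : ℝ) < ∑ i, ‖g i‖ ^ 2} ≤
      ENNReal.ofReal (48 * (p * n)) * ENNReal.ofReal (1 / 4) := by
    rw [← ENNReal.ofReal_mul (by positivity)]
    refine le_trans (mul_le_mul' le_rfl (measure_mono fun x hx => ?_)) (h1.trans (h0.trans
      (le_of_eq (by congr 1; ring))))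
    exact ENNReal.ofReal_le_ofReal (le_of_lt hx)
  rwa [ENNReal.mul_le_mul_iff_right (by simp [hn.ne', hp.ne']) ENNReal.ofReal_ne_top] at h3

/-- The Gaussian mean of the moment norm of order `p`, of the order of `√n`, is controlled. -/
lemma SymLC.mean_momNorm_le (h : SymLC ν) (hn : 0 < n) (hp : 0 < p) :
    ∫ g, momNorm ν p g ∂gaussMeasure n 1 ≤ 18 * (180 * p) * Real.sqrt p +
      2 * (6 * Real.exp 1 * (4 * Real.exp 6 + 3)) * Real.sqrt (192 * (p * n)) := by
  set w := ∫ g, momNorm ν p g ∂gaussMeasure n 1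
  set L : ℝ := 180 * p with hLdef
  have hp1 : (1 : ℝ) ≤ p := by exact_mod_cast hp
  have hL : 0 < L := by positivity
  have hw : 0 ≤ w := integral_nonneg fun g => momNorm_nonneg _
  have hR0 : 0 ≤ 2 * (6 * Real.exp 1 * (4 * Real.exp 6 + 3)) * Real.sqrt (192 * (p * n)) := by positivity
  by_cases hwL : w ≤ 18 * L * Real.sqrt p
  · linarith
  push Not at hwL
  obtain ⟨S, hScard, hS1, hS⟩ := exists_sphere_net p
  set P := Measure.pi fun _ : Fin p => gaussMeasure n 1
  have hcont := h.continuous_momNorm hp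
  have hbad : ∀ t ∈ S, P {g | w / 4 ≤ |momNorm ν p (∑ i, t i • g i) - w|} ≤
      ENNReal.ofReal (2 * Real.exp (-5 * p)) := fun t ht => by
    have h1 := (lc_gaussMeasure (d := n) one_pos).lipschitz_concentration one_pos hcont.measurable hL
      (h.momNorm_lipschitz hp) (s := w / 4) (by positivity)
    have hms : MeasurableSet {x : Euc n | w / 4 ≤ |momNorm ν p x - w|} :=
      measurableSet_le measurable_const (hcont.measurable.sub_const w).abs
    rw [← map_sum_gaussMeasure (hS1 t ht), Measure.map_apply (by fun_prop) (by
      rw [map_sum_gaussMeasure (hS1 t ht)]; exact hms)] at h1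
    rw [map_sum_gaussMeasure (hS1 t ht)] at h1
    refine h1.trans (ENNReal.ofReal_le_ofReal ?_)
    refine mul_le_mul_of_nonneg_left (Real.exp_le_exp.2 ?_) (by norm_num)
    have h2 : (18 * L * Real.sqrt p) ^ 2 ≤ w ^ 2 := pow_le_pow_left₀ (by positivity) hwL.le 2
    rw [mul_pow, mul_pow, Real.sq_sqrt (by linarith)] at h2
    have h3 : 5 * p ≤ 1 * (w / 4) ^ 2 / (4 * L ^ 2) := by
      rw [le_div_iff₀ (by positivity)]
      have : 0 ≤ L ^ 2 * p := by positivity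
      linarith
    linarith
  have hunion : P ((⋃ t ∈ S, {g | w / 4 ≤ |momNorm ν p (∑ i, t i • g i) - w|}) ∪
      {g | 48 * (p * n : ℝ) < ∑ i, ‖g i‖ ^ 2}) < 1 := by
    calc _ ≤ (∑ t ∈ S, P {g | w / 4 ≤ |momNorm ν p (∑ i, t i • g i) - w|}) +
          P {g | 48 * (p * n : ℝ) < ∑ i, ‖g i‖ ^ 2} :=
          (measure_union_le _ _).trans (add_le_add (measure_biUnion_finset_le _ _) le_rfl)
      _ ≤ (∑ t ∈ S, ENNReal.ofReal (2 * Real.exp (-5 * p))) + ENNReal.ofReal (1 / 4) :=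
          add_le_add (Finset.sum_le_sum hbad) (measure_pi_gauss_norm_le hn hp)
      _ ≤ ENNReal.ofReal (17 ^ p * (2 * Real.exp (-5 * p))) + ENNReal.ofReal (1 / 4) := by
          refine add_le_add ?_ le_rfl
          rw [Finset.sum_const, nsmul_eq_mul, ← ENNReal.ofReal_natCast,
            ← ENNReal.ofReal_mul (by positivity)]
          refine ENNReal.ofReal_le_ofReal (mul_le_mul_of_nonneg_right ?_ (by positivity))
          exact_mod_cast hScard
      _ < 1 := by
          rw [← ENNReal.ofReal_add (by positivity) (by norm_num), ← ENNReal.ofReal_one,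
            ENNReal.ofReal_lt_ofReal_iff one_pos]
          have h5 : Real.exp (-5 * p) = (Real.exp (-5)) ^ p := by rw [← Real.exp_nat_mul]; ring_nf
          have h6 : 17 * Real.exp (-5) ≤ 1 / 4 := by
            rw [Real.exp_neg, show (5 : ℝ) = (5 : ℕ) * 1 by norm_num, Real.exp_nat_mul]
            have : (68 : ℝ) ≤ Real.exp 1 ^ 5 := by
              calc (68 : ℝ) ≤ 2.7 ^ 5 := by norm_num
                _ ≤ _ := pow_le_pow_left₀ (by norm_num) (by linarith [Real.exp_one_gt_d9]) 5
            rw [← div_eq_mul_inv, div_le_iff₀ (by positivity)]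
            linarith
          have h7 : (17 * Real.exp (-5)) ^ p ≤ 1 / 4 :=
            (pow_le_of_le_one (by positivity) (by linarith) hp.ne').trans h6
          rw [h5]
          rw [mul_pow] at h7
          linarith
  obtain ⟨g, hg⟩ : ∃ g : Fin p → Euc n, g ∉ (⋃ t ∈ S, {g | w / 4 ≤ |momNorm ν p (∑ i, t i • g i) - w|}) ∪
      {g | 48 * (p * n : ℝ) < ∑ i, ‖g i‖ ^ 2} := by
    by_contra! hc
    rw [eq_univ_of_forall hc, measure_univ] at hunion
    exact lt_irrefl _ hunion
  rw [mem_union, not_or] at hg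
  simp only [mem_iUnion, not_exists] at hg
  have hnet : ∀ t ∈ S, |momNorm ν p (∑ i, t i • g i) - w| ≤ w / 4 := fun t ht =>
    (not_le.1 (hg.1 t ht)).le
  have hlow := half_le_of_net (N := fun t => momNorm ν p (∑ i, t i • g i))
    (hcont.comp (by fun_prop))
    (fun x y => by
      simp only [PiLp.add_apply, add_smul, Finset.sum_add_distrib]
      exact h.momNorm_add_le hp _ _)
    (fun c x => by
      simp only [PiLp.smul_apply, smul_eq_mul, mul_smul, ← Finset.smul_sum]
      exact h.momNorm_smul hp _ _) hS hw hnet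
  have := h.rowMap_moment_le hn hp g (not_lt.1 hg.2) (r := w / 2) (by positivity) hlow
  have h8 : 0 ≤ 18 * L * Real.sqrt p := by positivity
  linarith

/-- The large deviation inequality for the norm of a symmetric log-concave vector. -/
theorem exists_symLC_tail : ∃ A : ℝ, 0 < A ∧ ∀ (n p : ℕ) (ν : Measure (Euc n)), SymLC ν → 0 < n →
    n ≤ p ^ 2 → ν {x | A * p ≤ ‖x‖} ≤ ENNReal.ofReal (Real.exp (-3 * p)) := by
  set K : ℝ := 18 + 2 * (6 * Real.exp 1 * (4 * Real.exp 6 + 3)) with hK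
  refine ⟨180 * Real.exp (8 + K), by positivity, fun n p ν h hn hnp => ?_⟩
  have hprob := h.prob
  have hp : 0 < p := Nat.pos_of_ne_zero (by rintro rfl; simp at hnp; omega)
  have hp0 : (0 : ℝ) < p := by exact_mod_cast hp
  set s := Real.sqrt p with hs
  have hs0 : 0 < s := Real.sqrt_pos.2 hp0
  have hs2 : s ^ 2 = p := Real.sq_sqrt hp0.le
  set L : ℝ := 180 * p with hL
  have hL0 : 0 < L := by positivity
  set w := ∫ g, momNorm ν p g ∂gaussMeasure n 1
  have hw : w ≤ K * (L * s) := by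
    have h1 := h.mean_momNorm_le hn hp
    have h2 : Real.sqrt (192 * (p * n)) ≤ L * s := by
      refine Real.sqrt_le_iff.2 ⟨by positivity, ?_⟩
      have h3 : (n : ℝ) ≤ p ^ 2 := by exact_mod_cast hnp
      rw [mul_pow, hs2, hL, mul_pow]
      have h4 : (p : ℝ) * n ≤ p * p ^ 2 := mul_le_mul_of_nonneg_left h3 hp0.le
      have h5 : (0 : ℝ) ≤ p * p ^ 2 := by positivity
      linarith
    have h3 := mul_le_mul_of_nonneg_left h2
      (by positivity : 0 ≤ 2 * (6 * Real.exp 1 * (4 * Real.exp 6 + 3)))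
    calc w ≤ _ := h1
      _ ≤ 18 * L * s + 2 * (6 * Real.exp 1 * (4 * Real.exp 6 + 3)) * (L * s) := by linarith
      _ = _ := by rw [hK]; ring
  obtain ⟨-, hmgf⟩ := (lc_gaussMeasure (d := n) one_pos).lipschitz_mgf one_pos
    (h.continuous_momNorm hp).measurable (h.momNorm_lipschitz hp)
  obtain ⟨hi, hle⟩ := hmgf (s / L)
  have hup : ∫⁻ g, ENNReal.ofReal (momNorm ν p g ^ p) ∂gaussMeasure n 1 ≤
      ENNReal.ofReal ((L * s * Real.exp (K + 1)) ^ p) := by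
    calc _ ≤ ∫⁻ g, ENNReal.ofReal ((L * s) ^ p) * ENNReal.ofReal (Real.exp (s / L * momNorm ν p g))
          ∂gaussMeasure n 1 := by
          refine lintegral_mono fun g => ?_
          rw [← ENNReal.ofReal_mul (by positivity)]
          refine ENNReal.ofReal_le_ofReal ?_
          have e : s / L * momNorm ν p g = p * (momNorm ν p g / (L * s)) := by
            rw [← hs2]; field_simp
          rw [e, Real.exp_nat_mul, ← mul_pow]
          refine pow_le_pow_left₀ (momNorm_nonneg _) ?_ p
          have := Real.add_one_le_exp (momNorm ν p g / (L * s))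
          calc momNorm ν p g = L * s * (momNorm ν p g / (L * s)) := by field_simp
            _ ≤ _ := mul_le_mul_of_nonneg_left (by linarith) (by positivity)
      _ = ENNReal.ofReal ((L * s) ^ p) *
          ENNReal.ofReal (∫ g, Real.exp (s / L * momNorm ν p g) ∂gaussMeasure n 1) := by
          rw [lintegral_const_mul' _ _ ENNReal.ofReal_ne_top, ← ofReal_integral_eq_lintegral_ofReal hi
            (Eventually.of_forall fun x => (Real.exp_pos _).le)]
      _ ≤ _ := by
          rw [← ENNReal.ofReal_mul (by positivity)]
          refine ENNReal.ofReal_le_ofReal ?_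
          rw [mul_pow _ (Real.exp (K + 1)), ← Real.exp_nat_mul]
          refine mul_le_mul_of_nonneg_left (hle.trans (Real.exp_le_exp.2 ?_)) (by positivity)
          have e1 : (s / L) ^ 2 * L ^ 2 / 1 = p := by rw [← hs2]; field_simp
          have e2 : s / L * w ≤ s / L * (K * (L * s)) := mul_le_mul_of_nonneg_left hw (by positivity)
          have e3 : s / L * (K * (L * s)) = p * K := by rw [← hs2]; field_simp
          rw [hL] at e1
          rw [e1]
          linarith
  have hlow : ∫⁻ x, ENNReal.ofReal ((Real.exp (-4) * s * ‖x‖) ^ p) ∂ν ≤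
      ∫⁻ g, ENNReal.ofReal (momNorm ν p g ^ p) ∂gaussMeasure n 1 := by
    simp only [h.ofReal_momNorm_pow hp]
    rw [lintegral_lintegral_swap (by fun_prop)]
    exact lintegral_mono fun x => gaussMeasure_moment_ge hp x
  have h1 := (mul_meas_ge_le_lintegral (μ := ν)
    (f := fun x => ENNReal.ofReal ((Real.exp (-4) * s * ‖x‖) ^ p)) (by fun_prop)
    (ENNReal.ofReal ((L * s * Real.exp (K + 4)) ^ p))).trans (hlow.trans hup)
  have h2 : ENNReal.ofReal ((L * s * Real.exp (K + 4)) ^ p) *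
      ν {x | 180 * Real.exp (8 + K) * p ≤ ‖x‖} ≤ ENNReal.ofReal ((L * s * Real.exp (K + 4)) ^ p) *
        ENNReal.ofReal (Real.exp (-3 * p)) := by
    refine le_trans (mul_le_mul' le_rfl (measure_mono fun x hx => ?_)) (h1.trans (le_of_eq ?_))
    · refine ENNReal.ofReal_le_ofReal (pow_le_pow_left₀ (by positivity) ?_ p)
      have hx' : 180 * Real.exp (8 + K) * p ≤ ‖x‖ := hx
      calc L * s * Real.exp (K + 4) = Real.exp (-4) * s * (180 * Real.exp (8 + K) * p) := by
            rw [show K + 4 = -4 + (8 + K) by ring, Real.exp_add]; ring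
        _ ≤ _ := mul_le_mul_of_nonneg_left hx' (by positivity)
    · rw [← ENNReal.ofReal_mul (by positivity)]
      congr 1
      rw [show (-3 * (p : ℝ)) = p * (-3) by ring, Real.exp_nat_mul, ← mul_pow]
      congr 1
      rw [mul_assoc (L * s), ← Real.exp_add]
      ring_nf
  rwa [ENNReal.mul_le_mul_iff_right (by
    have : 0 < (L * s * Real.exp (K + 4)) ^ p := by positivity
    simpa using this) ENNReal.ofReal_ne_top] at h2

/-- The large deviation inequality for the norm of an isotropic log-concave vector. -/
theorem exists_norm_tail : ∃ A : ℝ, 0 < A ∧ ∀ (n : ℕ) (μ : Measure (Euc n)), Iso μ → 0 < n →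
    μ {x | A * Real.sqrt n < ‖x‖} ≤ ENNReal.ofReal (Real.exp (-2 * Real.sqrt n)) := by
  obtain ⟨A, hA, hmain⟩ := exists_symLC_tail
  refine ⟨2 * A + 2, by positivity, fun n μ h hn => ?_⟩
  have hprob := h.prob
  set s := Real.sqrt n with hs
  have hn1 : (1 : ℝ) ≤ n := by exact_mod_cast hn
  have hs1 : 1 ≤ s := Real.one_le_sqrt.2 hn1
  have hs2 : s ^ 2 = n := Real.sq_sqrt (by linarith)
  set p := ⌈s⌉₊ with hp
  have hps : s ≤ p := Nat.le_ceil s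
  have hp2 : (p : ℝ) ≤ 2 * s := by
    have := Nat.ceil_lt_add_one (by linarith : 0 ≤ s); linarith
  have hnp : n ≤ p ^ 2 := by
    have : (n : ℝ) ≤ (p : ℝ) ^ 2 := hs2 ▸ pow_le_pow_left₀ (by linarith) hps 2
    exact_mod_cast this
  have h1 := hmain n p _ h.symLC hn hnp
  rw [Measure.map_apply (by fun_prop) (measurableSet_le measurable_const (by fun_prop))] at h1
  have hball : ENNReal.ofReal (3 / 4) ≤ μ {x | ‖x‖ ≤ 2 * s} := by
    have h2 := mul_meas_ge_le_lintegral (μ := μ) (f := fun x => ENNReal.ofReal (‖x‖ ^ 2))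
      (by fun_prop) (ENNReal.ofReal (4 * n))
    rw [← ofReal_integral_eq_lintegral_ofReal h.integrable_norm_sq
      (Eventually.of_forall fun x => sq_nonneg _), h.integral_norm_sq] at h2
    have h3 : ENNReal.ofReal (4 * n) * μ {x | 2 * s < ‖x‖} ≤
        ENNReal.ofReal (4 * n) * ENNReal.ofReal (1 / 4) := by
      rw [← ENNReal.ofReal_mul (by positivity)]
      refine le_trans (mul_le_mul' le_rfl (measure_mono fun x hx => ?_)) (h2.trans
        (le_of_eq (by congr 1; ring)))
      have hx' : 2 * s < ‖x‖ := hx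
      refine ENNReal.ofReal_le_ofReal ?_
      have := pow_le_pow_left₀ (by linarith) hx'.le 2
      rw [mul_pow, hs2] at this
      linarith
    rw [ENNReal.mul_le_mul_iff_right (by simp [hn.ne']) ENNReal.ofReal_ne_top] at h3
    have e : {x : Euc n | ‖x‖ ≤ 2 * s} = {x | 2 * s < ‖x‖}ᶜ := by ext x; simp
    rw [e, prob_compl_eq_one_sub (measurableSet_lt measurable_const measurable_norm),
      show (3 / 4 : ℝ) = 1 - 1 / 4 by norm_num, ENNReal.ofReal_sub _ (by norm_num), ENNReal.ofReal_one]
    exact tsub_le_tsub_left h3 _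
  have h4 : μ {x | (2 * A + 2) * s < ‖x‖} * μ {x | ‖x‖ ≤ 2 * s} ≤
      ENNReal.ofReal (Real.exp (-3 * p)) := by
    rw [← Measure.prod_prod]
    refine (measure_mono ?_).trans h1
    rintro ⟨x, y⟩ ⟨hx, hy⟩
    have hx' : (2 * A + 2) * s < ‖x‖ := hx
    have hy' : ‖y‖ ≤ 2 * s := hy
    change A * p ≤ ‖x - y‖
    have h5 := norm_sub_norm_le x y
    have h6 := mul_le_mul_of_nonneg_left hp2 hA.le
    linarith
  calc μ {x | (2 * A + 2) * s < ‖x‖}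
      = μ {x | (2 * A + 2) * s < ‖x‖} * ENNReal.ofReal (3 / 4) * ENNReal.ofReal (4 / 3) := by
        rw [mul_assoc, ← ENNReal.ofReal_mul (by norm_num)]; norm_num
    _ ≤ ENNReal.ofReal (Real.exp (-3 * p)) * ENNReal.ofReal (4 / 3) :=
        mul_le_mul' ((mul_le_mul' le_rfl hball).trans h4) le_rfl
    _ ≤ _ := by
        rw [← ENNReal.ofReal_mul (Real.exp_nonneg _)]
        refine ENNReal.ofReal_le_ofReal ?_
        have h5 : (4 / 3 : ℝ) ≤ Real.exp s := by linarith [Real.add_one_le_exp s]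
        calc Real.exp (-3 * p) * (4 / 3) ≤ Real.exp (-3 * s) * Real.exp s :=
              mul_le_mul (Real.exp_le_exp.2 (by linarith)) h5 (by norm_num) (Real.exp_nonneg _)
          _ = _ := by rw [← Real.exp_add]; ring_nf

end paouris

section polytope

open Filter Topology

variable {n m : ℕ} {x : Fin m → Euc n}

lemma exists_coeff_of_mem_absConv {y : Euc n} (hy : y ∈ absConv n (range x)) :
    ∃ t : Fin m → ℝ, ∑ j, |t j| ≤ 1 ∧ y = ∑ j, t j • x j := by
  have hconv : Convex ℝ {y : Euc n | ∃ t : Fin m → ℝ, ∑ j, |t j| ≤ 1 ∧ y = ∑ j, t j • x j} := by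
    rintro _ ⟨t, ht, rfl⟩ _ ⟨s, hs, rfl⟩ a b ha hb hab
    refine ⟨fun j => a * t j + b * s j, ?_, ?_⟩
    · calc ∑ j, |a * t j + b * s j| ≤ ∑ j, (a * |t j| + b * |s j|) := by
            refine Finset.sum_le_sum fun j _ => (abs_add_le _ _).trans_eq ?_
            rw [abs_mul, abs_mul, abs_of_nonneg ha, abs_of_nonneg hb]
        _ = a * ∑ j, |t j| + b * ∑ j, |s j| := by
            rw [Finset.sum_add_distrib, Finset.mul_sum, Finset.mul_sum]
        _ ≤ a * 1 + b * 1 := by gcongr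
        _ = 1 := by linarith
    · simp only [add_smul, mul_smul, Finset.sum_add_distrib, Finset.smul_sum]
  refine convexHull_min ?_ hconv hy
  rintro z (⟨i, rfl⟩ | ⟨i, hi⟩)
  · refine ⟨Pi.single i 1, ?_, by simp [Pi.single_apply]⟩
    simp [Pi.single_apply, apply_ite abs]
  · refine ⟨Pi.single i (-1), ?_, ?_⟩
    · simp [Pi.single_apply, apply_ite abs]
    · rw [← neg_neg z, ← hi]; simp [Pi.single_apply]

lemma convex_absConv : Convex ℝ (absConv n (range x)) := convex_convexHull ℝ _

lemma mem_absConv (i : Fin m) : x i ∈ absConv n (range x) :=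
  subset_convexHull ℝ _ (Or.inl (mem_range_self i))

lemma neg_mem_absConv (i : Fin m) : -x i ∈ absConv n (range x) :=
  subset_convexHull ℝ _ (Or.inr (by simp))

lemma zero_mem_absConv (hm : 0 < m) : (0 : Euc n) ∈ absConv n (range x) := by
  have := convex_absConv (mem_absConv (x := x) ⟨0, hm⟩) (neg_mem_absConv ⟨0, hm⟩)
    (a := 1 / 2) (b := 1 / 2) (by norm_num) (by norm_num) (by norm_num)
  simpa using this

lemma sum_smul_mem_absConv (hm : 0 < m) {t : Fin m → ℝ} (ht : ∑ j, |t j| ≤ 1) :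
    ∑ j, t j • x j ∈ absConv n (range x) := by
  have hpt : ∀ j, (if 0 ≤ t j then x j else -x j) ∈ absConv n (range x) := fun j => by
    split_ifs
    exacts [mem_absConv j, neg_mem_absConv j]
  have h := (convex_absConv (x := x)).sum_mem (t := Finset.univ (α := Option (Fin m)))
    (w := fun o => o.elim (1 - ∑ j, |t j|) fun j => |t j|)
    (z := fun o => o.elim 0 fun j => if 0 ≤ t j then x j else -x j)
    (fun o _ => by
      rcases o with _ | j
      · simpa using ht
      · exact abs_nonneg _) (by rw [Fintype.sum_option]; simp)
    (fun o _ => by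
      rcases o with _ | j
      exacts [zero_mem_absConv hm, hpt j])
  rw [Fintype.sum_option] at h
  simp only [Option.elim, smul_zero, zero_add] at h
  convert h using 2 with j
  split_ifs with h0
  · rw [abs_of_nonneg h0]
  · rw [abs_of_neg (not_le.1 h0), smul_neg, neg_smul, neg_neg]

lemma absConv_mem_nhds (hm : 0 < m) (hx : Submodule.span ℝ (range x) = ⊤) :
    absConv n (range x) ∈ 𝓝 (0 : Euc n) := by
  let T : (Fin m → ℝ) →ₗ[ℝ] Euc n := Fintype.linearCombination ℝ x
  have hT : ∀ t, T t = ∑ j, t j • x j := fun t => Fintype.linearCombination_apply ℝ x t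
  have hsurj : Function.Surjective T := by
    rw [← LinearMap.range_eq_top, ← hx]
    exact Fintype.range_linearCombination ℝ x
  have hopen : IsOpenMap T.toContinuousLinearMap := ContinuousLinearMap.isOpenMap _ hsurj
  have hU : IsOpen {t : Fin m → ℝ | ∑ j, |t j| < 1} := isOpen_lt (by fun_prop) continuous_const
  have h0 : T.toContinuousLinearMap '' {t : Fin m → ℝ | ∑ j, |t j| < 1} ∈ 𝓝 (0 : Euc n) := by
    refine (hopen _ hU).mem_nhds ⟨0, by simp, by simp⟩
  refine Filter.mem_of_superset h0 ?_
  rintro _ ⟨t, ht, rfl⟩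
  change T t ∈ _
  rw [hT]
  exact sum_smul_mem_absConv hm (le_of_lt ht)

lemma absConv_subset_closedBall {R : ℝ} (hR : ∀ j, ‖x j‖ ≤ R) :
    absConv n (range x) ⊆ Metric.closedBall 0 R := by
  refine convexHull_min ?_ (convex_closedBall _ _)
  rintro z (⟨i, rfl⟩ | ⟨i, hi⟩)
  · simpa using hR i
  · rw [mem_closedBall_zero_iff, ← norm_neg, ← hi]; exact hR i

lemma exists_gauge_le (hK : absConv n (range x) ∈ 𝓝 (0 : Euc n)) :
    ∃ M : ℝ, 0 < M ∧ ∀ y, gauge (absConv n (range x)) y ≤ M * ‖y‖ := by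
  obtain ⟨r, hr, hrK⟩ := Metric.mem_nhds_iff.1 hK
  refine ⟨r⁻¹, inv_pos.2 hr, fun y => ?_⟩
  rw [inv_mul_eq_div, le_div_iff₀ hr, mul_comm]
  exact mul_gauge_le_norm hrK

lemma exists_norm_le : ∃ R : ℝ, 0 < R ∧ ∀ j, ‖x j‖ ≤ R :=
  ⟨1 + ∑ j, ‖x j‖, by positivity, fun j => by
    have := Finset.single_le_sum (f := fun j => ‖x j‖) (fun j _ => norm_nonneg _) (Finset.mem_univ j)
    linarith⟩

lemma bddAbove_bodyOpNorm (hK : absConv n (range x) ∈ 𝓝 (0 : Euc n)) (P : Euc n →ₗ[ℝ] Euc n) :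
    BddAbove ((fun y => gauge (absConv n (range x)) (P y)) '' absConv n (range x)) := by
  obtain ⟨M, hM, hMK⟩ := exists_gauge_le hK
  obtain ⟨R, hR0, hR⟩ := exists_norm_le (x := x)
  refine ⟨M * (‖P.toContinuousLinearMap‖ * R), ?_⟩
  rintro _ ⟨y, hy, rfl⟩
  refine (hMK _).trans (mul_le_mul_of_nonneg_left ?_ hM.le)
  refine (P.toContinuousLinearMap.le_opNorm y).trans (mul_le_mul_of_nonneg_left ?_ (norm_nonneg _))
  exact mem_closedBall_zero_iff.1 (absConv_subset_closedBall hR hy)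

lemma exists_coeff_of_bodyOpNorm_lt (hK : absConv n (range x) ∈ 𝓝 (0 : Euc n))
    {P : Euc n →ₗ[ℝ] Euc n} {a : ℝ}
    (h : bodyOpNorm n (absConv n (range x)) (absConv n (range x)) P < a) (i : Fin m) :
    ∃ t : Fin m → ℝ, ∑ j, |t j| ≤ a ∧ P (x i) = ∑ j, t j • x j := by
  have h1 : gauge (absConv n (range x)) (P (x i)) < a :=
    (le_csSup (bddAbove_bodyOpNorm hK P) ⟨x i, mem_absConv i, rfl⟩).trans_lt h
  obtain ⟨b, hb0, hba, z, hz, hzP⟩ := exists_lt_of_gauge_lt (absorbent_nhds_zero hK) h1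
  obtain ⟨t, ht, rfl⟩ := exists_coeff_of_mem_absConv hz
  refine ⟨fun j => b * t j, ?_, ?_⟩
  · simp only [abs_mul, abs_of_pos hb0]
    rw [← Finset.mul_sum]
    calc b * ∑ j, |t j| ≤ b * 1 := by gcongr
      _ ≤ a := by linarith
  · rw [← hzP]
    simp only [Finset.smul_sum, mul_smul]

lemma partial_sum_projection (b : Module.Basis (Fin n) ℝ (Euc n)) {k : ℕ} (hk : k ≤ n) :
    ∃ P : Euc n →ₗ[ℝ] Euc n, P ∘ₗ P = P ∧ Module.finrank ℝ (LinearMap.range P) = k ∧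
      ∀ lam : Fin n → ℝ, P (∑ i, lam i • b i) =
        ∑ i ∈ Finset.univ.filter (fun i : Fin n => (i : ℕ) < k), lam i • b i := by
  classical
  let P : Euc n →ₗ[ℝ] Euc n := b.constr ℝ fun i => if (i : ℕ) < k then b i else 0
  have hPb : ∀ i, P (b i) = if (i : ℕ) < k then b i else 0 := fun i => b.constr_basis ℝ _ i
  refine ⟨P, ?_, ?_, fun lam => ?_⟩
  · refine b.ext fun i => ?_
    rw [LinearMap.comp_apply, hPb]
    split_ifs with h
    · rw [hPb, if_pos h]
    · simp
  · have hr : LinearMap.range P = Submodule.span ℝ (range fun i : Fin k => b (Fin.castLE hk i)) := by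
      apply le_antisymm
      · rw [b.constr_range]
        refine Submodule.span_le.2 ?_
        rintro _ ⟨i, rfl⟩
        simp only [SetLike.mem_coe]
        split_ifs with h
        · exact Submodule.subset_span ⟨⟨i, h⟩, rfl⟩
        · exact Submodule.zero_mem _
      · refine Submodule.span_le.2 ?_
        rintro _ ⟨i, rfl⟩
        exact ⟨b (Fin.castLE hk i), by rw [hPb, if_pos (by simp)]⟩
    rw [hr]
    exact (finrank_span_eq_card (b.linearIndependent.comp _ (Fin.castLE_injective hk))).trans (by simp)
  · rw [map_sum, Finset.sum_filter]
    refine Finset.sum_congr rfl fun i _ => ?_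
    rw [map_smul, hPb]
    split_ifs <;> simp

/-- The basis constant dominates the norms of the projections of rank about `n / 2`. -/
lemma le_basisConstant (hn : 2 ≤ n) (hm : 0 < m) (hK : absConv n (range x) ∈ 𝓝 (0 : Euc n)) {a : ℝ}
    (h : ∀ P : Euc n →ₗ[ℝ] Euc n, P ∘ₗ P = P →
      (n : ℝ) / 4 ≤ (Module.finrank ℝ (LinearMap.range P) : ℝ) →
      (Module.finrank ℝ (LinearMap.range P) : ℝ) ≤ 3 * n / 4 →
      a ≤ bodyOpNorm n (absConv n (range x)) (absConv n (range x)) P) :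
    a ≤ basisConstant n (absConv n (range x)) := by
  set K := absConv n (range x) with hKdef
  refine le_csInf ?_ ?_
  · obtain ⟨M, hM, hMK⟩ := exists_gauge_le hK
    obtain ⟨R, hR0, hR⟩ := exists_norm_le (x := x)
    let b : Module.Basis (Fin n) ℝ (Euc n) := (EuclideanSpace.basisFun (Fin n) ℝ).toBasis
    choose! P hP1 hP2 hP3 using fun (k : ℕ) (hk : k ≤ n) => partial_sum_projection b hk
    refine ⟨1 + ∑ k ∈ Finset.range (n + 1), M * ‖(P k).toContinuousLinearMap‖ * R, by positivity, b,
      fun k hk lam => ?_⟩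
    rw [← hP3 k hk]
    set y := ∑ i, lam i • b i
    have h1 : ‖y‖ / R ≤ gauge K y := le_gauge_of_subset_closedBall (absorbent_nhds_zero hK) hR0.le
      (absConv_subset_closedBall hR)
    rw [div_le_iff₀ hR0] at h1
    have hg : 0 ≤ gauge K y := gauge_nonneg _
    calc gauge K (P k y) ≤ M * ‖P k y‖ := hMK _
      _ ≤ M * (‖(P k).toContinuousLinearMap‖ * (gauge K y * R)) := by
          refine mul_le_mul_of_nonneg_left ?_ hM.le
          exact ((P k).toContinuousLinearMap.le_opNorm y).trans
            (mul_le_mul_of_nonneg_left h1 (norm_nonneg _))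
      _ = M * ‖(P k).toContinuousLinearMap‖ * R * gauge K y := by ring
      _ ≤ _ := by
          refine mul_le_mul_of_nonneg_right ?_ hg
          have := Finset.single_le_sum
            (f := fun k => M * ‖(P k).toContinuousLinearMap‖ * R) (fun k _ => by positivity)
            (Finset.mem_range.2 (Nat.lt_succ_of_le hk))
          simp only at this
          linarith
  · rintro c ⟨hc, b, hb⟩
    have hk : n / 2 ≤ n := Nat.div_le_self _ _
    obtain ⟨P, hP1, hP2, hP3⟩ := partial_sum_projection b hk
    refine (h P hP1 ?_ ?_).trans ?_
    · rw [hP2, div_le_iff₀ (by norm_num)]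
      have : n ≤ n / 2 * 4 := by omega
      exact_mod_cast this
    · rw [hP2, le_div_iff₀ (by norm_num)]
      have : n / 2 * 4 ≤ 3 * n := by omega
      exact_mod_cast this
    · refine csSup_le (Nonempty.image _ ⟨0, zero_mem_absConv hm⟩) ?_
      rintro _ ⟨y, hy, rfl⟩
      have h1 := hb (n / 2) hk (b.repr y)
      rw [b.sum_repr, ← hP3, b.sum_repr] at h1
      refine h1.trans ?_
      have : gauge K y ≤ 1 := gauge_le_one_of_mem hy
      calc c * gauge K y ≤ c * 1 := by gcongr
        _ = c := mul_one c

lemma exists_isometry_of_orthonormal {k : ℕ} {v : Fin k → Euc n} (hv : Orthonormal ℝ v) :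
    ∃ W : Euc k →ₗᵢ[ℝ] Euc n, ∀ z, W z = ∑ i, z i • v i := by
  let e := EuclideanSpace.basisFun (Fin k) ℝ
  let W₀ : Euc k →ₗ[ℝ] Euc n := e.toBasis.constr ℝ v
  have hW₀ : ∀ i, W₀ (e.toBasis i) = v i := fun i => e.toBasis.constr_basis ℝ v i
  refine ⟨W₀.isometryOfOrthonormal (v := e.toBasis) (by simp [e.orthonormal]) ?_, fun z => ?_⟩
  · have : W₀ ∘ e.toBasis = v := funext hW₀
    rwa [this]
  · change W₀ z = _
    rw [Module.Basis.constr_apply_fintype]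
    rfl

lemma exists_coiso_eq_zero {k : ℕ} (F : Submodule ℝ (Euc n)) (hF : k + Module.finrank ℝ F ≤ n) :
    ∃ W : Euc k →ₗᵢ[ℝ] Euc n, ∀ y ∈ F, coiso W y = 0 := by
  have hdim : k ≤ Module.finrank ℝ Fᗮ := by
    have := F.finrank_add_finrank_orthogonal
    rw [finrank_euclideanSpace_fin] at this
    omega
  let b := stdOrthonormalBasis ℝ Fᗮ
  have hv : Orthonormal ℝ fun i : Fin k => ((b (Fin.castLE hdim i) : Fᗮ) : Euc n) := by
    have h1 : Orthonormal ℝ fun i => ((b i : Fᗮ) : Euc n) :=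
      b.orthonormal.comp_linearIsometry Fᗮ.subtypeₗᵢ
    exact h1.comp _ (Fin.castLE_injective hdim)
  obtain ⟨W, hW⟩ := exists_isometry_of_orthonormal hv
  refine ⟨W, fun y hy => ?_⟩
  refine ext_inner_left ℝ fun z => ?_
  rw [inner_coiso, hW, sum_inner, inner_zero_right]
  refine Finset.sum_eq_zero fun i _ => ?_
  rw [real_inner_smul_left, real_inner_comm, Submodule.inner_right_of_mem_orthogonal hy (b _).2, mul_zero]

lemma projection_relation {P : Euc n →ₗ[ℝ] Euc n} (hP : P ∘ₗ P = P) {a : ℝ} {i : Fin m}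
    (h : ∃ t : Fin m → ℝ, ∑ j, |t j| ≤ a ∧ P (x i) = ∑ j, t j • x j) :
    ∃ t : Fin m → ℝ, t i = 0 ∧ ∑ j, |t j| ≤ 2 * a ∧ (x i - ∑ j, t j • x j ∈ LinearMap.ker P ∨
      x i - ∑ j, t j • x j ∈ LinearMap.range P) := by
  classical
  obtain ⟨t, ht, hPx⟩ := h
  have hPP : ∀ y, P (P y) = P y := fun y => LinearMap.congr_fun hP y
  set t₀ := Function.update t i 0 with ht₀
  have ht₀i : t₀ i = 0 := by simp [ht₀]
  have hsum : ∑ j, t j • x j = t i • x i + ∑ j, t₀ j • x j := by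
    rw [← Finset.add_sum_erase _ _ (Finset.mem_univ i), ← Finset.add_sum_erase _ (fun j => t₀ j • x j)
      (Finset.mem_univ i), ht₀i, zero_smul, zero_add]
    congr 1
    refine Finset.sum_congr rfl fun j hj => ?_
    rw [ht₀, Function.update_of_ne (Finset.ne_of_mem_erase hj)]
  have habs : ∑ j, |t₀ j| ≤ a := by
    refine le_trans (Finset.sum_le_sum fun j _ => ?_) ht
    by_cases hj : j = i
    · rw [hj, ht₀i, abs_zero]; exact abs_nonneg _
    · rw [ht₀, Function.update_of_ne hj]
  have ha : 0 ≤ a := (Finset.sum_nonneg fun j _ => abs_nonneg _).trans ht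
  rw [hsum] at hPx
  have hscale : ∀ c : ℝ, |c| ≤ 2 → ∑ j, |c * t₀ j| ≤ 2 * a := fun c hc => by
    simp only [abs_mul]
    rw [← Finset.mul_sum]
    exact mul_le_mul hc habs (Finset.sum_nonneg fun j _ => abs_nonneg _) (by norm_num)
  have hsm : ∀ c : ℝ, ∑ j, (c * t₀ j) • x j = c • ∑ j, t₀ j • x j := fun c => by
    simp only [mul_smul, Finset.smul_sum]
  set z := ∑ j, t₀ j • x j
  by_cases hs : t i ≤ 1 / 2
  · have h1 : 0 < 1 - t i := by linarith
    refine ⟨fun j => (1 - t i)⁻¹ * t₀ j, by simp [ht₀i], hscale _ ?_, Or.inl ?_⟩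
    · rw [abs_of_pos (by positivity), inv_le_comm₀ h1 (by norm_num)]; linarith
    · have h2 : P (x i) = t i • P (x i) + P z := by
        conv_lhs => rw [← hPP, hPx, map_add, map_smul]
      have h3 : P z = (1 - t i) • P (x i) := by
        rw [sub_smul, one_smul, eq_sub_iff_add_eq, add_comm]; exact h2.symm
      rw [LinearMap.mem_ker, hsm, map_sub, map_smul, h3, smul_smul, inv_mul_cancel₀ h1.ne', one_smul,
        sub_self]
  · push Not at hs
    have h1 : 0 < t i := by linarith
    refine ⟨fun j => -(t i)⁻¹ * t₀ j, by simp [ht₀i], hscale _ ?_, Or.inr ?_⟩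
    · rw [abs_neg, abs_of_pos (by positivity), inv_le_comm₀ h1 (by norm_num)]; linarith
    · refine ⟨(t i)⁻¹ • P (x i), ?_⟩
      rw [hsm, map_smul, hPP, hPx, smul_add, smul_smul, inv_mul_cancel₀ h1.ne', one_smul, neg_smul,
        sub_neg_eq_add]

/-- A projection of small norm produces many short linear relations in a quotient. -/
lemma exists_relations {P : Euc n →ₗ[ℝ] Euc n} (hP : P ∘ₗ P = P)
    (hr1 : (n : ℝ) / 4 ≤ (Module.finrank ℝ (LinearMap.range P) : ℝ))
    (hr2 : (Module.finrank ℝ (LinearMap.range P) : ℝ) ≤ 3 * n / 4) {a : ℝ}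
    (h : ∀ i, ∃ t : Fin m → ℝ, ∑ j, |t j| ≤ a ∧ P (x i) = ∑ j, t j • x j) :
    ∃ (W : Euc ((n + 3) / 4) →ₗᵢ[ℝ] Euc n) (S : Finset (Fin m)) (t : Fin m → Fin m → ℝ),
      m ≤ 2 * S.card ∧ (∀ i, t i i = 0) ∧ (∀ i, ∑ j, |t i j| ≤ 2 * a) ∧
      ∀ i ∈ S, coiso W (x i - ∑ j, t i j • x j) = 0 := by
  classical
  have hr1' : n ≤ 4 * Module.finrank ℝ (LinearMap.range P) := by
    rw [div_le_iff₀ (by norm_num)] at hr1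
    have : (n : ℝ) ≤ (Module.finrank ℝ (LinearMap.range P) * 4 : ℕ) := by push_cast; exact hr1
    have : n ≤ Module.finrank ℝ (LinearMap.range P) * 4 := by exact_mod_cast this
    omega
  have hr2' : 4 * Module.finrank ℝ (LinearMap.range P) ≤ 3 * n := by
    rw [le_div_iff₀ (by norm_num)] at hr2
    have : ((Module.finrank ℝ (LinearMap.range P) * 4 : ℕ) : ℝ) ≤ (3 * n : ℕ) := by push_cast; exact hr2
    have : Module.finrank ℝ (LinearMap.range P) * 4 ≤ 3 * n := by exact_mod_cast this
    omega
  have hdim := P.finrank_range_add_finrank_ker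
  rw [finrank_euclideanSpace_fin] at hdim
  choose t ht0 ht1 ht2 using fun i => projection_relation hP (h i)
  set S := Finset.univ.filter fun i => x i - ∑ j, t i j • x j ∈ LinearMap.ker P with hS
  have hcard : S.card + Sᶜ.card = m := by
    rw [Finset.card_add_card_compl, Fintype.card_fin]
  by_cases hc : m ≤ 2 * S.card
  · obtain ⟨W, hW⟩ := exists_coiso_eq_zero (k := (n + 3) / 4) (LinearMap.ker P) (by omega)
    exact ⟨W, S, t, hc, ht0, ht1, fun i hi => hW _ (Finset.mem_filter.1 hi).2⟩
  · obtain ⟨W, hW⟩ := exists_coiso_eq_zero (k := (n + 3) / 4) (LinearMap.range P) (by omega)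
    refine ⟨W, Sᶜ, t, by omega, ht0, ht1, fun i hi => hW _ ?_⟩
    refine (ht2 i).resolve_left fun h1 => ?_
    exact Finset.mem_compl.1 hi (Finset.mem_filter.2 ⟨Finset.mem_univ i, h1⟩)

end polytope

section decoupling

open Filter Topology ProbabilityTheory

variable {m : ℕ}

/-- The Rademacher sign attached to membership in a set. -/
def memSign (I : Finset (Fin m)) (i : Fin m) : ℝ := if i ∈ I then 1 else -1

lemma memSign_symmDiff_self (I : Finset (Fin m)) (i : Fin m) :
    memSign (symmDiff I {i}) i = -memSign I i := by
  by_cases h : i ∈ I <;> simp [memSign, Finset.mem_symmDiff, h]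

lemma memSign_symmDiff_of_ne (I : Finset (Fin m)) {i j : Fin m} (hij : j ≠ i) :
    memSign (symmDiff I {i}) j = memSign I j := by
  by_cases h : j ∈ I <;> simp [memSign, Finset.mem_symmDiff, h, hij]

lemma sum_toggle (i : Fin m) (g : Finset (Fin m) → ℝ) :
    ∑ I : Finset (Fin m), g (symmDiff I {i}) = ∑ I, g I :=
  Function.Bijective.sum_comp
    (Function.Involutive.bijective fun I => symmDiff_symmDiff_cancel_right {i} I) g

lemma sum_memSign (i : Fin m) : ∑ I : Finset (Fin m), memSign I i = 0 := by
  have := sum_toggle i fun I => memSign I i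
  simp only [memSign_symmDiff_self, Finset.sum_neg_distrib] at this
  linarith

lemma sum_memSign_mul {i j : Fin m} (hij : j ≠ i) :
    ∑ I : Finset (Fin m), memSign I i * memSign I j = 0 := by
  have := sum_toggle i fun I => memSign I i * memSign I j
  simp only [memSign_symmDiff_self, memSign_symmDiff_of_ne _ hij, neg_mul,
    Finset.sum_neg_distrib] at this
  linarith

/-- A nonnegative matrix without diagonal has a quarter of its mass on some off-diagonal block. -/
lemma exists_decoupling (b : Fin m → Fin m → ℝ) (hb : ∀ i, b i i = 0) :
    ∃ I : Finset (Fin m), ∑ i, ∑ j, b i j ≤ 4 * ∑ i ∈ I, ∑ j ∈ Iᶜ, b i j := by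
  have key : ∀ I : Finset (Fin m), 4 * ∑ i ∈ I, ∑ j ∈ Iᶜ, b i j =
      ∑ i, ∑ j, b i j * (1 + memSign I i - memSign I j - memSign I i * memSign I j) := fun I => by
    have e1 : ∑ i ∈ I, ∑ j ∈ Iᶜ, b i j = ∑ i, ∑ j, if i ∈ I ∧ j ∉ I then b i j else 0 := by
      rw [← Finset.sum_subset (Finset.subset_univ I) fun i _ hi => by simp [hi]]
      refine Finset.sum_congr rfl fun i hi => ?_
      rw [← Finset.sum_subset (Finset.subset_univ Iᶜ) fun j _ hj => by
        rw [if_neg]; rintro ⟨-, h2⟩; exact hj (Finset.mem_compl.2 h2)]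
      exact Finset.sum_congr rfl fun j hj => by rw [if_pos ⟨hi, Finset.mem_compl.1 hj⟩]
    rw [e1, Finset.mul_sum]
    refine Finset.sum_congr rfl fun i _ => ?_
    rw [Finset.mul_sum]
    refine Finset.sum_congr rfl fun j _ => ?_
    by_cases hi : i ∈ I <;> by_cases hj : j ∈ I <;> simp [memSign, hi, hj]; ring
  have hsum : ∑ I : Finset (Fin m), ∑ i, ∑ j, b i j ≤
      ∑ I : Finset (Fin m), 4 * ∑ i ∈ I, ∑ j ∈ Iᶜ, b i j := by
    refine le_of_eq ?_
    simp only [key]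
    rw [Finset.sum_comm, Finset.sum_comm (s := Finset.univ (α := Finset (Fin m)))]
    refine Finset.sum_congr rfl fun i _ => ?_
    rw [Finset.sum_comm, Finset.sum_comm (s := Finset.univ (α := Finset (Fin m)))]
    refine Finset.sum_congr rfl fun j _ => ?_
    by_cases hij : j = i
    · simp [hij, hb]
    · rw [← Finset.mul_sum, Finset.sum_sub_distrib, Finset.sum_sub_distrib, Finset.sum_add_distrib,
        sum_memSign, sum_memSign, sum_memSign_mul hij]
      simp [mul_comm]
  obtain ⟨I, -, hI⟩ := Finset.exists_le_of_sum_le (Finset.univ_nonempty (α := Finset (Fin m))) hsum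
  exact ⟨I, hI⟩

lemma measure_pi_many_le {Ω : Type*} [MeasurableSpace Ω] {Q : Measure Ω} [IsProbabilityMeasure Q]
    {F : Set Ω} (hF : Q F ≤ ENNReal.ofReal (1 / 256)) :
    (Measure.pi fun _ : Fin m => Q) {ω | ∃ I : Finset (Fin m), m ≤ 4 * I.card ∧ ∀ i ∈ I, ω i ∈ F} ≤
      ENNReal.ofReal ((1 / 2) ^ m) := by
  classical
  have hI : ∀ I ∈ Finset.univ.filter (fun I : Finset (Fin m) => m ≤ 4 * I.card),
      (Measure.pi fun _ : Fin m => Q) {ω | ∀ i ∈ I, ω i ∈ F} ≤ ENNReal.ofReal ((1 / 4) ^ m) := by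
    intro I hI
    have hcard := (Finset.mem_filter.1 hI).2
    have e : {ω : Fin m → Ω | ∀ i ∈ I, ω i ∈ F} = Set.pi univ fun i => if i ∈ I then F else univ := by
      ext ω
      simp only [Set.mem_pi, mem_univ, true_imp_iff, mem_ofPred_eq]
      refine forall_congr' fun i => ?_
      split_ifs with h <;> simp [h]
    rw [e, Measure.pi_pi]
    calc ∏ i, Q (if i ∈ I then F else univ) = ∏ i, if i ∈ I then Q F else 1 := by
          refine Finset.prod_congr rfl fun i _ => ?_
          split_ifs <;> simp
      _ = Q F ^ I.card := by rw [Finset.prod_ite_mem, Finset.univ_inter, Finset.prod_const]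
      _ ≤ ENNReal.ofReal (1 / 256) ^ I.card := pow_le_pow_left' hF _
      _ = ENNReal.ofReal ((1 / 4) ^ (4 * I.card)) := by
          rw [← ENNReal.ofReal_pow (by norm_num), pow_mul]; norm_num
      _ ≤ _ := ENNReal.ofReal_le_ofReal (pow_le_pow_of_le_one (by norm_num) (by norm_num) hcard)
  calc _ ≤ (Measure.pi fun _ : Fin m => Q) (⋃ I ∈ Finset.univ.filter
        (fun I : Finset (Fin m) => m ≤ 4 * I.card), {ω | ∀ i ∈ I, ω i ∈ F}) := by
        refine measure_mono ?_
        rintro ω ⟨I, h1, h2⟩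
        simp only [mem_iUnion]
        exact ⟨I, Finset.mem_filter.2 ⟨Finset.mem_univ _, h1⟩, h2⟩
    _ ≤ _ := measure_biUnion_finset_le _ _
    _ ≤ ∑ I ∈ Finset.univ.filter (fun I : Finset (Fin m) => m ≤ 4 * I.card),
        ENNReal.ofReal ((1 / 4) ^ m) := Finset.sum_le_sum hI
    _ ≤ ∑ I : Finset (Fin m), ENNReal.ofReal ((1 / 4) ^ m) :=
        Finset.sum_le_sum_of_subset (Finset.filter_subset _ _)
    _ = ENNReal.ofReal ((1 / 2) ^ m) := by
        rw [Finset.sum_const, Finset.card_univ, Fintype.card_finset, Fintype.card_fin, nsmul_eq_mul,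
          ← ENNReal.ofReal_natCast, ← ENNReal.ofReal_mul (by positivity)]
        congr 1
        push_cast
        rw [← mul_pow]; norm_num

/-- Conditionally on the coordinates outside `I`, the factors indexed by `I` are independent. -/
lemma lintegral_prod_decoupled_le {Ω : Type*} [MeasurableSpace Ω] {Q : Measure Ω}
    [IsProbabilityMeasure Q] {ψ : Fin m → Ω → Ω → ℝ≥0∞}
    (hψ : ∀ i, Measurable fun p : Ω × Ω => ψ i p.1 p.2) {B : ℝ≥0∞} (hB : 1 ≤ B)
    (hi : ∀ i β, ∫⁻ α, ψ i β α ∂Q ≤ B)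
    (I : Finset (Fin m)) (f : Fin m → Fin m) (hf : ∀ i ∈ I, f i ∉ I) :
    ∫⁻ ω, ∏ i ∈ I, ψ i (ω (f i)) (ω i) ∂(Measure.pi fun _ : Fin m => Q) ≤ B ^ m := by
  classical
  let G : ({i // i ∈ I} → Ω) × ({i // i ∉ I} → Ω) → ℝ≥0∞ := fun p =>
    ∏ i : {i // i ∈ I}, ψ i (p.2 ⟨f i, hf i i.2⟩) (p.1 i)
  have hG : Measurable G := Finset.measurable_prod _ fun i _ => Measurable.comp
    (f := fun p : ({i // i ∈ I} → Ω) × ({i // i ∉ I} → Ω) => (p.2 ⟨f i, hf i i.2⟩, p.1 i)) (hψ i)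
    (((measurable_pi_apply _).comp measurable_snd).prodMk ((measurable_pi_apply _).comp measurable_fst))
  have hmp := measurePreserving_piEquivPiSubtypeProd (fun _ : Fin m => Q) (· ∈ I)
  have e : ∀ ω : Fin m → Ω, ∏ i ∈ I, ψ i (ω (f i)) (ω i) =
      G (MeasurableEquiv.piEquivPiSubtypeProd (fun _ => Ω) (· ∈ I) ω) := fun ω => by
    rw [← Finset.prod_coe_sort]; rfl
  simp only [e]
  rw [hmp.lintegral_comp hG, lintegral_prod_symm _ hG.aemeasurable]
  refine (lintegral_mono fun b => ?_).trans (le_of_eq ?_) (b := ∫⁻ _ : {i // i ∉ I} → Ω,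
    B ^ m ∂(Measure.pi fun _ => Q))
  · have hψ' : ∀ i : {i // i ∈ I}, Measurable fun α => ψ i (b ⟨f i, hf i i.2⟩) α := fun i =>
      (hψ i).comp (measurable_const.prodMk measurable_id)
    have hind := iIndepFun_pi (μ := fun _ : {i // i ∈ I} => Q)
      (X := fun i α => ψ i (b ⟨f i, hf i i.2⟩) α) fun i => (hψ' i).aemeasurable
    have h1 := lintegral_prod_eq_prod_lintegral_of_indepFun Finset.univ _ hind
      fun i => (hψ' i).comp (measurable_pi_apply i)
    refine le_trans (le_of_eq ?_) (h1.trans_le ?_)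
    · simp only [G]; congr!
    calc _ ≤ ∏ i : {i // i ∈ I}, B := by
          refine Finset.prod_le_prod' fun i _ => ?_
          have := (measurePreserving_eval (fun _ : {i // i ∈ I} => Q) i).lintegral_comp (hψ' i)
          exact this.trans_le (hi i _)
      _ = B ^ I.card := by rw [Finset.prod_const, Finset.card_univ, Fintype.card_coe]
      _ ≤ _ := pow_le_pow_right₀ hB ((Finset.card_le_univ I).trans_eq (Fintype.card_fin m))
  · simp

lemma measure_decoupled_le {Ω : Type*} [MeasurableSpace Ω] {Q : Measure Ω}
    [IsProbabilityMeasure Q] {ψ : Fin m → Ω → Ω → ℝ≥0∞}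
    (hψ : ∀ i, Measurable fun p : Ω × Ω => ψ i p.1 p.2) {B : ℝ≥0∞} (hB : 1 ≤ B)
    (hi : ∀ i β, ∫⁻ α, ψ i β α ∂Q ≤ B)
    (I : Finset (Fin m)) (f : Fin m → Fin m) (hf : ∀ i ∈ I, f i ∉ I) (s : ℝ) :
    (Measure.pi fun _ : Fin m => Q)
        {ω | ENNReal.ofReal (Real.exp s) ≤ ∏ i ∈ I, ψ i (ω (f i)) (ω i)} ≤
      ENNReal.ofReal (Real.exp (-s)) * B ^ m := by
  have hmeas : Measurable fun ω : Fin m → Ω => ∏ i ∈ I, ψ i (ω (f i)) (ω i) :=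
    Finset.measurable_prod _ fun i _ => Measurable.comp (f := fun ω : Fin m → Ω => (ω (f i), ω i)) (hψ i)
      ((measurable_pi_apply _).prodMk (measurable_pi_apply _))
  have h2 := (mul_meas_ge_le_lintegral (μ := Measure.pi fun _ : Fin m => Q) hmeas
    (ENNReal.ofReal (Real.exp s))).trans (lintegral_prod_decoupled_le hψ hB hi I f hf)
  have h3 : ENNReal.ofReal (Real.exp (-s)) * ENNReal.ofReal (Real.exp s) = 1 := by
    rw [← ENNReal.ofReal_mul (Real.exp_nonneg _), ← Real.exp_add]; simp
  calc _ = ENNReal.ofReal (Real.exp (-s)) * (ENNReal.ofReal (Real.exp s) *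
        (Measure.pi fun _ : Fin m => Q) {ω | ENNReal.ofReal (Real.exp s) ≤
          ∏ i ∈ I, ψ i (ω (f i)) (ω i)}) := by rw [← mul_assoc, h3, one_mul]
    _ ≤ _ := mul_le_mul' le_rfl h2

variable {n k : ℕ} {Q : Measure (Euc n × Euc k)} {T : ℝ}

/-- The exponential factor coupling the first component of `β` with the second one of `α`. -/
def cross (q : Euc n →L[ℝ] Euc k) (R c : ℝ) (β α : Euc n × Euc k) : ℝ≥0∞ :=
  {β : Euc n × Euc k | ‖β.1‖ ≤ R}.indicator 1 β * ENNReal.ofReal (Real.exp (c * ⟪q β.1, α.2⟫))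

lemma measurable_cross (q : Euc n →L[ℝ] Euc k) (R c : ℝ) :
    Measurable fun p : (Euc n × Euc k) × (Euc n × Euc k) => cross q R c p.1 p.2 := by
  refine Measurable.mul ?_ (by fun_prop)
  exact (measurable_one.indicator (measurableSet_le (by fun_prop) measurable_const)).comp measurable_fst

lemma lintegral_cross_le [IsProbabilityMeasure Q] (hT : 0 < T)
    (hQ : ∀ θ : Euc k, ∫⁻ p, ENNReal.ofReal (Real.exp ⟪θ, p.2⟫) ∂Q ≤
      ENNReal.ofReal (Real.exp (‖θ‖ ^ 2 / T)))
    {q : Euc n →L[ℝ] Euc k} (hq : ∀ x, ‖q x‖ ≤ ‖x‖) {R c θ : ℝ} (hc : |c| ≤ θ) (β : Euc n × Euc k) :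
    ∫⁻ α, cross q R c β α ∂Q ≤ ENNReal.ofReal (Real.exp (θ ^ 2 * R ^ 2 / T)) := by
  by_cases hβ : ‖β.1‖ ≤ R
  · have e : ∀ α, cross q R c β α = ENNReal.ofReal (Real.exp ⟪c • q β.1, α.2⟫) := fun α => by
      rw [cross, indicator_of_mem (by exact hβ), Pi.one_apply, one_mul, real_inner_smul_left]
    simp only [e]
    refine (hQ _).trans (ENNReal.ofReal_le_ofReal (Real.exp_le_exp.2 ?_))
    refine div_le_div_of_nonneg_right ?_ hT.le
    rw [norm_smul, mul_pow]
    exact mul_le_mul (pow_le_pow_left₀ (norm_nonneg _) hc 2)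
      (pow_le_pow_left₀ (norm_nonneg _) ((hq _).trans hβ) 2) (by positivity) (by positivity)
  · have e : ∀ α, cross q R c β α = 0 := fun α => by
      rw [cross, indicator_of_notMem (by exact hβ), zero_mul]
    simp [e]

lemma measure_cross_event_le [IsProbabilityMeasure Q] (hT : 0 < T)
    (hQ : ∀ θ : Euc k, ∫⁻ p, ENNReal.ofReal (Real.exp ⟪θ, p.2⟫) ∂Q ≤
      ENNReal.ofReal (Real.exp (‖θ‖ ^ 2 / T)))
    {q : Euc n →L[ℝ] Euc k} (hq : ∀ x, ‖q x‖ ≤ ‖x‖) {R θ τ : ℝ} (hθ : 0 ≤ θ)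
    {σ : Fin m → ℝ} (hσ : ∀ i, |σ i| ≤ 1)
    (I : Finset (Fin m)) (f : Fin m → Fin m) (hf : ∀ i ∈ I, f i ∉ I) :
    (Measure.pi fun _ : Fin m => Q) {ω | (∀ j, ‖(ω j).1‖ ≤ R) ∧
        τ ≤ ∑ i ∈ I, σ i * ⟪q (ω (f i)).1, (ω i).2⟫} ≤
      ENNReal.ofReal (Real.exp (-(θ * τ) + m * (θ ^ 2 * R ^ 2 / T))) := by
  have hc : ∀ i, |θ * σ i| ≤ θ := fun i => by
    rw [abs_mul, abs_of_nonneg hθ]; exact mul_le_of_le_one_right hθ (hσ i)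
  have h1 := measure_decoupled_le (Q := Q) (ψ := fun i => cross q R (θ * σ i))
    (B := ENNReal.ofReal (Real.exp (θ ^ 2 * R ^ 2 / T)))
    (fun i => measurable_cross q R _) (ENNReal.one_le_ofReal.2 (Real.one_le_exp (by positivity)))
    (fun i β => lintegral_cross_le hT hQ hq (hc i) β) I f hf (θ * τ)
  rw [← ENNReal.ofReal_pow (Real.exp_nonneg _), ← Real.exp_nat_mul,
    ← ENNReal.ofReal_mul (Real.exp_nonneg _), ← Real.exp_add] at h1
  refine (measure_mono ?_).trans h1
  rintro ω ⟨hω, hτ⟩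
  have e : ∀ i, cross q R (θ * σ i) (ω (f i)) (ω i) =
      ENNReal.ofReal (Real.exp (θ * σ i * ⟪q (ω (f i)).1, (ω i).2⟫)) := fun i => by
    rw [cross, indicator_of_mem (by exact hω _), Pi.one_apply, one_mul]
  change _ ≤ ∏ i ∈ I, cross q R (θ * σ i) (ω (f i)) (ω i)
  simp only [e]
  rw [← ENNReal.ofReal_prod_of_nonneg fun i _ => Real.exp_nonneg _, ← Real.exp_sum]
  refine ENNReal.ofReal_le_ofReal (Real.exp_le_exp.2 ?_)
  simp only [mul_assoc]
  rw [← Finset.mul_sum]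
  exact mul_le_mul_of_nonneg_left hτ hθ

end decoupling

section fixedIsometry

open Filter Topology ProbabilityTheory

variable {n k m : ℕ} {T Λ R : ℝ}

lemma exists_joint {μ : Measure (Euc n)} [IsProbabilityMeasure μ] (W : Euc k →ₗᵢ[ℝ] Euc n) {β : ℝ}
    (h : Coup T k (μ.map (coiso W)) β) :
    ∃ Q : Measure (Euc n × Euc k), IsProbabilityMeasure Q ∧ Q.map Prod.fst = μ ∧
      (∀ θ : Euc k, ∫⁻ p, ENNReal.ofReal (Real.exp ⟪θ, p.2⟫) ∂Q ≤
        ENNReal.ofReal (Real.exp (‖θ‖ ^ 2 / T))) ∧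
      Q {p | ¬((k : ℝ) / 5 ≤ ⟪coiso W p.1, p.2⟫ ∧ ‖p.2‖ ≤ 10 * Real.sqrt k)} ≤ ENNReal.ofReal β := by
  obtain ⟨P, hP, hPf, hPe, hPg⟩ := h
  obtain ⟨Q, hQ, hQf, hQP⟩ := exists_lift_coupling (coiso W).continuous.measurable hPf
  have hq : Measurable (Prod.map (coiso W) (id : Euc k → Euc k)) :=
    (coiso W).continuous.measurable.prodMap measurable_id
  refine ⟨Q, hQ, hQf, fun θ => ?_, ?_⟩
  · have := hPe θ
    rw [← hQP, lintegral_map (by fun_prop) hq] at this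
    exact this
  · rw [← hQP, Measure.map_apply hq (measurableSet_goodPairs k k).compl] at hPg
    exact hPg

/-- Approximate relations between the projections of the `x i` produce, after decoupling, a large
sum of correlations between distinct points. -/
lemma exists_cross_sum_ge {x : Fin m → Euc n} {u : Fin m → Euc k} {q : Euc n →L[ℝ] Euc k}
    {G : Finset (Fin m)} (hG : m ≤ 4 * G.card) {t : Fin m → Fin m → ℝ} (ht0 : ∀ i, t i i = 0)
    (hΛ : 0 < Λ) (ht : ∀ i, ∑ j, |t i j| ≤ Λ)
    (hu : ∀ i ∈ G, (k : ℝ) / 5 ≤ ⟪q (x i), u i⟫ ∧ ‖u i‖ ≤ 10 * Real.sqrt k)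
    (hk : 10 * Real.sqrt k ≤ k / 10)
    (hrel : ∀ i ∈ G, ‖q (x i - ∑ j, t i j • x j)‖ ≤ 1) :
    ∃ (I J : Finset (Fin m)) (f : Fin m → Fin m), (∀ i ∈ I, f i ∉ I) ∧
      m * k / (160 * Λ) ≤ ∑ i ∈ I, memSign J i * ⟪q (x (f i)), u i⟫ := by
  classical
  let v : Fin m → Fin m → ℝ := fun i j => ⟪q (x j), u i⟫
  let b : Fin m → Fin m → ℝ := fun i j => if i ∈ G then |t i j| * |v i j| else 0
  have hb : ∀ i, b i i = 0 := fun i => by simp [b, ht0]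
  have hrow : ∀ i ∈ G, (k : ℝ) / 10 ≤ ∑ j, b i j := fun i hi => by
    have h1 : ⟪q (x i), u i⟫ = ⟪q (x i - ∑ j, t i j • x j), u i⟫ + ∑ j, t i j * v i j := by
      rw [map_sub, inner_sub_left, map_sum, sum_inner]
      simp only [map_smul, real_inner_smul_left, v]
      ring
    have h2 : ⟪q (x i - ∑ j, t i j • x j), u i⟫ ≤ k / 10 := by
      refine (real_inner_le_norm _ _).trans ?_
      refine le_trans (mul_le_mul (hrel i hi) (hu i hi).2 (norm_nonneg _) zero_le_one) ?_
      rw [one_mul]; exact hk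
    have h3 : ∑ j, t i j * v i j ≤ ∑ j, b i j := Finset.sum_le_sum fun j _ => by
      simp only [b, if_pos hi]
      rw [← abs_mul]; exact le_abs_self _
    have h4 := (hu i hi).1
    linarith
  have htot : (m : ℝ) * k / 40 ≤ ∑ i, ∑ j, b i j := by
    have h1 : ∑ i ∈ G, ∑ j, b i j ≤ ∑ i, ∑ j, b i j :=
      Finset.sum_le_sum_of_subset_of_nonneg (Finset.subset_univ G) fun i _ hi => by simp [b, hi]
    have h2 := Finset.card_nsmul_le_sum G _ _ hrow
    rw [nsmul_eq_mul] at h2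
    have h3 : (m : ℝ) ≤ 4 * G.card := by exact_mod_cast hG
    have h4 : (m : ℝ) * k ≤ 4 * G.card * k := mul_le_mul_of_nonneg_right h3 (Nat.cast_nonneg _)
    linarith
  obtain ⟨I, hI⟩ := exists_decoupling b hb
  rcases (Iᶜ).eq_empty_or_nonempty with h0 | hne
  · refine ⟨∅, ∅, id, by simp, ?_⟩
    rw [h0] at hI
    simp only [Finset.sum_empty, Finset.sum_const_zero, mul_zero] at hI ⊢
    exact div_nonpos_of_nonpos_of_nonneg (by linarith) (by positivity)
  choose f hf hmax using fun i => Finset.exists_max_image Iᶜ (fun j => |v i j|) hne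
  refine ⟨I, Finset.univ.filter fun i => 0 ≤ v i (f i), f, fun i _ => Finset.mem_compl.1 (hf i), ?_⟩
  have habs : ∀ i, memSign (Finset.univ.filter fun i => 0 ≤ v i (f i)) i * ⟪q (x (f i)), u i⟫ =
      |v i (f i)| := fun i => by
    change memSign _ i * v i (f i) = _
    by_cases h : 0 ≤ v i (f i)
    · simp [memSign, h, abs_of_nonneg]
    · simp [memSign, h, abs_of_neg (not_le.1 h)]
  simp only [habs]
  rw [div_le_iff₀ (by positivity)]
  have h5 : ∑ i ∈ I, ∑ j ∈ Iᶜ, b i j ≤ ∑ i ∈ I, |v i (f i)| * Λ := Finset.sum_le_sum fun i _ => by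
    by_cases hi : i ∈ G
    · simp only [b, if_pos hi]
      calc ∑ j ∈ Iᶜ, |t i j| * |v i j| ≤ ∑ j ∈ Iᶜ, |t i j| * |v i (f i)| :=
            Finset.sum_le_sum fun j hj => mul_le_mul_of_nonneg_left (hmax i j hj) (abs_nonneg _)
        _ ≤ ∑ j, |t i j| * |v i (f i)| := Finset.sum_le_sum_of_subset_of_nonneg (Finset.subset_univ _)
            fun _ _ _ => by positivity
        _ = (∑ j, |t i j|) * |v i (f i)| := by rw [Finset.sum_mul]
        _ ≤ _ := by rw [mul_comm]; exact mul_le_mul_of_nonneg_left (ht i) (abs_nonneg _)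
    · simp only [b, if_neg hi, Finset.sum_const_zero]; positivity
  rw [← Finset.sum_mul] at h5
  linarith

/-- The configurations in the ball of radius `R` half of whose points are, after projection by
`coiso W`, close to combinations of the others with coefficients of `ℓ₁` norm at most `Λ`. -/
def badSet (W : Euc k →ₗᵢ[ℝ] Euc n) (m : ℕ) (R Λ : ℝ) : Set (Fin m → Euc n) :=
  {x | (∀ j, ‖x j‖ ≤ R) ∧ ∃ (S : Finset (Fin m)) (t : Fin m → Fin m → ℝ), m ≤ 2 * S.card ∧
    (∀ i, t i i = 0) ∧ (∀ i, ∑ j, |t i j| ≤ Λ) ∧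
    ∀ i ∈ S, ‖coiso W (x i - ∑ j, t i j • x j)‖ ≤ 1}

lemma isClosed_badSet (W : Euc k →ₗᵢ[ℝ] Euc n) (m : ℕ) (R Λ : ℝ) : IsClosed (badSet W m R Λ) := by
  let K : Set (Fin m → Fin m → ℝ) := {t | (∀ i, t i i = 0) ∧ ∀ i, ∑ j, |t i j| ≤ Λ}
  have hKc : IsClosed K := by
    have h1 : IsClosed {t : Fin m → Fin m → ℝ | ∀ i, t i i = 0} := by
      simp only [ofPred_forall]
      exact isClosed_iInter fun i => isClosed_eq (by fun_prop) continuous_const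
    have h2 : IsClosed {t : Fin m → Fin m → ℝ | ∀ i, ∑ j, |t i j| ≤ Λ} := by
      simp only [ofPred_forall]
      exact isClosed_iInter fun i => isClosed_le (by fun_prop) continuous_const
    exact h1.inter h2
  have hKb : K ⊆ Set.pi univ fun _ => Set.pi univ fun _ => Icc (-Λ) Λ := by
    rintro t ⟨-, ht⟩ i - j -
    exact abs_le.1 ((Finset.single_le_sum (f := fun j => |t i j|) (fun j _ => abs_nonneg _)
      (Finset.mem_univ j)).trans (ht i))
  have hK : IsCompact K := IsCompact.of_isClosed_subset
    (isCompact_univ_pi fun _ => isCompact_univ_pi fun _ => isCompact_Icc) hKc hKb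
  have : CompactSpace K := isCompact_iff_compactSpace.1 hK
  have e : badSet W m R Λ = {x | ∀ j, ‖x j‖ ≤ R} ∩ ⋃ S ∈ {S : Finset (Fin m) | m ≤ 2 * S.card},
      Prod.snd '' {p : K × (Fin m → Euc n) |
        ∀ i ∈ S, ‖coiso W (p.2 i - ∑ j, p.1.1 i j • p.2 j)‖ ≤ 1} := by
    ext x
    simp only [badSet, mem_inter_iff, mem_iUnion, mem_image, mem_ofPred_eq, Prod.exists,
      exists_eq_right]
    refine and_congr_right fun _ => ⟨?_, ?_⟩
    · rintro ⟨S, t, h1, h2, h3, h4⟩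
      exact ⟨S, h1, ⟨t, h2, h3⟩, h4⟩
    · rintro ⟨S, h1, ⟨t, h2, h3⟩, h4⟩
      exact ⟨S, t, h1, h2, h3, h4⟩
  rw [e]
  refine IsClosed.inter ?_ ((Set.toFinite _).isClosed_biUnion fun S _ =>
    isClosedMap_snd_of_compactSpace _ ?_)
  · simp only [ofPred_forall]
    exact isClosed_iInter fun j => isClosed_le (by fun_prop) continuous_const
  · simp only [ofPred_forall]
    refine isClosed_biInter fun i _ => isClosed_le ?_ continuous_const
    have : Continuous fun p : K × (Fin m → Euc n) => p.2 i - ∑ j, p.1.1 i j • p.2 j := by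
      refine Continuous.sub (by fun_prop) (continuous_finsetSum _ fun j _ => ?_)
      have h1 : Continuous fun p : K × (Fin m → Euc n) => p.1.1 i j :=
        (continuous_apply_apply i j).comp (continuous_subtype_val.comp continuous_fst)
      exact h1.smul (by fun_prop)
    exact ((coiso W).continuous.comp this).norm

lemma measure_badSet_le {μ : Measure (Euc n)} [IsProbabilityMeasure μ] (W : Euc k →ₗᵢ[ℝ] Euc n)
    (hT : 0 < T) (h : Coup T k (μ.map (coiso W)) (1 / 256)) (hΛ : 0 < Λ)
    (hk : 10 * Real.sqrt k ≤ k / 10) {θ : ℝ} (hθ : 0 ≤ θ) :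
    (Measure.pi fun _ : Fin m => μ) (badSet W m R Λ) ≤ ENNReal.ofReal ((1 / 2) ^ m +
      (4 * m) ^ m * Real.exp (-(θ * (m * k / (160 * Λ))) + m * (θ ^ 2 * R ^ 2 / T))) := by
  classical
  obtain ⟨Q, hQ, hQf, hQe, hQg⟩ := exists_joint W h
  set F : Set (Euc n × Euc k) :=
    {p | ¬((k : ℝ) / 5 ≤ ⟪coiso W p.1, p.2⟫ ∧ ‖p.2‖ ≤ 10 * Real.sqrt k)} with hF
  have hmf : Measurable fun (ω : Fin m → Euc n × Euc k) i => (ω i).1 :=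
    measurable_pi_lambda _ fun i => measurable_fst.comp (measurable_pi_apply i)
  have hpi : (Measure.pi fun _ : Fin m => Q).map (fun ω i => (ω i).1) = Measure.pi fun _ : Fin m => μ := by
    have : ∀ i : Fin m, SigmaFinite (Q.map Prod.fst) := fun i => by rw [hQf]; infer_instance
    rw [Measure.pi_map_pi (fun i => measurable_fst.aemeasurable), hQf]
  rw [← hpi, Measure.map_apply hmf (isClosed_badSet W m R Λ).measurableSet]
  let E : Finset (Fin m) × Finset (Fin m) × (Fin m → Fin m) → Set (Fin m → Euc n × Euc k) := fun a =>
    {ω | (∀ i ∈ a.1, a.2.2 i ∉ a.1) ∧ (∀ j, ‖(ω j).1‖ ≤ R) ∧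
      m * k / (160 * Λ) ≤ ∑ i ∈ a.1, memSign a.2.1 i * ⟪coiso W (ω (a.2.2 i)).1, (ω i).2⟫}
  have hsub : (fun (ω : Fin m → Euc n × Euc k) i => (ω i).1) ⁻¹' badSet W m R Λ ⊆
      {ω | ∃ I : Finset (Fin m), m ≤ 4 * I.card ∧ ∀ i ∈ I, ω i ∈ F} ∪ ⋃ a, E a := by
    rintro ω ⟨hR, S, t, hS, ht0, ht, hrel⟩
    by_cases hfail : m ≤ 4 * (S.filter fun i => ω i ∈ F).card
    · exact Or.inl ⟨_, hfail, fun i hi => (Finset.mem_filter.1 hi).2⟩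
    right
    have hcard := Finset.card_filter_add_card_filter_not (s := S) (fun i => ω i ∈ F)
    obtain ⟨I, J, f, h1, h2⟩ := exists_cross_sum_ge (x := fun i => (ω i).1) (u := fun i => (ω i).2)
      (q := coiso W) (G := S.filter fun i => ¬ω i ∈ F) (t := t) (by omega) ht0 hΛ ht
      (fun i hi => not_not.1 (Finset.mem_filter.1 hi).2) hk
      (fun i hi => hrel i (Finset.mem_filter.1 hi).1)
    exact mem_iUnion.2 ⟨(I, J, f), h1, hR, h2⟩
  have hE : ∀ a, (Measure.pi fun _ : Fin m => Q) (E a) ≤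
      ENNReal.ofReal (Real.exp (-(θ * (m * k / (160 * Λ))) + m * (θ ^ 2 * R ^ 2 / T))) := by
    rintro ⟨I, J, f⟩
    by_cases hf : ∀ i ∈ I, f i ∉ I
    · refine (measure_mono ?_).trans (measure_cross_event_le hT hQe (norm_coiso_le W) hθ
        (σ := memSign J) (fun i => ?_) I f hf)
      · rintro ω ⟨-, h⟩; exact h
      · unfold memSign; split_ifs <;> simp
    · rw [show E (I, J, f) = ∅ from eq_empty_of_forall_notMem fun ω hω => hf hω.1]
      simp
  refine (measure_mono hsub).trans ((measure_union_le _ _).trans ?_)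
  rw [ENNReal.ofReal_add (by positivity) (by positivity)]
  refine add_le_add (measure_pi_many_le hQg) ?_
  refine (measure_iUnion_fintype_le _ _).trans ((Finset.sum_le_sum fun a _ => hE a).trans (le_of_eq ?_))
  rw [Finset.sum_const, nsmul_eq_mul, ENNReal.ofReal_mul (by positivity)]
  congr 1
  rw [← ENNReal.ofReal_natCast]
  congr 1
  simp only [Finset.card_univ, Fintype.card_prod, Fintype.card_finset, Fintype.card_fin, Fintype.card_fun]
  push_cast
  rw [mul_pow, ← mul_assoc, ← mul_pow]; norm_num

end fixedIsometry

section isometryNet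

open Filter Topology ProbabilityTheory

variable {n k m : ℕ}

/-- The entries of the matrix of `W`, rounded down to multiples of `1 / N`. -/
def isometryCode (N : ℕ) (W : Euc k →ₗᵢ[ℝ] Euc n) (i : Fin k) (j : Fin n) : Finset.Icc (-N : ℤ) N :=
  ⟨⌊N * W (EuclideanSpace.single i 1) j⌋, by
    have h : |W (EuclideanSpace.single i 1) j| ≤ 1 := by
      have := PiLp.norm_apply_le (W (EuclideanSpace.single i 1)) j
      rwa [W.norm_map, PiLp.norm_single, norm_one, Real.norm_eq_abs] at this
    obtain ⟨h1, h2⟩ := abs_le.1 h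
    have hN : (0 : ℝ) ≤ N := Nat.cast_nonneg _
    rw [Finset.mem_Icc]
    refine ⟨Int.le_floor.2 ?_, ?_⟩
    · push_cast; nlinarith
    · have h3 := Int.floor_le ((N : ℝ) * W (EuclideanSpace.single i 1) j)
      have h4 : ((⌊(N : ℝ) * W (EuclideanSpace.single i 1) j⌋ : ℤ) : ℝ) ≤ ((N : ℤ) : ℝ) := by
        push_cast; nlinarith
      exact_mod_cast h4⟩

lemma eq_sum_smul_stdE {d : ℕ} (y : Euc d) : y = ∑ i, y i • stdE i := by
  simpa using ((EuclideanSpace.basisFun (Fin d) ℝ).sum_repr y).symm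

lemma norm_le_sum_abs {d : ℕ} (y : Euc d) : ‖y‖ ≤ ∑ i, |y i| := by
  conv_lhs => rw [eq_sum_smul_stdE y]
  refine (norm_sum_le _ _).trans_eq (Finset.sum_congr rfl fun i _ => ?_)
  simp [norm_smul]

lemma norm_sub_le_of_isometryCode_eq {N : ℕ} (hN : 0 < N) {W W' : Euc k →ₗᵢ[ℝ] Euc n}
    (h : isometryCode N W = isometryCode N W') (y : Euc k) :
    ‖W y - W' y‖ ≤ k * n / N * ‖y‖ := by
  have hN' : (0 : ℝ) < N := by exact_mod_cast hN
  have h1 : ∀ i j, |W (EuclideanSpace.single i 1) j - W' (EuclideanSpace.single i 1) j| ≤ 1 / N :=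
    fun i j => by
      have h2 : ⌊(N : ℝ) * W (EuclideanSpace.single i 1) j⌋ = ⌊(N : ℝ) * W' (EuclideanSpace.single i 1) j⌋ :=
        congrArg Subtype.val (congrFun (congrFun h i) j)
      have h3 := Int.abs_sub_lt_one_of_floor_eq_floor h2
      rw [← mul_sub, abs_mul, abs_of_pos hN'] at h3
      rw [le_div_iff₀ hN', mul_comm]; exact h3.le
  have h2 : ∀ i, ‖W (EuclideanSpace.single i 1) - W' (EuclideanSpace.single i 1)‖ ≤ n / N := fun i => by
    refine (norm_le_sum_abs _).trans ?_
    refine (Finset.sum_le_sum fun j _ => h1 i j).trans_eq ?_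
    simp [div_eq_mul_inv]
  have h3 : W y - W' y = ∑ i, y i • (W (EuclideanSpace.single i 1) - W' (EuclideanSpace.single i 1)) := by
    conv_lhs => rw [eq_sum_smul_stdE y]
    simp only [map_sum, map_smul, smul_sub, Finset.sum_sub_distrib]
  rw [h3]
  calc _ ≤ ∑ i, ‖y i • (W (EuclideanSpace.single i 1) - W' (EuclideanSpace.single i 1))‖ :=
        norm_sum_le _ _
    _ ≤ ∑ _i : Fin k, ‖y‖ * (n / N) := Finset.sum_le_sum fun i _ => by
        rw [norm_smul]
        exact mul_le_mul (PiLp.norm_apply_le y i) (h2 i) (norm_nonneg _) (norm_nonneg _)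
    _ = _ := by simp; ring

lemma exists_isometry_net {N : ℕ} (hN : 0 < N) : ∃ 𝒲 : Finset (Euc k →ₗᵢ[ℝ] Euc n),
    𝒲.card ≤ (2 * N + 1) ^ (n * k) ∧
    ∀ W : Euc k →ₗᵢ[ℝ] Euc n, ∃ W' ∈ 𝒲, ∀ x, ‖coiso W x - coiso W' x‖ ≤ k * n / N * ‖x‖ := by
  classical
  rcases isEmpty_or_nonempty (Euc k →ₗᵢ[ℝ] Euc n) with h | h
  · exact ⟨∅, by simp, fun W => h.elim W⟩
  refine ⟨Finset.univ.image (Function.invFun (isometryCode (k := k) (n := n) N)), ?_, fun W => ?_⟩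
  · refine Finset.card_image_le.trans (le_of_eq ?_)
    rw [Finset.card_univ, Fintype.card_fun, Fintype.card_fun, Fintype.card_coe, Int.card_Icc,
      Fintype.card_fin, Fintype.card_fin, pow_mul]
    congr 2
    omega
  · refine ⟨Function.invFun (isometryCode N) (isometryCode N W),
      Finset.mem_image_of_mem _ (Finset.mem_univ _), fun x => ?_⟩
    have hc : isometryCode N (Function.invFun (isometryCode N) (isometryCode N W)) = isometryCode N W :=
      Function.invFun_eq ⟨W, rfl⟩
    generalize Function.invFun (isometryCode N) (isometryCode N W) = W' at hc
    have h1 : ‖coiso W x - coiso W' x‖ ^ 2 ≤ k * n / N * ‖coiso W x - coiso W' x‖ * ‖x‖ := by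
      rw [← real_inner_self_eq_norm_sq]
      conv_lhs => rw [inner_sub_right, inner_coiso, inner_coiso, ← inner_sub_left]
      exact (real_inner_le_norm _ _).trans (mul_le_mul_of_nonneg_right
        (norm_sub_le_of_isometryCode_eq hN hc.symm _) (norm_nonneg _))
    rcases (norm_nonneg (coiso W x - coiso W' x)).eq_or_lt with h0 | h0
    · rw [← h0]; positivity
    · refine le_of_mul_le_mul_left ?_ h0
      nlinarith

/-- Exact relations for an arbitrary isometry become approximate ones for a member of the net. -/
lemma measure_exists_relations_le {μ : Measure (Euc n)} {R Λ : ℝ} {N : ℕ} (hN : 0 < N)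
    (hR : 0 ≤ R) (hsmall : (k * n / N : ℝ) * ((1 + Λ) * R) ≤ 1) {B : ℝ}
    (hB : ∀ W : Euc k →ₗᵢ[ℝ] Euc n, (Measure.pi fun _ : Fin m => μ) (badSet W m R Λ) ≤
      ENNReal.ofReal B) :
    (Measure.pi fun _ : Fin m => μ) {x | (∀ j, ‖x j‖ ≤ R) ∧
      ∃ (W : Euc k →ₗᵢ[ℝ] Euc n) (S : Finset (Fin m)) (t : Fin m → Fin m → ℝ), m ≤ 2 * S.card ∧
      (∀ i, t i i = 0) ∧ (∀ i, ∑ j, |t i j| ≤ Λ) ∧ ∀ i ∈ S, coiso W (x i - ∑ j, t i j • x j) = 0} ≤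
      ENNReal.ofReal ((2 * N + 1) ^ (n * k) * B) := by
  obtain ⟨𝒲, hcard, hnet⟩ := exists_isometry_net (k := k) (n := n) hN
  refine (measure_mono (t := ⋃ W ∈ 𝒲, badSet W m R Λ) ?_).trans ?_
  · rintro x ⟨hx, W, S, t, hS, ht0, ht, hrel⟩
    obtain ⟨W', hW', hd⟩ := hnet W
    refine mem_iUnion₂.2 ⟨W', hW', hx, S, t, hS, ht0, ht, fun i hi => ?_⟩
    have h1 := hd (x i - ∑ j, t i j • x j)
    rw [hrel i hi, zero_sub, norm_neg] at h1
    refine h1.trans (le_trans (mul_le_mul_of_nonneg_left ?_ (by positivity)) hsmall)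
    calc ‖x i - ∑ j, t i j • x j‖ ≤ ‖x i‖ + ∑ j, ‖t i j • x j‖ :=
          (norm_sub_le _ _).trans (add_le_add le_rfl (norm_sum_le _ _))
      _ ≤ R + ∑ j, |t i j| * R := by
          refine add_le_add (hx i) (Finset.sum_le_sum fun j _ => ?_)
          rw [norm_smul, Real.norm_eq_abs]
          exact mul_le_mul_of_nonneg_left (hx j) (abs_nonneg _)
      _ ≤ (1 + Λ) * R := by
          rw [← Finset.sum_mul, add_mul, one_mul]
          exact add_le_add le_rfl (mul_le_mul_of_nonneg_right (ht i) hR)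
  · refine (measure_biUnion_finset_le _ _).trans ((Finset.sum_le_sum fun W _ => hB W).trans ?_)
    rw [Finset.sum_const, nsmul_eq_mul, ENNReal.ofReal_mul (by positivity), ← ENNReal.ofReal_natCast]
    refine mul_le_mul' (ENNReal.ofReal_le_ofReal ?_) le_rfl
    exact_mod_cast hcard

end isometryNet

section span

open Filter Topology

variable {n m : ℕ} {μ : Measure (Euc n)}

lemma ae_linearIndependent [IsProbabilityMeasure μ] (hμ : μ ≪ volume) (hm : m ≤ n) :
    ∀ᵐ x ∂(Measure.pi fun _ : Fin m => μ), LinearIndependent ℝ x := by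
  induction m with
  | zero => exact Eventually.of_forall fun x => linearIndependent_empty_type
  | succ m ih =>
    let s : Set (Euc n × (Fin m → Euc n)) :=
      {p | ¬LinearIndependent ℝ (Fin.cons p.1 p.2 : Fin (m + 1) → Euc n)}
    have hs : MeasurableSet s := by
      have hc : Continuous fun p : Euc n × (Fin m → Euc n) => (Fin.cons p.1 p.2 : Fin (m + 1) → Euc n) :=
        continuous_pi fun i => by
          refine Fin.cases ?_ (fun j => ?_) i
          · exact continuous_fst
          · exact (continuous_apply j).comp continuous_snd
      exact ((isOpen_setOfPred_linearIndependent (𝕜 := ℝ)).preimage hc).measurableSet.compl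
    have h0 : (μ.prod (Measure.pi fun _ : Fin m => μ)) s = 0 := by
      rw [Measure.prod_apply_symm hs, lintegral_eq_zero_iff (measurable_measure_prodMk_right hs)]
      filter_upwards [ih (by omega)] with v hv
      have hne : Submodule.span ℝ (range v) ≠ ⊤ := fun h => by
        have h1 := finrank_span_eq_card hv
        rw [h, finrank_top, finrank_euclideanSpace_fin, Fintype.card_fin] at h1
        omega
      refine measure_mono_null (t := (Submodule.span ℝ (range v) : Set (Euc n))) (fun a ha => ?_)
        (hμ (Measure.addHaar_submodule volume _ hne))
      by_contra hav
      exact ha (linearIndependent_finCons.2 ⟨hv, hav⟩)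
    have hmp := measurePreserving_piFinSuccAbove (fun _ : Fin (m + 1) => μ) 0
    have h1 := hmp.quasiMeasurePreserving.ae (p := fun p => p ∉ s) (measure_eq_zero_iff_ae_notMem.1 h0)
    filter_upwards [h1] with x hx
    have hx' := not_not.1 hx
    convert hx' using 1
    exact (Fin.cons_self_tail x).symm

lemma ae_span_eq_top [IsProbabilityMeasure μ] (hμ : μ ≪ volume) (hm : n ≤ m) :
    ∀ᵐ x ∂(Measure.pi fun _ : Fin m => μ), Submodule.span ℝ (range x) = ⊤ := by
  induction m, hm using Nat.le_induction with
  | base =>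
    filter_upwards [ae_linearIndependent hμ le_rfl] with x hx
    exact hx.span_eq_top_of_card_eq_finrank' (by simp)
  | succ m _ ih =>
    have hmp := measurePreserving_piFinSuccAbove (fun _ : Fin (m + 1) => μ) 0
    have h1 := (Measure.quasiMeasurePreserving_snd.comp hmp.quasiMeasurePreserving).ae ih
    filter_upwards [h1] with x hx
    rw [eq_top_iff, ← hx]
    refine Submodule.span_mono ?_
    rintro _ ⟨j, rfl⟩
    exact ⟨Fin.succAbove 0 j, rfl⟩

end span

section conclusion

open Filter Topology ProbabilityTheory

variable {n m : ℕ}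

lemma le_exp_two_mul_log (hn : 0 < n) (hm : n ^ 2 ≤ m) :
    (m : ℝ) ≤ Real.exp (2 * Real.log (1 + m / n)) := by
  have hn' : (0 : ℝ) < n := by exact_mod_cast hn
  have hm' : (n : ℝ) ^ 2 ≤ m := by exact_mod_cast hm
  have h0 : (0 : ℝ) < 1 + m / n := by positivity
  rw [mul_comm, Real.exp_mul, Real.exp_log h0]
  have h1 : ((m : ℝ) / n) ^ 2 ≤ (1 + m / n) ^ 2 :=
    pow_le_pow_left₀ (by positivity) (by linarith) 2
  have h2 : (m : ℝ) ≤ (m / n) ^ 2 := by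
    rw [div_pow, le_div_iff₀ (by positivity), sq (m : ℝ)]
    exact mul_le_mul_of_nonneg_left hm' (Nat.cast_nonneg _)
  exact_mod_cast h2.trans h1

lemma one_le_of_le_exp_two_mul {l : ℝ} (hm : 8 ≤ m) (h : (m : ℝ) ≤ Real.exp (2 * l)) : 1 ≤ l := by
  have h1 : Real.exp 2 ≤ Real.exp (2 * l) := by
    refine le_trans ?_ h
    have h2 : (8 : ℝ) ≤ m := by exact_mod_cast hm
    refine le_trans ?_ h2
    have h3 := Real.exp_one_lt_d9
    have h4 : Real.exp 2 = Real.exp 1 ^ 2 := by rw [← Real.exp_nat_mul]; norm_num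
    rw [h4]
    nlinarith [Real.exp_pos 1]
  have := Real.exp_le_exp.1 h1
  linarith

lemma measure_badSet_le_pow {k : ℕ} {μ : Measure (Euc n)} [IsProbabilityMeasure μ]
    (W : Euc k →ₗᵢ[ℝ] Euc n) {T A l : ℝ} (hT : 0 < T) (hA : 0 < A)
    (h : Coup T k (μ.map (coiso W)) (1 / 256)) (hk : 10 * Real.sqrt k ≤ k / 10) (hn : 0 < n)
    (hnk : n ≤ 4 * k) (hm : 8 ≤ m) (hl : 1 ≤ l) (hml : (m : ℝ) ≤ Real.exp (2 * l)) :
    (Measure.pi fun _ : Fin m => μ) (badSet W m (A * Real.sqrt n)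
      (2 * (Real.sqrt T / (15360 * A) * Real.sqrt n / Real.sqrt l))) ≤
      ENNReal.ofReal (2 * (1 / 2) ^ m) := by
  have hn' : (0 : ℝ) < n := by exact_mod_cast hn
  have hm' : (8 : ℝ) ≤ m := by exact_mod_cast hm
  have hnk' : (n : ℝ) ≤ 4 * k := by exact_mod_cast hnk
  have hl0 : 0 < l := by linarith
  have hsn : 0 < Real.sqrt n := Real.sqrt_pos.2 hn'
  have hsl : 0 < Real.sqrt l := Real.sqrt_pos.2 hl0
  have hsT : 0 < Real.sqrt T := Real.sqrt_pos.2 hT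
  set Λ : ℝ := 2 * (Real.sqrt T / (15360 * A) * Real.sqrt n / Real.sqrt l) with hΛdef
  have hΛ : 0 < Λ := by positivity
  set θ : ℝ := Real.sqrt T * Real.sqrt l / (A * Real.sqrt n) with hθdef
  have hθ : 0 ≤ θ := by positivity
  refine (measure_badSet_le W hT h hΛ hk hθ).trans (ENNReal.ofReal_le_ofReal ?_)
  have e1 : θ ^ 2 * (A * Real.sqrt n) ^ 2 / T = l := by
    rw [hθdef, div_pow, div_mul_cancel₀ _ (by positivity), mul_pow, Real.sq_sqrt hT.le,
      Real.sq_sqrt hl0.le]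
    field_simp
  have e2 : θ * (m * k / (160 * Λ)) = 48 * l * m * (k / n) := by
    rw [hθdef, hΛdef]
    have h1 : Real.sqrt n * Real.sqrt n = n := Real.mul_self_sqrt hn'.le
    have h2 : Real.sqrt l * Real.sqrt l = l := Real.mul_self_sqrt hl0.le
    calc _ = 48 * (Real.sqrt l * Real.sqrt l) * m * (k / (Real.sqrt n * Real.sqrt n)) := by
          field_simp; ring
      _ = _ := by rw [h1, h2]
  have e3 : (1 : ℝ) / 4 ≤ k / n := by rw [le_div_iff₀ hn']; linarith
  have hexp : -(θ * (m * k / (160 * Λ))) + m * (θ ^ 2 * (A * Real.sqrt n) ^ 2 / T) ≤ m * (-(4 * l)) := by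
    rw [e1, e2]
    have h1 : 48 * l * m * (1 / 4) ≤ 48 * l * m * (k / n) :=
      mul_le_mul_of_nonneg_left e3 (by positivity)
    have h2 : 0 ≤ l * m := by positivity
    nlinarith
  have hsmall : 4 * m * Real.exp (-(4 * l)) ≤ 1 / 2 := by
    rw [Real.exp_neg, show 4 * l = ((2 : ℕ) : ℝ) * (2 * l) by push_cast; ring, Real.exp_nat_mul,
      ← div_eq_mul_inv, div_le_iff₀ (by positivity)]
    have h1 : (m : ℝ) ^ 2 ≤ Real.exp (2 * l) ^ 2 := pow_le_pow_left₀ (by positivity) hml 2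
    nlinarith
  calc (1 / 2 : ℝ) ^ m + (4 * m) ^ m * Real.exp (-(θ * (m * k / (160 * Λ))) +
        m * (θ ^ 2 * (A * Real.sqrt n) ^ 2 / T)) ≤
        (1 / 2) ^ m + (4 * m) ^ m * Real.exp (m * (-(4 * l))) := by gcongr
    _ = (1 / 2) ^ m + (4 * m * Real.exp (-(4 * l))) ^ m := by rw [Real.exp_nat_mul, ← mul_pow]
    _ ≤ (1 / 2) ^ m + (1 / 2) ^ m := by gcongr
    _ = _ := by ring

/-- The net over the isometries is beaten by the individual probabilities. -/
lemma net_card_mul_le {k : ℕ} (hn : 3 ≤ n) (hk : k ≤ n) (hm : 20 * (n : ℝ) ^ 2 * Real.log n ≤ m) :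
    (2 * ((n ^ 4 : ℕ) : ℝ) + 1) ^ (n * k) * (2 * (1 / 2) ^ m) ≤ Real.exp (-Real.sqrt n) := by
  have hn' : (3 : ℝ) ≤ n := by exact_mod_cast hn
  have hlog : 1 ≤ Real.log n := by
    rw [Real.le_log_iff_exp_le (by linarith)]
    linarith [Real.exp_one_lt_d9]
  have h1 : 2 * ((n ^ 4 : ℕ) : ℝ) + 1 ≤ (n : ℝ) ^ 5 := by
    push_cast
    have : (1 : ℝ) ≤ (n : ℝ) ^ 4 := one_le_pow₀ (by linarith)
    nlinarith
  have h2 : (2 * ((n ^ 4 : ℕ) : ℝ) + 1) ^ (n * k) ≤ Real.exp (5 * n ^ 2 * Real.log n) := by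
    calc (2 * ((n ^ 4 : ℕ) : ℝ) + 1) ^ (n * k) ≤ ((n : ℝ) ^ 5) ^ (n * k) := by gcongr
      _ ≤ ((n : ℝ) ^ 5) ^ (n * n) :=
          pow_le_pow_right₀ (one_le_pow₀ (by linarith)) (Nat.mul_le_mul_left n hk)
      _ = Real.exp (5 * n ^ 2 * Real.log n) := by
          rw [← pow_mul, show 5 * (n : ℝ) ^ 2 * Real.log n = ((5 * (n * n) : ℕ) : ℝ) * Real.log n by
            push_cast; ring, Real.exp_nat_mul, Real.exp_log (by linarith)]
  have h3 : (2 : ℝ) * (1 / 2) ^ m ≤ Real.exp (1 - m / 2) := by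
    have ha : (2 : ℝ) ≤ Real.exp 1 := by linarith [Real.exp_one_gt_d9]
    have hb : (1 / 2 : ℝ) ≤ Real.exp (-(1 / 2)) := by
      have := Real.add_one_le_exp (-(1 / 2) : ℝ)
      linarith
    calc (2 : ℝ) * (1 / 2) ^ m ≤ Real.exp 1 * Real.exp (-(1 / 2)) ^ m := by gcongr
      _ = _ := by rw [← Real.exp_nat_mul, ← Real.exp_add]; congr 1; ring
  refine (mul_le_mul h2 h3 (by positivity) (by positivity)).trans ?_
  rw [← Real.exp_add, Real.exp_le_exp]
  have h4 : Real.sqrt n ≤ n := by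
    rw [Real.sqrt_le_left (by linarith)]; nlinarith
  have h5 : (n : ℝ) ≤ n ^ 2 * Real.log n := by nlinarith
  nlinarith

lemma one_le_basisConstant {x : Fin m → Euc 1} (hK : absConv 1 (range x) ∈ 𝓝 (0 : Euc 1)) :
    1 ≤ basisConstant 1 (absConv 1 (range x)) := by
  set K := absConv 1 (range x) with hKdef
  refine le_csInf ⟨1, one_pos, (EuclideanSpace.basisFun (Fin 1) ℝ).toBasis, fun k hk lam => ?_⟩ ?_
  · rw [one_mul]
    interval_cases k
    · simp [gauge_nonneg]
    · simp
  · rintro c ⟨hc, b, hb⟩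
    have h1 := hb 1 le_rfl fun _ => 1
    have h2 : Finset.univ.filter (fun i : Fin 1 => (i : ℕ) < 1) = Finset.univ := by ext i; simp
    rw [h2] at h1
    simp only [Finset.univ_unique, Finset.sum_singleton, one_smul] at h1
    obtain ⟨R, hR0, hR⟩ := exists_norm_le (x := x)
    have h3 : ‖b default‖ / R ≤ gauge K (b default) :=
      le_gauge_of_subset_closedBall (absorbent_nhds_zero hK) hR0.le (absConv_subset_closedBall hR)
    have h4 : 0 < gauge K (b default) :=
      lt_of_lt_of_le (div_pos (norm_pos_iff.2 (b.ne_zero _)) hR0) h3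
    exact le_of_mul_le_mul_right (by rwa [one_mul]) h4

lemma measure_exists_norm_gt_le {μ : Measure (Euc n)} [IsProbabilityMeasure μ] {R p : ℝ}
    (h : μ {x | R < ‖x‖} ≤ ENNReal.ofReal p) :
    (Measure.pi fun _ : Fin m => μ) {x | ∃ j, R < ‖x j‖} ≤ ENNReal.ofReal (m * p) := by
  have e : {x : Fin m → Euc n | ∃ j, R < ‖x j‖} = ⋃ j, Function.eval j ⁻¹' {x | R < ‖x‖} := by
    ext x; simp
  rw [e]
  refine (measure_iUnion_fintype_le _ _).trans ?_
  have h1 : ∀ j : Fin m, (Measure.pi fun _ : Fin m => μ) (Function.eval j ⁻¹' {x | R < ‖x‖}) ≤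
      ENNReal.ofReal p := fun j => by
    rw [(measurePreserving_eval (fun _ : Fin m => μ) j).measure_preimage
      (measurableSet_lt measurable_const measurable_norm).nullMeasurableSet]
    exact h
  refine (Finset.sum_le_sum fun j _ => h1 j).trans (le_of_eq ?_)
  rw [Finset.sum_const, Finset.card_univ, Fintype.card_fin, nsmul_eq_mul,
    ENNReal.ofReal_mul (Nat.cast_nonneg _), ENNReal.ofReal_natCast]

lemma ofReal_one_sub_le_of_compl_le {Ω : Type*} [MeasurableSpace Ω] {P : Measure Ω}
    [IsProbabilityMeasure P] {s : Set Ω} {p : ℝ} (hp : 0 ≤ p) (h : P sᶜ ≤ ENNReal.ofReal p) :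
    ENNReal.ofReal (1 - p) ≤ P s := by
  rw [ENNReal.ofReal_sub _ hp, ENNReal.ofReal_one, tsub_le_iff_right]
  calc (1 : ℝ≥0∞) = P univ := measure_univ.symm
    _ ≤ P s + P sᶜ := by rw [← union_compl_self s]; exact measure_union_le _ _
    _ ≤ _ := add_le_add le_rfl h

lemma IsIsotropicLogConcave.absolutelyContinuous {μ : Measure (Euc n)} (h : IsIsotropicLogConcave n μ) :
    μ ≪ volume := by
  obtain ⟨f, -, -, hμ, -⟩ := h
  rw [hμ]
  exact withDensity_absolutelyContinuous _ _

end conclusion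

section conclusion

open Filter Topology ProbabilityTheory

variable {n m : ℕ}

/-- In high dimension all projections of proportional rank have large norm, up to a small
probability. -/
lemma measure_compl_projections_le {μ : Measure (Euc n)} (hμ : IsIsotropicLogConcave n μ) {T A : ℝ}
    (hT : 0 < T) (hA : 0 < A)
    (hcoup : ∀ W : Euc ((n + 3) / 4) →ₗᵢ[ℝ] Euc n, Coup T ((n + 3) / 4) (μ.map (coiso W)) (1 / 256))
    (htail : μ {x | A * Real.sqrt n < ‖x‖} ≤ ENNReal.ofReal (Real.exp (-2 * Real.sqrt n)))
    (hn : 40000 ≤ n) (hnA : (1 + 2 * (Real.sqrt T / (15360 * A))) * A ≤ n)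
    (hm : 20 * (n : ℝ) ^ 2 * Real.log n ≤ m) (hm' : (m : ℝ) ≤ Real.exp (Real.sqrt n)) :
    (Measure.pi fun _ : Fin m => μ) {x | Submodule.span ℝ (range x) = ⊤ ∧
      ∀ P : Euc n →ₗ[ℝ] Euc n, P ∘ₗ P = P →
        (n : ℝ) / 4 ≤ (Module.finrank ℝ (LinearMap.range P) : ℝ) →
        (Module.finrank ℝ (LinearMap.range P) : ℝ) ≤ 3 * n / 4 →
        Real.sqrt T / (15360 * A) * Real.sqrt n / Real.sqrt (Real.log (1 + (m : ℝ) / n)) ≤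
          bodyOpNorm n (absConv n (range x)) (absConv n (range x)) P}ᶜ ≤
      ENNReal.ofReal (Real.exp (-(1 / 2) * Real.sqrt n)) := by
  have hprob := hμ.iso.prob
  have hnR : (40000 : ℝ) ≤ n := by exact_mod_cast hn
  have hlog : 1 ≤ Real.log n := by
    rw [Real.le_log_iff_exp_le (by linarith)]
    linarith [Real.exp_one_lt_d9]
  have hmn : n ^ 2 ≤ m := by
    have h1 : (n : ℝ) ^ 2 ≤ m := by nlinarith [sq_nonneg (n : ℝ)]
    exact_mod_cast h1
  have hm8 : 8 ≤ m := by nlinarith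
  have hnm : n ≤ m := by nlinarith
  have hml := le_exp_two_mul_log (by omega) hmn
  have hl := one_le_of_le_exp_two_mul hm8 hml
  set l := Real.log (1 + (m : ℝ) / n) with hldef
  set k := (n + 3) / 4 with hkdef
  set c := Real.sqrt T / (15360 * A) with hcdef
  have hc : 0 < c := div_pos (Real.sqrt_pos.2 hT) (by positivity)
  have hsn : 0 ≤ Real.sqrt n := Real.sqrt_nonneg _
  have hkn : k ≤ n := by omega
  have hnk : n ≤ 4 * k := by omega
  have hkR : (10000 : ℝ) ≤ k := by
    have : 10000 ≤ k := by omega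
    exact_mod_cast this
  have hk : 10 * Real.sqrt k ≤ k / 10 := by
    have h1 : (100 : ℝ) ≤ Real.sqrt k := Real.le_sqrt_of_sq_le (by linarith)
    have h2 : Real.sqrt k * Real.sqrt k = k := Real.mul_self_sqrt (by linarith)
    nlinarith
  have hΛ : c * Real.sqrt n / Real.sqrt l ≤ c * Real.sqrt n :=
    div_le_self (by positivity) (Real.one_le_sqrt.2 hl)
  have hsmall : ((k : ℝ) * n / (n ^ 4 : ℕ)) * ((1 + 2 * (c * Real.sqrt n / Real.sqrt l)) *
      (A * Real.sqrt n)) ≤ 1 := by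
    have h1 : Real.sqrt n * Real.sqrt n = n := Real.mul_self_sqrt (by linarith)
    have h2 : (1 : ℝ) ≤ Real.sqrt n := Real.one_le_sqrt.2 (by linarith)
    have h3 : (1 + 2 * (c * Real.sqrt n / Real.sqrt l)) * (A * Real.sqrt n) ≤ n * n := by
      calc _ ≤ ((1 + 2 * c) * Real.sqrt n) * (A * Real.sqrt n) := by
            refine mul_le_mul_of_nonneg_right ?_ (by positivity)
            nlinarith
        _ = (1 + 2 * c) * A * (Real.sqrt n * Real.sqrt n) := by ring
        _ ≤ n * n := by rw [h1]; exact mul_le_mul_of_nonneg_right hnA (Nat.cast_nonneg _)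
    have h4 : (k : ℝ) ≤ n := by exact_mod_cast hkn
    calc _ ≤ ((n : ℝ) * n / (n ^ 4 : ℕ)) * (n * n) := by gcongr
      _ = 1 := by push_cast; field_simp
  have hrel := measure_exists_relations_le (m := m) (N := n ^ 4) (by positivity) (by positivity) hsmall
    fun W => measure_badSet_le_pow W hT hA (hcoup W) hk (by omega) hnk hm8 hl hml
  have hnorm := measure_exists_norm_gt_le (m := m) htail
  have hspan := ae_span_eq_top hμ.absolutelyContinuous hnm
  rw [ae_iff] at hspan
  refine (measure_mono (t := {x | ¬Submodule.span ℝ (range x) = ⊤} ∪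
    ({x | ∃ j, A * Real.sqrt n < ‖x j‖} ∪ {x | (∀ j, ‖x j‖ ≤ A * Real.sqrt n) ∧
      ∃ (W : Euc k →ₗᵢ[ℝ] Euc n) (S : Finset (Fin m)) (t : Fin m → Fin m → ℝ), m ≤ 2 * S.card ∧
      (∀ i, t i i = 0) ∧ (∀ i, ∑ j, |t i j| ≤ 2 * (c * Real.sqrt n / Real.sqrt l)) ∧
      ∀ i ∈ S, coiso W (x i - ∑ j, t i j • x j) = 0})) ?_).trans ?_
  · intro x hx
    by_cases h1 : Submodule.span ℝ (range x) = ⊤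
    swap
    · exact Or.inl h1
    by_cases h2 : ∃ j, A * Real.sqrt n < ‖x j‖
    · exact Or.inr (Or.inl h2)
    refine Or.inr (Or.inr ⟨fun j => not_lt.1 fun h => h2 ⟨j, h⟩, ?_⟩)
    by_contra h3
    refine hx ⟨h1, fun P hP hr1 hr2 => ?_⟩
    by_contra h4
    exact h3 (exists_relations hP hr1 hr2 fun i =>
      exists_coeff_of_bodyOpNorm_lt (absConv_mem_nhds (by omega) h1) (not_le.1 h4) i)
  · refine (measure_union_le _ _).trans ?_
    rw [hspan, zero_add]
    refine (measure_union_le _ _).trans ((add_le_add hnorm hrel).trans ?_)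
    rw [← ENNReal.ofReal_add (by positivity) (by positivity)]
    refine ENNReal.ofReal_le_ofReal ?_
    have h1 : (m : ℝ) * Real.exp (-2 * Real.sqrt n) ≤ Real.exp (-Real.sqrt n) := by
      refine (mul_le_mul_of_nonneg_right hm' (Real.exp_nonneg _)).trans_eq ?_
      rw [← Real.exp_add]; congr 1; ring
    have h2 := net_card_mul_le (by omega) hkn hm
    have h3 : 2 ≤ Real.exp (1 / 2 * Real.sqrt n) := by
      have h4 : (2 : ℝ) ≤ Real.sqrt n := Real.le_sqrt_of_sq_le (by linarith)
      linarith [Real.add_one_le_exp (1 / 2 * Real.sqrt n)]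
    have h5 : Real.exp (-(1 / 2) * Real.sqrt n) =
        Real.exp (1 / 2 * Real.sqrt n) * Real.exp (-Real.sqrt n) := by
      rw [← Real.exp_add]; congr 1; ring
    rw [h5]
    nlinarith [Real.exp_pos (-Real.sqrt n)]

lemma ofReal_le_measure_dim_one {μ : Measure (Euc 1)} (hμ : IsIsotropicLogConcave 1 μ) (m : ℕ)
    (c₁ p : ℝ) {c₃ : ℝ} (hc₃ : c₃ ≤ 1 / 2) (hp : 0 ≤ p) :
    ENNReal.ofReal (1 - p) ≤ (Measure.pi fun _ : Fin m => μ) {x : Fin m → Euc 1 |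
      (∀ P : Euc 1 →ₗ[ℝ] Euc 1, P ∘ₗ P = P →
        ((1 : ℕ) : ℝ) / 4 ≤ (Module.finrank ℝ (LinearMap.range P) : ℝ) →
        (Module.finrank ℝ (LinearMap.range P) : ℝ) ≤ 3 * ((1 : ℕ) : ℝ) / 4 →
        c₁ * Real.sqrt ((1 : ℕ) : ℝ) / Real.sqrt (Real.log (1 + (m : ℝ) / ((1 : ℕ) : ℝ))) ≤
          bodyOpNorm 1 (absConv 1 (range x)) (absConv 1 (range x)) P) ∧
      c₃ * Real.sqrt ((1 : ℕ) : ℝ) / Real.sqrt (Real.log (1 + (m : ℝ) / ((1 : ℕ) : ℝ))) ≤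
        basisConstant 1 (absConv 1 (range x))} := by
  have hprob := hμ.iso.prob
  refine ofReal_one_sub_le_of_compl_le hp (le_trans (le_of_eq ?_) bot_le)
  have hP : ∀ P : Euc 1 →ₗ[ℝ] Euc 1,
      ((1 : ℕ) : ℝ) / 4 ≤ (Module.finrank ℝ (LinearMap.range P) : ℝ) →
      (Module.finrank ℝ (LinearMap.range P) : ℝ) ≤ 3 * ((1 : ℕ) : ℝ) / 4 → False := by
    intro P h1 h2
    rcases Nat.eq_zero_or_pos (Module.finrank ℝ (LinearMap.range P)) with h | h
    · rw [h] at h1; norm_num at h1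
    · have : (1 : ℝ) ≤ Module.finrank ℝ (LinearMap.range P) := by exact_mod_cast h
      norm_num at h2; linarith
  rcases Nat.eq_zero_or_pos m with rfl | hm
  · refine measure_mono_null (t := ∅) (fun x hx => hx ⟨fun P _ h1 h2 => (hP P h1 h2).elim, ?_⟩)
      measure_empty
    simp only [Nat.cast_zero, zero_div, add_zero, Real.log_one, Real.sqrt_zero, div_zero]
    exact Real.sInf_nonneg fun c hc => hc.1.le
  · have hspan := ae_span_eq_top hμ.absolutelyContinuous hm
    rw [ae_iff] at hspan
    refine measure_mono_null (t := {x | ¬Submodule.span ℝ (range x) = ⊤})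
      (fun x hx h => hx ⟨fun P _ h1 h2 => (hP P h1 h2).elim, ?_⟩) hspan
    refine le_trans ?_ (one_le_basisConstant (absConv_mem_nhds hm h))
    have hm1 : (1 : ℝ) ≤ m := by exact_mod_cast hm
    have h1 : Real.log 2 ≤ Real.log (1 + (m : ℝ) / ((1 : ℕ) : ℝ)) :=
      Real.log_le_log (by norm_num) (by rw [Nat.cast_one, div_one]; linarith)
    have h2 : (1 : ℝ) / 2 ≤ Real.sqrt (Real.log (1 + (m : ℝ) / ((1 : ℕ) : ℝ))) :=
      Real.le_sqrt_of_sq_le (by linarith [Real.log_two_gt_d9])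
    rw [Nat.cast_one] at h2 ⊢
    rw [Real.sqrt_one, mul_one, div_le_one (by linarith)]
    exact hc₃.trans h2

end conclusion

theorem statement_2 :
    ∃ C c₁ c₂ c₃ : ℝ, 0 < C ∧ 0 < c₁ ∧ 0 < c₂ ∧ 0 < c₃ ∧
      ∀ (n : ℕ) (μ : Measure (Euc n)), IsIsotropicLogConcave n μ →
      ∀ (m : ℕ), C * (n : ℝ) ^ 2 * Real.log n ≤ m → (m : ℝ) ≤ Real.exp (Real.sqrt n) →
      ENNReal.ofReal (1 - Real.exp (-c₂ * Real.sqrt n)) ≤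
        (Measure.pi fun _ : Fin m => μ)
          {x : Fin m → Euc n |
            (∀ P : Euc n →ₗ[ℝ] Euc n, P ∘ₗ P = P →
              (n : ℝ) / 4 ≤ (Module.finrank ℝ (LinearMap.range P) : ℝ) →
              (Module.finrank ℝ (LinearMap.range P) : ℝ) ≤ 3 * n / 4 →
              c₁ * Real.sqrt n / Real.sqrt (Real.log (1 + (m : ℝ) / n)) ≤
                bodyOpNorm n (absConv n (Set.range x)) (absConv n (Set.range x)) P) ∧
            c₃ * Real.sqrt n / Real.sqrt (Real.log (1 + (m : ℝ) / n)) ≤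
              basisConstant n (absConv n (Set.range x))} := by
  obtain ⟨T, hT, k₀, hcoup⟩ := exists_coup
  obtain ⟨A, hA, htail⟩ := exists_norm_tail
  set c := Real.sqrt T / (15360 * A) with hcdef
  have hc : 0 < c := div_pos (Real.sqrt_pos.2 hT) (by positivity)
  set N : ℝ := 4 * k₀ + 40000 + (1 + 2 * c) * A with hNdef
  have hNA : 0 < (1 + 2 * c) * A := by positivity
  have hk₀ : (0 : ℝ) ≤ k₀ := Nat.cast_nonneg _
  refine ⟨Real.exp N + 20, c, 1 / 2, min c (1 / 2), by positivity, hc, by norm_num, by positivity,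
    fun n μ hμ m hm hm' => ?_⟩
  rcases Nat.lt_or_ge n 2 with hn2 | hn2
  · interval_cases n
    · simp
    · exact ofReal_le_measure_dim_one hμ m c _ (min_le_right _ _) (Real.exp_nonneg _)
  have hprob := hμ.iso.prob
  have hn2R : (2 : ℝ) ≤ n := by exact_mod_cast hn2
  have hn2l : 0 ≤ (n : ℝ) ^ 2 * Real.log n := mul_nonneg (sq_nonneg _) (Real.log_nonneg (by linarith))
  have hnN : N ≤ n := by
    by_contra! hlt
    have h1 : Real.sqrt n ≤ n := by rw [Real.sqrt_le_left (by linarith)]; nlinarith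
    have h2 : Real.exp (Real.sqrt n) ≤ Real.exp N := Real.exp_le_exp.2 (h1.trans hlt.le)
    have h3 : (1 : ℝ) ≤ n ^ 2 * Real.log n := by
      have h4 : Real.log 2 ≤ Real.log n := Real.log_le_log (by norm_num) hn2R
      have h5 := Real.log_two_gt_d9
      nlinarith
    rw [mul_assoc] at hm
    have h6 : Real.exp N + 20 ≤ (Real.exp N + 20) * (n ^ 2 * Real.log n) :=
      le_mul_of_one_le_right (by positivity) h3
    linarith
  have hm20 : 20 * (n : ℝ) ^ 2 * Real.log n ≤ m := by
    refine le_trans ?_ hm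
    rw [mul_assoc, mul_assoc]
    exact mul_le_mul_of_nonneg_right (by linarith [Real.exp_pos N]) hn2l
  have hn40 : 40000 ≤ n := by
    have : (40000 : ℝ) ≤ n := by linarith
    exact_mod_cast this
  have hnk₀ : 4 * k₀ ≤ n := by
    have : (4 * k₀ : ℝ) ≤ n := by linarith
    exact_mod_cast this
  have hmpos : 0 < m := by
    have h1 : (0 : ℝ) < n ^ 2 * Real.log n := mul_pos (by positivity) (Real.log_pos (by linarith))
    have : (0 : ℝ) < m := by nlinarith
    exact_mod_cast this
  refine (ofReal_one_sub_le_of_compl_le (Real.exp_nonneg _) (measure_compl_projections_le hμ hT hA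
    (fun W => hcoup _ (by omega) _ (hμ.iso.map_coiso W)) (htail n μ hμ.iso (by omega)) hn40
    (by linarith) hm20 hm')).trans (measure_mono ?_)
  rintro x ⟨hx, hP⟩
  refine ⟨hP, le_trans ?_ (le_basisConstant hn2 hmpos (absConv_mem_nhds hmpos hx) hP)⟩
  gcongr
  exact min_le_left _ _

end
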